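/- For any constants a, b > 0 with a + b < 1/2 and any constant C₀ > 0, there exist ε > 0, C > 0 and N such that the following holds for all n ≥ N. Let d = (d_1,…,d_n) be a graphical degree sequence satisfying δ ≤ C₀ n^{1/2+ε} and min{d̄, n − d̄ − 1} ≥ n/(3a log n). Let H^{[r]} be a graph on vertex set {1,…,r} with m edges and degree sequence (h_1,…,h_r), where r ≤ C₀ n^{1/2+ε} and (δ³/(λ³(1−λ)³n³)) Σ_{j=1}^r |h_j − λ(r−1)|³ ≤ C₀ n^{−b}. Then the expected number of induced copies of H^{[r]} in G ∼ 𝒢_d equals (r!/|Aut(H^{[r]})|) C(n,r) λ^m (1−λ)^{C(r,2)−m} exp( Λ₀ + Λ₁ + Λ₂ + E ) for some real E with |E| ≤ C n^{−b}, where Λ₀ = −ω₂/(2λ(1−λ)n) + R ω₂/(2λ²(1−λ)²n²), Λ₁ = r²/(2n) + (1−2λ)ω₁/(2λ(1−λ)n) − ω₁²/(4λ(1−λ)n²) − r²R/(2λ(1−λ)n²) − r ω₂/(2λ(1−λ)n²) − (1−2λ)ω₃/(6λ²(1−λ)²n²), and Λ₂ = −(1−2λ) R ω₁/(2λ²(1−λ)²n²)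 − r ω₁ (Σ_{j=1}^n (d_j − d̄)³)/(2λ²(1−λ)²n⁴). -/

import Mathlib

open scoped BigOperators Classical

namespace Stmt15

/-- The degree of vertex `j` in the graph `G`. -/
noncomputable def deg {n : ℕ} (G : SimpleGraph (Fin n)) (j : Fin n) : ℕ :=
  (Finset.univ.filter (fun k => G.Adj j k)).card

/-- The set of simple graphs on `{1,…,n}` with degree sequence `d`. -/
noncomputable def degFinset (n : ℕ) (d : Fin n → ℕ) : Finset (SimpleGraph (Fin n)) :=
  Finset.univ.filter (fun G => ∀ j, deg G j = d j)

/-- The average degree `d̄`. -/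
noncomputable def dbar (n : ℕ) (d : Fin n → ℕ) : ℝ := (∑ j, (d j : ℝ)) / n

/-- The edge density `λ = d̄ / (n-1)`. -/
noncomputable def lam (n : ℕ) (d : Fin n → ℕ) : ℝ := dbar n d / ((n : ℝ) - 1)

/-- `R = (1/n) Σ_j (d_j - d̄)²`. -/
noncomputable def Rpar (n : ℕ) (d : Fin n → ℕ) : ℝ :=
  (∑ j, ((d j : ℝ) - dbar n d) ^ 2) / n

/-- `δ = max_j |d_j - d̄|`. -/
noncomputable def deltaPar (n : ℕ) (d : Fin n → ℕ) : ℝ :=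
  ⨆ j : Fin n, |(d j : ℝ) - dbar n d|

/-- The number of automorphisms of `H`: permutations of the vertices preserving
the edge set. -/
noncomputable def autCard {k : ℕ} (H : SimpleGraph (Fin k)) : ℕ :=
  (Finset.univ.filter
    (fun π : Equiv.Perm (Fin k) => ∀ i j, H.Adj (π i) (π j) ↔ H.Adj i j)).card

/-- The number of induced copies of `H` (a graph on `Fin r`) in `G` (a graph on
`Fin n`): the number of `r`-subsets of vertices inducing a subgraph isomorphic to `H`. -/
noncomputable def indCount {n r : ℕ} (H : SimpleGraph (Fin r))
    (G : SimpleGraph (Fin n)) : ℕ :=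
  (Finset.univ.filter (fun S : Finset (Fin n) =>
    S.card = r ∧ Nonempty ((G.induce (S : Set (Fin n))) ≃g H))).card

/-- The expected number of induced copies of `H` in a uniformly random graph with
degree sequence `d`. -/
noncomputable def expInd (n : ℕ) (d : Fin n → ℕ) {r : ℕ}
    (H : SimpleGraph (Fin r)) : ℝ :=
  (∑ G ∈ degFinset n d, (indCount H G : ℝ)) / ((degFinset n d).card : ℝ)

/-- `ω_t = Σ_{j=1}^r (h_j - λ(r-1))^t`. -/
noncomputable def omega (n : ℕ) (d : Fin n → ℕ) {r : ℕ} (H : SimpleGraph (Fin r))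
    (t : ℕ) : ℝ :=
  ∑ j : Fin r, ((deg H j : ℝ) - lam n d * ((r : ℝ) - 1)) ^ t

section

open SimpleGraph

variable {n : ℕ}

/-- Edge indicator. -/
noncomputable def ind (G : SimpleGraph (Fin n)) (u v : Fin n) : ℝ := if G.Adj u v then 1 else 0

/-- Graphs with degree sequence `d` whose restriction to the revealed pairs `X` is `F`. -/
noncomputable def Om (d : Fin n → ℕ) (X F : SimpleGraph (Fin n)) :
    Finset (SimpleGraph (Fin n)) :=
  (degFinset n d).filter (fun G => G ⊓ X = F)

/-- Average of `f` over the finite set `S`. -/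
noncomputable def av (S : Finset (SimpleGraph (Fin n))) (f : SimpleGraph (Fin n) → ℝ) : ℝ :=
  (∑ G ∈ S, f G) / (S.card : ℝ)

/-- Conditional edge probability. -/
noncomputable def pr (d : Fin n → ℕ) (X F : SimpleGraph (Fin n)) (u v : Fin n) : ℝ :=
  av (Om d X F) (fun G => ind G u v)

/-- The revealed pairs after revealing `uv`. -/
noncomputable def rev (X : SimpleGraph (Fin n)) (u v : Fin n) : SimpleGraph (Fin n) := X ⊔ edge u v

lemma ind_comm (G : SimpleGraph (Fin n)) (u v : Fin n) : ind G u v = ind G v u := by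
  simp [ind, G.adj_comm]

lemma ind_nonneg (G : SimpleGraph (Fin n)) (u v : Fin n) : 0 ≤ ind G u v := by
  unfold ind; split_ifs <;> norm_num

lemma ind_le_one (G : SimpleGraph (Fin n)) (u v : Fin n) : ind G u v ≤ 1 := by
  unfold ind; split_ifs <;> norm_num

lemma ind_self (G : SimpleGraph (Fin n)) (u : Fin n) : ind G u u = 0 := by simp [ind]

lemma ind_zero_or_one (G : SimpleGraph (Fin n)) (u v : Fin n) : ind G u v = 0 ∨ ind G u v = 1 := by
  unfold ind; split_ifs <;> simp

lemma ind_of_adj {G : SimpleGraph (Fin n)} {u v : Fin n} (h : G.Adj u v) : ind G u v = 1 := by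
  simp [ind, h]

lemma ind_of_not_adj {G : SimpleGraph (Fin n)} {u v : Fin n} (h : ¬ G.Adj u v) :
    ind G u v = 0 := by
  simp [ind, h]

lemma deg_eq_sum (G : SimpleGraph (Fin n)) (u : Fin n) : (deg G u : ℝ) = ∑ v, ind G u v := by
  simp [deg, ind]

lemma mem_degFinset {d : Fin n → ℕ} {G : SimpleGraph (Fin n)} :
    G ∈ degFinset n d ↔ ∀ j, deg G j = d j := by
  simp [degFinset]

lemma mem_Om {d : Fin n → ℕ} {X F G : SimpleGraph (Fin n)} :
    G ∈ Om d X F ↔ (∀ j, deg G j = d j) ∧ G ⊓ X = F := by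
  simp [Om, degFinset]

lemma le_of_mem_Om {d : Fin n → ℕ} {X F G : SimpleGraph (Fin n)} (h : G ∈ Om d X F) : F ≤ X := by
  rw [mem_Om] at h; rw [← h.2]; exact inf_le_right

lemma rev_adj {X : SimpleGraph (Fin n)} {u v : Fin n} (huv : u ≠ v) {k l : Fin n} :
    (rev X u v).Adj k l ↔ X.Adj k l ∨ (k = u ∧ l = v) ∨ (k = v ∧ l = u) := by
  simp only [rev, sup_adj, edge_adj]
  constructor
  · rintro (h | ⟨h, -⟩)
    · exact Or.inl h
    · right; tauto
  · rintro (h | h)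
    · exact Or.inl h
    · right; refine ⟨by tauto, ?_⟩
      rcases h with ⟨rfl, rfl⟩ | ⟨rfl, rfl⟩
      · exact huv
      · exact huv.symm

lemma Om_present {d : Fin n → ℕ} {X F : SimpleGraph (Fin n)} {u v : Fin n} (huv : u ≠ v)
    (hX : ¬ X.Adj u v) (hF : F ≤ X) :
    Om d (rev X u v) (rev F u v) = (Om d X F).filter (fun G => G.Adj u v) := by
  ext G
  simp only [Finset.mem_filter, mem_Om, and_assoc]
  refine and_congr_right fun _ => ?_
  simp only [SimpleGraph.ext_iff, funext_iff, eq_iff_iff, inf_adj, rev_adj huv]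
  have hXs : ¬ X.Adj v u := fun h => hX h.symm
  constructor
  · intro h
    have huvG : G.Adj u v := ((h u v).2 (Or.inr (Or.inl ⟨rfl, rfl⟩))).1
    refine ⟨fun k l => ?_, huvG⟩
    have := h k l
    constructor
    · rintro ⟨h1, h2⟩
      rcases this.1 ⟨h1, Or.inl h2⟩ with h3 | ⟨rfl, rfl⟩ | ⟨rfl, rfl⟩
      · exact h3
      · exact absurd h2 hX
      · exact absurd h2 hXs
    · intro h1
      exact ⟨(this.2 (Or.inl h1)).1, hF h1⟩
  · rintro ⟨h, huvG⟩ k l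
    rw [← h k l]
    constructor
    · tauto
    · rintro (h1 | ⟨rfl, rfl⟩ | ⟨rfl, rfl⟩)
      · tauto
      · tauto
      · exact ⟨huvG.symm, by tauto⟩

lemma Om_absent {d : Fin n → ℕ} {X F : SimpleGraph (Fin n)} {u v : Fin n} (huv : u ≠ v)
    (hX : ¬ X.Adj u v) (hF : F ≤ X) :
    Om d (rev X u v) F = (Om d X F).filter (fun G => ¬ G.Adj u v) := by
  ext G
  simp only [Finset.mem_filter, mem_Om, and_assoc]
  refine and_congr_right fun _ => ?_
  simp only [SimpleGraph.ext_iff, funext_iff, eq_iff_iff, inf_adj, rev_adj huv]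
  have hXs : ¬ X.Adj v u := fun h => hX h.symm
  constructor
  · intro h
    have huvG : ¬ G.Adj u v := fun h' => hX (hF ((h u v).1 ⟨h', Or.inr (Or.inl ⟨rfl, rfl⟩)⟩))
    refine ⟨fun k l => ?_, huvG⟩
    have := h k l
    constructor
    · rintro ⟨h1, h2⟩
      exact this.1 ⟨h1, Or.inl h2⟩
    · intro h1
      exact ⟨(this.2 h1).1, hF h1⟩
  · rintro ⟨h, huvG⟩ k l
    rw [← h k l]
    constructor
    · rintro ⟨h1, h2 | ⟨rfl, rfl⟩ | ⟨rfl, rfl⟩⟩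
      · exact ⟨h1, h2⟩
      · exact absurd h1 huvG
      · exact absurd h1.symm huvG
    · tauto

/-- The edges of the 4-cycle `a b c e`. -/
noncomputable def cyc (a b c e : Fin n) : SimpleGraph (Fin n) :=
  edge a b ⊔ edge b c ⊔ edge c e ⊔ edge e a

/-- Toggle the edges of the 4-cycle `a b c e`. -/
noncomputable def flip4 (a b c e : Fin n) (G : SimpleGraph (Fin n)) : SimpleGraph (Fin n) :=
  symmDiff G (cyc a b c e)

lemma flip4_flip4 (a b c e : Fin n) (G : SimpleGraph (Fin n)) :
    flip4 a b c e (flip4 a b c e G) = G := by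
  simp [flip4]

lemma cyc_adj {a b c e : Fin n} (hab : a ≠ b) (hbc : b ≠ c) (hce : c ≠ e) (hea : e ≠ a)
    {k l : Fin n} : (cyc a b c e).Adj k l ↔
      (k = a ∧ l = b) ∨ (k = b ∧ l = a) ∨ (k = b ∧ l = c) ∨ (k = c ∧ l = b) ∨
      (k = c ∧ l = e) ∨ (k = e ∧ l = c) ∨ (k = e ∧ l = a) ∨ (k = a ∧ l = e) := by
  simp only [cyc, sup_adj, edge_adj]
  grind

lemma flip4_adj {a b c e : Fin n} (G : SimpleGraph (Fin n)) {k l : Fin n} :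
    (flip4 a b c e G).Adj k l ↔ ¬ (G.Adj k l ↔ (cyc a b c e).Adj k l) := by
  simp only [flip4, symmDiff, sup_adj, sdiff_adj]
  tauto

/-- The four edges alternate along the cycle: `ab, ce` present and `bc, ea` absent. -/
def Alt (G : SimpleGraph (Fin n)) (a b c e : Fin n) : Prop :=
  G.Adj a b ∧ G.Adj c e ∧ ¬ G.Adj b c ∧ ¬ G.Adj e a

lemma deg_flip4 {a b c e : Fin n} (hab : a ≠ b) (hbc : b ≠ c) (hce : c ≠ e) (hea : e ≠ a)
    (hac : a ≠ c) (hbe : b ≠ e) {G : SimpleGraph (Fin n)} (h : Alt G a b c e) (j : Fin n) :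
    deg (flip4 a b c e G) j = deg G j := by
  obtain ⟨h1, h2, h3, h4⟩ := h
  have key : ∀ σ : Equiv.Perm (Fin n),
      (∀ k, (flip4 a b c e G).Adj j k ↔ G.Adj j (σ k)) → deg (flip4 a b c e G) j = deg G j := by
    intro σ hσ
    unfold deg
    refine Finset.card_bij (fun k _ => σ k) ?_ ?_ ?_
    · intro k hk; simpa [hσ] using hk
    · intro k _ l _ hkl; exact σ.injective hkl
    · intro k hk; exact ⟨σ.symm k, by simpa [hσ] using hk, by simp⟩
  have h1' := h1.symm
  have h2' := h2.symm
  have h3' : ¬ G.Adj c b := fun h => h3 h.symm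
  have h4' : ¬ G.Adj a e := fun h => h4 h.symm
  by_cases hj : j = a ∨ j = c
  · apply key (Equiv.swap b e)
    intro k
    rw [flip4_adj, cyc_adj hab hbc hce hea, Equiv.swap_apply_def]
    rcases hj with rfl | rfl <;> split_ifs <;> subst_vars <;> grind
  · by_cases hj' : j = b ∨ j = e
    · apply key (Equiv.swap a c)
      intro k
      rw [flip4_adj, cyc_adj hab hbc hce hea, Equiv.swap_apply_def]
      rcases hj' with rfl | rfl <;> split_ifs <;> subst_vars <;> grind
    · apply key (Equiv.refl _)
      intro k
      rw [flip4_adj, cyc_adj hab hbc hce hea]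
      simp only [Equiv.refl_apply]
      grind

lemma flip4_inf {a b c e : Fin n} (hab : a ≠ b) (hbc : b ≠ c) (hce : c ≠ e) (hea : e ≠ a)
    {X : SimpleGraph (Fin n)} (x1 : ¬ X.Adj a b) (x2 : ¬ X.Adj b c) (x3 : ¬ X.Adj c e)
    (x4 : ¬ X.Adj e a) (G : SimpleGraph (Fin n)) : flip4 a b c e G ⊓ X = G ⊓ X := by
  ext k l
  simp only [inf_adj, flip4_adj, cyc_adj hab hbc hce hea]
  have := X.adj_comm
  grind

/-- Switching along an unrevealed 4-cycle is a bijection. -/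
lemma sum_flip {d : Fin n → ℕ} {X F : SimpleGraph (Fin n)} {a b c e : Fin n}
    (hab : a ≠ b) (hbc : b ≠ c) (hce : c ≠ e) (hea : e ≠ a) (hac : a ≠ c) (hbe : b ≠ e)
    (x1 : ¬ X.Adj a b) (x2 : ¬ X.Adj b c) (x3 : ¬ X.Adj c e) (x4 : ¬ X.Adj e a)
    (f : SimpleGraph (Fin n) → ℝ) :
    ∑ G ∈ (Om d X F).filter (fun G => Alt G a b c e), f (flip4 a b c e G) =
      ∑ G ∈ (Om d X F).filter (fun G => Alt G b c e a), f G := by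
  have e1 : ∀ G : SimpleGraph (Fin n), Alt G a b c e → Alt (flip4 a b c e G) b c e a := by
    intro G h
    simp only [Alt, flip4_adj, cyc_adj hab hbc hce hea] at *
    have := G.adj_comm
    grind
  have e2 : ∀ G : SimpleGraph (Fin n), Alt G b c e a → Alt (flip4 a b c e G) a b c e := by
    intro G h
    simp only [Alt, flip4_adj, cyc_adj hab hbc hce hea] at *
    have := G.adj_comm
    grind
  refine Finset.sum_bij' (fun G _ => flip4 a b c e G) (fun G _ => flip4 a b c e G) ?_ ?_ ?_ ?_ ?_
  · intro G hG
    simp only [Finset.mem_filter, mem_Om] at hG ⊢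
    refine ⟨⟨fun j => ?_, ?_⟩, e1 G hG.2⟩
    · rw [deg_flip4 hab hbc hce hea hac hbe hG.2]; exact hG.1.1 j
    · rw [flip4_inf hab hbc hce hea x1 x2 x3 x4]; exact hG.1.2
  · intro G hG
    simp only [Finset.mem_filter, mem_Om] at hG ⊢
    refine ⟨⟨fun j => ?_, ?_⟩, e2 G hG.2⟩
    · rw [← hG.1.1 j, ← deg_flip4 hab hbc hce hea hac hbe (e2 G hG.2), flip4_flip4]
    · rw [flip4_inf hab hbc hce hea x1 x2 x3 x4]; exact hG.1.2
  · intro G _; exact flip4_flip4 a b c e G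
  · intro G _; exact flip4_flip4 a b c e G
  · intro G _; rfl

end

section

open SimpleGraph

variable {n : ℕ}

/-- Standing assumptions: `p` is the density, `s = √n`, and `L` is a slowly growing quantity
absorbing all polylogarithmic and small power factors. -/
structure Par (n : ℕ) (d : Fin n → ℕ) (p s L : ℝ) : Prop where
  sq : s ^ 2 = n
  s_pos : 0 < s
  L_ge : 2000 ≤ L
  L_pow : L ^ 1000 ≤ s
  hp : 1 ≤ L * p
  hq : 1 ≤ L * (1 - p)
  hx : ∀ v, |(d v : ℝ) - p * (n - 1)| ≤ L * s
  hsum : ∑ v, ((d v : ℝ) - p * (n - 1)) = 0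
  hlog : Real.log s ≤ L

namespace Par

variable {d : Fin n → ℕ} {p s L : ℝ}

lemma L_pos (h : Par n d p s L) : 0 < L := by linarith [h.L_ge]

lemma one_le_L (h : Par n d p s L) : 1 ≤ L := by linarith [h.L_ge]

lemma pow_le (h : Par n d p s L) {k : ℕ} (hk : k ≤ 1000) : L ^ k ≤ s :=
  (pow_le_pow_right₀ h.one_le_L hk).trans h.L_pow

lemma s_ge (h : Par n d p s L) : 1000 ≤ s := by
  have := h.pow_le (k := 1) (by norm_num); linarith [h.L_ge]

lemma p_pos (h : Par n d p s L) : 0 < p := by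
  by_contra hp; nlinarith [h.hp, h.L_pos]

lemma p_lt_one (h : Par n d p s L) : p < 1 := by
  by_contra hp; nlinarith [h.hq, h.L_pos]

lemma compl (h : Par n d p s L) (hd : ∀ v, d v ≤ n - 1) :
    Par n (fun v => n - 1 - d v) (1 - p) s L := by
  have hn : 1 ≤ n := by
    have := h.sq; have := h.s_ge
    have h2 : (1 : ℝ) ≤ n := by nlinarith
    exact_mod_cast h2
  have key : ∀ v, (((n - 1 - d v : ℕ) : ℝ) - (1 - p) * (n - 1)) = -((d v : ℝ) - p * (n - 1)) := by
    intro v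
    rw [Nat.cast_sub (hd v), Nat.cast_sub hn]; push_cast; ring
  refine ⟨h.sq, h.s_pos, h.L_ge, h.L_pow, h.hq, by simpa using h.hp, ?_, ?_, h.hlog⟩
  · intro v; simp only [key, abs_neg]; exact h.hx v
  · simp only [key, Finset.sum_neg_distrib, h.hsum, neg_zero]

end Par

/-- Indicator that `c` is an unrevealed neighbour of `a`. -/
noncomputable def nb (X G : SimpleGraph (Fin n)) (a c : Fin n) : ℝ := (1 - ind X a c) * ind G a c

lemma nb_zero_or_one (X G : SimpleGraph (Fin n)) (a c : Fin n) :
    nb X G a c = 0 ∨ nb X G a c = 1 := by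
  unfold nb
  rcases ind_zero_or_one X a c with h | h <;> rcases ind_zero_or_one G a c with h' | h' <;>
    simp [h, h']

lemma nb_nonneg (X G : SimpleGraph (Fin n)) (a c : Fin n) : 0 ≤ nb X G a c := by
  rcases nb_zero_or_one X G a c with h | h <;> simp [h]

lemma nb_le_one (X G : SimpleGraph (Fin n)) (a c : Fin n) : nb X G a c ≤ 1 := by
  rcases nb_zero_or_one X G a c with h | h <;> simp [h]

/-- Kronecker delta. -/
noncomputable def eqi (u v : Fin n) : ℝ := if u = v then 1 else 0

lemma eqi_nonneg (u v : Fin n) : 0 ≤ eqi u v := by unfold eqi; split_ifs <;> norm_num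
lemma eqi_le_one (u v : Fin n) : eqi u v ≤ 1 := by unfold eqi; split_ifs <;> norm_num

/-- Counts the pairs of distinct non-adjacent unrevealed neighbours of `a` and `b`. -/
noncomputable def revc (X : SimpleGraph (Fin n)) (a b : Fin n) (G : SimpleGraph (Fin n)) : ℝ :=
  ∑ u, ∑ v, nb X G a u * nb X G b v * ((1 - ind X u v) * (1 - ind G u v) * (1 - eqi u v))

/-- The side conditions under which a cycle `u v w z` may be switched while keeping `au`, `bv`. -/
def Sw (X : SimpleGraph (Fin n)) (a b u v z w : Fin n) : Prop :=
  (u ≠ v ∧ v ≠ w ∧ w ≠ z ∧ z ≠ u ∧ u ≠ w ∧ v ≠ z) ∧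
  (¬ X.Adj u v ∧ ¬ X.Adj v w ∧ ¬ X.Adj w z ∧ ¬ X.Adj z u) ∧
  (u ≠ a ∧ u ≠ b ∧ v ≠ a ∧ v ≠ b ∧ z ≠ a ∧ z ≠ b ∧ w ≠ a ∧ w ≠ b)

lemma sw_lower {X : SimpleGraph (Fin n)} {a b : Fin n} (hab : X.Adj a b)
    (G : SimpleGraph (Fin n)) (u v z w : Fin n) :
    nb X G a u * nb X G b v * (1 - nb X G b z) * (1 - nb X G a w) * ind G z w
      - nb X G a u * nb X G b v * (1 - ind G u v)
      - nb X G a u * (1 - nb X G b z) * ind G u z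
      - nb X G b v * (1 - nb X G a w) * ind G v w
      - ind X u v - ind X z w - ind X u z - ind X v w
      - eqi u z - eqi v w - eqi z a - eqi z b - eqi w a - eqi w b
    ≤ (if Sw X a b u v z w ∧ Alt G u v w z then nb X G a u * nb X G b v else 0) := by
  have hR : 0 ≤ (if Sw X a b u v z w ∧ Alt G u v w z then nb X G a u * nb X G b v else 0) := by
    split_ifs
    · exact mul_nonneg (nb_nonneg _ _ _ _) (nb_nonneg _ _ _ _)
    · exact le_rfl
  have p1 := nb_nonneg X G a u
  have p2 := nb_nonneg X G b v
  have p1' := nb_le_one X G a u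
  have p2' := nb_le_one X G b v
  have p3 := nb_le_one X G b z
  have p4 := nb_le_one X G a w
  have p5 := nb_nonneg X G b z
  have p6 := nb_nonneg X G a w
  have q1 := ind_nonneg G u z
  have q2 := ind_nonneg G v w
  have q3 := ind_le_one G u v
  have r1 := ind_nonneg X u v
  have r2 := ind_nonneg X z w
  have r3 := ind_nonneg X u z
  have r4 := ind_nonneg X v w
  have t1 := eqi_nonneg u z
  have t2 := eqi_nonneg v w
  have t3 := eqi_nonneg z a
  have t4 := eqi_nonneg z b
  have t5 := eqi_nonneg w a
  have t6 := eqi_nonneg w b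
  have m2 : 0 ≤ nb X G a u * nb X G b v * (1 - ind G u v) := by
    have : 0 ≤ 1 - ind G u v := by linarith
    positivity
  have m3 : 0 ≤ nb X G a u * (1 - nb X G b z) * ind G u z := by
    have : 0 ≤ 1 - nb X G b z := by linarith
    positivity
  have m4 : 0 ≤ nb X G b v * (1 - nb X G a w) * ind G v w := by
    have : 0 ≤ 1 - nb X G a w := by linarith
    positivity
  rcases nb_zero_or_one X G a u with h1 | h1
  · simp only [h1] at *; linarith
  rcases nb_zero_or_one X G b v with h2 | h2
  · simp only [h2] at *; linarith
  rcases nb_zero_or_one X G b z with h3 | h3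
  swap
  · simp only [h3] at *; linarith
  rcases nb_zero_or_one X G a w with h4 | h4
  swap
  · simp only [h4] at *; linarith
  rcases ind_zero_or_one G z w with h5 | h5
  · simp only [h5] at *; linarith
  by_cases hc : Sw X a b u v z w ∧ Alt G u v w z
  · rw [if_pos hc]; rw [h1, h2, h3, h4, h5] at *; linarith
  · rw [if_neg hc]
    by_contra hlt
    push Not at hlt
    rw [h1, h2, h3, h4, h5] at hlt
    apply hc
    have aux : ∀ (Y : SimpleGraph (Fin n)) (k l : Fin n), ind Y k l < 1 → ¬ Y.Adj k l := by
      intro Y k l h h'; rw [ind_of_adj h'] at h; linarith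
    have aux2 : ∀ (k l : Fin n), eqi k l < 1 → k ≠ l := by
      intro k l h h'; simp [eqi, h'] at h
    have auv : G.Adj u v := by
      by_contra h; rw [ind_of_not_adj h] at hlt; linarith
    have azw : G.Adj z w := by
      by_contra h; rw [ind_of_not_adj h] at h5; norm_num at h5
    have auz : ¬ G.Adj u z := aux _ _ _ (by linarith)
    have avw : ¬ G.Adj v w := aux _ _ _ (by linarith)
    have xuv : ¬ X.Adj u v := aux _ _ _ (by linarith)
    have xzw : ¬ X.Adj z w := aux _ _ _ (by linarith)
    have xuz : ¬ X.Adj u z := aux _ _ _ (by linarith)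
    have xvw : ¬ X.Adj v w := aux _ _ _ (by linarith)
    have e1 := aux2 u z (by linarith)
    have e2 := aux2 v w (by linarith)
    have e3 := aux2 z a (by linarith)
    have e4 := aux2 z b (by linarith)
    have e5 := aux2 w a (by linarith)
    have e6 := aux2 w b (by linarith)
    have hua : u ≠ a := by rintro rfl; simp [nb, ind_self] at h1
    have hub : u ≠ b := by rintro rfl; simp [nb, ind_of_adj hab] at h1
    have hvb : v ≠ b := by rintro rfl; simp [nb, ind_self] at h2
    have hva : v ≠ a := by rintro rfl; simp [nb, ind_of_adj hab.symm] at h2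
    have huw : u ≠ w := by rintro rfl; rw [h1] at h4; norm_num at h4
    have hvz : v ≠ z := by rintro rfl; rw [h2] at h3; norm_num at h3
    refine ⟨⟨⟨auv.ne, e2, azw.ne', e1.symm, huw, hvz⟩, ⟨xuv, xvw, fun h => xzw h.symm,
      fun h => xuz h.symm⟩, hua, hub, hva, hvb, e3, e4, e5, e6⟩, auv, azw.symm, avw,
      fun h => auz h.symm⟩

end

section

open SimpleGraph

variable {n : ℕ} {d : Fin n → ℕ} {p s L : ℝ}

lemma sum_eqi (u : Fin n) : ∑ v, eqi u v = 1 := by simp [eqi]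
lemma sum_eqi' (u : Fin n) : ∑ v, eqi v u = 1 := by simp [eqi]

lemma sum_ind_le (X : SimpleGraph (Fin n)) {D : ℝ} (hD : ∀ v, (deg X v : ℝ) ≤ D) :
    ∑ u, ∑ v, ind X u v ≤ n * D := by
  simp only [← deg_eq_sum]
  calc ∑ u, (deg X u : ℝ) ≤ ∑ _u : Fin n, D := Finset.sum_le_sum fun u _ => hD u
    _ = n * D := by simp

lemma sum_nb_le (X G : SimpleGraph (Fin n)) (a : Fin n) : ∑ c, nb X G a c ≤ deg G a := by
  rw [deg_eq_sum]
  refine Finset.sum_le_sum fun c _ => ?_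
  unfold nb
  nlinarith [ind_nonneg X a c, ind_nonneg G a c]

lemma le_sum_nb (X G : SimpleGraph (Fin n)) (a : Fin n) :
    (deg G a : ℝ) - deg X a ≤ ∑ c, nb X G a c := by
  rw [deg_eq_sum, deg_eq_sum, ← Finset.sum_sub_distrib]
  refine Finset.sum_le_sum fun c _ => ?_
  unfold nb
  nlinarith [ind_nonneg X a c, ind_le_one G a c]

lemma sum_cross (α β : Fin n → ℝ) (G : SimpleGraph (Fin n)) {D M : ℝ}
    (hα : ∀ u, 0 ≤ α u) (hα1 : ∀ u, α u ≤ 1) (hD0 : 0 ≤ D)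
    (hdeg : ∀ u, (deg G u : ℝ) ≤ (∑ v, β v) + D)
    (hM : ∑ u, ∑ v, α u * β v * (1 - ind G u v) = M) :
    ∑ u, ∑ z, α u * (1 - β z) * ind G u z ≤ n * D + M := by
  have e : ∑ u, ∑ z, α u * (1 - β z) * ind G u z =
      ∑ u, α u * ((deg G u : ℝ) - ∑ v, β v) + ∑ u, ∑ v, α u * β v * (1 - ind G u v) := by
    rw [← Finset.sum_add_distrib]
    refine Finset.sum_congr rfl fun u _ => ?_
    rw [deg_eq_sum, ← Finset.sum_sub_distrib, Finset.mul_sum, ← Finset.sum_add_distrib]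
    exact Finset.sum_congr rfl fun v _ => by ring
  rw [e, hM]
  have : ∑ u, α u * ((deg G u : ℝ) - ∑ v, β v) ≤ ∑ _u : Fin n, D := by
    refine Finset.sum_le_sum fun u _ => ?_
    nlinarith [hα u, hα1 u, hdeg u]
  simp at this
  linarith

lemma Par.Ls_le (hP : Par n d p s L) : L ^ 2 * (1000 * s) ≤ s ^ 2 := by
  have hL := hP.L_ge
  have hb : L ^ 6 ≤ s := hP.pow_le (by norm_num)
  have : L ^ 2 * 1000 ≤ L ^ 6 := by
    have h4 : (2000 : ℝ) ^ 4 ≤ L ^ 4 := pow_le_pow_left₀ (by norm_num) hL 4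
    nlinarith [pow_pos hP.L_pos 2]
  nlinarith [hP.s_pos]

lemma Par.low_p (hP : Par n d p s L) : s ^ 2 / (2 * L) ≤ p * (n - 1) - 3 * L * s := by
  have hL0 := hP.L_pos
  have h1 : s ^ 2 ≤ L * p * s ^ 2 := by nlinarith [hP.hp, pow_pos hP.s_pos 2]
  have h2 := hP.Ls_le
  have h3 : L * p ≤ L := by nlinarith [hP.p_lt_one]
  have h4 : 1 * L ≤ L ^ 2 * s := by nlinarith [hP.L_ge, hP.s_ge, mul_pos hL0 hP.s_pos]
  rw [div_le_iff₀ (by positivity), ← hP.sq]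
  nlinarith

lemma Par.low_q (hP : Par n d p s L) : s ^ 2 / (2 * L) ≤ n - (p * (n - 1) + L * s) := by
  have hL0 := hP.L_pos
  have h1 : s ^ 2 ≤ L * (1 - p) * s ^ 2 := by nlinarith [hP.hq, pow_pos hP.s_pos 2]
  have h2 := hP.Ls_le
  have h3 := hP.p_pos
  have h4 : 0 < L ^ 2 * s := by nlinarith [hP.L_ge, hP.s_ge, mul_pos hL0 hP.s_pos]
  have h5 := mul_pos h3 hL0
  rw [div_le_iff₀ (by positivity), ← hP.sq]
  nlinarith

set_option maxHeartbeats 1000000 in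
lemma good_lower (hP : Par n d p s L) {X : SimpleGraph (Fin n)}
    (hD : ∀ v, (deg X v : ℝ) ≤ 2 * L * s) {a b : Fin n} (hab : X.Adj a b)
    {G : SimpleGraph (Fin n)} (hG : ∀ v, deg G v = d v) :
    s ^ 8 / (16 * L ^ 4) - 4 * s ^ 4 * revc X a b G - 60 * L * s ^ 7 ≤
      ∑ u, ∑ v, ∑ z, ∑ w,
        (if Sw X a b u v z w ∧ Alt G u v w z then nb X G a u * nb X G b v else 0) := by
  set α := nb X G a with hα
  set β := nb X G b with hβ
  set S1 := ∑ u, α u with hS1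
  set S2 := ∑ u, β u with hS2
  set M1 := ∑ u, ∑ v, α u * β v * (1 - ind G u v) with hM1
  set E1 := ∑ u, ∑ z, α u * (1 - β z) * ind G u z with hE1
  set E2 := ∑ u, ∑ z, β u * (1 - α z) * ind G u z with hE2
  set Mn := ∑ z, ∑ w, (1 - β z) * (1 - α w) * ind G z w with hMn
  set Xt := ∑ u, ∑ v, ind X u v with hXt
  have hL := hP.L_ge
  have hs := hP.s_pos
  have hs3 := hP.s_ge
  have hL0 := hP.L_pos
  have hn : (n : ℝ) = s ^ 2 := hP.sq.symm
  have hα0 : ∀ u, 0 ≤ α u := nb_nonneg X G a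
  have hβ0 : ∀ u, 0 ≤ β u := nb_nonneg X G b
  have hα1 : ∀ u, α u ≤ 1 := nb_le_one X G a
  have hβ1 : ∀ u, β u ≤ 1 := nb_le_one X G b
  have hlow : ∀ v, p * (n - 1) - L * s ≤ deg G v := by
    intro v; rw [hG v]; linarith [(abs_le.1 (hP.hx v)).1]
  have hupp : ∀ v, (deg G v : ℝ) ≤ p * (n - 1) + L * s := by
    intro v; rw [hG v]; linarith [(abs_le.1 (hP.hx v)).2]
  have hS1l : p * (n - 1) - 3 * L * s ≤ S1 := by
    linarith [le_sum_nb X G a, hlow a, hD a]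
  have hS2l : p * (n - 1) - 3 * L * s ≤ S2 := by
    linarith [le_sum_nb X G b, hlow b, hD b]
  have hS2u : S2 ≤ p * (n - 1) + L * s := by
    linarith [sum_nb_le X G b, hupp b]
  have hS1u : S1 ≤ p * (n - 1) + L * s := by
    linarith [sum_nb_le X G a, hupp a]
  have hXt2 : Xt ≤ n * (2 * L * s) := sum_ind_le X hD
  have hE1le : E1 ≤ n * (4 * L * s) + M1 :=
    sum_cross α β G hα0 hα1 (by positivity) (fun u => by linarith [hupp u]) rfl
  have hM1' : ∑ u, ∑ v, β u * α v * (1 - ind G u v) = M1 := by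
    rw [Finset.sum_comm]
    refine Finset.sum_congr rfl fun u _ => Finset.sum_congr rfl fun v _ => ?_
    rw [ind_comm]; ring
  have hE2le : E2 ≤ n * (4 * L * s) + M1 :=
    sum_cross β α G hβ0 hβ1 (by positivity) (fun u => by linarith [hupp u]) hM1'
  have hM1le : M1 ≤ revc X a b G + n + Xt := by
    have : M1 ≤ ∑ u, ∑ v, (α u * β v * ((1 - ind X u v) * (1 - ind G u v) * (1 - eqi u v))
        + eqi u v + ind X u v) := by
      refine Finset.sum_le_sum fun u _ => Finset.sum_le_sum fun v _ => ?_
      have h1 : 0 ≤ α u * β v := mul_nonneg (hα0 u) (hβ0 v)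
      have h2 : α u * β v ≤ 1 := mul_le_one₀ (hα1 u) (hβ0 v) (hβ1 v)
      rcases ind_zero_or_one X u v with h3 | h3 <;> rcases ind_zero_or_one G u v with h4 | h4 <;>
        unfold eqi <;> split_ifs <;> rw [h3, h4] <;> nlinarith
    simp only [Finset.sum_add_distrib, sum_eqi] at this
    simpa [revc, ← hα, ← hβ, hXt] using this
  have hMnE : Mn = ∑ z, (1 - β z) * deg G z - E1 := by
    have : E1 = ∑ z, ∑ w, (1 - β z) * α w * ind G z w := by
      rw [hE1, Finset.sum_comm]
      refine Finset.sum_congr rfl fun u _ => Finset.sum_congr rfl fun v _ => ?_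
      rw [ind_comm]; ring
    rw [this, ← Finset.sum_sub_distrib]
    refine Finset.sum_congr rfl fun z _ => ?_
    rw [deg_eq_sum, Finset.mul_sum, ← Finset.sum_sub_distrib]
    exact Finset.sum_congr rfl fun w _ => by ring
  have hE1n : 0 ≤ E1 := Finset.sum_nonneg fun u _ => Finset.sum_nonneg fun v _ =>
    mul_nonneg (mul_nonneg (hα0 u) (by linarith [hβ1 v])) (ind_nonneg _ _ _)
  have lowS : s ^ 2 / (2 * L) ≤ p * (n - 1) - 3 * L * s := hP.low_p
  have lowQ : s ^ 2 / (2 * L) ≤ n - S2 := by linarith [hP.low_q]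
  have hpos : 0 < s ^ 2 / (2 * L) := by positivity
  have hD1 : (s ^ 2 / (2 * L)) * (s ^ 2 / (2 * L)) ≤ ∑ z, (1 - β z) * deg G z := by
    have h1 : ∑ z, (1 - β z) * (s ^ 2 / (2 * L)) ≤ ∑ z, (1 - β z) * deg G z := by
      refine Finset.sum_le_sum fun z _ => ?_
      have : s ^ 2 / (2 * L) ≤ deg G z := by nlinarith [hlow z, mul_pos hL0 hs]
      exact mul_le_mul_of_nonneg_left this (by linarith [hβ1 z])
    rw [← Finset.sum_mul, Finset.sum_sub_distrib] at h1
    simp only [Finset.sum_const, Finset.card_univ, Fintype.card_fin, nsmul_eq_mul, mul_one] at h1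
    refine le_trans ?_ h1
    exact mul_le_mul_of_nonneg_right lowQ hpos.le
  have hS12 : (s ^ 2 / (2 * L)) * (s ^ 2 / (2 * L)) ≤ S1 * S2 :=
    mul_le_mul (by linarith) (by linarith) hpos.le (by linarith)
  have hSn : ∀ c, (∑ u, nb X G c u) ≤ n := by
    intro c
    calc ∑ u, nb X G c u ≤ ∑ _u : Fin n, (1 : ℝ) :=
          Finset.sum_le_sum fun u _ => nb_le_one X G c u
      _ = n := by simp
  have hS12u : S1 * S2 ≤ n * n :=
    mul_le_mul (hSn a) (hSn b) (by linarith) (by positivity)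
  have hmain : s ^ 8 / (16 * L ^ 4) - n ^ 2 * E1 ≤ S1 * S2 * Mn := by
    have h1 : (s ^ 2 / (2 * L)) * (s ^ 2 / (2 * L)) * ((s ^ 2 / (2 * L)) * (s ^ 2 / (2 * L))) ≤
        S1 * S2 * ∑ z, (1 - β z) * deg G z :=
      mul_le_mul hS12 hD1 (by positivity) (by nlinarith [mul_pos hpos hpos])
    have h2 : (s ^ 2 / (2 * L)) * (s ^ 2 / (2 * L)) * ((s ^ 2 / (2 * L)) * (s ^ 2 / (2 * L))) =
        s ^ 8 / (16 * L ^ 4) := by field_simp; ring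
    rw [hMnE]
    nlinarith
  have hsum := Finset.sum_le_sum fun u (_ : u ∈ Finset.univ) =>
    Finset.sum_le_sum fun v (_ : v ∈ Finset.univ) =>
    Finset.sum_le_sum fun z (_ : z ∈ Finset.univ) =>
    Finset.sum_le_sum fun w (_ : w ∈ Finset.univ) => sw_lower hab G u v z w
  refine le_trans ?_ hsum
  have t1 : ∑ u, ∑ v, ∑ z, ∑ w, α u * β v * (1 - β z) * (1 - α w) * ind G z w = S1 * S2 * Mn := by
    rw [hS1, hS2, Finset.sum_mul_sum, Finset.sum_mul]
    refine Finset.sum_congr rfl fun u _ => ?_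
    rw [Finset.sum_mul]
    refine Finset.sum_congr rfl fun v _ => ?_
    rw [hMn, Finset.mul_sum]
    refine Finset.sum_congr rfl fun z _ => ?_
    rw [Finset.mul_sum]
    exact Finset.sum_congr rfl fun w _ => by ring
  have t4 : ∑ v, ∑ w, β v * (1 - α w) * ind G v w = E2 := rfl
  simp only [Finset.sum_sub_distrib, ← hα, ← hβ]
  rw [t1]
  simp only [Finset.sum_const, Finset.card_univ, Fintype.card_fin, nsmul_eq_mul,
    ← Finset.mul_sum, sum_eqi, sum_eqi']
  rw [← hM1, ← hE1, ← hE2, ← hXt, hn] at *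
  have hLL : s ^ 6 ≤ L * s ^ 7 := by
    have : 1 ≤ L * s := by nlinarith
    nlinarith [pow_pos hs 6]
  nlinarith [pow_pos hs 4, mul_le_mul_of_nonneg_left hM1le (pow_pos hs 4).le,
    mul_le_mul_of_nonneg_left hE1le (pow_pos hs 4).le,
    mul_le_mul_of_nonneg_left hE2le (pow_pos hs 4).le,
    mul_le_mul_of_nonneg_left hXt2 (pow_pos hs 4).le]

lemma nb_flip4 {X G : SimpleGraph (Fin n)} {a u v w z k : Fin n} (huv : u ≠ v) (hvw : v ≠ w)
    (hwz : w ≠ z) (hzu : z ≠ u) (h1 : u ≠ a) (h2 : v ≠ a) (h3 : w ≠ a) (h4 : z ≠ a) :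
    nb X (flip4 u v w z G) a k = nb X G a k := by
  unfold nb ind
  have : (flip4 u v w z G).Adj a k ↔ G.Adj a k := by
    rw [flip4_adj, cyc_adj huv hvw hwz hzu]
    grind
  simp [this]

lemma sum_good_le {X F : SimpleGraph (Fin n)} (a b u v z w : Fin n) :
    ∑ G ∈ Om d X F, (if Sw X a b u v z w ∧ Alt G u v w z then nb X G a u * nb X G b v else 0) ≤
    ∑ G ∈ Om d X F, nb X G a u * nb X G b v *
      ((1 - ind X u v) * (1 - ind G u v) * (1 - eqi u v)) := by
  by_cases hS : Sw X a b u v z w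
  · have hS' := hS
    obtain ⟨⟨e1, e2, e3, e4, e5, e6⟩, ⟨x1, x2, x3, x4⟩, o1, o2, o3, o4, o5, o6, o7, o8⟩ := hS'
    simp only [hS, true_and]
    rw [← Finset.sum_filter]
    have := sum_flip (d := d) (F := F) e1 e2 e3 e4 e5 e6 x1 x2 x3 x4
      (fun G => nb X G a u * nb X G b v)
    simp only [nb_flip4 e1 e2 e3 e4 o1 o3 o7 o5, nb_flip4 e1 e2 e3 e4 o2 o4 o8 o6] at this
    rw [this, Finset.sum_filter]
    refine Finset.sum_le_sum fun G _ => ?_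
    have hnn : 0 ≤ nb X G a u * nb X G b v := mul_nonneg (nb_nonneg _ _ _ _) (nb_nonneg _ _ _ _)
    have he : eqi u v = 0 := by simp [eqi, e1]
    split_ifs with hA
    · rw [ind_of_not_adj x1, he, ind_of_not_adj (fun h => hA.2.2.2 h)]; simp
    · rw [ind_of_not_adj x1, he]
      have := ind_le_one G u v
      have h3 : 0 ≤ 1 - ind G u v := by linarith
      positivity
  · simp only [hS, false_and, if_false]
    rw [Finset.sum_const_zero]
    refine Finset.sum_nonneg fun G _ => ?_
    have := ind_le_one G u v
    have := ind_le_one X u v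
    have := eqi_le_one u v
    exact mul_nonneg (mul_nonneg (nb_nonneg _ _ _ _) (nb_nonneg _ _ _ _))
      (mul_nonneg (mul_nonneg (by linarith) (by linarith)) (by linarith))

/-- On average there are many non-adjacent pairs of unrevealed neighbours of `a` and `b`. -/
lemma sum_revc_lower (hP : Par n d p s L) {X F : SimpleGraph (Fin n)}
    (hD : ∀ v, (deg X v : ℝ) ≤ 2 * L * s) {a b : Fin n} (hab : X.Adj a b) :
    ((Om d X F).card : ℝ) * (s ^ 4 / L ^ 5) ≤ ∑ G ∈ Om d X F, revc X a b G := by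
  have h1 : ∑ G ∈ Om d X F, (s ^ 8 / (16 * L ^ 4) - 4 * s ^ 4 * revc X a b G - 60 * L * s ^ 7) ≤
      ∑ G ∈ Om d X F, ∑ u, ∑ v, ∑ z, ∑ w,
        (if Sw X a b u v z w ∧ Alt G u v w z then nb X G a u * nb X G b v else 0) :=
    Finset.sum_le_sum fun G hG => good_lower hP hD hab (mem_Om.1 hG).1
  have h2 : ∑ G ∈ Om d X F, ∑ u, ∑ v, ∑ z, ∑ w,
      (if Sw X a b u v z w ∧ Alt G u v w z then nb X G a u * nb X G b v else 0) ≤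
      s ^ 4 * ∑ G ∈ Om d X F, revc X a b G := by
    have e1 : ∀ u v : Fin n, ∑ z : Fin n, ∑ w : Fin n, ∑ G ∈ Om d X F,
        (if Sw X a b u v z w ∧ Alt G u v w z then nb X G a u * nb X G b v else 0) ≤
        s ^ 4 * ∑ G ∈ Om d X F, nb X G a u * nb X G b v *
          ((1 - ind X u v) * (1 - ind G u v) * (1 - eqi u v)) := by
      intro u v
      refine (Finset.sum_le_sum fun z _ => Finset.sum_le_sum fun w _ =>
        sum_good_le a b u v z w).trans (le_of_eq ?_)
      simp only [Finset.sum_const, Finset.card_univ, Fintype.card_fin, nsmul_eq_mul]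
      rw [← hP.sq]; ring
    have e2 := Finset.sum_le_sum fun u (_ : u ∈ Finset.univ) =>
      Finset.sum_le_sum fun v (_ : v ∈ Finset.univ) => e1 u v
    refine le_trans (le_of_eq ?_) (e2.trans (le_of_eq ?_))
    · rw [Finset.sum_comm]
      refine Finset.sum_congr rfl fun u _ => ?_
      rw [Finset.sum_comm]
      refine Finset.sum_congr rfl fun v _ => ?_
      rw [Finset.sum_comm]
      refine Finset.sum_congr rfl fun z _ => ?_
      rw [Finset.sum_comm]
    · simp only [revc, ← Finset.mul_sum]
      congr 1
      symm
      rw [Finset.sum_comm]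
      refine Finset.sum_congr rfl fun u _ => ?_
      rw [Finset.sum_comm]
  have h3 := h1.trans h2
  rw [Finset.sum_sub_distrib, Finset.sum_sub_distrib, ← Finset.mul_sum] at h3
  simp only [Finset.sum_const, nsmul_eq_mul] at h3
  set N : ℝ := ((Om d X F).card : ℝ) with hN
  set S := ∑ G ∈ Om d X F, revc X a b G with hS
  have hN0 : 0 ≤ N := by positivity
  have hs := hP.s_pos
  have hL0 := hP.L_pos
  have hL := hP.L_ge
  have k1 : 5 * s ^ 8 / L ^ 5 ≤ s ^ 8 / (16 * L ^ 4) - 60 * L * s ^ 7 := by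
    have hb : L ^ 6 ≤ s := hP.pow_le (by norm_num)
    have : 60 * L * s ^ 7 ≤ 60 * s ^ 8 / L ^ 5 := by
      rw [le_div_iff₀ (by positivity)]
      nlinarith [mul_le_mul_of_nonneg_right hb (pow_pos hs 7).le]
    have h5 : 65 * s ^ 8 / L ^ 5 ≤ s ^ 8 / (16 * L ^ 4) := by
      rw [div_le_div_iff₀ (by positivity) (by positivity)]
      have := mul_pos (pow_pos hs 8) (pow_pos hL0 4)
      nlinarith [mul_nonneg (mul_nonneg (pow_pos hs 8).le (pow_pos hL0 4).le) (sub_nonneg.2 hL)]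
    have : 5 * s ^ 8 / L ^ 5 = 65 * s ^ 8 / L ^ 5 - 60 * s ^ 8 / L ^ 5 := by ring
    linarith
  have k2 := mul_le_mul_of_nonneg_left k1 hN0
  have k3 : N * (5 * s ^ 8 / L ^ 5) ≤ 5 * s ^ 4 * S := by nlinarith
  have k4 : N * (5 * s ^ 8 / L ^ 5) = 5 * s ^ 4 * (N * (s ^ 4 / L ^ 5)) := by ring
  rw [k4] at k3
  exact le_of_mul_le_mul_left k3 (by positivity)

end

section

open SimpleGraph

variable {n : ℕ} {d : Fin n → ℕ} {p s L : ℝ}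

lemma deg_le (G : SimpleGraph (Fin n)) (v : Fin n) : deg G v ≤ n - 1 := by
  unfold deg
  have : (Finset.univ.filter fun k => G.Adj v k) ⊆ Finset.univ.erase v := by
    intro k hk
    simp only [Finset.mem_filter, Finset.mem_univ, true_and] at hk
    simp [hk.ne']
  have := Finset.card_le_card this
  simpa using this

lemma deg_compl (G : SimpleGraph (Fin n)) (v : Fin n) : deg Gᶜ v = n - 1 - deg G v := by
  have h : deg Gᶜ v =
      ((Finset.univ.erase v) \ (Finset.univ.filter fun k => G.Adj v k)).card := by
    unfold deg
    congr 1
    ext k; simp [compl_adj, eq_comm]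
  rw [h, Finset.card_sdiff_of_subset]
  · simp [deg]
  · intro k hk
    simp only [Finset.mem_filter, Finset.mem_univ, true_and] at hk
    simp [hk.ne']

lemma compl_mem_Om {X F G : SimpleGraph (Fin n)} (h : G ∈ Om d X F) :
    Gᶜ ∈ Om (fun v => n - 1 - d v) X (X \ F) := by
  rw [mem_Om] at h ⊢
  refine ⟨fun j => by rw [deg_compl, h.1], ?_⟩
  rw [← h.2]
  ext k l
  simp only [inf_adj, compl_adj, sdiff_adj]
  have := X.ne_of_adj (a := k) (b := l)
  tauto

lemma card_compl_filter {X F : SimpleGraph (Fin n)} (hF : F ≤ X) (hd : ∀ v, d v ≤ n - 1)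
    {a b : Fin n} (hab : a ≠ b) :
    ((Om (fun v => n - 1 - d v) X (X \ F)).filter fun G => G.Adj a b).card =
      ((Om d X F).filter fun G => ¬ G.Adj a b).card := by
  have hdd : (fun v => n - 1 - (n - 1 - d v)) = d := by
    funext v; have := hd v; omega
  have hXX : X \ (X \ F) = F := by simpa using hF
  refine Finset.card_bij' (fun G _ => Gᶜ) (fun G _ => Gᶜ) ?_ ?_ ?_ ?_
  · intro G hG
    rw [Finset.mem_filter] at hG ⊢
    have := compl_mem_Om hG.1
    rw [hdd, hXX] at this
    exact ⟨this, by simp [compl_adj, hG.2]⟩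
  · intro G hG
    rw [Finset.mem_filter] at hG ⊢
    exact ⟨compl_mem_Om hG.1, by simp [compl_adj, hG.2, hab]⟩
  · intro G _; simp
  · intro G _; simp

lemma deg_rev_le (X : SimpleGraph (Fin n)) (a b v : Fin n) : deg (rev X a b) v ≤ deg X v + 1 := by
  by_cases hab : a = b
  · subst hab; simp [rev]
  unfold deg
  have : (Finset.univ.filter fun k => (rev X a b).Adj v k) ⊆
      insert (if v = a then b else a) (Finset.univ.filter fun k => X.Adj v k) := by
    intro k hk
    simp only [Finset.mem_filter, Finset.mem_univ, true_and, rev_adj hab, Finset.mem_insert] at hk ⊢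
    split_ifs with h
    · grind
    · grind
  exact (Finset.card_le_card this).trans (Finset.card_insert_le _ _)

lemma card_absent_le (hP : Par n d p s L) {X F : SimpleGraph (Fin n)} (hF : F ≤ X)
    (hD : ∀ v, (deg X v : ℝ) + 1 ≤ 2 * L * s) {a b : Fin n} (hab : a ≠ b) (hX : ¬ X.Adj a b) :
    (((Om d X F).filter fun G => ¬ G.Adj a b).card : ℝ) ≤
      L ^ 5 * ((Om d X F).filter fun G => G.Adj a b).card := by
  have hX' : (rev X a b).Adj a b := by rw [rev_adj hab]; tauto
  have hXle : ∀ {k l}, ¬ (rev X a b).Adj k l → ¬ X.Adj k l := fun h h' => h (Or.inl h')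
  have hD' : ∀ v, (deg (rev X a b) v : ℝ) ≤ 2 * L * s := by
    intro v
    have : (deg (rev X a b) v : ℝ) ≤ deg X v + 1 := by exact_mod_cast deg_rev_le X a b v
    linarith [hD v]
  have h1 := sum_revc_lower hP (F := F) hD' hX'
  rw [Om_absent hab hX hF] at h1
  set N1 : ℝ := (((Om d X F).filter fun G => G.Adj a b).card : ℝ) with hN1
  set N0 : ℝ := (((Om d X F).filter fun G => ¬ G.Adj a b).card : ℝ) with hN0
  have h2 : ∑ G ∈ (Om d X F).filter fun G => ¬ G.Adj a b, revc (rev X a b) a b G ≤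
      s ^ 4 * N1 := by
    have h3 : ∀ u v : Fin n, ∑ G ∈ (Om d X F).filter fun G => ¬ G.Adj a b,
        nb (rev X a b) G a u * nb (rev X a b) G b v *
        ((1 - ind (rev X a b) u v) * (1 - ind G u v) * (1 - eqi u v)) ≤ N1 := by
      intro u v
      by_cases hc : (u ≠ v ∧ u ≠ a ∧ u ≠ b ∧ v ≠ a ∧ v ≠ b) ∧ ¬ (rev X a b).Adj a u ∧
          ¬ (rev X a b).Adj b v ∧ ¬ (rev X a b).Adj u v
      · obtain ⟨⟨e1, e2, e3, e4, e5⟩, x1, x2, x3⟩ := hc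
        have hfl := sum_flip (d := d) (X := X) (F := F) (a := u) (b := a) (c := b) (e := v)
          e2 hab e5.symm e1.symm e3 e4.symm
          (fun h => hXle x1 h.symm) hX (hXle x2) (fun h => hXle x3 h.symm) (fun _ => 1)
        calc _ ≤ ∑ G ∈ (Om d X F).filter (fun G => Alt G u a b v), (1 : ℝ) := by
              rw [Finset.sum_filter, Finset.sum_filter]
              refine Finset.sum_le_sum fun G _ => ?_
              simp only [nb, ind_of_not_adj x1, ind_of_not_adj x2, ind_of_not_adj x3]
              by_cases hA : Alt G u a b v
              · rw [if_pos hA]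
                obtain ⟨h5, h6, h7, h8⟩ := hA
                rw [ind_of_adj h5.symm, ind_of_adj h6, ind_of_not_adj (fun h => h8 h.symm)]
                split_ifs <;> simp [eqi, e1]
              · rw [if_neg hA]
                split_ifs with h
                · exact le_rfl
                · simp only [Alt, not_and_or, not_not] at hA
                  rcases hA with h5 | h5 | h5 | h5
                  · rw [ind_of_not_adj (fun h => h5 h.symm)]; simp
                  · rw [ind_of_not_adj h5]; simp
                  · exact absurd h5 h
                  · rw [ind_of_adj h5.symm]; simp
          _ = ∑ G ∈ (Om d X F).filter (fun G => Alt G a b v u), (1 : ℝ) := hfl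
          _ ≤ N1 := by
              simp only [Finset.sum_const, nsmul_eq_mul, mul_one, hN1]
              norm_cast
              refine Finset.card_le_card fun G hG => ?_
              rw [Finset.mem_filter] at hG ⊢
              exact ⟨hG.1, hG.2.1⟩
      · have hz : ∀ G : SimpleGraph (Fin n), nb (rev X a b) G a u * nb (rev X a b) G b v *
            ((1 - ind (rev X a b) u v) * (1 - ind G u v) * (1 - eqi u v)) = 0 := by
          intro G
          by_contra hne
          apply hc
          have hau : ¬ (rev X a b).Adj a u := fun h => hne (by simp [nb, ind_of_adj h])
          have hbv : ¬ (rev X a b).Adj b v := fun h => hne (by simp [nb, ind_of_adj h])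
          refine ⟨⟨?_, ?_, ?_, ?_, ?_⟩, hau, hbv, ?_⟩
          · rintro rfl; exact hne (by simp [eqi])
          · rintro rfl; exact hne (by simp [nb, ind_self])
          · rintro rfl; exact hau hX'
          · rintro rfl; exact hbv hX'.symm
          · rintro rfl; exact hne (by simp [nb, ind_self])
          · intro h; exact hne (by simp [ind_of_adj h])
        simp only [hz, Finset.sum_const_zero]
        positivity
    unfold revc
    rw [Finset.sum_comm]
    calc _ ≤ ∑ u : Fin n, ∑ v : Fin n, N1 := by
          refine Finset.sum_le_sum fun u _ => ?_
          rw [Finset.sum_comm]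
          exact Finset.sum_le_sum fun v _ => h3 u v
      _ = s ^ 4 * N1 := by
          simp only [Finset.sum_const, Finset.card_univ, Fintype.card_fin, nsmul_eq_mul]
          rw [← hP.sq]; ring
  have h4 := h1.trans h2
  have hs4 := pow_pos hP.s_pos 4
  have hL5 := pow_pos hP.L_pos 5
  have h5 : s ^ 4 * N0 ≤ s ^ 4 * (L ^ 5 * N1) := by
    have : N0 * (s ^ 4 / L ^ 5) = (s ^ 4 * N0) / L ^ 5 := by ring
    rw [this, div_le_iff₀ hL5] at h4
    linarith
  exact le_of_mul_le_mul_left h5 hs4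

lemma Om_nonempty_le {X F : SimpleGraph (Fin n)} (h : (Om d X F).Nonempty) : F ≤ X := by
  obtain ⟨G, hG⟩ := h; exact le_of_mem_Om hG

lemma card_present_le (hP : Par n d p s L) {X F : SimpleGraph (Fin n)}
    (hne : (Om d X F).Nonempty)
    (hD : ∀ v, (deg X v : ℝ) + 1 ≤ 2 * L * s) {a b : Fin n} (hab : a ≠ b) (hX : ¬ X.Adj a b) :
    (((Om d X F).filter fun G => G.Adj a b).card : ℝ) ≤
      L ^ 5 * ((Om d X F).filter fun G => ¬ G.Adj a b).card := by
  have hF := Om_nonempty_le hne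
  have hd : ∀ v, d v ≤ n - 1 := by
    obtain ⟨G, hG⟩ := hne
    intro v; rw [← (mem_Om.1 hG).1 v]; exact deg_le G v
  have h := card_absent_le (hP.compl hd) (X := X) (F := X \ F) sdiff_le hD hab hX
  rw [card_compl_filter hF hd hab] at h
  have hdd : (fun v => n - 1 - (n - 1 - d v)) = d := by
    funext v; have := hd v; omega
  have hXX : X \ (X \ F) = F := by simpa using hF
  have e : ((Om (fun v => n - 1 - d v) X (X \ F)).filter fun G => ¬ G.Adj a b).card =
      ((Om d X F).filter fun G => G.Adj a b).card := by
    have := card_compl_filter (d := fun v => n - 1 - d v) (X := X) (F := X \ F) sdiff_le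
      (fun v => by omega) hab
    rw [hdd, hXX] at this
    exact this.symm
  rw [e] at h
  exact h

lemma pr_eq (X F : SimpleGraph (Fin n)) (u v : Fin n) :
    pr d X F u v = (((Om d X F).filter fun G => G.Adj u v).card : ℝ) / (Om d X F).card := by
  unfold pr av
  congr 1
  simp [ind, Finset.sum_boole]

lemma card_filter_add (X F : SimpleGraph (Fin n)) (u v : Fin n) :
    (((Om d X F).filter fun G => G.Adj u v).card : ℝ) +
      ((Om d X F).filter fun G => ¬ G.Adj u v).card = (Om d X F).card := by
  exact_mod_cast Finset.card_filter_add_card_filter_not (s := Om d X F) (fun G => G.Adj u v)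

/-- Edge probabilities are bounded away from `0` and `1`. -/
lemma pr_bounds (hP : Par n d p s L) {X F : SimpleGraph (Fin n)}
    (hne : (Om d X F).Nonempty)
    (hD : ∀ v, (deg X v : ℝ) + 1 ≤ 2 * L * s) {a b : Fin n} (hab : a ≠ b) (hX : ¬ X.Adj a b) :
    1 / L ^ 6 ≤ pr d X F a b ∧ 1 / L ^ 6 ≤ 1 - pr d X F a b := by
  have hF := Om_nonempty_le hne
  have h1 := card_absent_le hP hF hD hab hX
  have h2 := card_present_le hP hne hD hab hX
  have h3 := card_filter_add (d := d) X F a b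
  have hN : (0 : ℝ) < (Om d X F).card := by exact_mod_cast hne.card_pos
  rw [pr_eq]
  have hL := hP.L_ge
  have hL5 := pow_pos hP.L_pos 5
  have hL6 : 1 + L ^ 5 ≤ L ^ 6 := by
    have : (1 : ℝ) ≤ L ^ 5 := one_le_pow₀ hP.one_le_L
    nlinarith
  have hL6' := pow_pos hP.L_pos 6
  set N1 : ℝ := (((Om d X F).filter fun G => G.Adj a b).card : ℝ)
  set N0 : ℝ := (((Om d X F).filter fun G => ¬ G.Adj a b).card : ℝ)
  have hN1 : 0 ≤ N1 := by positivity
  have hN0 : 0 ≤ N0 := by positivity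
  constructor
  · rw [div_le_div_iff₀ hL6' hN]; nlinarith
  · rw [le_sub_iff_add_le, div_add_div _ _ hL6'.ne' hN.ne', div_le_one (by positivity)]
    nlinarith

end

section

open SimpleGraph

variable {n : ℕ} {d : Fin n → ℕ} {p s L : ℝ}

section Average

variable {S : Finset (SimpleGraph (Fin n))} {f g : SimpleGraph (Fin n) → ℝ}

lemma av_add : av S (fun G => f G + g G) = av S f + av S g := by
  simp [av, Finset.sum_add_distrib, add_div]

lemma av_sub : av S (fun G => f G - g G) = av S f - av S g := by
  simp [av, Finset.sum_sub_distrib, sub_div]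

lemma av_mul_left (c : ℝ) : av S (fun G => c * f G) = c * av S f := by
  simp [av, ← Finset.mul_sum, mul_div_assoc]

lemma av_const (hS : S.Nonempty) (c : ℝ) : av S (fun _ => c) = c := by
  have : (S.card : ℝ) ≠ 0 := by exact_mod_cast hS.card_pos.ne'
  simp [av, this]

lemma av_sum {ι : Type*} (t : Finset ι) (h : ι → SimpleGraph (Fin n) → ℝ) :
    av S (fun G => ∑ i ∈ t, h i G) = ∑ i ∈ t, av S (h i) := by
  unfold av
  rw [Finset.sum_comm, Finset.sum_div]

lemma av_mono (h : ∀ G ∈ S, f G ≤ g G) : av S f ≤ av S g := by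
  unfold av
  gcongr with G hG
  exact h G hG

lemma av_congr (h : ∀ G ∈ S, f G = g G) : av S f = av S g := by
  unfold av
  rw [Finset.sum_congr rfl h]

lemma abs_av_le : |av S f| ≤ av S (fun G => |f G|) := by
  unfold av
  rw [abs_div, Nat.abs_cast]
  gcongr
  exact Finset.abs_sum_le_sum_abs _ _

lemma av_nonneg (h : ∀ G ∈ S, 0 ≤ f G) : 0 ≤ av S f := by
  unfold av
  exact div_nonneg (Finset.sum_nonneg h) (by positivity)

lemma av_le_of_le (hS : S.Nonempty) {c : ℝ} (h : ∀ G ∈ S, f G ≤ c) : av S f ≤ c := by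
  rw [← av_const hS c]; exact av_mono h

end Average

/-- Size constraints on the graph of revealed pairs. -/
structure Dom (s L : ℝ) (X : SimpleGraph (Fin n)) (j : ℕ) : Prop where
  max : ∀ v, (deg X v : ℝ) ≤ L * s + j
  tot : ∑ v, (deg X v : ℝ) ≤ L ^ 2 * s ^ 2 + 2 * j

lemma ind_rev_le (X : SimpleGraph (Fin n)) {a b : Fin n} (hab : a ≠ b) (u v : Fin n) :
    ind (rev X a b) u v ≤ ind X u v + (eqi u a * eqi v b + eqi u b * eqi v a) := by
  unfold ind eqi
  simp only [rev_adj hab]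
  split_ifs <;> simp_all

lemma Dom.rev {X : SimpleGraph (Fin n)} {j : ℕ} (h : Dom s L X j) (a b : Fin n) :
    Dom s L (rev X a b) (j + 1) := by
  refine ⟨fun v => ?_, ?_⟩
  · have : (deg (Stmt15.rev X a b) v : ℝ) ≤ deg X v + 1 := by exact_mod_cast deg_rev_le X a b v
    push_cast
    linarith [h.max v]
  · by_cases hab : a = b
    · subst hab
      have : Stmt15.rev X a a = X := by simp [Stmt15.rev]
      rw [this]
      push_cast
      linarith [h.tot]
    · have : ∑ v, (deg (Stmt15.rev X a b) v : ℝ) ≤ ∑ v, (deg X v : ℝ) + 2 := by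
        simp only [deg_eq_sum]
        calc _ ≤ ∑ v, ∑ w, (ind X v w + (eqi v a * eqi w b + eqi v b * eqi w a)) :=
              Finset.sum_le_sum fun v _ => Finset.sum_le_sum fun w _ => ind_rev_le X hab v w
          _ = _ := by
              simp only [Finset.sum_add_distrib, ← Finset.mul_sum, sum_eqi', mul_one]
              norm_num
      push_cast
      linarith [h.tot]

lemma Dom.deg_le {X : SimpleGraph (Fin n)} {j : ℕ} (h : Dom s L X j) (hj : (j : ℝ) + 1 ≤ L * s)
    (v : Fin n) : (deg X v : ℝ) + 1 ≤ 2 * L * s := by linarith [h.max v]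

lemma pr_nonneg (X F : SimpleGraph (Fin n)) (u v : Fin n) : 0 ≤ pr d X F u v :=
  av_nonneg fun _ _ => ind_nonneg _ _ _

lemma pr_le_one (X F : SimpleGraph (Fin n)) (u v : Fin n) : pr d X F u v ≤ 1 := by
  rw [pr_eq]
  refine div_le_one_of_le₀ ?_ (by positivity)
  exact_mod_cast Finset.card_filter_le _ _

lemma children_nonempty (hP : Par n d p s L) {X F : SimpleGraph (Fin n)} {j : ℕ}
    (hne : (Om d X F).Nonempty) (hD : Dom s L X j) (hj : (j : ℝ) + 1 ≤ L * s)
    {a b : Fin n} (hab : a ≠ b) (hX : ¬ X.Adj a b) :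
    (Om d (rev X a b) (rev F a b)).Nonempty ∧ (Om d (rev X a b) F).Nonempty := by
  have hF := Om_nonempty_le hne
  obtain ⟨h1, h2⟩ := pr_bounds hP hne (hD.deg_le hj) hab hX
  have hL6 := pow_pos hP.L_pos 6
  have h0 : 0 < 1 / L ^ 6 := by positivity
  rw [Om_present hab hX hF, Om_absent hab hX hF]
  have h3 := card_filter_add (d := d) X F a b
  have hN : (0 : ℝ) < (Om d X F).card := by exact_mod_cast hne.card_pos
  rw [pr_eq] at h1 h2
  constructor
  · rw [← Finset.card_pos]
    by_contra hc
    have : ((Om d X F).filter fun G => G.Adj a b).card = 0 := by omega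
    rw [this] at h1; simp at h1; linarith
  · rw [← Finset.card_pos]
    by_contra hc
    have : ((Om d X F).filter fun G => ¬ G.Adj a b).card = 0 := by omega
    rw [this] at h3
    rw [show (((Om d X F).filter fun G => G.Adj a b).card : ℝ) = (Om d X F).card by
      push_cast at h3; linarith] at h2
    rw [div_self hN.ne'] at h2; linarith

lemma av_ind_mul {X F : SimpleGraph (Fin n)} (hF : F ≤ X) {a b : Fin n} (hab : a ≠ b)
    (hX : ¬ X.Adj a b) (f : SimpleGraph (Fin n) → ℝ) :
    av (Om d X F) (fun G => ind G a b * f G) =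
      pr d X F a b * av (Om d (rev X a b) (rev F a b)) f := by
  rw [Om_present hab hX hF, pr_eq]
  unfold av
  by_cases h0 : (((Om d X F).filter fun G => G.Adj a b).card : ℝ) = 0
  · rw [h0]
    have : ∑ G ∈ Om d X F, ind G a b * f G = 0 := by
      refine Finset.sum_eq_zero fun G hG => ?_
      have he : (Om d X F).filter (fun G => G.Adj a b) = ∅ := by
        rw [← Finset.card_eq_zero]; exact_mod_cast h0
      have : ¬ G.Adj a b := fun h => by
        have : G ∈ (Om d X F).filter (fun G => G.Adj a b) := Finset.mem_filter.2 ⟨hG, h⟩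
        rw [he] at this; simp at this
      simp [ind_of_not_adj this]
    rw [this]; simp
  · have key : ∀ N₁ N A : ℝ, N₁ ≠ 0 → N₁ / N * (A / N₁) = A / N := fun N₁ N A h => by field_simp
    rw [key _ _ _ h0, Finset.sum_filter]
    congr 1
    refine Finset.sum_congr rfl fun G _ => ?_
    by_cases hG : G.Adj a b <;> simp [ind, hG]

lemma av_ind_compl_mul {X F : SimpleGraph (Fin n)} (hF : F ≤ X) {a b : Fin n} (hab : a ≠ b)
    (hX : ¬ X.Adj a b) (hne : (Om d X F).Nonempty) (f : SimpleGraph (Fin n) → ℝ) :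
    av (Om d X F) (fun G => (1 - ind G a b) * f G) =
      (1 - pr d X F a b) * av (Om d (rev X a b) F) f := by
  have hN : ((Om d X F).card : ℝ) ≠ 0 := by exact_mod_cast hne.card_pos.ne'
  have h1 : 1 - pr d X F a b = (((Om d X F).filter fun G => ¬ G.Adj a b).card : ℝ) /
      (Om d X F).card := by
    rw [pr_eq, eq_div_iff hN, sub_mul, div_mul_cancel₀ _ hN]
    linarith [card_filter_add (d := d) X F a b]
  rw [Om_absent hab hX hF, h1]
  unfold av
  by_cases h0 : (((Om d X F).filter fun G => ¬ G.Adj a b).card : ℝ) = 0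
  · rw [h0]
    have : ∑ G ∈ Om d X F, (1 - ind G a b) * f G = 0 := by
      refine Finset.sum_eq_zero fun G hG => ?_
      have he : (Om d X F).filter (fun G => ¬ G.Adj a b) = ∅ := by
        rw [← Finset.card_eq_zero]; exact_mod_cast h0
      have : G.Adj a b := by
        by_contra h
        have : G ∈ (Om d X F).filter (fun G => ¬ G.Adj a b) := Finset.mem_filter.2 ⟨hG, h⟩
        rw [he] at this; simp at this
      simp [ind_of_adj this]
    rw [this]; simp
  · have key : ∀ N₁ N A : ℝ, N₁ ≠ 0 → N₁ / N * (A / N₁) = A / N := fun N₁ N A h => by field_simp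
    rw [key _ _ _ h0, Finset.sum_filter]
    congr 1
    refine Finset.sum_congr rfl fun G _ => ?_
    by_cases hG : G.Adj a b <;> simp [ind, hG]

/-- `Q` approximates all edge probabilities, within the next `j` revelations. -/
def Near (d : Fin n → ℕ) (η : ℝ) (Q : Fin n → Fin n → ℝ) :
    ℕ → SimpleGraph (Fin n) → SimpleGraph (Fin n) → Prop
  | 0, _, _ => True
  | j + 1, X, F => ∀ u v, u ≠ v → ¬ X.Adj u v → |pr d X F u v - Q u v| ≤ η ∧
      Near d η Q j (rev X u v) (rev F u v) ∧ Near d η Q j (rev X u v) F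

lemma Near.of_le {η : ℝ} {Q : Fin n → Fin n → ℝ} : ∀ {i j : ℕ} {X F : SimpleGraph (Fin n)},
    Near d η Q j X F → i ≤ j → Near d η Q i X F
  | 0, _, _, _, _, _ => trivial
  | i + 1, 0, _, _, _, h => absurd h (by omega)
  | i + 1, j + 1, _, _, h, hij => fun u v huv hX =>
      ⟨(h u v huv hX).1, (h u v huv hX).2.1.of_le (by omega), (h u v huv hX).2.2.of_le (by omega)⟩

/-- The value of an edge status: `(u, v, true)` is the event that `uv` is an edge. -/
noncomputable def stv (x : Fin n → Fin n → ℝ) (e : Fin n × Fin n × Bool) : ℝ :=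
  if e.2.2 then x e.1 e.2.1 else 1 - x e.1 e.2.1

lemma stv_mem {x : Fin n → Fin n → ℝ} (hx : ∀ u v, 0 ≤ x u v ∧ x u v ≤ 1)
    (e : Fin n × Fin n × Bool) : 0 ≤ stv x e ∧ stv x e ≤ 1 := by
  have := hx e.1 e.2.1
  unfold stv
  split_ifs
  · exact this
  · constructor <;> linarith

lemma prod_stv_mem {x : Fin n → Fin n → ℝ} (hx : ∀ u v, 0 ≤ x u v ∧ x u v ≤ 1)
    (l : List (Fin n × Fin n × Bool)) : 0 ≤ (l.map (stv x)).prod ∧ (l.map (stv x)).prod ≤ 1 := by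
  induction l with
  | nil => simp
  | cons e l ih =>
    simp only [List.map_cons, List.prod_cons]
    have := stv_mem hx e
    exact ⟨mul_nonneg this.1 ih.1, mul_le_one₀ this.2 ih.1 ih.2⟩

lemma ind_mem (G : SimpleGraph (Fin n)) (u v : Fin n) : 0 ≤ ind G u v ∧ ind G u v ≤ 1 :=
  ⟨ind_nonneg G u v, ind_le_one G u v⟩

lemma near_prod (hP : Par n d p s L) {η : ℝ} (hη : 0 ≤ η) {Q : Fin n → Fin n → ℝ}
    (hQ : ∀ u v, 0 ≤ Q u v ∧ Q u v ≤ 1) (l : List (Fin n × Fin n × Bool)) :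
    ∀ {X F : SimpleGraph (Fin n)} {j : ℕ}, (Om d X F).Nonempty → Dom s L X j →
      (j : ℝ) + l.length ≤ L * s → Near d η Q l.length X F →
      (∀ e ∈ l, e.1 ≠ e.2.1 ∧ ¬ X.Adj e.1 e.2.1) →
      l.Pairwise (fun e f => s(e.1, e.2.1) ≠ s(f.1, f.2.1)) →
      |av (Om d X F) (fun G => (l.map (stv (ind G))).prod) - (l.map (stv Q)).prod| ≤
        l.length * η := by
  induction l with
  | nil =>
    intro X F j hne _ _ _ _ _
    simp [av_const hne]
  | cons e l ih =>
    intro X F j hne hD hj hN hu hpw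
    have hF := Om_nonempty_le hne
    obtain ⟨he, hX⟩ := hu e (by simp)
    have hj' : (j : ℝ) + 1 ≤ L * s := by
      have : (0 : ℝ) ≤ (l.length : ℝ) := by positivity
      simp only [List.length_cons] at hj
      push_cast at hj; linarith
    obtain ⟨hc1, hc0⟩ := children_nonempty hP hne hD hj' he hX
    simp only [List.length_cons] at hN hj
    obtain ⟨hN0, hN1, hN2⟩ := hN e.1 e.2.1 he hX
    rw [List.pairwise_cons] at hpw
    have hu' : ∀ f ∈ l, f.1 ≠ f.2.1 ∧ ¬ (rev X e.1 e.2.1).Adj f.1 f.2.1 := by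
      intro f hf
      obtain ⟨h1, h2⟩ := hu f (by simp [hf])
      refine ⟨h1, ?_⟩
      rw [rev_adj he]
      have h3 := hpw.1 f hf
      rw [Ne, Sym2.eq_iff] at h3
      grind
    have hjj : ((j + 1 : ℕ) : ℝ) + l.length ≤ L * s := by push_cast at hj ⊢; linarith
    have i1 := ih hc1 (hD.rev _ _) hjj hN1 hu' hpw.2
    have i0 := ih hc0 (hD.rev _ _) hjj hN2 hu' hpw.2
    have hB := prod_stv_mem hQ l
    have key : ∀ P q A B : ℝ, 0 ≤ P → P ≤ 1 → |P - q| ≤ η → 0 ≤ B → B ≤ 1 →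
        |A - B| ≤ l.length * η → |P * A - q * B| ≤ (l.length + 1) * η := by
      intro P q A B h1 h2 h3 h4 h5 h6
      have : P * A - q * B = P * (A - B) + (P - q) * B := by ring
      rw [this]
      calc _ ≤ |P * (A - B)| + |(P - q) * B| := abs_add_le _ _
        _ ≤ 1 * (l.length * η) + η * 1 := by
            rw [abs_mul, abs_mul, abs_of_nonneg h1, abs_of_nonneg h4]
            gcongr
        _ = _ := by ring
    have p0 := pr_nonneg (d := d) X F e.1 e.2.1
    have p1 := pr_le_one (d := d) X F e.1 e.2.1
    simp only [List.map_cons, List.prod_cons, List.length_cons]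
    push_cast
    cases hb : e.2.2
    · have hs1 : ∀ x : Fin n → Fin n → ℝ, stv x e = 1 - x e.1 e.2.1 := by
        intro x; simp [stv, hb]
      simp only [hs1]
      rw [av_ind_compl_mul hF he hX hne]
      refine key _ _ _ _ (by linarith) (by linarith) ?_ hB.1 hB.2 i0
      rw [show 1 - pr d X F e.1 e.2.1 - (1 - Q e.1 e.2.1) =
        -(pr d X F e.1 e.2.1 - Q e.1 e.2.1) by ring, abs_neg]
      exact hN0
    · have hs1 : ∀ x : Fin n → Fin n → ℝ, stv x e = x e.1 e.2.1 := by
        intro x; simp [stv, hb]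
      simp only [hs1]
      rw [av_ind_mul hF he hX]
      exact key _ _ _ _ p0 p1 hN0 hB.1 hB.2 i1

end

section

open SimpleGraph

variable {n : ℕ} {d : Fin n → ℕ} {p s L : ℝ}

/-- Common unrevealed partners of `b` and `c`, other than `a`. -/
noncomputable def Wset (X : SimpleGraph (Fin n)) (a b c : Fin n) : Finset (Fin n) :=
  Finset.univ.filter fun v => v ≠ a ∧ v ≠ b ∧ v ≠ c ∧ ¬ X.Adj b v ∧ ¬ X.Adj c v

/-- Partners of `b` revealed for `c` but not for `b`. -/
noncomputable def Yset (X : SimpleGraph (Fin n)) (a b c : Fin n) : Finset (Fin n) :=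
  Finset.univ.filter fun v => v ≠ a ∧ v ≠ b ∧ v ≠ c ∧ ¬ X.Adj b v ∧ X.Adj c v

lemma mem_Wset {X : SimpleGraph (Fin n)} {a b c v : Fin n} :
    v ∈ Wset X a b c ↔ v ≠ a ∧ v ≠ b ∧ v ≠ c ∧ ¬ X.Adj b v ∧ ¬ X.Adj c v := by simp [Wset]

lemma mem_Yset {X : SimpleGraph (Fin n)} {a b c v : Fin n} :
    v ∈ Yset X a b c ↔ v ≠ a ∧ v ≠ b ∧ v ≠ c ∧ ¬ X.Adj b v ∧ X.Adj c v := by simp [Yset]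

/-- The number of `v ∈ Wset` joined to `c` but not to `b`. -/
noncomputable def gW (X : SimpleGraph (Fin n)) (a b c : Fin n) (G : SimpleGraph (Fin n)) : ℝ :=
  ∑ v ∈ Wset X a b c, ind G c v * (1 - ind G b v)

/-- The residual degree of `v`. -/
noncomputable def res (d : Fin n → ℕ) (F : SimpleGraph (Fin n)) (v : Fin n) : ℝ := d v - deg F v

/-- The discrepancy between `b` and `c`. -/
noncomputable def dl (d : Fin n → ℕ) (X F : SimpleGraph (Fin n)) (a b c : Fin n)
    (x : Fin n → Fin n → ℝ) : ℝ :=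
  res d F b - res d F c - ∑ v ∈ Yset X a b c, x b v + ∑ v ∈ Yset X a c b, x c v

lemma gW_nonneg (X : SimpleGraph (Fin n)) (a b c : Fin n) (G : SimpleGraph (Fin n)) :
    0 ≤ gW X a b c G :=
  Finset.sum_nonneg fun v _ => mul_nonneg (ind_nonneg _ _ _) (by linarith [ind_le_one G b v])

lemma sum_nb {X F G : SimpleGraph (Fin n)} (hG : G ∈ Om d X F) (v : Fin n) :
    ∑ w, nb X G v w = res d F v := by
  rw [mem_Om] at hG
  unfold res
  rw [← hG.1 v, ← hG.2, deg_eq_sum, deg_eq_sum, ← Finset.sum_sub_distrib]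
  refine Finset.sum_congr rfl fun w _ => ?_
  unfold nb ind
  simp only [inf_adj]
  by_cases h1 : G.Adj v w <;> by_cases h2 : X.Adj v w <;> simp [h1, h2]

lemma gW_swap {X F G : SimpleGraph (Fin n)} {a b c : Fin n} (hab : a ≠ b) (hac : a ≠ c)
    (hbc : b ≠ c) (xb : ¬ X.Adj a b) (xc : ¬ X.Adj a c) (hG : G ∈ Om d X F) (h1 : ¬ G.Adj a b)
    (h2 : G.Adj a c) :
    gW X a c b G = gW X a b c G + 1 + dl d X F a b c (ind G) := by
  unfold gW dl
  rw [← sum_nb hG b, ← sum_nb hG c]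
  have hWs : Wset X a c b = Wset X a b c := by ext v; simp only [mem_Wset]; tauto
  rw [hWs]
  have e : ∀ (P : Fin n → Prop) [DecidablePred P] (f : Fin n → ℝ),
      ∑ v ∈ Finset.univ.filter P, f v = ∑ v, if P v then f v else 0 :=
    fun P _ f => Finset.sum_filter _ _
  have e1 : ∀ v : Fin n, ∀ x : ℝ, x = ∑ w, if w = v then x else 0 := fun v x => by simp
  have hb : nb X G b c = nb X G c b := by unfold nb; rw [ind_comm X, ind_comm G]
  have e2 : (∑ w, if w = b then nb X G c b else 0) = ∑ w, if w = c then nb X G b c else 0 := by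
    rw [← e1 b, ← e1 c, hb]
  rw [e1 a 1]
  have e3 : ∀ x y : ℝ, x = y + ((∑ w, if w = b then nb X G c b else 0) -
      ∑ w, if w = c then nb X G b c else 0) → x = y := by
    intro x y h; rw [e2] at h; linarith
  apply e3
  unfold Wset Yset
  simp only [e, ← Finset.sum_add_distrib, ← Finset.sum_sub_distrib]
  refine Finset.sum_congr rfl fun v _ => ?_
  by_cases hva : v = a
  · subst hva
    simp [nb, ind, hab, hac, X.adj_comm b v, X.adj_comm c v, G.adj_comm b v, G.adj_comm c v,
      xb, xc, h1, h2]
  by_cases hvb : v = b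
  · subst hvb
    simp [nb, ind, hbc, hab.symm]
  by_cases hvc : v = c
  · subst hvc
    simp [nb, ind, hbc.symm, hac.symm]
  by_cases x1 : X.Adj b v <;> by_cases x2 : X.Adj c v <;>
    by_cases g1 : G.Adj b v <;> by_cases g2 : G.Adj c v <;>
    simp [hva, hvb, hvc, nb, ind, x1, x2, g1, g2]

lemma gW_flip {X G : SimpleGraph (Fin n)} {a b c v : Fin n} (hab : a ≠ b) (hac : a ≠ c)
    (hv : v ∈ Wset X a b c) (hA : Alt G b v c a) :
    gW X a b c (flip4 b v c a G) = gW X a b c G + 1 := by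
  obtain ⟨h1, h2, h3, -⟩ := mem_Wset.1 hv
  unfold gW
  rw [← Finset.add_sum_erase _ _ hv, ← Finset.add_sum_erase _ _ hv]
  have e1 : ∑ w ∈ (Wset X a b c).erase v,
      ind (flip4 b v c a G) c w * (1 - ind (flip4 b v c a G) b w) =
      ∑ w ∈ (Wset X a b c).erase v, ind G c w * (1 - ind G b w) := by
    refine Finset.sum_congr rfl fun w hw => ?_
    rw [Finset.mem_erase, mem_Wset] at hw
    have i1 : ind (flip4 b v c a G) c w = ind G c w := by
      unfold ind
      simp only [flip4_adj, cyc_adj h2.symm h3 hac.symm hab]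
      congr 1
      grind
    have i2 : ind (flip4 b v c a G) b w = ind G b w := by
      unfold ind
      simp only [flip4_adj, cyc_adj h2.symm h3 hac.symm hab]
      congr 1
      grind
    rw [i1, i2]
  rw [e1]
  unfold Alt at hA
  have i1 : ind (flip4 b v c a G) c v = 1 := by
    refine ind_of_adj ?_
    simp only [flip4_adj, cyc_adj h2.symm h3 hac.symm hab]
    have := G.adj_comm
    grind
  have i2 : ind (flip4 b v c a G) b v = 0 := by
    refine ind_of_not_adj ?_
    simp only [flip4_adj, cyc_adj h2.symm h3 hac.symm hab]
    have := G.adj_comm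
    grind
  rw [i1, i2, ind_of_adj hA.1]
  ring

lemma sum_switch {X F : SimpleGraph (Fin n)} {a b c : Fin n} (hab : a ≠ b) (hac : a ≠ c)
    (hbc : b ≠ c) (xb : ¬ X.Adj a b) (xc : ¬ X.Adj a c) :
    ∑ G ∈ Om d X F, (1 - ind G a b) * ind G a c * (gW X a c b G / (gW X a b c G + 1)) =
      ∑ G ∈ Om d X F, ind G a b * (1 - ind G a c) * (if gW X a b c G = 0 then 0 else 1) := by
  have hWs : Wset X a c b = Wset X a b c := by ext v; simp only [mem_Wset]; tauto
  have key : ∀ v ∈ Wset X a b c,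
      ∑ G ∈ Om d X F, (1 - ind G a b) * ind G a c * (ind G b v * (1 - ind G c v)) /
        (gW X a b c G + 1) =
      ∑ G ∈ Om d X F, ind G a b * (1 - ind G a c) * (ind G c v * (1 - ind G b v)) /
        gW X a b c G := by
    intro v hv
    obtain ⟨h1, h2, h3, h4, h5⟩ := mem_Wset.1 hv
    have := sum_flip (d := d) (X := X) (F := F) h2.symm h3 hac.symm hab hbc h1 h4
      (fun h => h5 h.symm) (fun h => xc h.symm) xb (fun G => 1 / gW X a b c G)
    rw [Finset.sum_filter, Finset.sum_filter] at this
    convert this using 1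
    · refine Finset.sum_congr rfl fun G _ => ?_
      by_cases hA : Alt G b v c a
      · rw [if_pos hA, gW_flip hab hac hv hA]
        unfold Alt at hA
        rw [ind_of_not_adj hA.2.2.2, ind_comm G a c, ind_of_adj hA.2.1, ind_of_adj hA.1,
          ind_comm G c v, ind_of_not_adj hA.2.2.1]
        norm_num
      · rw [if_neg hA]
        have : (1 - ind G a b) * ind G a c * (ind G b v * (1 - ind G c v)) = 0 := by
          unfold Alt at hA
          unfold ind
          have := G.adj_comm
          split_ifs <;> simp_all
        rw [this, zero_div]
    · refine Finset.sum_congr rfl fun G _ => ?_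
      by_cases hA : Alt G v c a b
      · rw [if_pos hA]
        unfold Alt at hA
        rw [ind_of_adj hA.2.1, ind_comm G a c, ind_of_not_adj hA.2.2.1, ind_comm G c v,
          ind_of_adj hA.1, ind_of_not_adj hA.2.2.2]
        norm_num
      · rw [if_neg hA]
        have : ind G a b * (1 - ind G a c) * (ind G c v * (1 - ind G b v)) = 0 := by
          unfold Alt at hA
          unfold ind
          have := G.adj_comm
          split_ifs <;> simp_all
        rw [this, zero_div]
  have h := Finset.sum_congr rfl key
  rw [Finset.sum_comm, Finset.sum_comm (s := Wset X a b c)] at h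
  convert h using 1
  · refine Finset.sum_congr rfl fun G _ => ?_
    rw [← Finset.sum_div, ← Finset.mul_sum]
    unfold gW
    rw [hWs]
    ring
  · refine Finset.sum_congr rfl fun G _ => ?_
    rw [← Finset.sum_div, ← Finset.mul_sum]
    change _ = _ * gW X a b c G / gW X a b c G
    by_cases h0 : gW X a b c G = 0
    · simp [h0]
    · rw [if_neg h0, mul_div_assoc, div_self h0]

/-- Comparison of the edge probabilities at two vertices. -/
lemma pr_sub_pr {X F : SimpleGraph (Fin n)} {a b c : Fin n} (hab : a ≠ b) (hac : a ≠ c)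
    (hbc : b ≠ c) (xb : ¬ X.Adj a b) (xc : ¬ X.Adj a c) :
    pr d X F a b - pr d X F a c =
      av (Om d X F) (fun G => (1 - ind G a b) * ind G a c *
        (dl d X F a b c (ind G) / (gW X a b c G + 1))) +
      av (Om d X F) (fun G => ind G a b * (1 - ind G a c) *
        (if gW X a b c G = 0 then 1 else 0)) := by
  have h := sum_switch (d := d) (F := F) hab hac hbc xb xc
  unfold pr
  rw [← av_sub, ← av_add]
  unfold av
  congr 1
  rw [Finset.sum_add_distrib, Finset.sum_sub_distrib]
  have h1 : ∑ G ∈ Om d X F, (1 - ind G a b) * ind G a c * (gW X a c b G / (gW X a b c G + 1)) =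
      ∑ G ∈ Om d X F, (1 - ind G a b) * ind G a c +
      ∑ G ∈ Om d X F, (1 - ind G a b) * ind G a c *
        (dl d X F a b c (ind G) / (gW X a b c G + 1)) := by
    rw [← Finset.sum_add_distrib]
    refine Finset.sum_congr rfl fun G hG => ?_
    by_cases i1 : G.Adj a b
    · simp [ind_of_adj i1]
    by_cases i2 : G.Adj a c
    · rw [gW_swap hab hac hbc xb xc hG i1 i2]
      have := gW_nonneg X a b c G
      have : gW X a b c G + 1 ≠ 0 := by positivity
      field_simp
    · simp [ind_of_not_adj i2]
  have h2 : ∑ G ∈ Om d X F, ind G a b * (1 - ind G a c) * (if gW X a b c G = 0 then 0 else 1) +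
      ∑ G ∈ Om d X F, ind G a b * (1 - ind G a c) * (if gW X a b c G = 0 then 1 else 0) =
      ∑ G ∈ Om d X F, ind G a b * (1 - ind G a c) := by
    rw [← Finset.sum_add_distrib]
    refine Finset.sum_congr rfl fun G hG => ?_
    split_ifs <;> ring
  have h3 : ∑ G ∈ Om d X F, ind G a b * (1 - ind G a c) -
      ∑ G ∈ Om d X F, (1 - ind G a b) * ind G a c = ∑ G ∈ Om d X F, ind G a b - ∑ G ∈ Om d X F, ind G a c := by
    rw [← Finset.sum_sub_distrib, ← Finset.sum_sub_distrib]
    refine Finset.sum_congr rfl fun G hG => ?_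
    ring
  linarith

end

section

open SimpleGraph

variable {n : ℕ} {d : Fin n → ℕ} {p s L : ℝ}

lemma av_prod_le (hP : Par n d p s L) {b c : Fin n} (hbc : b ≠ c) (K : Finset (Fin n)) :
    ∀ {X F : SimpleGraph (Fin n)} {j : ℕ}, (Om d X F).Nonempty → Dom s L X j →
      (j : ℝ) + 2 * K.card + 1 ≤ L * s →
      (∀ v ∈ K, v ≠ b ∧ v ≠ c ∧ ¬ X.Adj b v ∧ ¬ X.Adj c v) →
      av (Om d X F) (fun G => ∏ v ∈ K, (1 - (1 - ind G b v) * ind G c v)) ≤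
        (1 - 1 / L ^ 12) ^ K.card := by
  have hL6 : 1 ≤ L ^ 6 := one_le_pow₀ hP.one_le_L
  have hq0 : 0 < 1 / L ^ 6 := by positivity
  have hq1 : 1 / L ^ 6 ≤ 1 := by rw [div_le_one (by positivity)]; exact hL6
  have hL12 : 1 / L ^ 12 = 1 / L ^ 6 * (1 / L ^ 6) := by
    rw [div_mul_div_comm, ← pow_add]; norm_num
  have hq2 : 0 ≤ 1 - 1 / L ^ 12 := by
    rw [hL12]; nlinarith
  induction K using Finset.induction_on with
  | empty => intro X F j hne _ _ _; simp [av_const hne]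
  | insert v K hv ih =>
    intro X F j hne hD hj hK
    obtain ⟨h1, h2, h3, h4⟩ := hK v (by simp)
    rw [Finset.card_insert_of_notMem hv] at hj ⊢
    push_cast at hj
    have hk0 : (0 : ℝ) ≤ K.card := by positivity
    have hF := Om_nonempty_le hne
    have hb := pr_bounds hP hne (hD.deg_le (by linarith)) h1.symm h3
    have hC := children_nonempty hP hne hD (by linarith) h1.symm h3
    have hcv : ¬ (rev X b v).Adj c v := by rw [rev_adj h1.symm]; grind
    have hD1 := hD.rev b v
    have hF1 : F ≤ rev X b v := hF.trans le_sup_left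
    have hc := pr_bounds hP hC.2 (hD1.deg_le (by push_cast; linarith)) h2.symm hcv
    have hC2 := children_nonempty hP hC.2 hD1 (by push_cast; linarith) h2.symm hcv
    have hD2 := hD1.rev c v
    have unre : ∀ w ∈ K, w ≠ b ∧ w ≠ c ∧ ¬ (rev X b v).Adj b w ∧ ¬ (rev X b v).Adj c w := by
      intro w hw
      have hwv : w ≠ v := fun h => hv (h ▸ hw)
      obtain ⟨i1, i2, i3, i4⟩ := hK w (by simp [hw])
      simp only [rev_adj h1.symm]
      grind
    have unre2 : ∀ w ∈ K, w ≠ b ∧ w ≠ c ∧ ¬ (rev (rev X b v) c v).Adj b w ∧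
        ¬ (rev (rev X b v) c v).Adj c w := by
      intro w hw
      have hwv : w ≠ v := fun h => hv (h ▸ hw)
      obtain ⟨i1, i2, i3, i4⟩ := unre w hw
      simp only [rev_adj h2.symm]
      grind
    have a1 := ih hC.1 hD1 (by push_cast; linarith) unre
    have a2 := ih hC2.2 hD2 (by push_cast; linarith) unre2
    have e : ∀ G : SimpleGraph (Fin n), ∏ w ∈ insert v K, (1 - (1 - ind G b w) * ind G c w) =
        ind G b v * ∏ w ∈ K, (1 - (1 - ind G b w) * ind G c w) +
        (1 - ind G b v) * ((1 - ind G c v) * ∏ w ∈ K, (1 - (1 - ind G b w) * ind G c w)) := by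
      intro G; rw [Finset.prod_insert hv]; ring
    simp only [e]
    rw [av_add, av_ind_mul hF h1.symm h3, av_ind_compl_mul hF h1.symm h3 hne,
      av_ind_compl_mul hF1 h2.symm hcv hC.2, pow_succ]
    have hq := pow_nonneg hq2 K.card
    set Q := (1 - 1 / L ^ 12) ^ K.card
    set P := pr d X F b v
    set P' := pr d (rev X b v) F c v
    have m1 : P * av (Om d (rev X b v) (rev F b v))
        (fun G => ∏ v ∈ K, (1 - (1 - ind G b v) * ind G c v)) ≤ P * Q :=
      mul_le_mul_of_nonneg_left a1 (by linarith)
    have m2 : (1 - P) * ((1 - P') * av (Om d (rev (rev X b v) c v) F)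
        (fun G => ∏ v ∈ K, (1 - (1 - ind G b v) * ind G c v))) ≤ (1 - P) * ((1 - P') * Q) :=
      mul_le_mul_of_nonneg_left (mul_le_mul_of_nonneg_left a2 (by linarith)) (by linarith)
    have m3 : 1 / L ^ 12 ≤ (1 - P) * P' := by
      rw [hL12]; exact mul_le_mul hb.2 hc.1 hq0.le (by linarith)
    have m4 : 1 / L ^ 12 * Q ≤ (1 - P) * P' * Q := mul_le_mul_of_nonneg_right m3 hq
    linarith

lemma card_Wset_ge {X : SimpleGraph (Fin n)}
    (hX : ∀ v, (deg X v : ℝ) + 1 ≤ 2 * L * s) (a b c : Fin n) :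
    (n : ℝ) - 4 * L * s ≤ (Wset X a b c).card + 1 := by
  have h : (Finset.univ : Finset (Fin n)) ⊆ Wset X a b c ∪
      ({a, b, c} ∪ ((Finset.univ.filter fun v => X.Adj b v) ∪
        (Finset.univ.filter fun v => X.Adj c v))) := by
    intro v _
    simp only [Finset.mem_union, mem_Wset, Finset.mem_insert, Finset.mem_singleton,
      Finset.mem_filter, Finset.mem_univ, true_and]
    tauto
  have h1 := Finset.card_le_card h
  have h2 := (Finset.card_union_le (Wset X a b c) ({a, b, c} ∪
    ((Finset.univ.filter fun v => X.Adj b v) ∪ (Finset.univ.filter fun v => X.Adj c v))))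
  have h3 := Finset.card_union_le ({a, b, c} : Finset (Fin n))
    ((Finset.univ.filter fun v => X.Adj b v) ∪ (Finset.univ.filter fun v => X.Adj c v))
  have h4 := Finset.card_union_le (Finset.univ.filter fun v => X.Adj b v)
    (Finset.univ.filter fun v => X.Adj c v)
  have h5 := Finset.card_le_three (a := a) (b := b) (c := c)
  have h6 : (Finset.univ : Finset (Fin n)).card = n := by simp
  have : n ≤ (Wset X a b c).card + 3 + deg X b + deg X c := by
    unfold deg; omega
  have h7 : (n : ℝ) ≤ (Wset X a b c).card + 3 + deg X b + deg X c := by exact_mod_cast this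
  linarith [hX b, hX c]

lemma sum_gW_compl (X G : SimpleGraph (Fin n)) (a b c : Fin n) :
    (((Wset X a b c).filter fun v => ¬ (¬ G.Adj b v ∧ G.Adj c v)).card : ℝ) =
      (Wset X a b c).card - gW X a b c G := by
  have h := Finset.card_filter_add_card_filter_not (s := Wset X a b c)
    (fun v => ¬ G.Adj b v ∧ G.Adj c v)
  have h2 : gW X a b c G = ((Wset X a b c).filter fun v => ¬ G.Adj b v ∧ G.Adj c v).card := by
    rw [Finset.card_filter]
    push_cast
    unfold gW
    refine Finset.sum_congr rfl fun v _ => ?_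
    by_cases h1 : G.Adj b v <;> by_cases h2 : G.Adj c v <;> simp [ind, h1, h2]
  rw [h2, ← h]; push_cast; ring

lemma pow_card_le (X G : SimpleGraph (Fin n)) (a b c : Fin n) (k : ℕ) {θ : ℝ}
    (h : gW X a b c G < θ) (hk : 0 ≤ (Wset X a b c).card - θ - k) :
    ((Wset X a b c).card - θ - k) ^ k ≤ (Nat.factorial k) * ∑ K ∈ (Wset X a b c).powersetCard k,
      ∏ v ∈ K, (1 - (1 - ind G b v) * ind G c v) := by
  set Z := (Wset X a b c).filter fun v => ¬ (¬ G.Adj b v ∧ G.Adj c v)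
  have hZ := sum_gW_compl X G a b c
  have h1 : (Z.card.choose k : ℝ) ≤ ∑ K ∈ (Wset X a b c).powersetCard k,
      ∏ v ∈ K, (1 - (1 - ind G b v) * ind G c v) := by
    rw [← Finset.card_powersetCard, Finset.card_eq_sum_ones]
    push_cast
    have hsub : Z.powersetCard k ⊆ (Wset X a b c).powersetCard k :=
      Finset.powersetCard_mono (Finset.filter_subset _ _)
    calc ∑ K ∈ Z.powersetCard k, (1 : ℝ) ≤ ∑ K ∈ Z.powersetCard k,
          ∏ v ∈ K, (1 - (1 - ind G b v) * ind G c v) := by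
          refine Finset.sum_le_sum fun K hK => ?_
          rw [Finset.mem_powersetCard] at hK
          rw [Finset.prod_eq_one]
          intro v hv
          have := (Finset.mem_filter.1 (hK.1 hv)).2
          by_cases g1 : G.Adj b v <;> by_cases g2 : G.Adj c v <;> simp_all [ind]
      _ ≤ _ := by
          refine Finset.sum_le_sum_of_subset_of_nonneg hsub fun K _ _ => ?_
          refine Finset.prod_nonneg fun v _ => ?_
          nlinarith [ind_nonneg G b v, ind_le_one G b v, ind_nonneg G c v, ind_le_one G c v]
  have h2 : (Nat.factorial k : ℝ) * (Z.card.choose k : ℝ) = Z.card.descFactorial k := by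
    rw [Nat.descFactorial_eq_factorial_mul_choose]; push_cast; ring
  have h3 : ((Z.card + 1 - k : ℕ) : ℝ) ^ k ≤ Z.card.descFactorial k := by
    exact_mod_cast Nat.pow_sub_le_descFactorial Z.card k
  calc ((Wset X a b c).card - θ - k) ^ k ≤ ((Z.card + 1 - k : ℕ) : ℝ) ^ k := by
        have hkz : (k : ℝ) ≤ Z.card := by rw [hZ]; linarith
        have hkz' : k ≤ Z.card := by exact_mod_cast hkz
        refine pow_le_pow_left₀ hk ?_ k
        rw [Nat.cast_sub (by omega)]
        push_cast
        change _ ≤ ((Finset.card _ : ℕ) : ℝ) + 1 - _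
        rw [hZ]; linarith
    _ ≤ _ := h3
    _ = _ := h2.symm
    _ ≤ _ := by gcongr

/-- The common-switch count is rarely small. -/
lemma tail_bound (hP : Par n d p s L) {X F : SimpleGraph (Fin n)} {j : ℕ}
    (hne : (Om d X F).Nonempty) (hD : Dom s L X j) (hj : j ≤ 100) {a b c : Fin n}
    (hbc : b ≠ c) :
    av (Om d X F) (fun G => if gW X a b c G < s ^ 2 / L ^ 14 then 1 else 0) ≤ 1 / s ^ 8 := by
  have hL := hP.L_pos
  have hs := hP.s_pos
  have hL1 := hP.L_ge
  set k := ⌈L ^ 14⌉₊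
  have hk1 : L ^ 14 ≤ k := Nat.le_ceil _
  have hk2 : (k : ℝ) ≤ L ^ 14 + 1 := (Nat.ceil_lt_add_one (by positivity)).le
  have h14 : 1 ≤ L ^ 14 := one_le_pow₀ hP.one_le_L
  have hk3 : (k : ℝ) ≤ L ^ 15 := by
    calc (k : ℝ) ≤ 2 * L ^ 14 := by linarith
      _ ≤ L * L ^ 14 := by gcongr; linarith
      _ = L ^ 15 := by ring
  have hj' : (j : ℝ) ≤ 100 := by exact_mod_cast hj
  have h15 := hP.pow_le (k := 15) (by norm_num)
  have hLs : 2000 * s ≤ L * s := by gcongr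
  have hs1 := hP.s_ge
  set w : ℝ := ((Wset X a b c).card : ℝ)
  set θ := s ^ 2 / L ^ 14
  set q := 1 / L ^ 12
  have hw : s ^ 2 / 2 ≤ w := by
    have h1 := card_Wset_ge (hD.deg_le (by linarith)) a b c
    have h2 := hP.Ls_le
    rw [← hP.sq] at h1
    have h3 : L * (2000 * s) ≤ L ^ 2 * s := by nlinarith
    change _ ≤ w + 1 at h1
    nlinarith
  have hkθ : (k : ℝ) ≤ θ := by
    rw [le_div_iff₀ (by positivity)]
    calc (k : ℝ) * L ^ 14 ≤ L ^ 15 * L ^ 14 := by gcongr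
      _ = L ^ 29 := by ring
      _ ≤ s := hP.pow_le (by norm_num)
      _ ≤ s ^ 2 := by nlinarith
  have hθq : 2 * θ ≤ q * w / 2 := by
    have : q * w / 2 ≥ q * (s ^ 2 / 2) / 2 := by gcongr
    refine le_trans ?_ this
    have e : 2 * θ = q * (s ^ 2 / 2) / 2 * (8 / L ^ 2) := by
      simp only [θ, q]; field_simp; norm_num
    rw [e]
    refine mul_le_of_le_one_right (by positivity) ?_
    rw [div_le_one (by positivity)]; nlinarith
  have hq0 : 0 < q := by positivity
  have hq1 : q ≤ 1 := by
    rw [div_le_one (by positivity)]; exact one_le_pow₀ hP.one_le_L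
  have hθ0 : 0 < θ := by positivity
  have hw0 : 0 < w := lt_of_lt_of_le (by positivity) hw
  have hmain : (1 - q) * w ≤ (1 - q / 2) * (w - θ - k) := by nlinarith
  have hpos : 0 < w - θ - k := by nlinarith
  set T := av (Om d X F) (fun G => if gW X a b c G < θ then (1 : ℝ) else 0)
  have hT : (w - θ - k) ^ k * T ≤ ((1 - q) * w) ^ k := by
    calc (w - θ - k) ^ k * T = av (Om d X F) (fun G => (w - θ - k) ^ k *
          if gW X a b c G < θ then (1 : ℝ) else 0) := (av_mul_left _).symm
      _ ≤ av (Om d X F) (fun G => (Nat.factorial k) * ∑ K ∈ (Wset X a b c).powersetCard k,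
            ∏ v ∈ K, (1 - (1 - ind G b v) * ind G c v)) := by
          refine av_mono fun G _ => ?_
          split_ifs with h
          · rw [mul_one]; exact pow_card_le X G a b c k h hpos.le
          · rw [mul_zero]
            refine mul_nonneg (by positivity) (Finset.sum_nonneg fun K _ =>
              Finset.prod_nonneg fun v _ => ?_)
            nlinarith [ind_nonneg G b v, ind_le_one G b v, ind_nonneg G c v, ind_le_one G c v]
      _ = (Nat.factorial k) * ∑ K ∈ (Wset X a b c).powersetCard k, av (Om d X F) (fun G =>
            ∏ v ∈ K, (1 - (1 - ind G b v) * ind G c v)) := by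
          rw [av_mul_left, av_sum]
      _ ≤ (Nat.factorial k) * ∑ K ∈ (Wset X a b c).powersetCard k, (1 - q) ^ k := by
          gcongr with K hK
          rw [Finset.mem_powersetCard] at hK
          have := av_prod_le hP hbc K hne hD (by rw [hK.2]; linarith) (fun v hv => by
            have := mem_Wset.1 (hK.1 hv); tauto)
          rwa [hK.2] at this
      _ = (Wset X a b c).card.descFactorial k * (1 - q) ^ k := by
          rw [Finset.sum_const, Finset.card_powersetCard, nsmul_eq_mul,
            Nat.descFactorial_eq_factorial_mul_choose]
          push_cast; ring
      _ ≤ w ^ k * (1 - q) ^ k := by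
          refine mul_le_mul_of_nonneg_right ?_ (pow_nonneg (by linarith) k)
          have := Nat.descFactorial_le_pow (Wset X a b c).card k
          simp only [w]
          exact_mod_cast this
      _ = _ := by rw [mul_pow]; ring
  have hT2 : T ≤ (1 - q / 2) ^ k := by
    have h1 : ((1 - q) * w) ^ k ≤ ((1 - q / 2) * (w - θ - k)) ^ k := by
      refine pow_le_pow_left₀ (mul_nonneg (by linarith) hw0.le) hmain k
    rw [mul_pow (1 - q / 2)] at h1
    have h2 : (w - θ - k) ^ k * T ≤ (w - θ - k) ^ k * (1 - q / 2) ^ k := by linarith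
    exact le_of_mul_le_mul_left h2 (by positivity)
  refine hT2.trans ?_
  have hexp : (1 - q / 2) ^ k ≤ Real.exp (-(8 * Real.log s)) := by
    calc (1 - q / 2) ^ k ≤ (Real.exp (-(q / 2))) ^ k := by
          refine pow_le_pow_left₀ (by linarith) ?_ k
          have := Real.add_one_le_exp (-(q / 2)); linarith
      _ = Real.exp (k * (-(q / 2))) := (Real.exp_nat_mul _ _).symm
      _ ≤ _ := by
          rw [Real.exp_le_exp]
          have h1 : L ^ 14 * q ≤ k * q := by gcongr
          have h2 : L ^ 14 * q = L ^ 2 := by simp only [q]; field_simp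
          nlinarith [hP.hlog]
  refine hexp.trans (le_of_eq ?_)
  rw [Real.exp_neg, one_div]
  congr 1
  rw [show 8 * Real.log s = ((8 : ℕ) : ℝ) * Real.log s by norm_num, Real.exp_nat_mul,
    Real.exp_log hs]

end

section

open SimpleGraph

variable {n : ℕ} {d : Fin n → ℕ} {p s L : ℝ}

lemma deg_mono {F X : SimpleGraph (Fin n)} (h : F ≤ X) (v : Fin n) : deg F v ≤ deg X v := by
  unfold deg
  exact Finset.card_le_card fun w hw => by
    simp only [Finset.mem_filter, Finset.mem_univ, true_and] at hw ⊢; exact h hw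

lemma card_Yset_le (X : SimpleGraph (Fin n)) (a b c : Fin n) : (Yset X a b c).card ≤ deg X c := by
  unfold deg
  exact Finset.card_le_card fun w hw => by
    rw [mem_Yset] at hw
    simp only [Finset.mem_filter, Finset.mem_univ, true_and]; tauto

lemma card_Wset_le (X : SimpleGraph (Fin n)) (a b c : Fin n) : (Wset X a b c).card ≤ n := by
  simpa using Finset.card_le_univ (Wset X a b c)

lemma abs_sum_le_card {ι : Type*} (S : Finset ι) {f : ι → ℝ} {C : ℝ} (h : ∀ i ∈ S, |f i| ≤ C) :
    |∑ i ∈ S, f i| ≤ S.card * C :=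
  calc |∑ i ∈ S, f i| ≤ ∑ i ∈ S, |f i| := Finset.abs_sum_le_sum_abs _ _
    _ ≤ ∑ _i ∈ S, C := Finset.sum_le_sum h
    _ = _ := by rw [Finset.sum_const, nsmul_eq_mul]

lemma abs_res_sub_le (hP : Par n d p s L) {X F : SimpleGraph (Fin n)} (hF : F ≤ X)
    (hX : ∀ v, (deg X v : ℝ) + 1 ≤ 2 * L * s) (b c : Fin n) :
    |res d F b - res d F c| ≤ 6 * (L * s) := by
  have h1 := abs_le.1 (hP.hx b)
  have h2 := abs_le.1 (hP.hx c)
  have h3 : (deg F b : ℝ) ≤ deg X b := by exact_mod_cast deg_mono hF b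
  have h4 : (deg F c : ℝ) ≤ deg X c := by exact_mod_cast deg_mono hF c
  have h5 := hX b
  have h6 := hX c
  have h7 : (0 : ℝ) ≤ deg F b := by positivity
  have h8 : (0 : ℝ) ≤ deg F c := by positivity
  unfold res
  rw [abs_le]
  constructor <;> linarith

lemma abs_dl_le (hP : Par n d p s L) {X F : SimpleGraph (Fin n)} (hF : F ≤ X)
    (hX : ∀ v, (deg X v : ℝ) + 1 ≤ 2 * L * s) {x : Fin n → Fin n → ℝ}
    (hx : ∀ u v, 0 ≤ x u v ∧ x u v ≤ 1) (a b c : Fin n) :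
    |dl d X F a b c x| ≤ 10 * (L * s) := by
  have h0 := abs_res_sub_le hP hF hX b c
  have hY : ∀ b c : Fin n, |∑ v ∈ Yset X a b c, x b v| ≤ 2 * (L * s) := by
    intro b c
    have := abs_sum_le_card (Yset X a b c) (f := fun v => x b v) (C := 1)
      (fun v _ => by rw [abs_of_nonneg (hx b v).1]; exact (hx b v).2)
    have h2 : ((Yset X a b c).card : ℝ) ≤ deg X c := by exact_mod_cast card_Yset_le X a b c
    linarith [hX c]
  have h1 := hY b c
  have h2 := hY c b
  unfold dl
  rw [abs_le] at *
  constructor <;> linarith [h0.1, h0.2, h1.1, h1.2, h2.1, h2.2]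

lemma inv_gW_le (hP : Par n d p s L) (X G : SimpleGraph (Fin n)) (a b c : Fin n) :
    1 / (gW X a b c G + 1) ≤ (if gW X a b c G < s ^ 2 / L ^ 14 then 1 else 0) +
      L ^ 14 / s ^ 2 := by
  have h := gW_nonneg X a b c G
  have h1 := hP.L_pos
  have h2 := hP.s_pos
  have h3 : 0 ≤ L ^ 14 / s ^ 2 := by positivity
  split_ifs with h4
  · have : 1 / (gW X a b c G + 1) ≤ 1 := by rw [div_le_one (by linarith)]; linarith
    linarith
  · rw [zero_add, div_le_div_iff₀ (by linarith) (by positivity)]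
    push Not at h4
    rw [div_le_iff₀ (by positivity)] at h4
    nlinarith [pow_pos h1 14]

lemma av_inv_gW_le (hP : Par n d p s L) {X F : SimpleGraph (Fin n)} {j : ℕ}
    (hne : (Om d X F).Nonempty) (hD : Dom s L X j) (hj : j ≤ 100) {a b c : Fin n}
    (hbc : b ≠ c) :
    av (Om d X F) (fun G => 1 / (gW X a b c G + 1)) ≤ 1 / s ^ 8 + L ^ 14 / s ^ 2 := by
  refine (av_mono fun G _ => inv_gW_le hP X G a b c).trans ?_
  rw [av_add, av_const hne]
  linarith [tail_bound hP hne hD hj (a := a) hbc]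

lemma av_zero_gW_le (hP : Par n d p s L) {X F : SimpleGraph (Fin n)} {j : ℕ}
    (hne : (Om d X F).Nonempty) (hD : Dom s L X j) (hj : j ≤ 100) {a b c : Fin n}
    (hbc : b ≠ c) :
    |av (Om d X F) (fun G => ind G a b * (1 - ind G a c) * (if gW X a b c G = 0 then 1 else 0))| ≤
      1 / s ^ 8 := by
  refine abs_av_le.trans (le_trans (av_mono fun G _ => ?_)
    (tail_bound hP hne hD hj (a := a) hbc))
  have h1 := hP.L_pos
  have h2 := hP.s_pos
  have h3 : 0 < s ^ 2 / L ^ 14 := by positivity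
  have h4 : |ind G a b * (1 - ind G a c)| ≤ 1 := by
    rcases ind_zero_or_one G a b with h | h <;> rcases ind_zero_or_one G a c with h' | h' <;>
      simp [h, h']
  rw [abs_mul]
  by_cases h : gW X a b c G = 0
  · rw [if_pos h, if_pos (by rw [h]; exact h3)]; simpa using h4
  · rw [if_neg h]; split_ifs <;> simp

lemma Dom.deg_le' (hP : Par n d p s L) {X : SimpleGraph (Fin n)} {j : ℕ} (h : Dom s L X j)
    (hj : j ≤ 100) (v : Fin n) : (deg X v : ℝ) + 1 ≤ 2 * L * s := by
  refine h.deg_le ?_ v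
  have : (j : ℝ) ≤ 100 := by exact_mod_cast hj
  nlinarith [hP.s_ge, hP.L_ge]

lemma abs_pr_sub_le (hP : Par n d p s L) {X F : SimpleGraph (Fin n)} {j : ℕ}
    (hne : (Om d X F).Nonempty) (hD : Dom s L X j) (hj : j ≤ 100) {a b c : Fin n}
    (hab : a ≠ b) (hac : a ≠ c) (hbc : b ≠ c) (xb : ¬ X.Adj a b) (xc : ¬ X.Adj a c) :
    |pr d X F a b - pr d X F a c| ≤ L ^ 16 / s := by
  have hF := Om_nonempty_le hne
  have hX := hD.deg_le' hP hj
  have hL := hP.L_pos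
  have hs := hP.s_pos
  rw [pr_sub_pr hab hac hbc xb xc]
  have h1 := av_zero_gW_le hP hne hD hj (a := a) hbc
  have h2 : |av (Om d X F) (fun G => (1 - ind G a b) * ind G a c *
        (dl d X F a b c (ind G) / (gW X a b c G + 1)))| ≤
      10 * (L * s) * (1 / s ^ 8 + L ^ 14 / s ^ 2) := by
    refine abs_av_le.trans ?_
    calc _ ≤ av (Om d X F) (fun G => 10 * (L * s) * (1 / (gW X a b c G + 1))) := by
          refine av_mono fun G _ => ?_
          have h3 := abs_dl_le hP hF hX (ind_mem G) a b c
          have h4 := gW_nonneg X a b c G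
          have h5 : |(1 - ind G a b) * ind G a c| ≤ 1 := by
            rcases ind_zero_or_one G a b with h | h <;>
              rcases ind_zero_or_one G a c with h' | h' <;> simp [h, h']
          rw [abs_mul, abs_div, abs_of_pos (by linarith : 0 < gW X a b c G + 1)]
          calc _ ≤ 1 * (|dl d X F a b c (ind G)| / (gW X a b c G + 1)) := by gcongr
            _ ≤ 1 * (10 * (L * s) / (gW X a b c G + 1)) := by gcongr
            _ = _ := by ring
      _ ≤ _ := by
          rw [av_mul_left]
          gcongr
          exact av_inv_gW_le hP hne hD hj hbc
  refine (abs_add_le _ _).trans ?_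
  have hs1 := hP.s_ge
  have e1 : 1 / s ^ 8 ≤ 1 / s := by
    gcongr
    exact le_self_pow₀ (by linarith) (by norm_num)
  have e2 : 10 * (L * s) * (1 / s ^ 8) ≤ 10 * L / s := by
    have : 10 * (L * s) * (1 / s ^ 8) = 10 * L / s ^ 7 := by field_simp
    rw [this]; gcongr
    exact le_self_pow₀ (by linarith) (by norm_num)
  have e3 : 10 * (L * s) * (L ^ 14 / s ^ 2) = 10 * L ^ 15 / s := by field_simp
  have e4 : 1 + 10 * L + 10 * L ^ 15 ≤ L ^ 16 := by
    have := hP.L_ge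
    have h6 : L ≤ L ^ 15 := le_self_pow₀ (by linarith) (by norm_num)
    have : L ^ 16 = L * L ^ 15 := by ring
    nlinarith
  calc _ ≤ 1 / s + 10 * L / s + 10 * L ^ 15 / s := by linarith
    _ = (1 + 10 * L + 10 * L ^ 15) / s := by ring
    _ ≤ _ := by gcongr

/-- Unrevealed partners of `a`. -/
noncomputable def Uset (X : SimpleGraph (Fin n)) (a : Fin n) : Finset (Fin n) :=
  Finset.univ.filter fun v => v ≠ a ∧ ¬ X.Adj a v

lemma mem_Uset {X : SimpleGraph (Fin n)} {a v : Fin n} :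
    v ∈ Uset X a ↔ v ≠ a ∧ ¬ X.Adj a v := by simp [Uset]

lemma sum_Uset (X : SimpleGraph (Fin n)) (a : Fin n) (f : Fin n → ℝ) :
    ∑ v ∈ Uset X a, f v = ∑ v, f v - f a - ∑ v, ind X a v * f v := by
  have : f a = ∑ v, eqi v a * f v := by simp [eqi]
  rw [this, ← Finset.sum_sub_distrib, ← Finset.sum_sub_distrib, Uset, Finset.sum_filter]
  refine Finset.sum_congr rfl fun v _ => ?_
  by_cases h : v = a
  · subst h; simp [eqi, ind]
  · by_cases h2 : X.Adj a v <;> simp [eqi, ind, h, h2]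

lemma card_Uset (X : SimpleGraph (Fin n)) (a : Fin n) :
    ((Uset X a).card : ℝ) = n - 1 - deg X a := by
  have := sum_Uset X a (fun _ => 1)
  simpa [deg_eq_sum] using this

lemma sum_pr {X F : SimpleGraph (Fin n)} (hne : (Om d X F).Nonempty) (a : Fin n) :
    ∑ v ∈ Uset X a, pr d X F a v = res d F a := by
  unfold pr
  rw [← av_sum]
  rw [← av_const hne (res d F a)]
  refine av_congr fun G hG => ?_
  rw [← sum_nb hG a, sum_Uset, ind_self, sub_zero, ← Finset.sum_sub_distrib]
  refine Finset.sum_congr rfl fun v _ => ?_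
  unfold nb; ring

/-- The excess residual degree. -/
noncomputable def xi (d : Fin n → ℕ) (p : ℝ) (X F : SimpleGraph (Fin n)) (v : Fin n) : ℝ :=
  res d F v - p * (n - 1 - deg X v)

lemma abs_xi_le (hP : Par n d p s L) {X F : SimpleGraph (Fin n)} (hF : F ≤ X) {j : ℕ}
    (hD : Dom s L X j) (hj : j ≤ 100) (v : Fin n) : |xi d p X F v| ≤ 3 * (L * s) := by
  have h1 := hP.hx v
  have h2 : (deg F v : ℝ) ≤ deg X v := by exact_mod_cast deg_mono hF v
  have h3 := hD.deg_le' hP hj v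
  have h4 : (0 : ℝ) ≤ deg F v := by positivity
  have hp := hP.p_pos
  have hp1 := hP.p_lt_one
  have h5 : xi d p X F v = (d v - p * (n - 1)) + (p * deg X v - deg F v) := by
    unfold xi res; ring
  rw [abs_le] at h1
  rw [h5, abs_le]
  have h6 : p * deg X v ≤ deg X v := mul_le_of_le_one_left (by positivity) hp1.le
  have h7 : 0 ≤ p * deg X v := by positivity
  constructor <;> linarith [h1.1, h1.2]

lemma half_le_card_Uset (hP : Par n d p s L) {X : SimpleGraph (Fin n)} {j : ℕ}
    (hD : Dom s L X j) (hj : j ≤ 100) (a : Fin n) :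
    s ^ 2 / 2 ≤ (Uset X a).card := by
  rw [card_Uset, ← hP.sq]
  have h1 := hD.deg_le' hP hj a
  have h2 := hP.Ls_le
  have h0 := mul_pos hP.L_pos hP.s_pos
  have h3 : L * (2000 * s) ≤ L ^ 2 * s := by nlinarith [mul_le_mul_of_nonneg_right hP.L_ge h0.le]
  nlinarith [hP.s_ge]

/-- First-order approximation of edge probabilities. -/
lemma abs_pr_sub_p_le (hP : Par n d p s L) {X F : SimpleGraph (Fin n)} {j : ℕ}
    (hne : (Om d X F).Nonempty) (hD : Dom s L X j) (hj : j ≤ 100) {a b : Fin n}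
    (hab : a ≠ b) (xb : ¬ X.Adj a b) : |pr d X F a b - p| ≤ L ^ 17 / s := by
  have hL := hP.L_pos
  have hs := hP.s_pos
  have hF := Om_nonempty_le hne
  have hU := half_le_card_Uset hP hD hj a
  have hU0 : (0 : ℝ) < (Uset X a).card := lt_of_lt_of_le (by positivity) hU
  have h1 : |∑ c ∈ Uset X a, (pr d X F a b - pr d X F a c)| ≤ (Uset X a).card * (L ^ 16 / s) := by
    refine abs_sum_le_card _ fun c hc => ?_
    rw [mem_Uset] at hc
    by_cases hbc : b = c
    · subst hbc; simp; positivity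
    · exact abs_pr_sub_le hP hne hD hj hab hc.1.symm hbc xb hc.2
  rw [Finset.sum_sub_distrib, sum_pr hne, Finset.sum_const, nsmul_eq_mul] at h1
  have h2 := abs_xi_le hP hF hD hj a
  unfold xi at h2
  rw [← card_Uset] at h2
  have h3 : |(Uset X a).card * (pr d X F a b - p)| ≤
      (Uset X a).card * (L ^ 16 / s) + 3 * (L * s) := by
    have : (Uset X a).card * (pr d X F a b - p) =
      ((Uset X a).card * pr d X F a b - res d F a) + (res d F a - p * (Uset X a).card) := by ring
    rw [this]
    exact (abs_add_le _ _).trans (add_le_add h1 h2)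
  rw [abs_mul, Nat.abs_cast] at h3
  have h4 : 3 * (L * s) ≤ (Uset X a).card * (6 * L / s) := by
    calc 3 * (L * s) = s ^ 2 / 2 * (6 * L / s) := by field_simp; norm_num
      _ ≤ _ := by gcongr
  have h5 : (Uset X a).card * |pr d X F a b - p| ≤ (Uset X a).card * (L ^ 16 / s + 6 * L / s) := by
    linarith
  refine (le_of_mul_le_mul_left h5 hU0).trans ?_
  rw [← add_div]
  gcongr
  have h6 : L ≤ L ^ 16 := le_self_pow₀ hP.one_le_L (by norm_num)
  have : L ^ 17 = L * L ^ 16 := by ring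
  nlinarith [hP.L_ge]

end

section

open SimpleGraph

variable {n : ℕ} {d : Fin n → ℕ} {p s L : ℝ}

lemma near_of_inv {η : ℝ} {Q : Fin n → Fin n → ℝ}
    {I : ℕ → SimpleGraph (Fin n) → SimpleGraph (Fin n) → Prop} {J : ℕ}
    (hstep : ∀ i X F, i ≤ J → I i X F → ∀ u v, u ≠ v → ¬ X.Adj u v →
      I (i + 1) (rev X u v) (rev F u v) ∧ I (i + 1) (rev X u v) F)
    (hI : ∀ i X F, i ≤ J → I i X F → ∀ u v, u ≠ v → ¬ X.Adj u v → |pr d X F u v - Q u v| ≤ η) :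
    ∀ k i X F, i + k ≤ J + 1 → I i X F → Near d η Q k X F
  | 0, _, _, _, _, _ => trivial
  | k + 1, i, X, F, hk, h => fun u v huv hX =>
      ⟨hI i X F (by omega) h u v huv hX,
        near_of_inv hstep hI k (i + 1) _ _ (by omega) (hstep i X F (by omega) h u v huv hX).1,
        near_of_inv hstep hI k (i + 1) _ _ (by omega) (hstep i X F (by omega) h u v huv hX).2⟩

/-- The expected number of common switches under `Q`. -/
noncomputable def gm (X : SimpleGraph (Fin n)) (a b c : Fin n) (Q : Fin n → Fin n → ℝ) : ℝ :=
  ∑ v ∈ Wset X a b c, Q c v * (1 - Q b v)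

section Approx

variable {X F : SimpleGraph (Fin n)} {j : ℕ} {η : ℝ} {Q : Fin n → Fin n → ℝ} {a b c : Fin n}

lemma approx_list (hP : Par n d p s L) (hη : 0 ≤ η) (hQ : ∀ u v, 0 ≤ Q u v ∧ Q u v ≤ 1)
    (hne : (Om d X F).Nonempty) (hD : Dom s L X j) (hj : j ≤ 90) (hN : Near d η Q 6 X F)
    (l : List (Fin n × Fin n × Bool)) (hl : l.length ≤ 6)
    (hu : ∀ e ∈ l, e.1 ≠ e.2.1 ∧ ¬ X.Adj e.1 e.2.1)
    (hpw : l.Pairwise (fun e f => s(e.1, e.2.1) ≠ s(f.1, f.2.1))) :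
    |av (Om d X F) (fun G => (l.map (stv (ind G))).prod) - (l.map (stv Q)).prod| ≤ 6 * η := by
  have h1 : (j : ℝ) ≤ 90 := by exact_mod_cast hj
  have h2 : (l.length : ℝ) ≤ 6 := by exact_mod_cast hl
  refine (near_prod hP hη hQ l hne hD ?_ (hN.of_le hl) hu hpw).trans ?_
  · nlinarith [hP.s_ge, hP.L_ge]
  · gcongr

lemma av_switch_error {x : SimpleGraph (Fin n) → ℝ} {E : ℝ} (hη : 0 ≤ η)
    (hQ : ∀ u v, 0 ≤ Q u v ∧ Q u v ≤ 1)
    (h1 : |av (Om d X F) x - E| ≤ 6 * η)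
    (h2 : ∀ v ∈ Wset X a b c, |av (Om d X F) (fun G => x G * (ind G c v * (1 - ind G b v))) -
      E * (Q c v * (1 - Q b v))| ≤ 6 * η) :
    |av (Om d X F) (fun G => x G * (gm X a b c Q - gW X a b c G))| ≤ n * (12 * η) := by
  have e : ∀ G, x G * (gm X a b c Q - gW X a b c G) = ∑ v ∈ Wset X a b c,
      (Q c v * (1 - Q b v) * x G - x G * (ind G c v * (1 - ind G b v))) := by
    intro G
    unfold gm gW
    rw [← Finset.sum_sub_distrib, Finset.mul_sum]
    refine Finset.sum_congr rfl fun v _ => by ring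
  simp only [e]
  rw [av_sum]
  refine (abs_sum_le_card _ (C := 12 * η) fun v hv => ?_).trans ?_
  · rw [av_sub, av_mul_left]
    have hq : |Q c v * (1 - Q b v)| ≤ 1 := by
      rw [abs_of_nonneg (mul_nonneg (hQ _ _).1 (by linarith [(hQ b v).2]))]
      exact mul_le_one₀ (hQ _ _).2 (by linarith [(hQ b v).2]) (by linarith [(hQ b v).1])
    have : Q c v * (1 - Q b v) * av (Om d X F) x -
        av (Om d X F) (fun G => x G * (ind G c v * (1 - ind G b v))) =
        Q c v * (1 - Q b v) * (av (Om d X F) x - E) -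
        (av (Om d X F) (fun G => x G * (ind G c v * (1 - ind G b v))) -
          E * (Q c v * (1 - Q b v))) := by ring
    rw [this]
    refine (abs_sub _ _).trans ?_
    rw [abs_mul]
    have := mul_le_mul hq h1 (abs_nonneg _) zero_le_one
    linarith [h2 v hv]
  · gcongr
    exact_mod_cast card_Wset_le X a b c

lemma av_sq_error (hP : Par n d p s L) (hη : 0 ≤ η) (hQ : ∀ u v, 0 ≤ Q u v ∧ Q u v ≤ 1)
    (hne : (Om d X F).Nonempty) (hD : Dom s L X j) (hj : j ≤ 90) (hN : Near d η Q 6 X F)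
    (hbc : b ≠ c) :
    av (Om d X F) (fun G => (gm X a b c Q - gW X a b c G) ^ 2) ≤ n + n * n * (24 * η) := by
  set W := Wset X a b c
  let t : SimpleGraph (Fin n) → Fin n → ℝ := fun G v => ind G c v * (1 - ind G b v)
  let τ : Fin n → ℝ := fun v => Q c v * (1 - Q b v)
  have ht : ∀ G v, 0 ≤ t G v ∧ t G v ≤ 1 := fun G v =>
    ⟨mul_nonneg (ind_nonneg _ _ _) (by linarith [ind_le_one G b v]),
      mul_le_one₀ (ind_le_one _ _ _) (by linarith [ind_le_one G b v])
        (by linarith [ind_nonneg G b v])⟩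
  have hτ : ∀ v, 0 ≤ τ v ∧ τ v ≤ 1 := fun v =>
    ⟨mul_nonneg (hQ _ _).1 (by linarith [(hQ b v).2]),
      mul_le_one₀ (hQ _ _).2 (by linarith [(hQ b v).2]) (by linarith [(hQ b v).1])⟩
  have e : ∀ G, (gm X a b c Q - gW X a b c G) ^ 2 =
      ∑ v ∈ W, ∑ w ∈ W, (τ v - t G v) * (τ w - t G w) := by
    intro G
    unfold gm gW
    rw [← Finset.sum_sub_distrib, sq, Finset.sum_mul_sum]
  simp only [e]
  rw [av_sum]
  have hu : ∀ v ∈ W, b ≠ v ∧ c ≠ v ∧ ¬ X.Adj b v ∧ ¬ X.Adj c v := by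
    intro v hv
    have := mem_Wset.1 hv
    exact ⟨this.2.1.symm, this.2.2.1.symm, this.2.2.2⟩
  have h1 : ∀ v ∈ W, |av (Om d X F) (fun G => t G v) - τ v| ≤ 6 * η := by
    intro v hv
    obtain ⟨i1, i2, i3, i4⟩ := hu v hv
    have := approx_list hP hη hQ hne hD hj hN [(c, v, true), (b, v, false)] (by simp)
      (by simp [i1, i2, i3, i4]) (by simp; grind)
    simpa [stv] using this
  have h2 : ∀ v ∈ W, ∀ w ∈ W, v ≠ w →
      |av (Om d X F) (fun G => t G v * t G w) - τ v * τ w| ≤ 6 * η := by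
    intro v hv w hw hvw
    obtain ⟨i1, i2, i3, i4⟩ := hu v hv
    obtain ⟨j1, j2, j3, j4⟩ := hu w hw
    have := approx_list hP hη hQ hne hD hj hN
      [(c, v, true), (b, v, false), (c, w, true), (b, w, false)] (by simp)
      (by simp [i1, i2, i3, i4, j1, j2, j3, j4]) (by simp; grind)
    simpa [stv, t, τ, mul_assoc] using this
  have h3 : ∀ v ∈ W, av (Om d X F) (fun G => ∑ w ∈ W, (τ v - t G v) * (τ w - t G w)) ≤
      1 + n * (24 * η) := by
    intro v hv
    rw [av_sum, ← Finset.add_sum_erase _ _ hv]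
    have k1 : av (Om d X F) (fun G => (τ v - t G v) * (τ v - t G v)) ≤ 1 := by
      refine av_le_of_le hne fun G _ => ?_
      nlinarith [ht G v, hτ v]
    have k2 : ∑ w ∈ W.erase v, av (Om d X F) (fun G => (τ v - t G v) * (τ w - t G w)) ≤
        (W.erase v).card * (24 * η) := by
      rw [← nsmul_eq_mul, ← Finset.sum_const]
      refine Finset.sum_le_sum fun w hw => ?_
      obtain ⟨hwv, hw⟩ := Finset.mem_erase.1 hw
      have e2 : ∀ G, (τ v - t G v) * (τ w - t G w) =
          (τ v * τ w - τ v * t G w) - (τ w * t G v - t G v * t G w) := fun G => by ring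
      simp only [e2]
      rw [av_sub, av_sub, av_sub, av_const hne, av_mul_left, av_mul_left]
      have m1 := abs_le.1 (h1 v hv)
      have m2 := abs_le.1 (h1 w hw)
      have m3 := abs_le.1 (h2 v hv w hw hwv.symm)
      have m4 := hτ v
      have m5 := hτ w
      nlinarith
    have k3 : ((W.erase v).card : ℝ) ≤ n := by
      exact_mod_cast (Finset.card_le_card (Finset.erase_subset v W)).trans (card_Wset_le X a b c)
    have k4 : ((W.erase v).card : ℝ) * (24 * η) ≤ n * (24 * η) := by gcongr
    linarith
  calc _ ≤ ∑ v ∈ W, (1 + n * (24 * η)) := Finset.sum_le_sum h3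
    _ = W.card * (1 + n * (24 * η)) := by rw [Finset.sum_const, nsmul_eq_mul]
    _ ≤ n * (1 + n * (24 * η)) := by
        gcongr
        exact_mod_cast card_Wset_le X a b c
    _ = _ := by ring

end Approx

end

section

open SimpleGraph

variable {n : ℕ} {d : Fin n → ℕ} {p s L : ℝ}

lemma av_dl {X F : SimpleGraph (Fin n)} (a b c : Fin n) (φ : SimpleGraph (Fin n) → ℝ) :
    av (Om d X F) (fun G => φ G * dl d X F a b c (ind G)) =
      (res d F b - res d F c) * av (Om d X F) φ -
        ∑ v ∈ Yset X a b c, av (Om d X F) (fun G => φ G * ind G b v) +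
        ∑ v ∈ Yset X a c b, av (Om d X F) (fun G => φ G * ind G c v) := by
  rw [← av_sum, ← av_sum, ← av_mul_left, ← av_sub, ← av_add]
  refine av_congr fun G _ => ?_
  unfold dl
  rw [← Finset.mul_sum, ← Finset.mul_sum]
  ring

lemma dl_error (hP : Par n d p s L) {X F : SimpleGraph (Fin n)} (hF : F ≤ X)
    (hX : ∀ v, (deg X v : ℝ) + 1 ≤ 2 * L * s) {a b c : Fin n} {A M : ℝ} {B C : Fin n → ℝ}
    (hM : 0 ≤ M) (hA : |A| ≤ M) (hB : ∀ v ∈ Yset X a b c, |B v| ≤ M)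
    (hC : ∀ v ∈ Yset X a c b, |C v| ≤ M) :
    |(res d F b - res d F c) * A - ∑ v ∈ Yset X a b c, B v + ∑ v ∈ Yset X a c b, C v| ≤
      10 * (L * s) * M := by
  have h1 := abs_res_sub_le hP hF hX b c
  have h2 := abs_sum_le_card _ hB
  have h3 := abs_sum_le_card _ hC
  have h4 : ((Yset X a b c).card : ℝ) ≤ 2 * (L * s) := by
    have : ((Yset X a b c).card : ℝ) ≤ deg X c := by exact_mod_cast card_Yset_le X a b c
    linarith [hX c]
  have h5 : ((Yset X a c b).card : ℝ) ≤ 2 * (L * s) := by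
    have : ((Yset X a c b).card : ℝ) ≤ deg X b := by exact_mod_cast card_Yset_le X a c b
    linarith [hX b]
  have h6 : |(res d F b - res d F c) * A| ≤ 6 * (L * s) * M := by
    rw [abs_mul]
    exact mul_le_mul h1 hA (abs_nonneg _) (by have := hP.L_pos; have := hP.s_pos; positivity)
  have h7 : ((Yset X a b c).card : ℝ) * M ≤ 2 * (L * s) * M := by gcongr
  have h8 : ((Yset X a c b).card : ℝ) * M ≤ 2 * (L * s) * M := by gcongr
  refine (abs_add_le _ _).trans ?_
  have := abs_sub ((res d F b - res d F c) * A) (∑ v ∈ Yset X a b c, B v)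
  linarith

lemma refined_numeric {η γ T1 T2 T3 Z K : ℝ} (hL : 2000 ≤ L) (hs : 1 ≤ s) (hη : 1 / s ^ 2 ≤ η)
    (hγ : s ^ 2 / L ^ 5 ≤ γ) (hA : |T1 - K| ≤ 10 * (L * s) * (6 * η))
    (hT1 : |T1| ≤ 10 * (L * s)) (hB : |T2| ≤ 10 * (L * s) * (s ^ 2 * (12 * η)))
    (hC : |T3| ≤ 10 * (L * s) *
      (4 / s ^ 4 + L ^ 14 / s ^ 2 * (2 * (s ^ 2 + s ^ 2 * s ^ 2 * (24 * η)) + 2)))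
    (hZ : |Z| ≤ 1 / s ^ 8) :
    |T1 * (1 / γ - 1 / γ ^ 2) + T2 * (1 / γ ^ 2) + T3 * (1 / γ ^ 2) + Z - K / γ| ≤
      L ^ 30 * η / s := by
  have hs0 : 0 < s := by linarith
  have hL0 : 0 < L := by linarith
  have hL1 : 1 ≤ L := by linarith
  have hη0 : 0 < η := lt_of_lt_of_le (by positivity) hη
  have hγ0 : 0 < γ := lt_of_lt_of_le (by positivity) hγ
  have hu : 1 / γ ≤ L ^ 5 / s ^ 2 := by
    rw [div_le_div_iff₀ hγ0 (by positivity)]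
    rw [div_le_iff₀ (by positivity)] at hγ
    linarith
  have hu2 : 1 / γ ^ 2 ≤ L ^ 10 / s ^ 4 := by
    have := pow_le_pow_left₀ (by positivity) hu 2
    calc 1 / γ ^ 2 = (1 / γ) ^ 2 := by field_simp
      _ ≤ _ := this
      _ = _ := by field_simp
  have hη1 : 1 ≤ η * s ^ 2 := by rwa [div_le_iff₀ (by positivity)] at hη
  set w := η / s with hw
  have hw0 : 0 < w := by positivity
  have hηw : η = w * s := by rw [hw]; field_simp
  have hpow : ∀ k, k ≤ 25 → L ^ k ≤ L ^ 25 := fun k hk => pow_le_pow_right₀ hL1 hk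
  have t1 : |(T1 - K) * (1 / γ)| ≤ 60 * (L ^ 25 * w) := by
    rw [abs_mul, abs_of_pos (by positivity : 0 < 1 / γ)]
    calc _ ≤ 10 * (L * s) * (6 * η) * (L ^ 5 / s ^ 2) := by gcongr
      _ = 60 * (L ^ 6 * w) := by rw [hηw]; field_simp; norm_num
      _ ≤ _ := by have := hpow 6 (by norm_num); gcongr
  have t2 : |T1 * (1 / γ ^ 2)| ≤ 10 * (L ^ 25 * w) := by
    rw [abs_mul, abs_of_pos (by positivity : 0 < 1 / γ ^ 2)]
    calc _ ≤ 10 * (L * s) * (L ^ 10 / s ^ 4) := by gcongr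
      _ ≤ 10 * (L * s) * (L ^ 10 / s ^ 4) * (η * s ^ 2) :=
        le_mul_of_one_le_right (by positivity) hη1
      _ = 10 * (L ^ 11 * w) := by rw [hηw]; field_simp
      _ ≤ _ := by have := hpow 11 (by norm_num); gcongr
  have t3 : |T2 * (1 / γ ^ 2)| ≤ 120 * (L ^ 25 * w) := by
    rw [abs_mul, abs_of_pos (by positivity : 0 < 1 / γ ^ 2)]
    calc _ ≤ 10 * (L * s) * (s ^ 2 * (12 * η)) * (L ^ 10 / s ^ 4) := by gcongr
      _ = 120 * (L ^ 11 * w) := by rw [hηw]; field_simp; norm_num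
      _ ≤ _ := by have := hpow 11 (by norm_num); gcongr
  have t4 : |T3 * (1 / γ ^ 2)| ≤ 600 * (L ^ 25 * w) := by
    rw [abs_mul, abs_of_pos (by positivity : 0 < 1 / γ ^ 2)]
    have hb : 4 / s ^ 4 + L ^ 14 / s ^ 2 * (2 * (s ^ 2 + s ^ 2 * s ^ 2 * (24 * η)) + 2) ≤
        60 * (L ^ 14 * (η * s ^ 2)) := by
      have b1 : 4 / s ^ 4 ≤ 4 * (L ^ 14 * (η * s ^ 2)) := by
        have : 4 / s ^ 4 ≤ 4 := div_le_self (by norm_num) (one_le_pow₀ hs)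
        have : 1 ≤ L ^ 14 * (η * s ^ 2) := one_le_mul_of_one_le_of_one_le (one_le_pow₀ hL1) hη1
        linarith
      have b2 : 2 * (s ^ 2 + s ^ 2 * s ^ 2 * (24 * η)) + 2 ≤ 52 * (s ^ 2 * (η * s ^ 2)) := by
        have : s ^ 2 ≤ s ^ 2 * (η * s ^ 2) := le_mul_of_one_le_right (by positivity) hη1
        have : 1 ≤ s ^ 2 := one_le_pow₀ hs
        linarith
      have b3 : L ^ 14 / s ^ 2 * (2 * (s ^ 2 + s ^ 2 * s ^ 2 * (24 * η)) + 2) ≤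
          L ^ 14 / s ^ 2 * (52 * (s ^ 2 * (η * s ^ 2))) := by gcongr
      have b4 : L ^ 14 / s ^ 2 * (52 * (s ^ 2 * (η * s ^ 2))) = 52 * (L ^ 14 * (η * s ^ 2)) := by
        field_simp
      have b5 : 0 ≤ L ^ 14 * (η * s ^ 2) := by positivity
      linarith
    calc _ ≤ 10 * (L * s) * (60 * (L ^ 14 * (η * s ^ 2))) * (L ^ 10 / s ^ 4) := by
          gcongr; exact hC.trans (by gcongr)
      _ = 600 * (L ^ 25 * w) := by rw [hηw]; field_simp; norm_num
  have t5 : |Z| ≤ L ^ 25 * w := by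
    refine hZ.trans ?_
    have h1 : 1 / s ^ 8 ≤ 1 / s ^ 3 := by
      gcongr
      norm_num
    have h2 : 1 / s ^ 3 ≤ w := by
      rw [hw, div_le_div_iff₀ (by positivity) hs0]
      calc 1 * s ≤ η * s ^ 2 * s := by gcongr
        _ = _ := by ring
    exact (h1.trans h2).trans (le_mul_of_one_le_left hw0.le (one_le_pow₀ hL1))
  have t6 : 1000 * (L ^ 25 * w) ≤ L ^ 30 * η / s := by
    have h1 : 1000 ≤ L ^ 5 := by
      have := pow_le_pow_right₀ hL1 (show 1 ≤ 5 by norm_num)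
      linarith
    calc 1000 * (L ^ 25 * w) ≤ L ^ 5 * (L ^ 25 * w) := by gcongr
      _ = _ := by rw [hw]; ring
  have e : T1 * (1 / γ - 1 / γ ^ 2) + T2 * (1 / γ ^ 2) + T3 * (1 / γ ^ 2) + Z - K / γ =
      (T1 - K) * (1 / γ) - T1 * (1 / γ ^ 2) + T2 * (1 / γ ^ 2) + T3 * (1 / γ ^ 2) + Z := by ring
  have t0 : 0 ≤ L ^ 25 * w := by positivity
  rw [e]
  refine le_trans ?_ t6
  rw [abs_le] at t1 t2 t3 t4 t5 ⊢
  constructor <;> linarith [t1.1, t1.2, t2.1, t2.2, t3.1, t3.2, t4.1, t4.2, t5.1, t5.2]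

section Approx

variable {X F : SimpleGraph (Fin n)} {j : ℕ} {η : ℝ} {Q : Fin n → Fin n → ℝ} {a b c : Fin n}

lemma av_pair_approx (hP : Par n d p s L) (hη : 0 ≤ η) (hQ : ∀ u v, 0 ≤ Q u v ∧ Q u v ≤ 1)
    (hne : (Om d X F).Nonempty) (hD : Dom s L X j) (hj : j ≤ 90) (hN : Near d η Q 6 X F)
    (hab : a ≠ b) (hac : a ≠ c) (hbc : b ≠ c) (xb : ¬ X.Adj a b) (xc : ¬ X.Adj a c)
    (l : List (Fin n × Fin n × Bool)) (hl : l.length ≤ 4)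
    (hu : ∀ e ∈ l, e.1 ≠ e.2.1 ∧ ¬ X.Adj e.1 e.2.1 ∧ e.1 ≠ a ∧ e.2.1 ≠ a)
    (hpw : l.Pairwise (fun e f => s(e.1, e.2.1) ≠ s(f.1, f.2.1))) :
    |av (Om d X F) (fun G => (1 - ind G a b) * ind G a c * (l.map (stv (ind G))).prod) -
      (1 - Q a b) * Q a c * (l.map (stv Q)).prod| ≤ 6 * η := by
  have := approx_list hP hη hQ hne hD hj hN ((a, b, false) :: (a, c, true) :: l)
    (by simp; omega) (by
      intro e he
      simp only [List.mem_cons] at he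
      rcases he with rfl | rfl | he
      · exact ⟨hab, xb⟩
      · exact ⟨hac, xc⟩
      · exact ⟨(hu e he).1, (hu e he).2.1⟩) (by
      rw [List.pairwise_cons, List.pairwise_cons]
      refine ⟨fun e he => ?_, fun e he => ?_, hpw⟩
      · simp only [List.mem_cons] at he
        rcases he with rfl | he
        · simp; grind
        · have := hu e he
          simp; grind
      · have := hu e he
        simp; grind)
  simpa [stv, mul_assoc] using this

/-- Refined comparison of edge probabilities, given approximations valid for a few revelations. -/
lemma pr_sub_refined (hP : Par n d p s L) (hη : 1 / s ^ 2 ≤ η)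
    (hQ : ∀ u v, 1 / L ^ 2 ≤ Q u v ∧ 1 / L ^ 2 ≤ 1 - Q u v)
    (hne : (Om d X F).Nonempty) (hD : Dom s L X j) (hj : j ≤ 90) (hN : Near d η Q 6 X F)
    (hab : a ≠ b) (hac : a ≠ c) (hbc : b ≠ c) (xb : ¬ X.Adj a b) (xc : ¬ X.Adj a c) :
    |pr d X F a b - pr d X F a c -
      (1 - Q a b) * Q a c * dl d X F a b c Q / gm X a b c Q| ≤ L ^ 30 * η / s := by
  have hF := Om_nonempty_le hne
  have hX := hD.deg_le' hP (by omega)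
  have hL := hP.L_pos
  have hs := hP.s_pos
  have hs1 := hP.s_ge
  have hL1 := hP.L_ge
  have hη0 : 0 < η := lt_of_lt_of_le (by positivity) hη
  have hL2 : 0 < 1 / L ^ 2 := by positivity
  have hQ' : ∀ u v, 0 ≤ Q u v ∧ Q u v ≤ 1 := fun u v =>
    ⟨hL2.le.trans (hQ u v).1, by linarith [(hQ u v).2]⟩
  set e : SimpleGraph (Fin n) → ℝ := fun G => (1 - ind G a b) * ind G a c with he
  set E := (1 - Q a b) * Q a c with hE
  set γ := gm X a b c Q with hγ
  set κ := dl d X F a b c Q with hκ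
  have he1 : ∀ G, |e G| ≤ 1 := by
    intro G
    rcases ind_zero_or_one G a b with h | h <;> rcases ind_zero_or_one G a c with h' | h' <;>
      simp [e, h, h']
  -- status approximations
  have hW : ∀ v ∈ Wset X a b c, b ≠ v ∧ c ≠ v ∧ v ≠ a ∧ ¬ X.Adj b v ∧ ¬ X.Adj c v := by
    intro v hv; have := mem_Wset.1 hv; tauto
  have hY : ∀ b c, ∀ v ∈ Yset X a b c, b ≠ v ∧ c ≠ v ∧ v ≠ a ∧ ¬ X.Adj b v := by
    intro b c v hv; have := mem_Yset.1 hv; tauto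
  have S1 : |av (Om d X F) e - E| ≤ 6 * η := by
    simpa using av_pair_approx hP hη0.le hQ' hne hD hj hN hab hac hbc xb xc [] (by simp)
      (by simp) (by simp)
  have S2 : ∀ v ∈ Yset X a b c, |av (Om d X F) (fun G => e G * ind G b v) - E * Q b v| ≤ 6 * η := by
    intro v hv
    obtain ⟨i1, i2, i3, i4⟩ := hY b c v hv
    simpa [stv] using av_pair_approx hP hη0.le hQ' hne hD hj hN hab hac hbc xb xc
      [(b, v, true)] (by simp) (by simp [i1, i3, i4, hab.symm]) (by simp)
  have S3 : ∀ v ∈ Yset X a c b, |av (Om d X F) (fun G => e G * ind G c v) - E * Q c v| ≤ 6 * η := by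
    intro v hv
    obtain ⟨i1, i2, i3, i4⟩ := hY c b v hv
    simpa [stv] using av_pair_approx hP hη0.le hQ' hne hD hj hN hab hac hbc xb xc
      [(c, v, true)] (by simp) (by simp [i1, i3, i4, hac.symm]) (by simp)
  have S4 : ∀ v ∈ Wset X a b c, |av (Om d X F) (fun G => e G * (ind G c v * (1 - ind G b v))) -
      E * (Q c v * (1 - Q b v))| ≤ 6 * η := by
    intro v hv
    obtain ⟨i1, i2, i3, i4, i5⟩ := hW v hv
    simpa [stv] using av_pair_approx hP hη0.le hQ' hne hD hj hN hab hac hbc xb xc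
      [(c, v, true), (b, v, false)] (by simp) (by simp [i1, i2, i3, i4, i5, hab.symm, hac.symm])
      (by simp; grind)
  have S5 : ∀ u ∈ Yset X a b c, ∀ v ∈ Wset X a b c,
      |av (Om d X F) (fun G => e G * ind G b u * (ind G c v * (1 - ind G b v))) -
      E * Q b u * (Q c v * (1 - Q b v))| ≤ 6 * η := by
    intro u hu v hv
    obtain ⟨i1, i2, i3, i4, i5⟩ := hW v hv
    obtain ⟨j1, j2, j3, j4⟩ := hY b c u hu
    have huv : u ≠ v := fun h => (mem_Wset.1 hv).2.2.2.2 (h ▸ (mem_Yset.1 hu).2.2.2.2)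
    have := av_pair_approx hP hη0.le hQ' hne hD hj hN hab hac hbc xb xc
      [(b, u, true), (c, v, true), (b, v, false)] (by simp)
      (by simp [i1, i2, i3, i4, i5, j1, j3, j4, hab.symm, hac.symm]) (by simp; grind)
    convert this using 3
    · congr 1
      ext G
      simp [stv, he]
      ring
    · simp [stv, hE]
      ring
  have S6 : ∀ u ∈ Yset X a c b, ∀ v ∈ Wset X a b c,
      |av (Om d X F) (fun G => e G * ind G c u * (ind G c v * (1 - ind G b v))) -
      E * Q c u * (Q c v * (1 - Q b v))| ≤ 6 * η := by
    intro u hu v hv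
    obtain ⟨i1, i2, i3, i4, i5⟩ := hW v hv
    obtain ⟨j1, j2, j3, j4⟩ := hY c b u hu
    have huv : u ≠ v := fun h => (mem_Wset.1 hv).2.2.2.1 (h ▸ (mem_Yset.1 hu).2.2.2.2)
    have := av_pair_approx hP hη0.le hQ' hne hD hj hN hab hac hbc xb xc
      [(c, u, true), (c, v, true), (b, v, false)] (by simp)
      (by simp [i1, i2, i3, i4, i5, j1, j3, j4, hab.symm, hac.symm]) (by simp; grind)
    convert this using 3
    · congr 1
      ext G
      simp [stv, he]
      ring
    · simp [stv, hE]
      ring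
  -- first-order term
  have hA : |av (Om d X F) (fun G => e G * dl d X F a b c (ind G)) - E * κ| ≤
      10 * (L * s) * (6 * η) := by
    have := dl_error hP hF hX (by positivity : 0 ≤ 6 * η) S1 S2 S3
    convert this using 2
    rw [av_dl, hκ, dl, Finset.sum_sub_distrib, Finset.sum_sub_distrib, ← Finset.mul_sum,
      ← Finset.mul_sum]
    ring
  -- second-order term
  have hB : |av (Om d X F) (fun G => e G * (γ - gW X a b c G) * dl d X F a b c (ind G))| ≤
      10 * (L * s) * (n * (12 * η)) := by
    rw [av_dl]
    refine dl_error hP hF hX (by positivity) (av_switch_error hη0.le hQ' S1 S4)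
      (fun u hu => ?_) (fun u hu => ?_)
    · have := av_switch_error (a := a) (b := b) (c := c) hη0.le hQ' (S2 u hu) (S5 u hu)
      convert this using 3
      ext G; ring
    · have := av_switch_error (a := a) (b := b) (c := c) hη0.le hQ' (S3 u hu) (S6 u hu)
      convert this using 3
      ext G; ring
  have hsq := av_sq_error (a := a) hP hη0.le hQ' hne hD hj hN hbc
  have htail := tail_bound hP hne hD (by omega) (a := a) hbc
  have hzero := av_zero_gW_le hP hne hD (by omega) (a := a) hbc
  -- size of `γ`
  have hγ1 : s ^ 2 / L ^ 5 ≤ γ := by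
    have h1 := card_Wset_ge hX a b c
    have h2 := hP.Ls_le
    rw [← hP.sq] at h1
    have h0 := mul_pos hL hs
    have h3 : L * (2000 * s) ≤ L ^ 2 * s := by nlinarith [mul_le_mul_of_nonneg_right hL1 h0.le]
    have h4 : s ^ 2 / 2 ≤ (Wset X a b c).card := by nlinarith
    have h5 : (Wset X a b c).card * (1 / L ^ 4) ≤ γ := by
      rw [← nsmul_eq_mul, ← Finset.sum_const]
      refine Finset.sum_le_sum fun v _ => ?_
      have : 1 / L ^ 4 = 1 / L ^ 2 * (1 / L ^ 2) := by field_simp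
      rw [this]
      exact mul_le_mul (hQ c v).1 (hQ b v).2 hL2.le (hQ' c v).1
    refine le_trans ?_ h5
    have h6 : s ^ 2 / L ^ 5 = s ^ 2 / 2 * (1 / L ^ 4) * (2 / L) := by field_simp
    have h7 : 2 / L ≤ 1 := by rw [div_le_one hL]; linarith
    rw [h6]
    refine (mul_le_of_le_one_right (by positivity) h7).trans ?_
    gcongr
  have hγ0 : 0 < γ := lt_of_lt_of_le (by positivity) hγ1
  have hγn : γ ≤ n := by
    have : γ ≤ ∑ v ∈ Wset X a b c, (1 : ℝ) := Finset.sum_le_sum fun v _ =>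
      mul_le_one₀ (hQ' c v).2 (by linarith [(hQ' b v).2]) (by linarith [(hQ' b v).1])
    rw [Finset.sum_const, nsmul_eq_mul, mul_one] at this
    refine this.trans ?_
    exact_mod_cast card_Wset_le X a b c
  have hgn : ∀ G, gW X a b c G ≤ n := by
    intro G
    have : gW X a b c G ≤ ∑ v ∈ Wset X a b c, (1 : ℝ) := Finset.sum_le_sum fun v _ =>
      mul_le_one₀ (ind_le_one _ _ _) (by linarith [ind_le_one G b v])
        (by linarith [ind_nonneg G b v])
    rw [Finset.sum_const, nsmul_eq_mul, mul_one] at this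
    refine this.trans ?_
    exact_mod_cast card_Wset_le X a b c
  -- remainder
  set Rm : SimpleGraph (Fin n) → ℝ := fun G =>
    e G * dl d X F a b c (ind G) * ((γ - gW X a b c G - 1) ^ 2 / (gW X a b c G + 1))
  have hC : |av (Om d X F) Rm| ≤
      10 * (L * s) * (4 / s ^ 4 + L ^ 14 / s ^ 2 * (2 * (n + n * n * (24 * η)) + 2)) := by
    refine abs_av_le.trans ?_
    calc _ ≤ av (Om d X F) (fun G => 10 * (L * s) *
          (4 * s ^ 4 * (if gW X a b c G < s ^ 2 / L ^ 14 then 1 else 0) +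
            L ^ 14 / s ^ 2 * (2 * (γ - gW X a b c G) ^ 2 + 2))) := by
          refine av_mono fun G _ => ?_
          have h3 := abs_dl_le hP hF hX (ind_mem G) a b c
          have h4 := gW_nonneg X a b c G
          have h5 := inv_gW_le hP X G a b c
          have h6 : |e G * dl d X F a b c (ind G)| ≤ 10 * (L * s) := by
            rw [abs_mul]
            exact (mul_le_of_le_one_left (abs_nonneg _) (he1 G)).trans h3
          have h7 : (γ - gW X a b c G - 1) ^ 2 ≤ 4 * s ^ 4 := by
            have h8 : |γ - gW X a b c G - 1| ≤ 2 * s ^ 2 := by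
              rw [hP.sq, abs_le]
              have : (1 : ℝ) ≤ n := by rw [← hP.sq]; nlinarith
              constructor <;> linarith [hgn G]
            calc (γ - gW X a b c G - 1) ^ 2 ≤ (2 * s ^ 2) ^ 2 :=
                sq_le_sq' (abs_le.1 h8).1 (abs_le.1 h8).2
              _ = _ := by ring
          have h9 : (γ - gW X a b c G - 1) ^ 2 ≤ 2 * (γ - gW X a b c G) ^ 2 + 2 := by
            nlinarith [sq_nonneg (γ - gW X a b c G + 1)]
          have h10 : (γ - gW X a b c G - 1) ^ 2 / (gW X a b c G + 1) ≤
              4 * s ^ 4 * (if gW X a b c G < s ^ 2 / L ^ 14 then 1 else 0) +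
              L ^ 14 / s ^ 2 * (2 * (γ - gW X a b c G) ^ 2 + 2) := by
            rw [div_eq_mul_one_div]
            refine (mul_le_mul_of_nonneg_left h5 (sq_nonneg _)).trans ?_
            rw [mul_add]
            refine add_le_add ?_ ?_
            · refine mul_le_mul_of_nonneg_right h7 ?_
              split_ifs <;> norm_num
            · rw [mul_comm]
              exact mul_le_mul_of_nonneg_left h9 (by positivity)
          rw [abs_mul, abs_of_nonneg (div_nonneg (sq_nonneg _) (by linarith) :
            0 ≤ (γ - gW X a b c G - 1) ^ 2 / (gW X a b c G + 1))]
          exact mul_le_mul h6 h10 (div_nonneg (sq_nonneg _) (by linarith)) (by positivity)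
      _ ≤ _ := by
          rw [av_mul_left, av_add, av_mul_left, av_mul_left, av_add, av_mul_left, av_const hne]
          gcongr
          calc _ ≤ 4 * s ^ 4 * (1 / s ^ 8) := by gcongr
            _ = _ := by field_simp
  -- combination
  have hexp : av (Om d X F) (fun G => (1 - ind G a b) * ind G a c *
        (dl d X F a b c (ind G) / (gW X a b c G + 1))) =
      av (Om d X F) (fun G => e G * dl d X F a b c (ind G)) * (1 / γ - 1 / γ ^ 2) +
      av (Om d X F) (fun G => e G * (γ - gW X a b c G) * dl d X F a b c (ind G)) * (1 / γ ^ 2) +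
      av (Om d X F) Rm * (1 / γ ^ 2) := by
    rw [mul_comm _ (1 / γ - 1 / γ ^ 2), mul_comm _ (1 / γ ^ 2), mul_comm _ (1 / γ ^ 2),
      ← av_mul_left, ← av_mul_left, ← av_mul_left, ← av_add, ← av_add]
    refine av_congr fun G _ => ?_
    have h4 := gW_nonneg X a b c G
    have h5 : gW X a b c G + 1 ≠ 0 := by positivity
    simp only [Rm, e]
    field_simp
    ring
  rw [pr_sub_pr hab hac hbc xb xc, hexp]
  have hT1 : |av (Om d X F) (fun G => e G * dl d X F a b c (ind G))| ≤ 10 * (L * s) := by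
    refine abs_av_le.trans (av_le_of_le hne fun G _ => ?_)
    rw [abs_mul]
    exact (mul_le_of_le_one_left (abs_nonneg _) (he1 G)).trans
      (abs_dl_le hP hF hX (ind_mem G) a b c)
  rw [← hP.sq] at hB hC
  exact refined_numeric hL1 (by linarith) hη hγ1 hA hT1 hB hC hzero

end Approx

end

section

open SimpleGraph

variable {n : ℕ} {d : Fin n → ℕ} {p s L : ℝ}

lemma sum_Yset {X : SimpleGraph (Fin n)} {a b c : Fin n}
    (xc : ¬ X.Adj a c) (f : Fin n → ℝ) :
    ∑ v ∈ Yset X a b c, f v =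
      ∑ v, ind X c v * f v - ∑ v, ind X b v * ind X c v * f v - ind X c b * f b := by
  have : ind X c b * f b = ∑ v, eqi v b * (ind X c v * f v) := by simp [eqi]
  rw [this, ← Finset.sum_sub_distrib, ← Finset.sum_sub_distrib, Yset, Finset.sum_filter]
  refine Finset.sum_congr rfl fun v _ => ?_
  by_cases h1 : v = a
  · subst h1
    by_cases h2 : v = b
    · subst h2; simp [eqi, ind]
    · simp [eqi, ind, X.adj_comm c v, xc]
  by_cases h2 : v = b
  · subst h2; simp [eqi, ind]
  by_cases h3 : v = c
  · subst h3; simp [eqi, ind]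
  by_cases h4 : X.Adj b v <;> by_cases h5 : X.Adj c v <;> simp [eqi, ind, h1, h2, h3, h4, h5]

lemma sum_Wset {X : SimpleGraph (Fin n)} {a b c : Fin n} (hab : a ≠ b) (hac : a ≠ c) (hbc : b ≠ c)
    (xb : ¬ X.Adj a b) (xc : ¬ X.Adj a c) (f : Fin n → ℝ) :
    ∑ v ∈ Wset X a b c, f v =
      ∑ v, f v - ∑ v, ind X b v * f v - ∑ v, ind X c v * f v + ∑ v, ind X b v * ind X c v * f v -
        f a - f b - f c + ind X b c * (f b + f c) := by
  have ea : f a = ∑ v, eqi v a * f v := by simp [eqi]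
  have eb : f b = ∑ v, eqi v b * f v := by simp [eqi]
  have ec : f c = ∑ v, eqi v c * f v := by simp [eqi]
  have e : ∑ v, f v - ∑ v, ind X b v * f v - ∑ v, ind X c v * f v +
      ∑ v, ind X b v * ind X c v * f v - f a - f b - f c + ind X b c * (f b + f c) =
      ∑ v, (f v - ind X b v * f v - ind X c v * f v + ind X b v * ind X c v * f v -
        eqi v a * f v - eqi v b * f v - eqi v c * f v +
        ind X b c * (eqi v b * f v + eqi v c * f v)) := by
    rw [Finset.sum_add_distrib, Finset.sum_sub_distrib, Finset.sum_sub_distrib,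
      Finset.sum_sub_distrib, Finset.sum_add_distrib, Finset.sum_sub_distrib,
      Finset.sum_sub_distrib, ← Finset.mul_sum, Finset.sum_add_distrib, ← ea, ← eb, ← ec]
  rw [e, Wset, Finset.sum_filter]
  refine Finset.sum_congr rfl fun v _ => ?_
  by_cases h1 : v = a
  · subst h1
    simp [eqi, ind, hab, hac, X.adj_comm b v, X.adj_comm c v, xb, xc]
  by_cases h2 : v = b
  · subst h2
    by_cases h5 : X.Adj v c <;> simp [eqi, ind, hbc, h1, X.adj_comm c v, h5]
  by_cases h3 : v = c
  · subst h3
    by_cases h5 : X.Adj b v <;> simp [eqi, ind, hbc.symm, h1, h5]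
  by_cases h4 : X.Adj b v <;> by_cases h5 : X.Adj c v <;> simp [eqi, ind, h1, h2, h3, h4, h5]

lemma dl_const {X F : SimpleGraph (Fin n)} {a b c : Fin n} (xb : ¬ X.Adj a b)
    (xc : ¬ X.Adj a c) :
    dl d X F a b c (fun _ _ => p) = xi d p X F b - xi d p X F c := by
  unfold dl xi
  rw [sum_Yset xc, sum_Yset xb]
  simp only [← Finset.sum_mul, ← deg_eq_sum, ind_comm X c b, mul_comm (ind X c _) (ind X b _)]
  ring

lemma gm_const (X : SimpleGraph (Fin n)) (a b c : Fin n) :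
    gm X a b c (fun _ _ => p) = (Wset X a b c).card * (p * (1 - p)) := by
  simp [gm]

/-- The sum of the excess residual degrees. -/
noncomputable def Xi (d : Fin n → ℕ) (p : ℝ) (X F : SimpleGraph (Fin n)) : ℝ := ∑ v, xi d p X F v

lemma Xi_eq (hP : Par n d p s L) (X F : SimpleGraph (Fin n)) :
    Xi d p X F = ∑ v, (p * deg X v - deg F v) := by
  unfold Xi
  have : ∀ v, xi d p X F v = ((d v : ℝ) - p * (n - 1)) + (p * deg X v - deg F v) := by
    intro v; unfold xi res; ring
  simp only [this]
  rw [Finset.sum_add_distrib, hP.hsum, zero_add]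

lemma Dom.tot_le (hP : Par n d p s L) {X : SimpleGraph (Fin n)} {j : ℕ} (h : Dom s L X j)
    (hj : j ≤ 100) : ∑ v, (deg X v : ℝ) ≤ 2 * (L ^ 2 * s ^ 2) := by
  have h1 : (j : ℝ) ≤ 100 := by exact_mod_cast hj
  have h2 : 1 ≤ L ^ 2 := one_le_pow₀ hP.one_le_L
  have h3 := hP.s_ge
  have : 200 ≤ L ^ 2 * s ^ 2 := by nlinarith
  linarith [h.tot]

lemma abs_Xi_le (hP : Par n d p s L) {X F : SimpleGraph (Fin n)} (hF : F ≤ X) {j : ℕ}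
    (hD : Dom s L X j) (hj : j ≤ 100) : |Xi d p X F| ≤ 2 * (L ^ 2 * s ^ 2) := by
  rw [Xi_eq hP]
  refine (Finset.abs_sum_le_sum_abs _ _).trans (le_trans ?_ (hD.tot_le hP hj))
  refine Finset.sum_le_sum fun v _ => ?_
  have h2 : (deg F v : ℝ) ≤ deg X v := by exact_mod_cast deg_mono hF v
  have h4 : (0 : ℝ) ≤ deg F v := by positivity
  have hp := hP.p_pos
  have h6 : p * deg X v ≤ deg X v := mul_le_of_le_one_left (by positivity) hP.p_lt_one.le
  have h7 : 0 ≤ p * deg X v := by positivity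
  rw [abs_le]
  constructor <;> linarith

/-- The sum of the excess residual degrees over revealed partners. -/
noncomputable def Sx (d : Fin n → ℕ) (p : ℝ) (X F : SimpleGraph (Fin n)) (u : Fin n) : ℝ :=
  ∑ v, ind X u v * xi d p X F v

lemma abs_sum_ind_le {X : SimpleGraph (Fin n)} {f : Fin n → ℝ} {M : ℝ} (hf : ∀ v, |f v| ≤ M)
    (u : Fin n) : |∑ v, ind X u v * f v| ≤ deg X u * M := by
  rw [deg_eq_sum, Finset.sum_mul]
  refine (Finset.abs_sum_le_sum_abs _ _).trans (Finset.sum_le_sum fun v _ => ?_)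
  rw [abs_mul, abs_of_nonneg (ind_nonneg _ _ _)]
  exact mul_le_mul_of_nonneg_left (hf v) (ind_nonneg _ _ _)

lemma abs_Sx_le (hP : Par n d p s L) {X F : SimpleGraph (Fin n)} (hF : F ≤ X) {j : ℕ}
    (hD : Dom s L X j) (hj : j ≤ 100) (u : Fin n) : |Sx d p X F u| ≤ 6 * (L ^ 2 * s ^ 2) := by
  refine (abs_sum_ind_le (abs_xi_le hP hF hD hj) u).trans ?_
  have h := hD.deg_le' hP hj u
  have h0 := mul_pos hP.L_pos hP.s_pos
  calc (deg X u : ℝ) * (3 * (L * s)) ≤ 2 * L * s * (3 * (L * s)) := by gcongr; linarith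
    _ = _ := by ring

lemma sum_Uset_xi (X F : SimpleGraph (Fin n)) (a : Fin n) :
    ∑ c ∈ Uset X a, xi d p X F c = Xi d p X F - xi d p X F a - Sx d p X F a :=
  sum_Uset X a _

lemma half_le_card_Wset (hP : Par n d p s L) {X : SimpleGraph (Fin n)} {j : ℕ}
    (hD : Dom s L X j) (hj : j ≤ 100) (a b c : Fin n) :
    s ^ 2 / 2 ≤ (Wset X a b c).card := by
  have h1 := card_Wset_ge (hD.deg_le' hP hj) a b c
  rw [← hP.sq] at h1
  have h2 := hP.Ls_le
  have h0 := mul_pos hP.L_pos hP.s_pos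
  have h3 : L * (2000 * s) ≤ L ^ 2 * s := by nlinarith [mul_le_mul_of_nonneg_right hP.L_ge h0.le]
  nlinarith [hP.s_ge]

lemma Par.dom_pow (hP : Par n d p s L) {k l : ℕ} (C : ℝ) (hC : C ≤ 2000) (hkl : k + 1 ≤ l) :
    C * L ^ k ≤ L ^ l := by
  have h1 : 1 ≤ L := hP.one_le_L
  have h2 : 0 < L ^ k := pow_pos hP.L_pos _
  calc C * L ^ k ≤ L * L ^ k := by gcongr; linarith [hP.L_ge]
    _ = L ^ (k + 1) := by ring
    _ ≤ L ^ l := pow_le_pow_right₀ h1 hkl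

section Second

variable {X F : SimpleGraph (Fin n)} {j : ℕ} {a b c : Fin n}

lemma near_const (hP : Par n d p s L) (hne : (Om d X F).Nonempty) (hD : Dom s L X j)
    (hj : j ≤ 90) : Near d (L ^ 17 / s) (fun _ _ => p) 6 X F := by
  refine near_of_inv (J := 99) (I := fun i X F => (Om d X F).Nonempty ∧ Dom s L X i) ?_ ?_ 6 j X F
    (by omega) ⟨hne, hD⟩
  · rintro i X F hi ⟨h1, h2⟩ u v huv hX
    have hi' : (i : ℝ) ≤ 99 := by exact_mod_cast hi
    have := children_nonempty hP h1 h2 (by nlinarith [hP.s_ge, hP.L_ge]) huv hX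
    exact ⟨⟨this.1, h2.rev u v⟩, this.2, h2.rev u v⟩
  · rintro i X F hi ⟨h1, h2⟩ u v huv hX
    exact abs_pr_sub_p_le hP h1 h2 (by omega) huv hX

lemma Par.inv_sq_le (hP : Par n d p s L) : 1 / L ^ 2 ≤ p ∧ 1 / L ^ 2 ≤ 1 - p := by
  have hL := hP.L_pos
  have h1 := hP.one_le_L
  constructor
  · rw [div_le_iff₀ (by positivity)]
    nlinarith [hP.hp, mul_pos hL hP.p_pos]
  · rw [div_le_iff₀ (by positivity)]
    nlinarith [hP.hq, mul_pos hL (sub_pos.2 hP.p_lt_one)]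

lemma abs_pr_sub_sub_le (hP : Par n d p s L) (hne : (Om d X F).Nonempty) (hD : Dom s L X j)
    (hj : j ≤ 90) (hab : a ≠ b) (hac : a ≠ c) (hbc : b ≠ c) (xb : ¬ X.Adj a b)
    (xc : ¬ X.Adj a c) :
    |pr d X F a b - pr d X F a c - (xi d p X F b - xi d p X F c) / n| ≤ L ^ 48 / s ^ 2 := by
  have hs := hP.s_pos
  have hL := hP.L_pos
  have hs1 : 1 ≤ s := by linarith [hP.s_ge]
  have hF := Om_nonempty_le hne
  have h1 := pr_sub_refined hP (η := L ^ 17 / s) (Q := fun _ _ => p) (by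
    rw [div_le_div_iff₀ (by positivity) hs]
    have := one_le_pow₀ hP.one_le_L (n := 17)
    nlinarith) (fun _ _ => hP.inv_sq_le) hne hD hj (near_const hP hne hD hj) hab hac hbc xb xc
  rw [dl_const xb xc, gm_const] at h1
  set w : ℝ := ((Wset X a b c).card : ℝ) with hw
  set x := xi d p X F b - xi d p X F c with hx
  have hw1 : s ^ 2 / 2 ≤ w := half_le_card_Wset hP hD (by omega) a b c
  have hw0 : 0 < w := lt_of_lt_of_le (by positivity) hw1
  have hp := hP.p_pos
  have hp1 : 0 < 1 - p := by linarith [hP.p_lt_one]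
  have e1 : (1 - p) * p * x / (w * (p * (1 - p))) = x / w := by field_simp
  rw [e1] at h1
  have hx1 : |x| ≤ 6 * (L * s) := by
    have := abs_sub (xi d p X F b) (xi d p X F c)
    linarith [abs_xi_le hP hF hD (by omega) b, abs_xi_le hP hF hD (by omega) c]
  have hwn : |(n : ℝ) - w| ≤ 5 * (L * s) := by
    have h2 := card_Wset_ge (hD.deg_le' hP (by omega)) a b c
    have h3 : w ≤ n := by rw [hw]; exact_mod_cast card_Wset_le X a b c
    have : 1 ≤ L * s := one_le_mul_of_one_le_of_one_le hP.one_le_L hs1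
    rw [abs_of_nonneg (by linarith)]
    linarith
  have e2 : x / w - x / n = x * (n - w) / (w * n) := by
    have : (n : ℝ) ≠ 0 := by rw [← hP.sq]; positivity
    field_simp
  have h2 : |x / w - x / n| ≤ 60 * L ^ 2 / s ^ 2 := by
    rw [e2, abs_div, abs_mul, abs_of_pos (by rw [← hP.sq]; positivity : 0 < w * n)]
    calc _ ≤ 6 * (L * s) * (5 * (L * s)) / (s ^ 2 / 2 * n) := by gcongr; rw [← hP.sq]; positivity
      _ = _ := by rw [← hP.sq]; field_simp; norm_num
  have e3 : pr d X F a b - pr d X F a c - x / n =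
      (pr d X F a b - pr d X F a c - x / w) + (x / w - x / n) := by ring
  rw [e3]
  refine (abs_add_le _ _).trans ((add_le_add h1 h2).trans ?_)
  have e4 : L ^ 30 * (L ^ 17 / s) / s + 60 * L ^ 2 / s ^ 2 = (L ^ 47 + 60 * L ^ 2) / s ^ 2 := by
    field_simp
  rw [e4]
  gcongr
  have h5 := hP.dom_pow 60 (by norm_num) (show 2 + 1 ≤ 47 by norm_num)
  have h6 := hP.dom_pow 2 (by norm_num) (show 47 + 1 ≤ 48 by norm_num)
  linarith

/-- Second-order approximation of edge probabilities. -/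
lemma abs_pr_sub_second_le (hP : Par n d p s L) (hne : (Om d X F).Nonempty) (hD : Dom s L X j)
    (hj : j ≤ 90) (hab : a ≠ b) (xb : ¬ X.Adj a b) :
    |pr d X F a b - (p + xi d p X F a / n + xi d p X F b / n)| ≤ L ^ 49 / s ^ 2 := by
  have hs := hP.s_pos
  have hL := hP.L_pos
  have hF := Om_nonempty_le hne
  have hj' : j ≤ 100 := by omega
  have hn : (n : ℝ) ≠ 0 := by rw [← hP.sq]; positivity
  have hU := half_le_card_Uset hP hD hj' a
  set u : ℝ := ((Uset X a).card : ℝ) with hu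
  have hU0 : 0 < u := lt_of_lt_of_le (by positivity) hU
  have h1 : |∑ c ∈ Uset X a, (pr d X F a b - pr d X F a c -
      (xi d p X F b - xi d p X F c) / n)| ≤ u * (L ^ 48 / s ^ 2) := by
    refine abs_sum_le_card _ fun c hc => ?_
    rw [mem_Uset] at hc
    by_cases hbc : b = c
    · subst hbc; simp; positivity
    · exact abs_pr_sub_sub_le hP hne hD hj hab hc.1.symm hbc xb hc.2
  rw [Finset.sum_sub_distrib, Finset.sum_sub_distrib, sum_pr hne, Finset.sum_const,
    nsmul_eq_mul, ← Finset.sum_div, Finset.sum_sub_distrib, Finset.sum_const, nsmul_eq_mul,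
    sum_Uset_xi, ← hu] at h1
  have hcard := card_Uset X a
  rw [← hu] at hcard
  have hxa : xi d p X F a = res d F a - p * u := by rw [hcard]; rfl
  set xa := xi d p X F a
  set xb' := xi d p X F b
  have e : u * (pr d X F a b - (p + xa / n + xb' / n)) =
      (u * pr d X F a b - res d F a - (u * xb' - (Xi d p X F - xa - Sx d p X F a)) / n) +
      (xa * ((n - u) / n) - (Xi d p X F - xa - Sx d p X F a) / n) := by
    have : res d F a = xa + p * u := by linarith
    rw [this]
    field_simp
    ring
  have b1 : |xa * ((n - u) / n)| ≤ 9 * L ^ 2 := by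
    have := abs_xi_le hP hF hD hj' a
    have hdd := hD.deg_le' hP hj' a
    have h0 : 0 ≤ (deg X a : ℝ) := by positivity
    have hq : |(n : ℝ) - u| ≤ 3 * (L * s) := by
      rw [hcard, abs_le]
      have : 1 ≤ L * s := one_le_mul_of_one_le_of_one_le hP.one_le_L (by linarith [hP.s_ge])
      constructor <;> linarith
    rw [abs_mul, abs_div, Nat.abs_cast]
    calc _ ≤ 3 * (L * s) * (3 * (L * s) / n) := by gcongr
      _ = _ := by rw [← hP.sq]; field_simp; norm_num
  have b2 : |(Xi d p X F - xa - Sx d p X F a) / n| ≤ 11 * L ^ 2 := by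
    have t1 := abs_Xi_le hP hF hD hj'
    have t2 := abs_xi_le hP hF hD hj' a
    have t3 := abs_Sx_le hP hF hD hj' a
    have t4 : L * s ≤ L ^ 2 * s ^ 2 := by
      have : 1 ≤ L * s := one_le_mul_of_one_le_of_one_le hP.one_le_L (by linarith [hP.s_ge])
      nlinarith
    rw [abs_div, Nat.abs_cast, ← hP.sq, div_le_iff₀ (by positivity)]
    refine (abs_sub _ _).trans ?_
    have := abs_sub (Xi d p X F) xa
    linarith
  have h2 : u * |pr d X F a b - (p + xa / n + xb' / n)| ≤
      u * (L ^ 48 / s ^ 2) + 20 * L ^ 2 := by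
    rw [← abs_of_pos hU0, ← abs_mul, e, abs_of_pos hU0]
    refine (abs_add_le _ _).trans ?_
    have := abs_sub (xa * ((n - u) / n)) ((Xi d p X F - xa - Sx d p X F a) / n)
    linarith
  have h3 : 20 * L ^ 2 ≤ u * (40 * L ^ 2 / s ^ 2) := by
    calc 20 * L ^ 2 = s ^ 2 / 2 * (40 * L ^ 2 / s ^ 2) := by field_simp; norm_num
      _ ≤ _ := by gcongr
  have h4 : u * |pr d X F a b - (p + xa / n + xb' / n)| ≤
      u * (L ^ 48 / s ^ 2 + 40 * L ^ 2 / s ^ 2) := by linarith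
  refine (le_of_mul_le_mul_left h4 hU0).trans ?_
  rw [← add_div]
  gcongr
  have h5 := hP.dom_pow 40 (by norm_num) (show 2 + 1 ≤ 48 by norm_num)
  have h6 := hP.dom_pow 2 (by norm_num) (show 48 + 1 ≤ 49 by norm_num)
  linarith

end Second

end

section

open SimpleGraph

variable {n : ℕ} {d : Fin n → ℕ} {p s L : ℝ}

lemma ind_rev {X : SimpleGraph (Fin n)} {a b : Fin n} (hab : a ≠ b) (hX : ¬ X.Adj a b)
    (u v : Fin n) :
    ind (rev X a b) u v = ind X u v + (eqi u a * eqi v b + eqi u b * eqi v a) := by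
  unfold ind eqi
  simp only [rev_adj hab]
  by_cases h1 : u = a ∧ v = b
  · obtain ⟨rfl, rfl⟩ := h1
    simp [hX, hab]
  by_cases h2 : u = b ∧ v = a
  · obtain ⟨rfl, rfl⟩ := h2
    have : ¬ X.Adj u v := fun h => hX h.symm
    simp [this, hab.symm]
  by_cases h3 : X.Adj u v <;> simp only [h1, h2, h3, or_false, if_true, if_false] <;>
    split_ifs <;> simp_all

lemma deg_rev {X : SimpleGraph (Fin n)} {a b : Fin n} (hab : a ≠ b) (hX : ¬ X.Adj a b)
    (v : Fin n) : (deg (rev X a b) v : ℝ) = deg X v + (eqi v a + eqi v b) := by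
  rw [deg_eq_sum, deg_eq_sum]
  simp only [ind_rev hab hX]
  rw [Finset.sum_add_distrib, Finset.sum_add_distrib, ← Finset.mul_sum, ← Finset.mul_sum,
    sum_eqi', sum_eqi', mul_one, mul_one]

lemma xi_present {X F : SimpleGraph (Fin n)} (hF : F ≤ X) {a b : Fin n} (hab : a ≠ b)
    (hX : ¬ X.Adj a b) (v : Fin n) :
    xi d p (rev X a b) (rev F a b) v = xi d p X F v - (1 - p) * (eqi v a + eqi v b) := by
  unfold xi res
  rw [deg_rev hab hX, deg_rev hab fun h => hX (hF h)]
  ring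

lemma xi_absent (X F : SimpleGraph (Fin n)) {a b : Fin n} (hab : a ≠ b)
    (hX : ¬ X.Adj a b) (v : Fin n) :
    xi d p (rev X a b) F v = xi d p X F v - (0 - p) * (eqi v a + eqi v b) := by
  unfold xi res
  rw [deg_rev hab hX]
  ring

lemma eqi_add_mem {a b : Fin n} (hab : a ≠ b) (v : Fin n) :
    0 ≤ eqi v a + eqi v b ∧ eqi v a + eqi v b ≤ 1 := by
  unfold eqi
  by_cases h : v = a
  · subst h; simp [hab]
  · simp only [h, if_false]; split_ifs <;> simp

lemma abs_mul_le_mul {x y M N : ℝ} (hx : |x| ≤ M) (hy : |y| ≤ N) : |x * y| ≤ M * N := by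
  rw [abs_mul]
  exact mul_le_mul hx hy (abs_nonneg _) ((abs_nonneg _).trans hx)

lemma abs_add_le_add {x y M N : ℝ} (hx : |x| ≤ M) (hy : |y| ≤ N) : |x + y| ≤ M + N :=
  (abs_add_le _ _).trans (add_le_add hx hy)

lemma abs_sub_le_add {x y M N : ℝ} (hx : |x| ≤ M) (hy : |y| ≤ N) : |x - y| ≤ M + N :=
  (abs_sub _ _).trans (add_le_add hx hy)

/-- Third-order expansion of the comparison ratio. -/
lemma ratio_expansion {p A B τ va vb vc β χ q Sb Sc i w2 m1 m2 γ : ℝ} (hp : 0 ≤ p) (hp1 : p ≤ 1)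
    (hA : A = p * (1 - p)) (hAτ : 50 * τ ≤ A) (hA0 : 0 < A) (hA1 : A ≤ 1) (hB : B = 1 / A)
    (hτ : 0 ≤ τ) (hτ1 : τ ≤ 1) (hva : |va| ≤ τ) (hvb : |vb| ≤ τ) (hvc : |vc| ≤ τ) (hβ : |β| ≤ τ)
    (hχ : |χ| ≤ τ) (hq : |q| ≤ τ) (hSb : |Sb| ≤ τ ^ 2) (hSc : |Sc| ≤ τ ^ 2) (hi : |i| ≤ τ ^ 2)
    (hw2 : |w2| ≤ τ ^ 2) (hm1 : |m1| ≤ τ ^ 2) (hm2 : |m2| ≤ τ ^ 2)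
    (hγ : γ = (1 - (β + χ - q) + w2) * ((p + vc) * (1 - p - vb)) +
      (1 - 2 * p - vb - vc) * m1 - m2) :
    |(1 - p - va - vb) * (p + va + vc) * (vb - vc + (-vb * (χ - q) + vc * (β - q) + Sb - Sc) +
        2 * i * (vb - vc)) / γ -
      (vb - vc + (vb * β - vc * χ + Sb - Sc + (1 - 2 * p) * va * (vb - vc) * B))| ≤
      1000 * B ^ 2 * τ ^ 3 := by
  set δ1 := vb - vc with hδ1
  set δ2 := -vb * (χ - q) + vc * (β - q) + Sb - Sc with hδ2
  set δ3 := 2 * i * δ1 with hδ3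
  set T2 := vb * β - vc * χ + Sb - Sc + (1 - 2 * p) * va * δ1 * B with hT2
  set ω := β + χ - q with hω
  set e1 := (1 - 2 * p) * va + (1 - p) * vc - p * vb with he1
  set e2 := -((va + vb) * (va + vc)) with he2
  set g1 := (1 - p) * vc - p * vb with hg1
  set γ2 := -(vb * vc) * (1 - ω) + w2 * (A + g1 - vb * vc) +
    (1 - 2 * p - vb - vc) * m1 - m2 with hγ2
  have hB1 : 1 ≤ B := by rw [hB, le_div_iff₀ hA0]; linarith
  have hAB : A * B = 1 := by rw [hB]; field_simp
  have hτ2 : τ ^ 2 ≤ τ := by nlinarith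
  have hτ20 : 0 ≤ τ ^ 2 := by positivity
  have hp2 : |1 - 2 * p| ≤ 1 := by rw [abs_le]; constructor <;> linarith
  have hp3 : |1 - p| ≤ 1 := by rw [abs_le]; constructor <;> linarith
  have hp4 : |p| ≤ 1 := by rw [abs_le]; constructor <;> linarith
  have k1 := abs_mul_le_mul hp2 hva
  have k2 := abs_mul_le_mul hp3 hvc
  have k3 := abs_mul_le_mul hp4 hvb
  have d1 : |δ1| ≤ 2 * τ := (abs_sub_le_add hvb hvc).trans_eq (by ring)
  have be1 : |e1| ≤ 3 * τ := (abs_sub_le_add (abs_add_le_add k1 k2) k3).trans_eq (by ring)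
  have bg1 : |g1| ≤ 2 * τ := (abs_sub_le_add k2 k3).trans_eq (by ring)
  have bω : |ω| ≤ 3 * τ := (abs_sub_le_add (abs_add_le_add hβ hχ) hq).trans_eq (by ring)
  have k4 : |va + vb| ≤ 2 * τ := (abs_add_le_add hva hvb).trans_eq (by ring)
  have k5 : |va + vc| ≤ 2 * τ := (abs_add_le_add hva hvc).trans_eq (by ring)
  have be2 : |e2| ≤ 4 * τ ^ 2 := by
    rw [he2, abs_neg]; exact (abs_mul_le_mul k4 k5).trans_eq (by ring)
  have k6 : |χ - q| ≤ 2 * τ := (abs_sub_le_add hχ hq).trans_eq (by ring)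
  have k7 : |β - q| ≤ 2 * τ := (abs_sub_le_add hβ hq).trans_eq (by ring)
  have k8 := abs_mul_le_mul ((abs_neg vb).trans_le hvb) k6
  have k9 := abs_mul_le_mul hvc k7
  have d2 : |δ2| ≤ 6 * τ ^ 2 :=
    (abs_sub_le_add (abs_add_le_add (abs_add_le_add k8 k9) hSb) hSc).trans_eq (by ring)
  have d3 : |δ3| ≤ 4 * τ ^ 2 := by
    rw [hδ3, mul_assoc, abs_mul, abs_two]
    calc 2 * |i * δ1| ≤ 2 * (τ ^ 2 * (2 * τ)) := by gcongr; exact abs_mul_le_mul hi d1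
      _ = 4 * τ ^ 2 * τ := by ring
      _ ≤ 4 * τ ^ 2 := mul_le_of_le_one_right (by positivity) hτ1
  have d3' : |δ3| ≤ 4 * τ ^ 3 := by
    rw [hδ3, mul_assoc, abs_mul, abs_two]
    calc 2 * |i * δ1| ≤ 2 * (τ ^ 2 * (2 * τ)) := by gcongr; exact abs_mul_le_mul hi d1
      _ = _ := by ring
  have k10 := abs_mul_le_mul hvb hβ
  have k11 := abs_mul_le_mul hvc hχ
  have k12 := abs_mul_le_mul (abs_mul_le_mul k1 d1) (le_of_eq (abs_of_nonneg (by linarith : 0 ≤ B)))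
  have hBτ : τ ^ 2 ≤ B * τ ^ 2 := le_mul_of_one_le_left hτ20 hB1
  have t2 : |T2| ≤ 6 * (B * τ ^ 2) := by
    refine (abs_add_le_add (abs_sub_le_add (abs_add_le_add (abs_sub_le_add k10 k11) hSb) hSc)
      k12).trans ?_
    calc τ * τ + τ * τ + τ ^ 2 + τ ^ 2 + 1 * τ * (2 * τ) * B =
        4 * τ ^ 2 + 2 * (B * τ ^ 2) := by ring
      _ ≤ _ := by linarith
  have k13 := abs_mul_le_mul hvb hvc
  have k13' : |vb * vc| ≤ τ ^ 2 := by rw [sq]; exact k13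
  have k14 : |1 - ω| ≤ 4 :=
    (abs_sub_le_add (le_of_eq abs_one) bω).trans (by linarith)
  have k15 := abs_mul_le_mul k13' k14
  have k16 : |A + g1 - vb * vc| ≤ 4 :=
    (abs_sub_le_add (abs_add_le_add (le_of_eq (abs_of_pos hA0)) bg1) k13').trans (by linarith)
  have k17 := abs_mul_le_mul hw2 k16
  have k18 : |1 - 2 * p - vb - vc| ≤ 3 :=
    (abs_sub_le_add (abs_sub_le_add hp2 hvb) hvc).trans (by linarith)
  have k19 := abs_mul_le_mul k18 hm1
  have g2 : |γ2| ≤ 12 * τ ^ 2 := by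
    have e : -(vb * vc) * (1 - ω) = -((vb * vc) * (1 - ω)) := by ring
    rw [hγ2, e]
    exact (abs_sub_le_add (abs_add_le_add (abs_add_le_add ((abs_neg _).trans_le k15) k17) k19)
      hm2).trans_eq (by ring)
  have hγ' : γ = (A + g1) * (1 - ω) + γ2 := by rw [hγ, hγ2, hg1, hA]; ring
  have k20 := abs_mul_le_mul bg1 bω
  have k21 : |A * ω| ≤ 3 * τ := by
    rw [abs_mul, abs_of_pos hA0]
    exact (mul_le_of_le_one_left (abs_nonneg _) hA1).trans bω
  have hγA : A / 2 ≤ γ := by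
    have e : γ = A + g1 - A * ω - g1 * ω + γ2 := by rw [hγ']; ring
    rw [e]
    have x1 : 2 * τ * (3 * τ) = 6 * τ ^ 2 := by ring
    rw [x1] at k20
    linarith [(abs_le.1 bg1).1, (abs_le.1 k21).2, (abs_le.1 k20).2, (abs_le.1 g2).1]
  have hγ0 : 0 < γ := by linarith
  have hE : (1 - p - va - vb) * (p + va + vc) = A + e1 + e2 := by
    rw [he1, he2, hA]; ring
  rw [hE]
  have key : (A + e1 + e2) * (δ1 + δ2 + δ3) - γ * (δ1 + T2) =
      A * δ3 + e1 * (δ2 + δ3) + e2 * (δ1 + δ2 + δ3) - (g1 * T2 - A * ω * T2 -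
        g1 * ω * (δ1 + T2) + γ2 * (δ1 + T2)) := by
    rw [hγ']
    have e : A * T2 = A * (vb * β - vc * χ + Sb - Sc) + (1 - 2 * p) * va * δ1 := by
      rw [hT2]; linear_combination (1 - 2 * p) * va * δ1 * hAB
    have e' : e1 = g1 + (1 - 2 * p) * va := by rw [he1, hg1]; ring
    have e'' : δ2 = vb * β - vc * χ + Sb - Sc - ω * δ1 := by rw [hδ2, hω, hδ1]; ring
    rw [e'']
    linear_combination (-1) * e + δ1 * e'
  have r1 : |A * δ3| ≤ 4 * τ ^ 3 := by
    rw [abs_mul, abs_of_pos hA0]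
    exact (mul_le_of_le_one_left (abs_nonneg _) hA1).trans d3'
  have hBτ3 : τ ^ 3 ≤ B * τ ^ 3 := le_mul_of_one_le_left (by positivity) hB1
  have hτ43 : B * τ ^ 4 ≤ B * τ ^ 3 := by
    have : τ ^ 4 ≤ τ ^ 3 := pow_le_pow_of_le_one hτ hτ1 (by norm_num)
    gcongr
  have r2 : |e1 * (δ2 + δ3)| ≤ 3 * τ * (10 * τ ^ 2) :=
    abs_mul_le_mul be1 ((abs_add_le _ _).trans (by linarith))
  have r3 : |e2 * (δ1 + δ2 + δ3)| ≤ 4 * τ ^ 2 * (12 * τ) := by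
    refine abs_mul_le_mul be2 ((abs_add_three _ _ _).trans (by linarith))
  have r4 := abs_mul_le_mul bg1 t2
  have r5 := abs_mul_le_mul k21 t2
  have b6 : |δ1 + T2| ≤ 8 * (B * τ) := by
    have : B * τ ^ 2 ≤ B * τ := by gcongr
    have : τ ≤ B * τ := le_mul_of_one_le_left hτ hB1
    exact (abs_add_le _ _).trans (by linarith)
  have r6 := abs_mul_le_mul k20 b6
  have r7 := abs_mul_le_mul g2 b6
  have hfin : |(A + e1 + e2) * (δ1 + δ2 + δ3) - γ * (δ1 + T2)| ≤ 400 * (B * τ ^ 3) := by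
    rw [key]
    have x2 : 3 * τ * (10 * τ ^ 2) = 30 * τ ^ 3 := by ring
    have x3 : 4 * τ ^ 2 * (12 * τ) = 48 * τ ^ 3 := by ring
    have x4 : 2 * τ * (6 * (B * τ ^ 2)) = 12 * (B * τ ^ 3) := by ring
    have x5 : 3 * τ * (6 * (B * τ ^ 2)) = 18 * (B * τ ^ 3) := by ring
    have x6 : 2 * τ * (3 * τ) * (8 * (B * τ)) = 48 * (B * τ ^ 3) := by ring
    have x7 : 12 * τ ^ 2 * (8 * (B * τ)) = 96 * (B * τ ^ 3) := by ring
    rw [x2] at r2; rw [x3] at r3; rw [x4] at r4; rw [x5] at r5; rw [x6] at r6; rw [x7] at r7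
    have : 0 ≤ τ ^ 3 := by positivity
    rw [abs_le] at r1 r2 r3 r4 r5 r6 r7 ⊢
    constructor <;> linarith [r1.1, r1.2, r2.1, r2.2, r3.1, r3.2, r4.1, r4.2, r5.1, r5.2, r6.1,
      r6.2, r7.1, r7.2]
  have e : (A + e1 + e2) * (δ1 + δ2 + δ3) / γ - (δ1 + T2) =
      ((A + e1 + e2) * (δ1 + δ2 + δ3) - γ * (δ1 + T2)) / γ := by field_simp
  rw [e, abs_div, abs_of_pos hγ0, div_le_iff₀ hγ0]
  calc _ ≤ 400 * (B * τ ^ 3) := hfin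
    _ ≤ 500 * (B * τ ^ 3) := by
        have : 0 ≤ B * τ ^ 3 := by positivity
        linarith
    _ = 1000 * B ^ 2 * τ ^ 3 * (A / 2) := by linear_combination -(500 * B * τ ^ 3) * hAB
    _ ≤ _ := by gcongr

end

section

open SimpleGraph

variable {n : ℕ} {d : Fin n → ℕ} {p s L : ℝ}

/-- The second-order edge probability. -/
noncomputable def Q2 (d : Fin n → ℕ) (p : ℝ) (X F : SimpleGraph (Fin n)) (u v : Fin n) : ℝ :=
  p + xi d p X F u / n + xi d p X F v / n

/-- The corrected excess at a vertex. -/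
noncomputable def kap (d : Fin n → ℕ) (p : ℝ) (X F : SimpleGraph (Fin n)) (v : Fin n) : ℝ :=
  xi d p X F v / n + xi d p X F v / n * (deg X v / n) + Sx d p X F v / n ^ 2

section Third

variable {X F : SimpleGraph (Fin n)} {a b c : Fin n}

lemma near_second (hP : Par n d p s L) (hne : (Om d X F).Nonempty) (hD : Dom s L X 0) :
    Near d (L ^ 50 / s ^ 2) (Q2 d p X F) 6 X F := by
  have hs := hP.s_pos
  have hL := hP.L_pos
  refine near_of_inv (J := 6) (I := fun i X' F' => (Om d X' F').Nonempty ∧ Dom s L X' i ∧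
    ∀ v, |xi d p X' F' v - xi d p X F v| ≤ i) ?_ ?_ 6 0 X F
    (by omega) ⟨hne, hD, fun v => by simp⟩
  · rintro i X' F' hi ⟨h1, h2, h3⟩ u v huv hX
    have hi' : (i : ℝ) ≤ 6 := by exact_mod_cast hi
    have hF' := Om_nonempty_le h1
    have := children_nonempty hP h1 h2 (by nlinarith [hP.s_ge, hP.L_ge]) huv hX
    have hp := hP.p_pos
    have hp1 := hP.p_lt_one
    refine ⟨⟨this.1, h2.rev u v, fun w => ?_⟩, this.2, h2.rev u v, fun w => ?_⟩
    · rw [xi_present hF' huv hX]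
      have h4 := abs_le.1 (h3 w)
      have h5 := eqi_add_mem huv w
      push_cast
      rw [abs_le]
      constructor <;> nlinarith
    · rw [xi_absent _ _ huv hX]
      have h4 := abs_le.1 (h3 w)
      have h5 := eqi_add_mem huv w
      push_cast
      rw [abs_le]
      constructor <;> nlinarith
  · rintro i X' F' hi ⟨h1, h2, h3⟩ u v huv hX
    have hi' : (i : ℝ) ≤ 6 := by exact_mod_cast hi
    have h4 := abs_pr_sub_second_le hP h1 h2 (by omega) huv hX
    have h5 : pr d X' F' u v - Q2 d p X F u v =
        (pr d X' F' u v - (p + xi d p X' F' u / n + xi d p X' F' v / n)) +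
        ((xi d p X' F' u - xi d p X F u) / n + (xi d p X' F' v - xi d p X F v) / n) := by
      unfold Q2; ring
    have h6 : ∀ w, |(xi d p X' F' w - xi d p X F w) / n| ≤ 6 / s ^ 2 := by
      intro w
      rw [abs_div, Nat.abs_cast, ← hP.sq]
      have := (h3 w).trans hi'
      gcongr
    rw [h5]
    refine (abs_add_le_add h4 (abs_add_le_add (h6 u) (h6 v))).trans ?_
    rw [← add_div, ← add_div]
    gcongr
    have := hP.dom_pow 2 (by norm_num) (show 49 + 1 ≤ 50 by norm_num)
    have := hP.dom_pow (k := 0) (l := 49) 12 (by norm_num) (by norm_num)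
    linarith

lemma dl_Q2 (hn : (n : ℝ) ≠ 0) (xb : ¬ X.Adj a b) (xc : ¬ X.Adj a c) :
    dl d X F a b c (Q2 d p X F) / n =
      (xi d p X F b / n - xi d p X F c / n) + (-(xi d p X F b / n) *
        (deg X c / n - (∑ v, ind X b v * ind X c v) / n) + xi d p X F c / n *
        (deg X b / n - (∑ v, ind X b v * ind X c v) / n) + Sx d p X F b / n ^ 2 -
        Sx d p X F c / n ^ 2) +
        2 * (ind X b c / n) * (xi d p X F b / n - xi d p X F c / n) := by
  have e1 : ∑ v ∈ Yset X a b c, Q2 d p X F b v =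
      (p + xi d p X F b / n) * (∑ v ∈ Yset X a b c, (1 : ℝ)) +
      (∑ v ∈ Yset X a b c, xi d p X F v) / n := by
    unfold Q2
    rw [Finset.sum_add_distrib, Finset.sum_div, Finset.mul_sum, mul_one]
  have e2 : ∑ v ∈ Yset X a c b, Q2 d p X F c v =
      (p + xi d p X F c / n) * (∑ v ∈ Yset X a c b, (1 : ℝ)) +
      (∑ v ∈ Yset X a c b, xi d p X F v) / n := by
    unfold Q2
    rw [Finset.sum_add_distrib, Finset.sum_div, Finset.mul_sum, mul_one]
  unfold dl
  rw [e1, e2, sum_Yset xc, sum_Yset xb, sum_Yset xc, sum_Yset xb]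
  simp only [mul_one, ← deg_eq_sum, ind_comm X c b, mul_comm (ind X c _) (ind X b _)]
  have r1 : res d F b = xi d p X F b + p * (n - 1 - deg X b) := by unfold xi; ring
  have r2 : res d F c = xi d p X F c + p * (n - 1 - deg X c) := by unfold xi; ring
  rw [r1, r2]
  change _ = xi d p X F b / n - xi d p X F c / n +
    (_ + _ + (∑ v, ind X b v * xi d p X F v) / n ^ 2 -
    (∑ v, ind X c v * xi d p X F v) / n ^ 2) + _
  field_simp
  ring

lemma gm_Q2 (hn : (n : ℝ) ≠ 0) (hab : a ≠ b) (hac : a ≠ c) (hbc : b ≠ c)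
    (xb : ¬ X.Adj a b) (xc : ¬ X.Adj a c) :
    gm X a b c (Q2 d p X F) / n =
      (1 - (deg X b / n + deg X c / n - (∑ v, ind X b v * ind X c v) / n) +
        (2 * ind X b c - 3) / n) * ((p + xi d p X F c / n) * (1 - p - xi d p X F b / n)) +
      (1 - 2 * p - xi d p X F b / n - xi d p X F c / n) *
        ((∑ v ∈ Wset X a b c, xi d p X F v) / n / n) -
      (∑ v ∈ Wset X a b c, (xi d p X F v / n) ^ 2) / n := by
  have e1 : gm X a b c (Q2 d p X F) =
      (p + xi d p X F c / n) * (1 - p - xi d p X F b / n) * (∑ v ∈ Wset X a b c, (1 : ℝ)) +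
      (1 - 2 * p - xi d p X F b / n - xi d p X F c / n) *
        ((∑ v ∈ Wset X a b c, xi d p X F v) / n) -
      ∑ v ∈ Wset X a b c, (xi d p X F v / n) ^ 2 := by
    unfold gm Q2
    rw [Finset.mul_sum, Finset.sum_div, Finset.mul_sum, ← Finset.sum_add_distrib,
      ← Finset.sum_sub_distrib]
    refine Finset.sum_congr rfl fun v _ => ?_
    ring
  rw [e1, sum_Wset hab hac hbc xb xc]
  simp only [mul_one, ← deg_eq_sum, Finset.sum_const, Finset.card_univ, Fintype.card_fin,
    nsmul_eq_mul]
  field_simp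
  ring

end Third

end

section

open SimpleGraph

variable {n : ℕ} {d : Fin n → ℕ} {p s L : ℝ}

lemma Par.n_ne (hP : Par n d p s L) : (n : ℝ) ≠ 0 := by
  have := hP.s_pos
  rw [← hP.sq]; positivity

lemma Par.inv_sq_le_mul (hP : Par n d p s L) : 1 / L ^ 2 ≤ p * (1 - p) := by
  have hL := hP.L_pos
  rw [div_le_iff₀ (by positivity)]
  calc (1 : ℝ) = 1 * 1 := by ring
    _ ≤ (L * p) * (L * (1 - p)) := mul_le_mul hP.hp hP.hq (by norm_num) (by linarith [hP.hp])
    _ = _ := by ring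

lemma Par.pow_div_le (hP : Par n d p s L) {k : ℕ} (hk : k ≤ 1000) : L ^ k / s ≤ 1 :=
  (div_le_one hP.s_pos).2 (hP.pow_le hk)

section Third

variable {X F : SimpleGraph (Fin n)} {a b c : Fin n}

lemma abs_xi_div_le (hP : Par n d p s L) (hF : F ≤ X) (hD : Dom s L X 0) (v : Fin n) :
    |xi d p X F v / n| ≤ 3 * L / s := by
  have hs := hP.s_pos
  rw [abs_div, Nat.abs_cast, ← hP.sq, div_le_div_iff₀ (by positivity) hs]
  nlinarith [mul_le_mul_of_nonneg_right (abs_xi_le hP hF hD (by norm_num) v) hs.le]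

lemma Q2_mem (hP : Par n d p s L) (hF : F ≤ X) (hD : Dom s L X 0) (u v : Fin n) :
    1 / L ^ 2 ≤ Q2 d p X F u v ∧ 1 / L ^ 2 ≤ 1 - Q2 d p X F u v := by
  have hs := hP.s_pos
  have hL := hP.L_pos
  have h1 := abs_le.1 (abs_xi_div_le hP hF hD u)
  have h2 := abs_le.1 (abs_xi_div_le hP hF hD v)
  have h3 : 3 * L / s ≤ 3 * (1 / L ^ 2) := by
    rw [mul_one_div, div_le_div_iff₀ hs (by positivity)]
    nlinarith [hP.pow_le (k := 3) (by norm_num)]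
  have h4 : 2000 * (1 / L ^ 2) ≤ 1 / L := by
    rw [mul_one_div, div_le_div_iff₀ (by positivity) hL]
    nlinarith [hP.L_ge]
  have h5 : 0 < 1 / L ^ 2 := by positivity
  have h6 : 1 / L ≤ p := by
    rw [div_le_iff₀ hL]; linarith [hP.hp]
  have h7 : 1 / L ≤ 1 - p := by
    rw [div_le_iff₀ hL]; linarith [hP.hq]
  unfold Q2
  constructor <;> linarith

lemma abs_sum_Wset_xi_le (hP : Par n d p s L) (hF : F ≤ X) (hD : Dom s L X 0)
    (hab : a ≠ b) (hac : a ≠ c) (hbc : b ≠ c) (xb : ¬ X.Adj a b) (xc : ¬ X.Adj a c) :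
    |∑ v ∈ Wset X a b c, xi d p X F v| ≤ 100 * (L ^ 2 * s ^ 2) := by
  have hx := abs_xi_le hP hF hD (by norm_num : 0 ≤ 100)
  have hLs : 1 ≤ L * s := one_le_mul_of_one_le_of_one_le hP.one_le_L (by linarith [hP.s_ge])
  have h0 : L * s ≤ L ^ 2 * s ^ 2 := by nlinarith
  have hS := abs_Sx_le hP hF hD (by norm_num : 0 ≤ 100)
  have h1 : |∑ v, ind X b v * ind X c v * xi d p X F v| ≤ 6 * (L ^ 2 * s ^ 2) := by
    have : ∀ v, |ind X c v * xi d p X F v| ≤ 3 * (L * s) := by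
      intro v
      rw [abs_mul, abs_of_nonneg (ind_nonneg _ _ _)]
      exact (mul_le_of_le_one_left (abs_nonneg _) (ind_le_one _ _ _)).trans (hx v)
    simp only [mul_assoc]
    refine (abs_sum_ind_le this b).trans ?_
    have h := hD.deg_le' hP (by norm_num) b
    calc (deg X b : ℝ) * (3 * (L * s)) ≤ 2 * L * s * (3 * (L * s)) := by gcongr; linarith
      _ = _ := by ring
  rw [sum_Wset hab hac hbc xb xc]
  have h2 : |ind X b c * (xi d p X F b + xi d p X F c)| ≤ 1 * (3 * (L * s) + 3 * (L * s)) :=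
    abs_mul_le_mul (by rw [abs_of_nonneg (ind_nonneg _ _ _)]; exact ind_le_one _ _ _)
      (abs_add_le_add (hx b) (hx c))
  refine (abs_add_le_add (abs_sub_le_add (abs_sub_le_add (abs_sub_le_add (abs_add_le_add
    (abs_sub_le_add (abs_sub_le_add (abs_Xi_le hP hF hD (by norm_num : 0 ≤ 100)) (hS b)) (hS c)) h1)
    (hx a)) (hx b)) (hx c)) h2).trans ?_
  linarith

/-- Third-order comparison of the probabilities of two edges at the same vertex. -/
lemma abs_pr_sub_third_le (hP : Par n d p s L) (hne : (Om d X F).Nonempty) (hD : Dom s L X 0)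
    (hab : a ≠ b) (hac : a ≠ c) (hbc : b ≠ c) (xb : ¬ X.Adj a b) (xc : ¬ X.Adj a c) :
    |pr d X F a b - pr d X F a c - (kap d p X F b - kap d p X F c + (1 - 2 * p) *
      (xi d p X F a / n) * (xi d p X F b / n - xi d p X F c / n) * (1 / (p * (1 - p))))| ≤
      L ^ 81 / s ^ 3 := by
  have hs := hP.s_pos
  have hL := hP.L_pos
  have hs1 : 1 ≤ s := by linarith [hP.s_ge]
  have hL1 := hP.one_le_L
  have hF := Om_nonempty_le hne
  have hn := hP.n_ne
  have h1 := pr_sub_refined hP (η := L ^ 50 / s ^ 2) (Q := Q2 d p X F) (by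
    gcongr; exact one_le_pow₀ hL1) (Q2_mem hP hF hD) hne hD (by norm_num)
    (near_second hP hne hD) hab hac hbc xb xc
  have hx := abs_xi_le hP hF hD (by norm_num : 0 ≤ 100)
  have hS := abs_Sx_le hP hF hD (by norm_num : 0 ≤ 100)
  have hAL := hP.inv_sq_le_mul
  have hp := hP.p_pos
  have hp1 := hP.p_lt_one
  have hL0 : 0 < 1 / L ^ 2 := by positivity
  have bx : ∀ v, |xi d p X F v / n| ≤ L ^ 3 / s := fun v =>
    (abs_xi_div_le hP hF hD v).trans (by
      gcongr; simpa using hP.dom_pow (k := 1) (l := 3) 3 (by norm_num) (by norm_num))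
  have bdd : ∀ v, (deg X v : ℝ) ≤ 2 * L * s := fun v => by
    linarith [hD.deg_le' hP (by norm_num) v]
  have c1 : 2 * L * s / n ≤ L ^ 3 / s := by
    rw [← hP.sq, div_le_div_iff₀ (by positivity) hs]
    have := hP.dom_pow (k := 1) (l := 3) 2 (by norm_num) (by norm_num)
    calc 2 * L * s * s = (2 * L ^ 1) * s ^ 2 := by ring
      _ ≤ _ := by gcongr
  have bd : ∀ v, |(deg X v : ℝ) / n| ≤ L ^ 3 / s := fun v => by
    rw [abs_of_nonneg (by positivity)]
    refine le_trans ?_ c1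
    gcongr
    exact bdd v
  have key2 : ∀ y : ℝ, |y| ≤ 100 * (L ^ 2 * s ^ 2) → |y / n ^ 2| ≤ (L ^ 3 / s) ^ 2 := by
    intro y hy
    rw [abs_div, abs_of_pos (by positivity : (0 : ℝ) < (n : ℝ) ^ 2), ← hP.sq, div_pow,
      div_le_div_iff₀ (by positivity) (by positivity)]
    have := hP.dom_pow (k := 2) (l := 6) 100 (by norm_num) (by norm_num)
    calc |y| * s ^ 2 ≤ 100 * (L ^ 2 * s ^ 2) * s ^ 2 := by gcongr
      _ = 100 * L ^ 2 * (s ^ 2) ^ 2 := by ring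
      _ ≤ L ^ 6 * (s ^ 2) ^ 2 := by gcongr
      _ = _ := by ring
  have key1 : ∀ y : ℝ, |y| ≤ 10 → |y / n| ≤ (L ^ 3 / s) ^ 2 := by
    intro y hy
    rw [abs_div, Nat.abs_cast, ← hP.sq, div_pow]
    gcongr
    refine hy.trans ?_
    have := hP.dom_pow (k := 0) (l := 6) 10 (by norm_num) (by norm_num)
    nlinarith
  have bS : ∀ v, |Sx d p X F v / n ^ 2| ≤ (L ^ 3 / s) ^ 2 := fun v =>
    key2 _ ((hS v).trans (by have : 0 ≤ L ^ 2 * s ^ 2 := by positivity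
                             linarith))
  have bi : ind X b c ≤ 1 := ind_le_one _ _ _
  have bi0 : 0 ≤ ind X b c := ind_nonneg _ _ _
  have bq : |(∑ v, ind X b v * ind X c v) / n| ≤ L ^ 3 / s := by
    rw [abs_of_nonneg (div_nonneg (Finset.sum_nonneg fun v _ => mul_nonneg (ind_nonneg _ _ _)
      (ind_nonneg _ _ _)) (by positivity))]
    refine le_trans ?_ c1
    gcongr
    refine le_trans ?_ (bdd b)
    rw [deg_eq_sum]
    exact Finset.sum_le_sum fun v _ => mul_le_of_le_one_right (ind_nonneg _ _ _) (ind_le_one _ _ _)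
  have bm1 : |(∑ v ∈ Wset X a b c, xi d p X F v) / n / n| ≤ (L ^ 3 / s) ^ 2 := by
    rw [div_div, ← pow_two]
    exact key2 _ (abs_sum_Wset_xi_le hP hF hD hab hac hbc xb xc)
  have bm2 : |(∑ v ∈ Wset X a b c, (xi d p X F v / n) ^ 2) / n| ≤ (L ^ 3 / s) ^ 2 := by
    rw [abs_div, Nat.abs_cast, div_le_iff₀ (lt_of_le_of_ne (by positivity) hn.symm)]
    refine (abs_sum_le_card (C := (L ^ 3 / s) ^ 2) _ fun v _ => ?_).trans ?_
    · rw [abs_pow]; exact pow_le_pow_left₀ (abs_nonneg _) (bx v) 2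
    · rw [mul_comm]
      gcongr
      exact card_Wset_le X a b c
  have hτ1 : L ^ 3 / s ≤ 1 := hP.pow_div_le (by norm_num)
  have hAτ : 50 * (L ^ 3 / s) ≤ p * (1 - p) := by
    refine le_trans ?_ hAL
    rw [← mul_div_assoc, div_le_div_iff₀ hs (by positivity)]
    have := hP.dom_pow (k := 5) (l := 6) 50 (by norm_num) (by norm_num)
    have := hP.pow_le (k := 6) (by norm_num)
    nlinarith
  have h2 := ratio_expansion (p := p) (A := p * (1 - p)) (B := 1 / (p * (1 - p)))
    (τ := L ^ 3 / s) hp.le hp1.le rfl hAτ (by nlinarith) (by nlinarith) rfl (by positivity) hτ1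
    (bx a) (bx b) (bx c) (bd b) (bd c) bq (bS b) (bS c)
    (key1 _ (by rw [abs_of_nonneg bi0]; linarith))
    (key1 (2 * ind X b c - 3) (by rw [abs_le]; constructor <;> linarith))
    bm1 bm2 (gm_Q2 hn hab hac hbc xb xc)
  rw [← dl_Q2 hn xb xc] at h2
  have e1 : (1 - Q2 d p X F a b) * Q2 d p X F a c * dl d X F a b c (Q2 d p X F) /
      gm X a b c (Q2 d p X F) =
      (1 - p - xi d p X F a / n - xi d p X F b / n) * (p + xi d p X F a / n + xi d p X F c / n) *
        (dl d X F a b c (Q2 d p X F) / n) / (gm X a b c (Q2 d p X F) / n) := by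
    rw [← mul_div_assoc, div_div_div_cancel_right₀ hn]
    unfold Q2; ring
  rw [e1] at h1
  have h3 := abs_add_le_add h1 h2
  have hB : (1 / (p * (1 - p))) ^ 2 ≤ L ^ 4 := by
    have : 1 / (p * (1 - p)) ≤ L ^ 2 := by
      rw [div_le_iff₀ (by nlinarith)]
      rw [div_le_iff₀ (by positivity)] at hAL
      linarith
    calc _ ≤ (L ^ 2) ^ 2 := pow_le_pow_left₀ (by
            have : 0 < 1 - p := by linarith
            positivity) this 2
      _ = _ := by ring
  have h4 : L ^ 30 * (L ^ 50 / s ^ 2) / s + 1000 * (1 / (p * (1 - p))) ^ 2 * (L ^ 3 / s) ^ 3 ≤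
      L ^ 81 / s ^ 3 := by
    calc _ ≤ L ^ 30 * (L ^ 50 / s ^ 2) / s + 1000 * L ^ 4 * (L ^ 3 / s) ^ 3 := by gcongr
      _ = (L ^ 80 + 1000 * L ^ 13) / s ^ 3 := by field_simp
      _ ≤ _ := by
        gcongr
        have h5 := hP.dom_pow 1000 (by norm_num) (show 13 + 1 ≤ 80 by norm_num)
        have h6 := hP.dom_pow 2 (by norm_num) (show 80 + 1 ≤ 81 by norm_num)
        linarith
  refine le_trans (le_of_eq ?_) (h3.trans h4)
  congr 1
  unfold kap
  ring

end Third

end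

section

open SimpleGraph

variable {n : ℕ} {d : Fin n → ℕ} {p s L : ℝ}

section Third

variable {X F : SimpleGraph (Fin n)} {a b : Fin n}

/-- The third-order approximation to the probability of the edge `ab`. -/
noncomputable def Q3 (d : Fin n → ℕ) (p : ℝ) (X F : SimpleGraph (Fin n)) (a b : Fin n) : ℝ :=
  p + kap d p X F a + kap d p X F b - Xi d p X F / n ^ 2 +
    (1 - 2 * p) * (xi d p X F a / n) * (xi d p X F b / n) * (1 / (p * (1 - p)))

lemma Par.inv_mul_le (hP : Par n d p s L) :
    0 ≤ 1 / (p * (1 - p)) ∧ 1 / (p * (1 - p)) ≤ L ^ 2 := by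
  have hL := hP.L_pos
  have h := hP.inv_sq_le_mul
  have h0 : 0 < 1 / L ^ 2 := by positivity
  have h1 : 0 < p * (1 - p) := by linarith
  refine ⟨by positivity, ?_⟩
  rw [div_le_iff₀ h1]
  rw [div_le_iff₀ (by positivity)] at h
  linarith

/-- Third-order approximation of edge probabilities. -/
lemma abs_pr_sub_Q3_le (hP : Par n d p s L) (hne : (Om d X F).Nonempty) (hD : Dom s L X 0)
    (hab : a ≠ b) (xb : ¬ X.Adj a b) :
    |pr d X F a b - Q3 d p X F a b| ≤ L ^ 82 / s ^ 3 := by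
  have hs := hP.s_pos
  have hL := hP.L_pos
  have hs1 : 1 ≤ s := by linarith [hP.s_ge]
  have hF := Om_nonempty_le hne
  have hn := hP.n_ne
  have h0 : 0 ≤ 100 := by norm_num
  have hx := abs_xi_le hP hF hD h0
  have hS := abs_Sx_le hP hF hD h0
  have hXi := abs_Xi_le hP hF hD h0
  have hdd := fun v => hD.deg_le' hP h0 v
  have htot := hD.tot_le hP h0
  have hLs : 1 ≤ L * s := one_le_mul_of_one_le_of_one_le hP.one_le_L hs1
  have hLs2 : L * s ≤ L ^ 2 * s ^ 2 := by nlinarith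
  have hU := half_le_card_Uset hP hD h0 a
  set u : ℝ := ((Uset X a).card : ℝ) with hu
  have hU0 : 0 < u := lt_of_lt_of_le (by positivity) hU
  set B := 1 / (p * (1 - p)) with hB
  have h1 : |∑ c ∈ Uset X a, (pr d X F a b - pr d X F a c - (kap d p X F b - kap d p X F c +
      (1 - 2 * p) * (xi d p X F a / n) * (xi d p X F b / n - xi d p X F c / n) * B))| ≤
      u * (L ^ 81 / s ^ 3) := by
    refine abs_sum_le_card _ fun c hc => ?_
    rw [mem_Uset] at hc
    by_cases hbc : b = c
    · subst hbc; simp; positivity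
    · exact abs_pr_sub_third_le hP hne hD hab hc.1.symm hbc xb hc.2
  have e0 : ∑ c ∈ Uset X a, (pr d X F a b - pr d X F a c - (kap d p X F b - kap d p X F c +
      (1 - 2 * p) * (xi d p X F a / n) * (xi d p X F b / n - xi d p X F c / n) * B)) =
      u * pr d X F a b - res d F a - (u * kap d p X F b - ((Xi d p X F - xi d p X F a -
        Sx d p X F a) / n + (∑ c ∈ Uset X a, (xi d p X F c * deg X c + Sx d p X F c)) / n ^ 2) +
      (1 - 2 * p) * (xi d p X F a / n) * (u * (xi d p X F b / n) -
        (Xi d p X F - xi d p X F a - Sx d p X F a) / n) * B) := by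
    have hu' : ∀ x : ℝ, u * x = ∑ c ∈ Uset X a, x := fun x => by
      rw [Finset.sum_const, nsmul_eq_mul]
    rw [← sum_pr hne, ← sum_Uset_xi, Finset.sum_div, Finset.sum_div]
    simp only [hu']
    simp only [← Finset.sum_add_distrib, ← Finset.sum_sub_distrib, Finset.mul_sum, Finset.sum_mul]
    refine Finset.sum_congr rfl fun c _ => ?_
    unfold kap
    field_simp
    ring
  rw [e0] at h1
  have b4 : |∑ c ∈ Uset X a, (xi d p X F c * deg X c + Sx d p X F c)| ≤ 12 * (L ^ 3 * s ^ 3) := by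
    refine (Finset.abs_sum_le_sum_abs _ _).trans ?_
    calc _ ≤ ∑ c, |xi d p X F c * deg X c + Sx d p X F c| :=
          Finset.sum_le_univ_sum_of_nonneg fun c => abs_nonneg _
      _ ≤ ∑ c, (deg X c : ℝ) * (6 * (L * s)) := by
        refine Finset.sum_le_sum fun c _ => ?_
        refine (abs_add_le_add (abs_mul_le_mul (hx c) (abs_of_nonneg (Nat.cast_nonneg _)).le)
          (abs_sum_ind_le hx c)).trans_eq ?_
        ring
      _ = (∑ c, (deg X c : ℝ)) * (6 * (L * s)) := by rw [Finset.sum_mul]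
      _ ≤ 2 * (L ^ 2 * s ^ 2) * (6 * (L * s)) := by gcongr
      _ = _ := by ring
  set T := ∑ c ∈ Uset X a, (xi d p X F c * deg X c + Sx d p X F c) with hT
  have hcard := card_Uset X a
  rw [← hu] at hcard
  have hres : res d F a = xi d p X F a + p * u := by rw [hcard]; unfold xi; ring
  rw [hres] at h1
  have e : u * (pr d X F a b - Q3 d p X F a b) =
      (u * pr d X F a b - (xi d p X F a + p * u) - (u * kap d p X F b - ((Xi d p X F -
        xi d p X F a - Sx d p X F a) / n + T / n ^ 2) +
      (1 - 2 * p) * (xi d p X F a / n) * (u * (xi d p X F b / n) -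
        (Xi d p X F - xi d p X F a - Sx d p X F a) / n) * B)) +
      (2 * (xi d p X F a / n) +
        (deg X a + 1) * (xi d p X F a * deg X a + Sx d p X F a - Xi d p X F) / n ^ 2 - T / n ^ 2 -
        (1 - 2 * p) * (xi d p X F a / n) *
          ((Xi d p X F - xi d p X F a - Sx d p X F a) / n) * B) := by
    unfold Q3
    rw [← hB]
    have : kap d p X F a = xi d p X F a / n + xi d p X F a / n * (deg X a / n) +
      Sx d p X F a / n ^ 2 := rfl
    rw [this, hcard]
    field_simp
    ring
  have bx := abs_xi_div_le hP hF hD a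
  have c2 : |2 * (xi d p X F a / n)| ≤ 6 * L / s := by
    refine (abs_mul_le_mul (abs_two).le bx).trans_eq ?_
    ring
  have c3 : |(deg X a + 1) * (xi d p X F a * deg X a + Sx d p X F a - Xi d p X F) / n ^ 2| ≤
      28 * L ^ 3 / s := by
    rw [abs_div, abs_of_pos (by positivity : (0 : ℝ) < (n : ℝ) ^ 2), ← hP.sq]
    have : |(deg X a + 1) * (xi d p X F a * deg X a + Sx d p X F a - Xi d p X F)| ≤
        2 * L * s * (3 * (L * s) * (2 * L * s) + 6 * (L ^ 2 * s ^ 2) + 2 * (L ^ 2 * s ^ 2)) := by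
      refine abs_mul_le_mul ?_
        (abs_sub_le_add (abs_add_le_add (abs_mul_le_mul (hx a) ?_) (hS a)) hXi)
      · rw [abs_of_nonneg (by positivity)]; exact hdd a
      · rw [Nat.abs_cast]; linarith [hdd a]
    calc _ ≤ 2 * L * s * (3 * (L * s) * (2 * L * s) + 6 * (L ^ 2 * s ^ 2) + 2 * (L ^ 2 * s ^ 2)) /
        (s ^ 2) ^ 2 := by gcongr
      _ = _ := by field_simp; norm_num
  have c4 : |T / n ^ 2| ≤ 12 * L ^ 3 / s := by
    rw [abs_div, abs_of_pos (by positivity : (0 : ℝ) < (n : ℝ) ^ 2), ← hP.sq]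
    calc _ ≤ 12 * (L ^ 3 * s ^ 3) / (s ^ 2) ^ 2 := by gcongr
      _ = _ := by field_simp
  have c5 : |(1 - 2 * p) * (xi d p X F a / n) *
      ((Xi d p X F - xi d p X F a - Sx d p X F a) / n) * B| ≤ 33 * L ^ 5 / s := by
    have t1 : |1 - 2 * p| ≤ 1 := by
      rw [abs_le]; constructor <;> linarith [hP.p_pos, hP.p_lt_one]
    have t2 : |(Xi d p X F - xi d p X F a - Sx d p X F a) / n| ≤ 11 * L ^ 2 := by
      rw [abs_div, Nat.abs_cast, ← hP.sq, div_le_iff₀ (by positivity)]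
      refine (abs_sub_le_add (abs_sub_le_add hXi (hx a)) (hS a)).trans ?_
      linarith
    have t3 : |B| ≤ L ^ 2 := by
      rw [abs_of_nonneg hP.inv_mul_le.1]; exact hP.inv_mul_le.2
    refine (abs_mul_le_mul (abs_mul_le_mul (abs_mul_le_mul t1 bx) t2) t3).trans_eq ?_
    ring
  have h2 : u * |pr d X F a b - Q3 d p X F a b| ≤ u * (L ^ 81 / s ^ 3) + L ^ 6 / s := by
    have h3 := abs_add_le_add h1 (abs_sub_le_add (abs_sub_le_add (abs_add_le_add c2 c3) c4) c5)
    rw [← e, abs_mul, abs_of_pos hU0] at h3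
    refine h3.trans (add_le_add le_rfl ?_)
    rw [← add_div, ← add_div, ← add_div]
    gcongr
    have h5 := hP.dom_pow 6 (by norm_num) (show 1 + 1 ≤ 5 by norm_num)
    have h6 := hP.dom_pow 40 (by norm_num) (show 3 + 1 ≤ 5 by norm_num)
    have h7 := hP.dom_pow 35 (by norm_num) (show 5 + 1 ≤ 6 by norm_num)
    have h8 : L ^ 1 = L := pow_one L
    rw [h8] at h5
    linarith
  have h4 : u * |pr d X F a b - Q3 d p X F a b| ≤ u * (L ^ 81 / s ^ 3 + 2 * L ^ 6 / s ^ 3) := by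
    refine h2.trans ?_
    rw [mul_add]
    gcongr
    calc L ^ 6 / s = s ^ 2 / 2 * (2 * L ^ 6 / s ^ 3) := by field_simp
      _ ≤ _ := by gcongr
  refine (le_of_mul_le_mul_left h4 hU0).trans ?_
  rw [← add_div]
  gcongr
  have h5 := hP.dom_pow 2 (by norm_num) (show 6 + 1 ≤ 81 by norm_num)
  have h6 := hP.dom_pow 2 (by norm_num) (show 81 + 1 ≤ 82 by norm_num)
  linarith

end Third

end

section

open SimpleGraph

variable {n : ℕ} {d : Fin n → ℕ} {p s L : ℝ}

lemma abs_log_one_add_sub_le {y : ℝ} (hy : |y| ≤ 1 / 2) :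
    |Real.log (1 + y) - (y - y ^ 2 / 2)| ≤ 2 * |y| ^ 3 := by
  have h1 : |-y| < 1 := by rw [abs_neg]; linarith
  have h := Real.abs_log_sub_add_sum_range_le h1 2
  simp only [Finset.sum_range_succ, Finset.sum_range_zero, abs_neg, sub_neg_eq_add] at h
  norm_num at h
  have e : Real.log (1 + y) - (y - y ^ 2 / 2) = -y + y ^ 2 / 2 + Real.log (1 + y) := by ring
  rw [e]
  refine h.trans ?_
  rw [div_le_iff₀ (by linarith)]
  have := pow_nonneg (abs_nonneg y) 3
  nlinarith

/-- The contribution of a vertex to the potential. -/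
noncomputable def phiv (p N ξ D : ℝ) : ℝ :=
  -ξ ^ 2 / (2 * (p * (1 - p)) * N) - D * ξ ^ 2 / (2 * (p * (1 - p)) * N ^ 2) +
    (1 - 2 * p) * ξ ^ 3 / (6 * (p * (1 - p)) ^ 2 * N ^ 2) + D / (2 * N) -
    (1 - 2 * p) * ξ / (2 * (p * (1 - p)) * N)

/-- The potential whose increments approximate the logarithms of the revealing probabilities,
relative to those of independent edges. -/
noncomputable def Phi (d : Fin n → ℕ) (p : ℝ) (X F : SimpleGraph (Fin n)) : ℝ :=
  ∑ v, phiv p n (xi d p X F v) (deg X v) -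
    (∑ u, xi d p X F u * Sx d p X F u) / (2 * (p * (1 - p)) * n ^ 2) +
    Xi d p X F ^ 2 / (4 * (p * (1 - p)) * n ^ 2)

lemma sum_eqi_mul (a : Fin n) (f : Fin n → ℝ) : ∑ v, eqi v a * f v = f a := by simp [eqi]

section Diff

variable {X F F' : SimpleGraph (Fin n)} {a b : Fin n} {c : ℝ}

lemma Xi_rev (hξ : ∀ v, xi d p (rev X a b) F' v = xi d p X F v - c * (eqi v a + eqi v b)) :
    Xi d p (rev X a b) F' = Xi d p X F - 2 * c := by
  unfold Xi
  simp only [hξ]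
  rw [Finset.sum_sub_distrib, ← Finset.mul_sum, Finset.sum_add_distrib, sum_eqi', sum_eqi']
  ring

lemma Sx_rev (hab : a ≠ b) (hX : ¬ X.Adj a b)
    (hξ : ∀ v, xi d p (rev X a b) F' v = xi d p X F v - c * (eqi v a + eqi v b)) (u : Fin n) :
    Sx d p (rev X a b) F' u = Sx d p X F u - c * (ind X u a + ind X u b) +
      eqi u a * xi d p (rev X a b) F' b + eqi u b * xi d p (rev X a b) F' a := by
  have e1 : Sx d p (rev X a b) F' u = ∑ v, (ind X u v * xi d p X F v -
      c * (eqi v a * ind X u v + eqi v b * ind X u v) +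
      (eqi u a * (eqi v b * xi d p (rev X a b) F' v) +
        eqi u b * (eqi v a * xi d p (rev X a b) F' v))) := by
    unfold Sx
    refine Finset.sum_congr rfl fun v _ => ?_
    rw [ind_rev hab hX]
    have := hξ v
    linear_combination (ind X u v) * this
  rw [e1, Finset.sum_add_distrib, Finset.sum_sub_distrib, ← Finset.mul_sum,
    Finset.sum_add_distrib, Finset.sum_add_distrib, ← Finset.mul_sum, ← Finset.mul_sum]
  simp only [sum_eqi_mul]
  unfold Sx
  ring

lemma sum_xi_Sx_rev (hab : a ≠ b) (hX : ¬ X.Adj a b)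
    (hξ : ∀ v, xi d p (rev X a b) F' v = xi d p X F v - c * (eqi v a + eqi v b)) :
    ∑ u, xi d p (rev X a b) F' u * Sx d p (rev X a b) F' u =
      ∑ u, xi d p X F u * Sx d p X F u - 2 * c * (Sx d p X F a + Sx d p X F b) +
        2 * (xi d p X F a - c) * (xi d p X F b - c) := by
  have ha : xi d p (rev X a b) F' a = xi d p X F a - c := by
    rw [hξ]; simp [eqi, hab]
  have hb : xi d p (rev X a b) F' b = xi d p X F b - c := by
    rw [hξ]; simp [eqi, hab.symm]
  have iab : ind X a b = 0 := ind_of_not_adj hX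
  have e1 : ∀ u, xi d p (rev X a b) F' u * Sx d p (rev X a b) F' u =
      xi d p X F u * Sx d p X F u - c * (ind X a u * xi d p X F u + ind X b u * xi d p X F u)
      - c * (eqi u a * Sx d p X F u + eqi u b * Sx d p X F u)
      + c ^ 2 * (eqi u a * (ind X u a + ind X u b) + eqi u b * (ind X u a + ind X u b))
      + (eqi u a * (xi d p (rev X a b) F' u * xi d p (rev X a b) F' b) +
         eqi u b * (xi d p (rev X a b) F' u * xi d p (rev X a b) F' a)) := by
    intro u
    have h1 := Sx_rev hab hX hξ u
    rw [h1, ind_comm X a u, ind_comm X b u]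
    have h2 := hξ u
    linear_combination (Sx d p X F u - c * (ind X u a + ind X u b)) * h2
  simp only [e1]
  rw [Finset.sum_add_distrib, Finset.sum_add_distrib, Finset.sum_sub_distrib,
    Finset.sum_sub_distrib, ← Finset.mul_sum, ← Finset.mul_sum, ← Finset.mul_sum,
    Finset.sum_add_distrib, Finset.sum_add_distrib, Finset.sum_add_distrib, Finset.sum_add_distrib]
  simp only [sum_eqi_mul]
  rw [ha, hb, ind_comm X b a, iab, ind_self, ind_self]
  unfold Sx
  ring

lemma Phi_rev (hab : a ≠ b) (hX : ¬ X.Adj a b)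
    (hξ : ∀ v, xi d p (rev X a b) F' v = xi d p X F v - c * (eqi v a + eqi v b)) :
    Phi d p (rev X a b) F' - Phi d p X F =
      (phiv p n (xi d p X F a - c) (deg X a + 1) - phiv p n (xi d p X F a) (deg X a)) +
      (phiv p n (xi d p X F b - c) (deg X b + 1) - phiv p n (xi d p X F b) (deg X b)) -
      (2 * (xi d p X F a - c) * (xi d p X F b - c) - 2 * c * (Sx d p X F a + Sx d p X F b)) /
        (2 * (p * (1 - p)) * n ^ 2) +
      (4 * c ^ 2 - 4 * c * Xi d p X F) / (4 * (p * (1 - p)) * n ^ 2) := by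
  have e1 : ∀ v, phiv p n (xi d p (rev X a b) F' v) (deg (rev X a b) v) =
      phiv p n (xi d p X F v) (deg X v) +
      (eqi v a * (phiv p n (xi d p X F v - c) (deg X v + 1) - phiv p n (xi d p X F v) (deg X v)) +
       eqi v b *
        (phiv p n (xi d p X F v - c) (deg X v + 1) - phiv p n (xi d p X F v) (deg X v))) := by
    intro v
    rw [hξ, deg_rev hab hX]
    unfold eqi
    by_cases h : v = a
    · subst h; simp [hab]
    · by_cases h2 : v = b
      · subst h2; simp [h]
      · simp [h, h2]
  unfold Phi
  simp only [e1]
  rw [Finset.sum_add_distrib, Finset.sum_add_distrib, sum_xi_Sx_rev hab hX hξ, Xi_rev hξ]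
  simp only [sum_eqi_mul]
  ring

end Diff

/-- Increment of the vertex contribution. -/
lemma phiv_diff {p N ξ D c : ℝ} (hN : N ≠ 0) (hA : p * (1 - p) ≠ 0)
    (hc : c ^ 2 = p * (1 - p) + (1 - 2 * p) * c) :
    phiv p N (ξ - c) (D + 1) - phiv p N ξ D =
      c * (1 / (p * (1 - p))) * (ξ / N + ξ / N * (D / N)) - (ξ / N) ^ 2 * (1 / (p * (1 - p))) / 2 -
      (1 - 2 * p) * c * (1 / (p * (1 - p))) ^ 2 * (ξ / N) ^ 2 / 2 +
      (-((c ^ 2 * (D + 1) - 2 * c * ξ) * (1 / (p * (1 - p))) / (2 * N ^ 2)) +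
        (1 - 2 * p) * (3 * ξ * c ^ 2 - c ^ 3) * (1 / (p * (1 - p))) ^ 2 / (6 * N ^ 2)) := by
  unfold phiv
  generalize p * (1 - p) = A at *
  field_simp
  linear_combination (-6 * A * N) * hc

end

section

open SimpleGraph

variable {n : ℕ} {d : Fin n → ℕ} {p s L : ℝ}

section Diff

variable {X F F' : SimpleGraph (Fin n)} {a b : Fin n} {c : ℝ}

lemma Phi_rev_approx (hP : Par n d p s L) (hF : F ≤ X) (hD : Dom s L X 0) (hab : a ≠ b)
    (hX : ¬ X.Adj a b) (hc : c ^ 2 = p * (1 - p) + (1 - 2 * p) * c) (hc1 : |c| ≤ 1)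
    (hξ : ∀ v, xi d p (rev X a b) F' v = xi d p X F v - c * (eqi v a + eqi v b)) :
    |Phi d p (rev X a b) F' - Phi d p X F -
      (c * (1 / (p * (1 - p))) * (kap d p X F a + kap d p X F b - Xi d p X F / n ^ 2) -
        (xi d p X F a / n + xi d p X F b / n) ^ 2 * (1 / (p * (1 - p))) / 2 -
        (1 - 2 * p) * c * (1 / (p * (1 - p))) ^ 2 *
          ((xi d p X F a / n) ^ 2 + (xi d p X F b / n) ^ 2) / 2)| ≤ L ^ 7 / s ^ 3 := by
  have hs := hP.s_pos
  have hL := hP.L_pos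
  have hs1 : 1 ≤ s := by linarith [hP.s_ge]
  have hn := hP.n_ne
  have h0 : 0 ≤ 100 := by norm_num
  have hx := abs_xi_le hP hF hD h0
  have hLs : 1 ≤ L * s := one_le_mul_of_one_le_of_one_le hP.one_le_L hs1
  have hA : p * (1 - p) ≠ 0 := by
    have := hP.p_pos; have := hP.p_lt_one
    have h : 0 < 1 - p := by linarith
    positivity
  have hB : |1 / (p * (1 - p))| ≤ L ^ 2 := by
    rw [abs_of_nonneg hP.inv_mul_le.1]; exact hP.inv_mul_le.2
  have hp12 : |1 - 2 * p| ≤ 1 := by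
    rw [abs_le]; constructor <;> linarith [hP.p_pos, hP.p_lt_one]
  have hc2 : |c ^ 2| ≤ 1 := by rw [abs_pow]; exact pow_le_one₀ (abs_nonneg _) hc1
  have hc3 : |c ^ 3| ≤ 1 := by rw [abs_pow]; exact pow_le_one₀ (abs_nonneg _) hc1
  rw [Phi_rev hab hX hξ, phiv_diff hn hA hc, phiv_diff hn hA hc]
  set B := 1 / (p * (1 - p)) with hBd
  have e1 : ∀ y : ℝ, y / (2 * (p * (1 - p)) * n ^ 2) = y * B / (2 * n ^ 2) := by
    intro y; rw [hBd]; field_simp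
  have e2 : ∀ y : ℝ, y / (4 * (p * (1 - p)) * n ^ 2) = y * B / (4 * n ^ 2) := by
    intro y; rw [hBd]; field_simp
  rw [e1, e2]
  have hn2 : |(2 : ℝ) * n ^ 2| = 2 * s ^ 4 := by
    rw [abs_of_pos (by positivity), ← hP.sq]; ring
  have hn6 : |(6 : ℝ) * n ^ 2| = 6 * s ^ 4 := by
    rw [abs_of_pos (by positivity), ← hP.sq]; ring
  have b1 : ∀ v, |(c ^ 2 * (deg X v + 1) - 2 * c * xi d p X F v) * B / (2 * n ^ 2)| ≤
      4 * L ^ 3 / s ^ 3 := by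
    intro v
    rw [abs_div, hn2]
    have h1 : |(deg X v : ℝ) + 1| ≤ 2 * L * s := by
      rw [abs_of_nonneg (by positivity)]; exact hD.deg_le' hP h0 v
    have h2 : |2 * c| ≤ 2 * 1 := abs_mul_le_mul (abs_two).le hc1
    calc _ ≤ (1 * (2 * L * s) + 2 * 1 * (3 * (L * s))) * L ^ 2 / (2 * s ^ 4) := by
          gcongr
          exact abs_mul_le_mul (abs_sub_le_add (abs_mul_le_mul hc2 h1)
            (abs_mul_le_mul h2 (hx v))) hB
      _ = _ := by field_simp; norm_num
  have b2 : ∀ v, |(1 - 2 * p) * (3 * xi d p X F v * c ^ 2 - c ^ 3) * B ^ 2 / (6 * n ^ 2)| ≤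
      2 * L ^ 5 / s ^ 3 := by
    intro v
    rw [abs_div, hn6]
    have h2 : |3 * xi d p X F v| ≤ 3 * (3 * (L * s)) :=
      abs_mul_le_mul (by norm_num) (hx v)
    have h3 : |B ^ 2| ≤ (L ^ 2) ^ 2 := by rw [abs_pow]; exact pow_le_pow_left₀ (abs_nonneg _) hB 2
    calc _ ≤ (1 * (3 * (3 * (L * s)) * 1 + 1) * (L ^ 2) ^ 2) / (6 * s ^ 4) := by
          gcongr
          exact abs_mul_le_mul (abs_mul_le_mul hp12 (abs_sub_le_add (abs_mul_le_mul h2 hc2) hc3)) h3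
      _ ≤ (1 * (3 * (3 * (L * s)) * 1 + 3 * (L * s)) * (L ^ 2) ^ 2) / (6 * s ^ 4) := by
          gcongr; linarith
      _ = _ := by field_simp; norm_num
  have b3 : |c * (xi d p X F a + xi d p X F b) * B / n ^ 2| ≤ 6 * L ^ 3 / s ^ 3 := by
    rw [abs_div, abs_of_pos (by positivity : (0 : ℝ) < (n : ℝ) ^ 2), ← hP.sq]
    calc _ ≤ 1 * (3 * (L * s) + 3 * (L * s)) * L ^ 2 / (s ^ 2) ^ 2 := by
          gcongr
          exact abs_mul_le_mul (abs_mul_le_mul hc1 (abs_add_le_add (hx a) (hx b))) hB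
      _ = _ := by field_simp; norm_num
  have key := abs_add_le_add (abs_sub_le_add (abs_sub_le_add (abs_add_le_add (b2 a) (b2 b)) (b1 a))
    (b1 b)) b3
  refine (le_of_eq ?_).trans (key.trans ?_)
  · congr 1
    unfold kap
    field_simp
    ring
  · rw [← add_div, ← add_div, ← add_div, ← add_div]
    gcongr
    have h5 := hP.dom_pow 100 (by norm_num) (show 3 + 1 ≤ 5 by norm_num)
    have h6 := hP.dom_pow 100 (by norm_num) (show 5 + 1 ≤ 7 by norm_num)
    have : 0 < L ^ 5 := by positivity
    linarith

/-- The logarithm of a revealing probability, relative to the density. -/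
lemma log_prob_approx (hP : Par n d p s L) (hne : (Om d X F).Nonempty) (hD : Dom s L X 0)
    (hab : a ≠ b) (hX : ¬ X.Adj a b) (hc : c ^ 2 = p * (1 - p) + (1 - 2 * p) * c)
    (hc1 : |c| ≤ 1) :
    |Real.log (1 + c * (1 / (p * (1 - p))) * (pr d X F a b - p)) -
      (c * (1 / (p * (1 - p))) * (kap d p X F a + kap d p X F b - Xi d p X F / n ^ 2) -
        (xi d p X F a / n + xi d p X F b / n) ^ 2 * (1 / (p * (1 - p))) / 2 -
        (1 - 2 * p) * c * (1 / (p * (1 - p))) ^ 2 *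
          ((xi d p X F a / n) ^ 2 + (xi d p X F b / n) ^ 2) / 2)| ≤ L ^ 86 / s ^ 3 := by
  have hs := hP.s_pos
  have hL := hP.L_pos
  have hL1 := hP.one_le_L
  have hs1 : 1 ≤ s := by linarith [hP.s_ge]
  have hF := Om_nonempty_le hne
  have hn := hP.n_ne
  have h3 := abs_pr_sub_Q3_le hP hne hD hab hX
  have h2 := abs_pr_sub_second_le hP hne hD (by norm_num) hab hX
  have hA : p * (1 - p) ≠ 0 := by
    have := hP.p_pos; have := hP.p_lt_one
    have h : 0 < 1 - p := by linarith
    positivity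
  have hB : |1 / (p * (1 - p))| ≤ L ^ 2 := by
    rw [abs_of_nonneg hP.inv_mul_le.1]; exact hP.inv_mul_le.2
  unfold Q3 at h3
  have hBA : (1 / (p * (1 - p))) * (p * (1 - p)) = 1 := one_div_mul_cancel hA
  set B := 1 / (p * (1 - p)) with hBd
  have bva := abs_xi_div_le hP hF hD a
  have bvb := abs_xi_div_le hP hF hD b
  set va := xi d p X F a / n
  set vb := xi d p X F b / n
  set t := pr d X F a b - p with ht
  have bw : |va + vb| ≤ 6 * L / s := (abs_add_le_add bva bvb).trans_eq (by ring)
  have b2 : |t - (va + vb)| ≤ L ^ 49 / s ^ 2 := by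
    refine le_trans (le_of_eq ?_) h2
    congr 1; rw [ht]; ring
  have l1 : L ^ 49 / s ^ 2 ≤ 1 / s := by
    rw [div_le_div_iff₀ (by positivity) hs]
    nlinarith [hP.pow_le (k := 49) (by norm_num)]
  have bt : |t| ≤ 7 * L / s := by
    have e : t = (t - (va + vb)) + (va + vb) := by ring
    rw [e]
    refine (abs_add_le_add b2 bw).trans ?_
    have : 1 / s ≤ L / s := by gcongr
    have e2 : 7 * L / s = L / s + 6 * L / s := by ring
    linarith
  have hcB : |c * B| ≤ L ^ 2 := (abs_mul_le_mul hc1 hB).trans_eq (by ring)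
  have by1 : |c * B * t| ≤ 7 * L ^ 3 / s := (abs_mul_le_mul hcB bt).trans_eq (by ring)
  have by2 : |c * B * t| ≤ 1 / 2 := by
    refine by1.trans ?_
    rw [div_le_div_iff₀ hs (by norm_num)]
    have h5 := hP.dom_pow 14 (by norm_num) (show 3 + 1 ≤ 4 by norm_num)
    have := hP.pow_le (k := 4) (by norm_num)
    linarith
  have g1 := abs_log_one_add_sub_le by2
  have g1' : 2 * |c * B * t| ^ 3 ≤ 2 * (7 * L ^ 3 / s) ^ 3 := by gcongr
  have g2 := abs_mul_le_mul hcB h3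
  have b5 : |t + (va + vb)| ≤ 13 * L / s := (abs_add_le_add bt bw).trans_eq (by ring)
  have g3 : |(c * B) ^ 2 * ((t - (va + vb)) * (t + (va + vb))) / 2| ≤
      (L ^ 2) ^ 2 * ((L ^ 49 / s ^ 2) * (13 * L / s)) / 2 := by
    rw [abs_div, abs_two]
    gcongr
    refine abs_mul_le_mul ?_ (abs_mul_le_mul b2 b5)
    rw [abs_pow]; exact pow_le_pow_left₀ (abs_nonneg _) hcB 2
  have key := abs_sub_le_add (abs_add_le_add (g1.trans g1') g2) g3
  refine (le_of_eq ?_).trans (key.trans ?_)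
  · congr 1
    have hc' : c ^ 2 * B ^ 2 = B + (1 - 2 * p) * c * B ^ 2 := by
      rw [hc]; linear_combination B * hBA
    rw [ht]
    linear_combination (-(va + vb) ^ 2 / 2) * hc'
  · have e : 2 * (7 * L ^ 3 / s) ^ 3 + L ^ 2 * (L ^ 82 / s ^ 3) +
        (L ^ 2) ^ 2 * ((L ^ 49 / s ^ 2) * (13 * L / s)) / 2 =
        (686 * L ^ 9 + L ^ 84 + 13 / 2 * L ^ 54) / s ^ 3 := by
      field_simp; ring
    rw [e]
    gcongr
    have h5 := hP.dom_pow 686 (by norm_num) (show 9 + 1 ≤ 84 by norm_num)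
    have h6 := hP.dom_pow (13 / 2) (by norm_num) (show 54 + 1 ≤ 84 by norm_num)
    have h7 := hP.dom_pow 3 (by norm_num) (show 84 + 1 ≤ 86 by norm_num)
    linarith

/-- The logarithmic weight of the status pattern `(X, F)` in the binomial random graph with
density `p`, tilted by the potential. -/
noncomputable def pot (d : Fin n → ℕ) (p : ℝ) (X F : SimpleGraph (Fin n)) : ℝ :=
  Phi d p X F + (∑ v, (deg F v * Real.log p + (deg X v - deg F v) * Real.log (1 - p))) / 2

lemma log_pr_present (hP : Par n d p s L) (hne : (Om d X F).Nonempty) (hD : Dom s L X 0)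
    (hab : a ≠ b) (hX : ¬ X.Adj a b) (hpr : 0 < pr d X F a b) :
    |Real.log (pr d X F a b) - (pot d p (rev X a b) (rev F a b) - pot d p X F)| ≤
      L ^ 87 / s ^ 3 := by
  have hs := hP.s_pos
  have hL := hP.L_pos
  have hF := Om_nonempty_le hne
  have hp := hP.p_pos
  have hp1 : 0 < 1 - p := by linarith [hP.p_lt_one]
  have hc : (1 - p) ^ 2 = p * (1 - p) + (1 - 2 * p) * (1 - p) := by ring
  have hc1 : |1 - p| ≤ 1 := by rw [abs_of_pos hp1]; linarith
  have h1 := Phi_rev_approx hP hF hD hab hX hc hc1 (xi_present hF hab hX)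
  have h2 := log_prob_approx hP hne hD hab hX hc hc1
  have h3 := abs_sub_le_add h2 h1
  have e1 : 1 + (1 - p) * (1 / (p * (1 - p))) * (pr d X F a b - p) = pr d X F a b / p := by
    field_simp; ring
  rw [e1, Real.log_div hpr.ne' hp.ne'] at h3
  have e2 : (∑ v, (deg (rev F a b) v * Real.log p +
      (deg (rev X a b) v - deg (rev F a b) v) * Real.log (1 - p)) : ℝ) =
      (∑ v, (deg F v * Real.log p + (deg X v - deg F v) * Real.log (1 - p))) +
        2 * Real.log p := by
    simp only [deg_rev hab hX, deg_rev hab fun h => hX (hF h)]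
    have : ∀ v, ((deg F v + (eqi v a + eqi v b)) * Real.log p + ((deg X v + (eqi v a + eqi v b)) -
      (deg F v + (eqi v a + eqi v b))) * Real.log (1 - p) : ℝ) =
      (deg F v * Real.log p + (deg X v - deg F v) * Real.log (1 - p)) +
      (eqi v a * Real.log p + eqi v b * Real.log p) := fun v => by ring
    simp only [this]
    rw [Finset.sum_add_distrib, add_right_inj, Finset.sum_add_distrib, sum_eqi_mul, sum_eqi_mul]
    ring
  unfold pot
  rw [e2]
  refine (le_of_eq ?_).trans (h3.trans ?_)
  · congr 1; ring
  · rw [← add_div]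
    gcongr
    have h5 := hP.dom_pow 1 (by norm_num) (show 7 + 1 ≤ 86 by norm_num)
    have h7 := hP.dom_pow 2 (by norm_num) (show 86 + 1 ≤ 87 by norm_num)
    linarith

lemma log_pr_absent (hP : Par n d p s L) (hne : (Om d X F).Nonempty) (hD : Dom s L X 0)
    (hab : a ≠ b) (hX : ¬ X.Adj a b) (hpr : 0 < 1 - pr d X F a b) :
    |Real.log (1 - pr d X F a b) - (pot d p (rev X a b) F - pot d p X F)| ≤
      L ^ 87 / s ^ 3 := by
  have hs := hP.s_pos
  have hL := hP.L_pos
  have hF := Om_nonempty_le hne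
  have hp := hP.p_pos
  have hp1 : 0 < 1 - p := by linarith [hP.p_lt_one]
  have hc : (0 - p) ^ 2 = p * (1 - p) + (1 - 2 * p) * (0 - p) := by ring
  have hc1 : |0 - p| ≤ 1 := by rw [zero_sub, abs_neg, abs_of_pos hp]; linarith
  have h1 := Phi_rev_approx hP hF hD hab hX hc hc1 (xi_absent X F hab hX)
  have h2 := log_prob_approx hP hne hD hab hX hc hc1
  have h3 := abs_sub_le_add h2 h1
  have e1 : 1 + (0 - p) * (1 / (p * (1 - p))) * (pr d X F a b - p) =
      (1 - pr d X F a b) / (1 - p) := by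
    field_simp; ring
  rw [e1, Real.log_div hpr.ne' hp1.ne'] at h3
  have e2 : (∑ v, (deg F v * Real.log p +
      (deg (rev X a b) v - deg F v) * Real.log (1 - p)) : ℝ) =
      (∑ v, (deg F v * Real.log p + (deg X v - deg F v) * Real.log (1 - p))) +
        2 * Real.log (1 - p) := by
    simp only [deg_rev hab hX]
    have : ∀ v, (deg F v * Real.log p + ((deg X v + (eqi v a + eqi v b)) -
      deg F v) * Real.log (1 - p) : ℝ) =
      (deg F v * Real.log p + (deg X v - deg F v) * Real.log (1 - p)) +
      (eqi v a * Real.log (1 - p) + eqi v b * Real.log (1 - p)) := fun v => by ring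
    simp only [this]
    rw [Finset.sum_add_distrib, add_right_inj, Finset.sum_add_distrib, sum_eqi_mul, sum_eqi_mul]
    ring
  unfold pot
  rw [e2]
  refine (le_of_eq ?_).trans (h3.trans ?_)
  · congr 1; ring
  · rw [← add_div]
    gcongr
    have h5 := hP.dom_pow 1 (by norm_num) (show 7 + 1 ≤ 86 by norm_num)
    have h7 := hP.dom_pow 2 (by norm_num) (show 86 + 1 ≤ 87 by norm_num)
    linarith

end Diff

end

section

open SimpleGraph

variable {n : ℕ} {d : Fin n → ℕ} {p s L : ℝ}

lemma exists_rev_eq {X : SimpleGraph (Fin n)} {a b : Fin n} (h : X.Adj a b) :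
    ∃ X₀ : SimpleGraph (Fin n), ¬ X₀.Adj a b ∧ rev X₀ a b = X := by
  have hab := h.ne
  refine ⟨X.deleteEdges {s(a, b)}, by simp, ?_⟩
  ext u v
  rw [rev_adj hab]
  simp only [deleteEdges_adj, Set.mem_singleton_iff, Sym2.eq_iff]
  constructor
  · rintro (h1 | ⟨rfl, rfl⟩ | ⟨rfl, rfl⟩)
    exacts [h1.1, h, h.symm]
  · intro h1
    by_cases h2 : u = a ∧ v = b ∨ u = b ∧ v = a
    · exact Or.inr h2
    · exact Or.inl ⟨h1, h2⟩

lemma le_of_le_rev {X F : SimpleGraph (Fin n)} {a b : Fin n} (hab : a ≠ b)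
    (h : F ≤ rev X a b) (hF : ¬ F.Adj a b) : F ≤ X := by
  intro u v huv
  rcases (rev_adj hab).1 (h huv) with h1 | ⟨rfl, rfl⟩ | ⟨rfl, rfl⟩
  exacts [h1, (hF huv).elim, (hF huv.symm).elim]

lemma le_rev (X : SimpleGraph (Fin n)) (a b : Fin n) : X ≤ rev X a b := le_sup_left

lemma Dom.of_le {X X₀ : SimpleGraph (Fin n)} {j : ℕ} (h : Dom s L X j) (hX : X₀ ≤ X) :
    Dom s L X₀ j := by
  have h1 : ∀ v, (deg X₀ v : ℝ) ≤ deg X v := fun v => by exact_mod_cast deg_mono hX v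
  exact ⟨fun v => (h1 v).trans (h.max v), (Finset.sum_le_sum fun v _ => h1 v).trans h.tot⟩

lemma Om_bot (d : Fin n → ℕ) : Om d ⊥ ⊥ = degFinset n d := by
  ext G; simp [mem_Om, mem_degFinset]

/-- The number of graphs with prescribed statuses on the edges of `X`, up to third order. -/
lemma log_card_Om (hP : Par n d p s L) (hne : (degFinset n d).Nonempty) (m : ℕ) :
    ∀ X F : SimpleGraph (Fin n), F ≤ X → Dom s L X 0 → ∑ v, (deg X v : ℝ) ≤ 2 * m →
      (Om d X F).Nonempty ∧
      |Real.log (Om d X F).card - Real.log (degFinset n d).card - (pot d p X F - pot d p ⊥ ⊥)| ≤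
        m * (L ^ 87 / s ^ 3) := by
  induction m with
  | zero =>
    intro X F hF hD hm
    have hX : X = ⊥ := by
      ext u v
      simp only [bot_adj, iff_false]
      intro h
      have h1 : ∑ v, (deg X v : ℝ) = 0 :=
        le_antisymm (by simpa using hm) (Finset.sum_nonneg fun v _ => Nat.cast_nonneg _)
      rw [Finset.sum_eq_zero_iff_of_nonneg fun v _ => Nat.cast_nonneg _] at h1
      have h2 := h1 u (Finset.mem_univ _)
      rw [deg_eq_sum, Finset.sum_eq_zero_iff_of_nonneg fun v _ => ind_nonneg _ _ _] at h2
      have h3 := h2 v (Finset.mem_univ _)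
      rw [ind_of_adj h] at h3
      exact one_ne_zero h3
    subst hX
    obtain rfl : F = ⊥ := le_bot_iff.1 hF
    rw [Om_bot]
    exact ⟨hne, by simp⟩
  | succ m ih =>
    intro X F hF hD hm
    have hpos : 0 ≤ L ^ 87 / s ^ 3 := by
      have := hP.s_pos; have := hP.L_pos; positivity
    by_cases hX : ∃ a b, X.Adj a b
    · obtain ⟨a, b, hadj⟩ := hX
      have hab := hadj.ne
      obtain ⟨X₀, hX₀, rfl⟩ := exists_rev_eq hadj
      have hD₀ := hD.of_le (le_rev X₀ a b)
      have hm₀ : ∑ v, (deg X₀ v : ℝ) ≤ 2 * m := by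
        simp only [deg_rev hab hX₀] at hm
        rw [Finset.sum_add_distrib, Finset.sum_add_distrib, sum_eqi', sum_eqi'] at hm
        push_cast at hm
        linarith
      have hj : ((0 : ℕ) : ℝ) + 1 ≤ L * s := by
        have := one_le_mul_of_one_le_of_one_le hP.one_le_L
          (show 1 ≤ s by linarith [hP.s_ge])
        push_cast; linarith
      have main : ∀ F₀ F₁ : SimpleGraph (Fin n), ∀ P : ℝ, (Om d X₀ F₀).Nonempty →
          |Real.log (Om d X₀ F₀).card - Real.log (degFinset n d).card -
            (pot d p X₀ F₀ - pot d p ⊥ ⊥)| ≤ m * (L ^ 87 / s ^ 3) →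
          (Om d (rev X₀ a b) F₁).Nonempty → P = (Om d (rev X₀ a b) F₁).card / (Om d X₀ F₀).card →
          |Real.log P - (pot d p (rev X₀ a b) F₁ - pot d p X₀ F₀)| ≤ L ^ 87 / s ^ 3 →
          |Real.log (Om d (rev X₀ a b) F₁).card - Real.log (degFinset n d).card -
            (pot d p (rev X₀ a b) F₁ - pot d p ⊥ ⊥)| ≤ ((m + 1 : ℕ) : ℝ) * (L ^ 87 / s ^ 3) := by
        intro F₀ F₁ P h1 h2 h3 h4 h5
        have c1 : ((Om d X₀ F₀).card : ℝ) ≠ 0 := by exact_mod_cast h1.card_pos.ne'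
        have c2 : ((Om d (rev X₀ a b) F₁).card : ℝ) ≠ 0 := by exact_mod_cast h3.card_pos.ne'
        rw [h4, Real.log_div c2 c1] at h5
        refine (le_of_eq ?_).trans ((abs_add_le_add h5 h2).trans_eq ?_)
        · congr 1; ring
        · push_cast; ring
      by_cases hFab : F.Adj a b
      · obtain ⟨F₀, hF₀, rfl⟩ := exists_rev_eq hFab
        have hle : F₀ ≤ X₀ := le_of_le_rev hab ((le_rev F₀ a b).trans hF) hF₀
        obtain ⟨i1, i2⟩ := ih X₀ F₀ hle hD₀ hm₀
        have hne' := (children_nonempty hP i1 hD₀ hj hab hX₀).1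
        have hpr : pr d X₀ F₀ a b =
            (Om d (rev X₀ a b) (rev F₀ a b)).card / (Om d X₀ F₀).card := by
          rw [pr_eq, Om_present hab hX₀ hle]
        refine ⟨hne', main F₀ _ _ i1 i2 hne' hpr (log_pr_present hP i1 hD₀ hab hX₀ ?_)⟩
        have := i1.card_pos
        have := hne'.card_pos
        rw [hpr]; positivity
      · have hle : F ≤ X₀ := le_of_le_rev hab hF hFab
        obtain ⟨i1, i2⟩ := ih X₀ F hle hD₀ hm₀
        have hne' := (children_nonempty hP i1 hD₀ hj hab hX₀).2
        have c1 : ((Om d X₀ F).card : ℝ) ≠ 0 := by exact_mod_cast i1.card_pos.ne'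
        have hpr : 1 - pr d X₀ F a b =
            (Om d (rev X₀ a b) F).card / (Om d X₀ F).card := by
          rw [pr_eq, Om_absent hab hX₀ hle, eq_div_iff c1, sub_mul, div_mul_cancel₀ _ c1, one_mul,
            ← card_filter_add X₀ F a b]
          ring
        refine ⟨hne', main F _ _ i1 i2 hne' hpr (log_pr_absent hP i1 hD₀ hab hX₀ ?_)⟩
        have := i1.card_pos
        have := hne'.card_pos
        rw [hpr]; positivity
    · have hX0 : ∀ v, deg X v = 0 := by
        intro v
        unfold deg
        rw [Finset.card_eq_zero, Finset.filter_eq_empty_iff]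
        exact fun w _ h => hX ⟨v, w, h⟩
      obtain ⟨i1, i2⟩ := ih X F hF hD (by simp [hX0])
      refine ⟨i1, i2.trans ?_⟩
      exact mul_le_mul_of_nonneg_right (by push_cast; linarith) hpos

end

section

open SimpleGraph

variable {n r : ℕ} {d : Fin n → ℕ} {p s L : ℝ}

/-- Deviation of the degree of `v` from the average. -/
noncomputable def dev (d : Fin n → ℕ) (p : ℝ) (v : Fin n) : ℝ := d v - p * (n - 1)

/-- Deviation of the degree in `H` from its expectation at density `p`. -/
noncomputable def hdev (p : ℝ) (H : SimpleGraph (Fin r)) (j : Fin r) : ℝ :=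
  deg H j - p * (r - 1)

lemma ind_map (H : SimpleGraph (Fin r)) (φ : Fin r ↪ Fin n) (i j : Fin r) :
    ind (H.map φ) (φ i) (φ j) = ind H i j := by
  unfold ind; rw [map_adj_apply]

lemma ind_map_of_notMem (H : SimpleGraph (Fin r)) (φ : Fin r ↪ Fin n) {u : Fin n} (v : Fin n)
    (hu : u ∉ Set.range φ) : ind (H.map φ) u v = 0 := by
  refine ind_of_not_adj fun h => ?_
  obtain ⟨i, j, -, rfl, -⟩ := (map_adj _ _ _ _).1 h
  exact hu ⟨i, rfl⟩

lemma sum_map_ind (H : SimpleGraph (Fin r)) (φ : Fin r ↪ Fin n) (i : Fin r) (f : Fin n → ℝ) :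
    ∑ v, ind (H.map φ) (φ i) v * f v = ∑ j, ind H i j * f (φ j) := by
  symm
  refine Fintype.sum_of_injective φ φ.injective _ _ (fun v hv => ?_) fun j => ?_
  · rw [ind_comm, ind_map_of_notMem _ _ _ hv, zero_mul]
  · rw [ind_map]

lemma deg_map (H : SimpleGraph (Fin r)) (φ : Fin r ↪ Fin n) (i : Fin r) :
    (deg (H.map φ) (φ i) : ℝ) = deg H i := by
  rw [deg_eq_sum, deg_eq_sum]
  simpa using sum_map_ind H φ i (fun _ => 1)

lemma deg_map_of_notMem (H : SimpleGraph (Fin r)) (φ : Fin r ↪ Fin n) {u : Fin n}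
    (hu : u ∉ Set.range φ) : (deg (H.map φ) u : ℝ) = 0 := by
  rw [deg_eq_sum]
  exact Finset.sum_eq_zero fun v _ => ind_map_of_notMem H φ v hu

lemma ind_top (i j : Fin r) : ind (⊤ : SimpleGraph (Fin r)) i j = 1 - eqi j i := by
  unfold ind eqi
  by_cases h : i = j
  · subst h; simp
  · simp [h, Ne.symm h]

lemma deg_top (i : Fin r) : (deg (⊤ : SimpleGraph (Fin r)) i : ℝ) = r - 1 := by
  rw [deg_eq_sum]
  simp only [ind_top]
  rw [Finset.sum_sub_distrib, sum_eqi']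
  simp

lemma mem_Om_map {H : SimpleGraph (Fin r)} {φ : Fin r ↪ Fin n} {G : SimpleGraph (Fin n)} :
    G ∈ Om d ((⊤ : SimpleGraph (Fin r)).map φ) (H.map φ) ↔
      G ∈ degFinset n d ∧ ∀ i j, G.Adj (φ i) (φ j) ↔ H.Adj i j := by
  rw [mem_Om, mem_degFinset]
  refine and_congr_right fun _ => ?_
  constructor
  · intro h i j
    have h1 : (G ⊓ (⊤ : SimpleGraph (Fin r)).map φ).Adj (φ i) (φ j) ↔
        (H.map φ).Adj (φ i) (φ j) := by
      rw [h]
    rw [inf_adj, map_adj_apply, map_adj_apply, top_adj] at h1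
    rw [← h1]
    exact ⟨fun h2 => ⟨h2, fun h3 => h2.ne (by rw [h3])⟩, fun h2 => h2.1⟩
  · intro h
    ext u v
    rw [inf_adj, map_adj, map_adj]
    constructor
    · rintro ⟨h1, i, j, -, rfl, rfl⟩
      exact ⟨i, j, (h i j).1 h1, rfl, rfl⟩
    · rintro ⟨i, j, h1, rfl, rfl⟩
      exact ⟨(h i j).2 h1, i, j, h1.ne, rfl, rfl⟩

section Embedding

variable (H : SimpleGraph (Fin r)) (φ : Fin r ↪ Fin n)

lemma sum_deg_map : ∑ v, (deg (H.map φ) v : ℝ) = ∑ i, (deg H i : ℝ) := by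
  symm
  exact Fintype.sum_of_injective φ φ.injective _ _ (fun v hv => deg_map_of_notMem H φ hv)
    fun j => (deg_map H φ j).symm

lemma dom_map (hL : 0 < L) (hs : 0 < s) (hr : (r : ℝ) ≤ L * s) :
    Dom s L ((⊤ : SimpleGraph (Fin r)).map φ) 0 := by
  constructor
  · intro v
    by_cases hv : v ∈ Set.range φ
    · obtain ⟨i, rfl⟩ := hv
      rw [deg_map, deg_top]; push_cast; linarith
    · rw [deg_map_of_notMem _ _ hv]; push_cast; have := mul_pos hL hs; linarith
  · rw [sum_deg_map]
    simp only [deg_top]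
    rw [Finset.sum_const, Finset.card_univ, Fintype.card_fin, nsmul_eq_mul]
    have h0 : (0 : ℝ) ≤ r := by positivity
    push_cast
    nlinarith [mul_le_mul hr hr h0 (by positivity)]

lemma xi_map (j : Fin r) : xi d p ((⊤ : SimpleGraph (Fin r)).map φ) (H.map φ) (φ j) =
    dev d p (φ j) - hdev p H j := by
  unfold xi res dev hdev
  rw [deg_map, deg_map, deg_top]; ring

lemma xi_map_of_notMem {v : Fin n} (hv : v ∉ Set.range φ) :
    xi d p ((⊤ : SimpleGraph (Fin r)).map φ) (H.map φ) v = dev d p v := by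
  unfold xi res dev
  rw [deg_map_of_notMem _ _ hv, deg_map_of_notMem _ _ hv]; ring

lemma deg_bot (v : Fin n) : deg (⊥ : SimpleGraph (Fin n)) v = 0 := by simp [deg]

lemma xi_bot (v : Fin n) : xi d p ⊥ ⊥ v = dev d p v := by
  unfold xi res dev; simp [deg_bot]

lemma sum_xi_Sx_map : ∑ u, xi d p ((⊤ : SimpleGraph (Fin r)).map φ) (H.map φ) u *
      Sx d p ((⊤ : SimpleGraph (Fin r)).map φ) (H.map φ) u =
    (∑ j, (dev d p (φ j) - hdev p H j)) ^ 2 - ∑ j, (dev d p (φ j) - hdev p H j) ^ 2 := by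
  have h1 : ∀ i, Sx d p ((⊤ : SimpleGraph (Fin r)).map φ) (H.map φ) (φ i) =
      ∑ j, (dev d p (φ j) - hdev p H j) - (dev d p (φ i) - hdev p H i) := by
    intro i
    unfold Sx
    rw [sum_map_ind]
    simp only [ind_top, xi_map, sub_mul (1 : ℝ), one_mul]
    rw [Finset.sum_sub_distrib, sum_eqi_mul]
  have h2 : ∑ i, (dev d p (φ i) - hdev p H i) *
      (∑ j, (dev d p (φ j) - hdev p H j) - (dev d p (φ i) - hdev p H i)) =
      ∑ u, xi d p ((⊤ : SimpleGraph (Fin r)).map φ) (H.map φ) u *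
      Sx d p ((⊤ : SimpleGraph (Fin r)).map φ) (H.map φ) u := by
    refine Fintype.sum_of_injective φ φ.injective _ _ (fun v hv => ?_) fun j => ?_
    · unfold Sx
      rw [Finset.sum_eq_zero fun w _ => by rw [ind_map_of_notMem _ _ _ hv, zero_mul], mul_zero]
    · rw [h1, xi_map]
  rw [← h2]
  simp only [mul_sub]
  rw [Finset.sum_sub_distrib, ← Finset.sum_mul, pow_two]
  congr 1
  exact Finset.sum_congr rfl fun i _ => by ring

lemma Phi_map_sub (hP : Par n d p s L) :
    Phi d p ((⊤ : SimpleGraph (Fin r)).map φ) (H.map φ) - Phi d p ⊥ ⊥ =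
      ∑ j, (phiv p n (dev d p (φ j) - hdev p H j) (r - 1) - phiv p n (dev d p (φ j)) 0) -
      ((∑ j, (dev d p (φ j) - hdev p H j)) ^ 2 - ∑ j, (dev d p (φ j) - hdev p H j) ^ 2) /
        (2 * (p * (1 - p)) * n ^ 2) +
      (∑ j, hdev p H j) ^ 2 / (4 * (p * (1 - p)) * n ^ 2) := by
  have hΞ : Xi d p ((⊤ : SimpleGraph (Fin r)).map φ) (H.map φ) = -∑ j, hdev p H j := by
    rw [Xi_eq hP, Finset.sum_sub_distrib, ← Finset.mul_sum, sum_deg_map, sum_deg_map,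
      Finset.mul_sum, ← Finset.sum_sub_distrib, ← Finset.sum_neg_distrib]
    refine Finset.sum_congr rfl fun j _ => ?_
    rw [deg_top]; unfold hdev; ring
  have hΞ0 : Xi d p (⊥ : SimpleGraph (Fin n)) ⊥ = 0 := by
    rw [Xi_eq hP]; simp [deg_bot]
  have hS0 : ∑ u, xi d p (⊥ : SimpleGraph (Fin n)) ⊥ u * Sx d p ⊥ ⊥ u = 0 := by
    refine Finset.sum_eq_zero fun u _ => ?_
    unfold Sx; simp [ind]
  have h1 : ∑ j, (phiv p n (dev d p (φ j) - hdev p H j) (r - 1) - phiv p n (dev d p (φ j)) 0) =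
      ∑ v, (phiv p n (xi d p ((⊤ : SimpleGraph (Fin r)).map φ) (H.map φ) v)
        (deg ((⊤ : SimpleGraph (Fin r)).map φ) v) -
        phiv p n (xi d p ⊥ ⊥ v) (deg (⊥ : SimpleGraph (Fin n)) v)) := by
    refine Fintype.sum_of_injective φ φ.injective _ _ (fun v hv => ?_) fun j => ?_
    · rw [xi_map_of_notMem _ _ hv, xi_bot, deg_map_of_notMem _ _ hv, deg_bot]; simp
    · rw [xi_map, xi_bot, deg_map, deg_top, deg_bot]; simp
  rw [h1, Finset.sum_sub_distrib]
  unfold Phi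
  rw [hΞ, hΞ0, hS0, sum_xi_Sx_map]
  ring

lemma pot_map_sub {m : ℕ} (hm : ∑ j, deg H j = 2 * m) :
    pot d p ((⊤ : SimpleGraph (Fin r)).map φ) (H.map φ) - pot d p ⊥ ⊥ =
      (Phi d p ((⊤ : SimpleGraph (Fin r)).map φ) (H.map φ) - Phi d p ⊥ ⊥) +
      (m * Real.log p + ((r.choose 2 : ℕ) - m) * Real.log (1 - p)) := by
  have h1 : ∑ v, ((deg (H.map φ) v : ℝ) * Real.log p +
      (deg ((⊤ : SimpleGraph (Fin r)).map φ) v - deg (H.map φ) v) * Real.log (1 - p)) =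
      2 * (m * Real.log p + ((r.choose 2 : ℕ) - m) * Real.log (1 - p)) := by
    have hm' : ∑ j, (deg H j : ℝ) = 2 * m := by exact_mod_cast hm
    rw [Finset.sum_add_distrib, ← Finset.sum_mul, ← Finset.sum_mul, Finset.sum_sub_distrib,
      sum_deg_map, sum_deg_map, hm']
    simp only [deg_top]
    rw [Finset.sum_const, Finset.card_univ, Fintype.card_fin, nsmul_eq_mul, Nat.cast_choose_two]
    ring
  unfold pot
  rw [h1]
  simp [deg_bot]
  ring

end Embedding

end

section

open SimpleGraph

variable {n r : ℕ} {d : Fin n → ℕ} {p s L : ℝ}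

/-- Linear coefficient, in the deviation of the image vertex, of the logarithm of the
probability of an embedding. -/
noncomputable def linc (p N R ω y : ℝ) : ℝ :=
  y * (1 + R / N) / (p * (1 - p) * N) + ω / (p * (1 - p) * N ^ 2) +
    (1 - 2 * p) * y ^ 2 / (2 * (p * (1 - p)) ^ 2 * N ^ 2)

/-- Quadratic coefficient, in the deviation of the image vertex, of the logarithm of the
probability of an embedding. -/
noncomputable def quadc (p N R y : ℝ) : ℝ :=
  -R / (2 * (p * (1 - p)) * N ^ 2) - (1 - 2 * p) * y / (2 * (p * (1 - p)) ^ 2 * N ^ 2)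

/-- The part of the logarithm of the probability of an embedding not depending on the
embedding. -/
noncomputable def basec (p N : ℝ) (y : Fin r → ℝ) : ℝ :=
  -(∑ j, y j ^ 2) / (2 * (p * (1 - p)) * N) - r * (∑ j, y j ^ 2) / (2 * (p * (1 - p)) * N ^ 2) -
    (1 - 2 * p) * (∑ j, y j ^ 3) / (6 * (p * (1 - p)) ^ 2 * N ^ 2) + r ^ 2 / (2 * N) +
    (1 - 2 * p) * (∑ j, y j) / (2 * (p * (1 - p)) * N) -
    (∑ j, y j) ^ 2 / (4 * (p * (1 - p)) * N ^ 2)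

lemma phiv_sub_eq {N R x y : ℝ} (hN : N ≠ 0) (hp : p ≠ 0) (hq : 1 - p ≠ 0) :
    phiv p N (x - y) (R - 1) - phiv p N x 0 =
      (linc p N R 0 y * x + quadc p N R y * x ^ 2) - y ^ 2 / (2 * (p * (1 - p)) * N) -
      R * y ^ 2 / (2 * (p * (1 - p)) * N ^ 2) -
      (1 - 2 * p) * y ^ 3 / (6 * (p * (1 - p)) ^ 2 * N ^ 2) + (R - 1) / (2 * N) +
      (1 - 2 * p) * y / (2 * (p * (1 - p)) * N) + (x - y) ^ 2 / (2 * (p * (1 - p)) * N ^ 2) := by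
  unfold phiv linc quadc
  field_simp
  ring

lemma sum_phiv_sub_eq {N : ℝ} (x y : Fin r → ℝ) (hN : N ≠ 0) (hp : p ≠ 0) (hq : 1 - p ≠ 0) :
    ∑ j, (phiv p N (x j - y j) (r - 1) - phiv p N (x j) 0) -
      ((∑ j, (x j - y j)) ^ 2 - ∑ j, (x j - y j) ^ 2) / (2 * (p * (1 - p)) * N ^ 2) +
      (∑ j, y j) ^ 2 / (4 * (p * (1 - p)) * N ^ 2) -
    (basec p N y + ∑ j, (linc p N r (∑ i, y i) (y j) * x j + quadc p N r (y j) * x j ^ 2) -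
      (∑ j, x j) ^ 2 / (2 * (p * (1 - p)) * N ^ 2)) =
    (∑ j, (x j - y j) ^ 2) / (p * (1 - p) * N ^ 2) - r / (2 * N) := by
  have h1 : ∀ j, linc p N r (∑ i, y i) (y j) * x j + quadc p N r (y j) * x j ^ 2 =
      (linc p N r 0 (y j) * x j + quadc p N r (y j) * x j ^ 2) +
        (∑ i, y i) / (p * (1 - p) * N ^ 2) * x j := by
    intro j; unfold linc; ring
  simp only [phiv_sub_eq hN hp hq, h1]
  rw [Finset.sum_add_distrib (f := fun j => linc p N r 0 (y j) * x j + quadc p N r (y j) * x j ^ 2),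
    ← Finset.mul_sum (s := Finset.univ) (f := x)]
  rw [Finset.sum_add_distrib, Finset.sum_add_distrib, Finset.sum_add_distrib,
    Finset.sum_sub_distrib, Finset.sum_sub_distrib, Finset.sum_sub_distrib,
    Finset.sum_sub_distrib]
  simp only [mul_div_assoc]
  simp only [div_eq_mul_inv, ← Finset.sum_mul, ← Finset.mul_sum]
  rw [Finset.sum_const, Finset.card_univ, Fintype.card_fin, nsmul_eq_mul]
  unfold basec
  field_simp
  ring

lemma abs_dev_le (hP : Par n d p s L) (v : Fin n) : |dev d p v| ≤ L * s := hP.hx v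

lemma abs_hdev_le (hP : Par n d p s L) (H : SimpleGraph (Fin r)) (j : Fin r) :
    |hdev p H j| ≤ r := by
  have hr : (1 : ℝ) ≤ r := by exact_mod_cast Fin.pos j
  have h1 : (deg H j : ℝ) ≤ r - 1 := by
    rw [← deg_top j]
    unfold deg
    exact_mod_cast Finset.card_le_card fun v hv => by
      simp only [Finset.mem_filter, Finset.mem_univ, true_and, top_adj] at hv ⊢
      exact hv.ne
  have h0 : (0 : ℝ) ≤ deg H j := by positivity
  unfold hdev
  have h2 : p * (r - 1) ≤ r - 1 := mul_le_of_le_one_left (by linarith) hP.p_lt_one.le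
  have h3 : 0 ≤ p * (r - 1) := mul_nonneg hP.p_pos.le (by linarith)
  rw [abs_le]; constructor <;> linarith

lemma one_sub_p_ne (hP : Par n d p s L) : 1 - p ≠ 0 := by linarith [hP.p_lt_one]

/-- Asymptotics of the number of graphs in which the image of an embedding induces `H`. -/
lemma log_card_Om_map (hP : Par n d p s L) (hne : (degFinset n d).Nonempty)
    (hr : (r : ℝ) ≤ L * s) (H : SimpleGraph (Fin r)) (φ : Fin r ↪ Fin n) {m : ℕ}
    (hm : ∑ j, deg H j = 2 * m) :
    (Om d ((⊤ : SimpleGraph (Fin r)).map φ) (H.map φ)).Nonempty ∧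
    |Real.log (Om d ((⊤ : SimpleGraph (Fin r)).map φ) (H.map φ)).card -
        Real.log (degFinset n d).card -
      ((m * Real.log p + ((r.choose 2 : ℕ) - m) * Real.log (1 - p)) +
        (basec p n (hdev p H) + ∑ j, (linc p n r (∑ i, hdev p H i) (hdev p H j) * dev d p (φ j) +
          quadc p n r (hdev p H j) * dev d p (φ j) ^ 2) -
        (∑ j, dev d p (φ j)) ^ 2 / (2 * (p * (1 - p)) * n ^ 2)))| ≤ L ^ 90 / s := by
  have hL := hP.L_pos
  have hs := hP.s_pos
  have hr0 : (0 : ℝ) ≤ r := by positivity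
  have hdeg : ∑ v, deg ((⊤ : SimpleGraph (Fin r)).map φ) v ≤ 2 * r.choose 2 := by
    have : (∑ v, (deg ((⊤ : SimpleGraph (Fin r)).map φ) v : ℝ)) = 2 * (r.choose 2 : ℕ) := by
      rw [sum_deg_map, Nat.cast_choose_two]
      simp only [deg_top]
      rw [Finset.sum_const, Finset.card_univ, Fintype.card_fin, nsmul_eq_mul]; ring
    exact le_of_eq (by exact_mod_cast this)
  obtain ⟨h1, h2⟩ := log_card_Om hP hne (r.choose 2) ((⊤ : SimpleGraph (Fin r)).map φ) (H.map φ)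
    (map_monotone φ le_top) (dom_map φ hL hs hr) (by exact_mod_cast hdeg)
  refine ⟨h1, ?_⟩
  rw [pot_map_sub H φ hm, Phi_map_sub H φ hP] at h2
  have h3 := sum_phiv_sub_eq (p := p) (fun j => dev d p (φ j)) (hdev p H) hP.n_ne hP.p_pos.ne'
    (one_sub_p_ne hP)
  have hch : ((r.choose 2 : ℕ) : ℝ) ≤ L ^ 2 * s ^ 2 := by
    rw [Nat.cast_choose_two]
    have := mul_le_mul hr hr hr0 (by positivity)
    nlinarith
  have h4 : ((r.choose 2 : ℕ) : ℝ) * (L ^ 87 / s ^ 3) ≤ L ^ 89 / s := by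
    refine (mul_le_mul_of_nonneg_right hch (by positivity)).trans_eq ?_
    field_simp
  have hA := hP.inv_mul_le
  have h5 : (∑ j, (dev d p (φ j) - hdev p H j) ^ 2) / (p * (1 - p) * (n : ℝ) ^ 2) ≤
      4 * L ^ 5 / s := by
    have e1 : ∑ j, (dev d p (φ j) - hdev p H j) ^ 2 ≤ r * (2 * (L * s)) ^ 2 := by
      refine (Finset.sum_le_sum (g := fun _ => (2 * (L * s)) ^ 2) fun j _ => ?_).trans_eq (by simp)
      rw [← sq_abs]
      refine pow_le_pow_left₀ (abs_nonneg _) ?_ 2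
      have := abs_sub_le_add (abs_dev_le hP (φ j)) ((abs_hdev_le hP H j).trans hr)
      linarith
    have e2 : r * (2 * (L * s)) ^ 2 ≤ L * s * (2 * (L * s)) ^ 2 :=
      mul_le_mul_of_nonneg_right hr (by positivity)
    have e3 : (∑ j, (dev d p (φ j) - hdev p H j) ^ 2) / (p * (1 - p) * (n : ℝ) ^ 2) =
        (1 / (p * (1 - p))) * ((∑ j, (dev d p (φ j) - hdev p H j) ^ 2) / s ^ 4) := by
      rw [← hP.sq]; 
      have := hP.p_pos.ne'
      have := one_sub_p_ne hP
      field_simp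
    rw [e3]
    calc _ ≤ L ^ 2 * (L * s * (2 * (L * s)) ^ 2 / s ^ 4) := by
          refine mul_le_mul hA.2 (by gcongr; linarith) (by positivity) (by positivity)
      _ = _ := by field_simp; ring
  have h50 : 0 ≤ (∑ j, (dev d p (φ j) - hdev p H j) ^ 2) / (p * (1 - p) * (n : ℝ) ^ 2) := by
    have := hP.p_pos
    have := hP.p_lt_one
    have : 0 < 1 - p := by linarith
    positivity
  have h6 : (r : ℝ) / (2 * n) ≤ L / s := by
    rw [← hP.sq, div_le_div_iff₀ (by positivity) hs]
    nlinarith [mul_le_mul_of_nonneg_right hr hs.le, mul_pos hL (pow_pos hs 2)]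
  have h60 : (0 : ℝ) ≤ r / (2 * n) := by positivity
  have h7 : L ^ 89 / s + (4 * L ^ 5 / s + L / s) ≤ L ^ 90 / s := by
    rw [← add_div, ← add_div]
    gcongr
    have g5 : L ^ 5 ≤ L ^ 89 := pow_le_pow_right₀ hP.one_le_L (by norm_num)
    have g6 : L ^ 1 ≤ L ^ 89 := pow_le_pow_right₀ hP.one_le_L (by norm_num)
    have g7 : L ^ 90 = L * L ^ 89 := by ring
    have := hP.L_ge
    have := pow_pos hL 89
    nlinarith
  refine le_trans ?_ h7
  refine le_trans (le_of_eq ?_) ((abs_add_le _ _).trans (add_le_add (h2.trans h4)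
    (abs_sub_le_add (abs_of_nonneg h50 ▸ h5) (abs_of_nonneg h60 ▸ h6))))
  rw [← h3]
  congr 1
  ring

end

section

open Equiv

variable {n : ℕ}

/-- Product weight of a permutation over the positions in `J`. -/
noncomputable def wt (F : Fin n → Fin n → ℝ) (J : Finset (Fin n)) (π : Perm (Fin n)) : ℝ :=
  ∏ j ∈ J, F j (π j)

/-- Resampling: a weight that is invariant under transpositions outside `J` allows averaging over
the positions outside `J`. -/
lemma sum_mul_apply_eq {J : Finset (Fin n)} {k : Fin n} (w : Perm (Fin n) → ℝ)
    (hw : ∀ l ∉ J, ∀ π, w (π * swap k l) = w π) (f : Fin n → ℝ) :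
    ((n : ℝ) - J.card) * ∑ π, w π * f (π k) =
      ∑ π, w π * (∑ v, f v - ∑ i ∈ J, f (π i)) := by
  have h1 : ∀ l ∈ Jᶜ, ∑ π, w π * f (π l) = ∑ π, w π * f (π k) := by
    intro l hl
    rw [← Equiv.sum_comp (Equiv.mulRight (swap k l))]
    refine Finset.sum_congr rfl fun π _ => ?_
    rw [Equiv.coe_mulRight, hw l (Finset.mem_compl.1 hl), Perm.mul_apply, swap_apply_right]
  have h2 : ∀ π : Perm (Fin n), ∑ v, f v - ∑ i ∈ J, f (π i) = ∑ l ∈ Jᶜ, f (π l) := by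
    intro π
    rw [← Equiv.sum_comp π f, ← Finset.sum_add_sum_compl J]
    ring
  simp only [h2, Finset.mul_sum]
  rw [Finset.sum_comm, ← Finset.mul_sum, Finset.sum_congr rfl h1, Finset.sum_const,
    Finset.card_compl, Fintype.card_fin, nsmul_eq_mul,
    Nat.cast_sub (by simpa using Finset.card_le_univ J)]

lemma wt_mul_swap (F : Fin n → Fin n → ℝ) {J : Finset (Fin n)} {k l : Fin n} (hk : k ∉ J)
    (hl : l ∉ J) (π : Perm (Fin n)) : wt F J (π * swap k l) = wt F J π := by
  refine Finset.prod_congr rfl fun j hj => ?_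
  rw [Perm.mul_apply, swap_apply_of_ne_of_ne (ne_of_mem_of_not_mem hj hk)
    (ne_of_mem_of_not_mem hj hl)]

lemma wt_erase_mul (F : Fin n → Fin n → ℝ) {J : Finset (Fin n)} {i : Fin n} (hi : i ∈ J)
    (π : Perm (Fin n)) : wt F J π = wt F (J.erase i) π * F i (π i) :=
  (Finset.prod_erase_mul J _ hi).symm

/-- Row weights close to one with row averages equal to one. -/
structure RowWt (F : Fin n → Fin n → ℝ) (t : Fin n → ℝ) (R : ℝ) : Prop where
  sub_le : ∀ j v, |F j v - 1| ≤ t j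
  t_le : ∀ j, t j ≤ 1 / 2
  sum_eq : ∀ j, ∑ v, (F j v - 1) = 0
  R_nonneg : 0 ≤ R
  R_le : 100 * R ≤ n
  n_pos : 0 < (n : ℝ)

namespace RowWt

variable {F : Fin n → Fin n → ℝ} {t : Fin n → ℝ} {R : ℝ}

lemma t_nonneg (h : RowWt F t R) (j : Fin n) : 0 ≤ t j := (abs_nonneg _).trans (h.sub_le j j)

lemma half_le (h : RowWt F t R) (j v : Fin n) : 1 / 2 ≤ F j v := by
  have := (abs_le.1 (h.sub_le j v)).1
  linarith [h.t_le j]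

lemma abs_le_three_halves (h : RowWt F t R) (j v : Fin n) : |F j v| ≤ 3 / 2 := by
  have := abs_le.1 (h.sub_le j v)
  rw [abs_of_nonneg (by linarith [h.half_le j v])]
  linarith [h.t_le j]

lemma wt_pos (h : RowWt F t R) (J : Finset (Fin n)) (π : Perm (Fin n)) : 0 < wt F J π :=
  Finset.prod_pos fun j _ => by linarith [h.half_le j (π j)]

lemma sum_wt_pos (h : RowWt F t R) (J : Finset (Fin n)) : 0 < ∑ π, wt F J π :=
  Finset.sum_pos (fun π _ => h.wt_pos J π) Finset.univ_nonempty

lemma sum_wt_erase_le (h : RowWt F t R) {J : Finset (Fin n)} {i : Fin n} (hi : i ∈ J) :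
    ∑ π, wt F (J.erase i) π ≤ 2 * ∑ π, wt F J π := by
  rw [Finset.mul_sum]
  refine Finset.sum_le_sum fun π _ => ?_
  rw [wt_erase_mul F hi]
  nlinarith [h.half_le i (π i), h.wt_pos (J.erase i) π]

lemma abs_sum_wt_mul_le (h : RowWt F t R) {J : Finset (Fin n)} (hJ : (J.card : ℝ) ≤ R) {i : Fin n}
    (hi : i ∉ J) {f : Fin n → ℝ} {M μ : ℝ} (hf : ∀ v, |f v| ≤ M) (hμ : |∑ v, f v| ≤ n * μ) :
    |∑ π, wt F J π * f (π i)| ≤ (2 * μ + 2 * R * M / n) * ∑ π, wt F J π := by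
  have hn := h.n_pos
  have hM : 0 ≤ M := (abs_nonneg _).trans (hf i)
  have h1 := sum_mul_apply_eq (wt F J) (fun l hl π => wt_mul_swap F hi hl π) f
  have h2 : |∑ π, wt F J π * (∑ v, f v - ∑ i ∈ J, f (π i))| ≤
      (n * μ + R * M) * ∑ π, wt F J π := by
    rw [Finset.mul_sum]
    refine (Finset.abs_sum_le_sum_abs _ _).trans (Finset.sum_le_sum fun π _ => ?_)
    rw [abs_mul, abs_of_pos (h.wt_pos J π), mul_comm]
    refine mul_le_mul_of_nonneg_right ?_ (h.wt_pos J π).le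
    refine (abs_sub _ _).trans (add_le_add hμ ?_)
    refine (Finset.abs_sum_le_sum_abs _ _).trans
      ((Finset.sum_le_sum fun j _ => hf (π j)).trans ?_)
    rw [Finset.sum_const, nsmul_eq_mul]
    exact mul_le_mul_of_nonneg_right hJ hM
  rw [← h1, abs_mul] at h2
  have h3 : (n : ℝ) / 2 ≤ |(n : ℝ) - J.card| := by
    refine le_trans ?_ (le_abs_self _)
    linarith [h.R_le, h.R_nonneg]
  have h4 := (mul_le_mul_of_nonneg_right h3 (abs_nonneg _)).trans h2
  have h5 : (2 * μ + 2 * R * M / n) * ∑ π, wt F J π =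
      2 / n * ((n * μ + R * M) * ∑ π, wt F J π) := by field_simp
  rw [h5, div_mul_eq_mul_div, le_div_iff₀ hn]
  linarith

lemma abs_sum_mul_le (h : RowWt F t R) (i : Fin n) {f : Fin n → ℝ} {M : ℝ} (hf : ∀ v, |f v| ≤ M)
    (hf0 : ∑ v, f v = 0) : |∑ v, F i v * f v| ≤ n * (t i * M) := by
  have h1 : ∑ v, F i v * f v = ∑ v, (F i v - 1) * f v := by
    simp only [sub_mul, one_mul]
    rw [Finset.sum_sub_distrib, hf0, sub_zero]
  rw [h1]
  refine (Finset.abs_sum_le_sum_abs _ _).trans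
    ((Finset.sum_le_sum (g := fun _ => t i * M) fun v _ => ?_).trans_eq (by simp))
  exact abs_mul_le_mul (h.sub_le i v) (hf v)

/-- Adding one row to the weight barely changes the total weight. -/
lemma abs_sum_wt_insert_sub_le (h : RowWt F t R) {J : Finset (Fin n)} (hJ : (J.card : ℝ) ≤ R)
    {k : Fin n} (hk : k ∉ J) :
    |∑ π, wt F (insert k J) π - ∑ π, wt F J π| ≤
      8 / n * t k * (∑ i ∈ J, t i + 2 * R ^ 2 / n) * ∑ π, wt F J π := by
  have hn := h.n_pos
  have hR := h.R_nonneg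
  have htk := h.t_nonneg k
  have h0 : ∑ π, wt F (insert k J) π - ∑ π, wt F J π =
      ∑ π, wt F J π * (F k (π k) - 1) := by
    rw [← Finset.sum_sub_distrib]
    refine Finset.sum_congr rfl fun π _ => ?_
    unfold wt
    rw [Finset.prod_insert hk]; ring
  have h1 := sum_mul_apply_eq (wt F J) (fun l hl π => wt_mul_swap F hk hl π)
    (fun v => F k v - 1)
  rw [h.sum_eq k] at h1
  have h2 : ∑ π, wt F J π * (0 - ∑ i ∈ J, (F k (π i) - 1)) =
      -∑ i ∈ J, ∑ π, wt F J π * (F k (π i) - 1) := by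
    rw [Finset.sum_comm, ← Finset.sum_neg_distrib]
    refine Finset.sum_congr rfl fun π _ => ?_
    rw [← Finset.mul_sum]; ring
  have h3 : ∀ i ∈ J, |∑ π, wt F J π * (F k (π i) - 1)| ≤
      (4 * (t i * t k) + 8 * R * t k / n) * ∑ π, wt F J π := by
    intro i hi
    have e1 : ∑ π, wt F J π * (F k (π i) - 1) =
        ∑ π, wt F (J.erase i) π * ((fun v => F i v * (F k v - 1)) (π i)) := by
      refine Finset.sum_congr rfl fun π _ => ?_
      rw [wt_erase_mul F hi]; ring
    have e2 := h.abs_sum_wt_mul_le (J := J.erase i) (i := i)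
      (f := fun v => F i v * (F k v - 1)) (M := 2 * t k) (μ := t i * t k)
      ((Nat.cast_le.2 (Finset.card_le_card (Finset.erase_subset i J))).trans hJ)
      (Finset.notMem_erase i J)
      (fun v => (abs_mul_le_mul (h.abs_le_three_halves i v) (h.sub_le k v)).trans (by linarith))
      (h.abs_sum_mul_le i (h.sub_le k) (h.sum_eq k))
    rw [e1]
    have hti := h.t_nonneg i
    refine e2.trans ((mul_le_mul_of_nonneg_left (h.sum_wt_erase_le hi)
      (by positivity)).trans_eq ?_)
    ring
  have h4 : |((n : ℝ) - J.card) * ∑ π, wt F J π * (F k (π k) - 1)| ≤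
      4 * t k * (∑ i ∈ J, t i + 2 * R ^ 2 / n) * ∑ π, wt F J π := by
    rw [h1, h2, abs_neg]
    refine (Finset.abs_sum_le_sum_abs _ _).trans ((Finset.sum_le_sum h3).trans ?_)
    rw [← Finset.sum_mul, Finset.sum_add_distrib, ← Finset.mul_sum, ← Finset.sum_mul,
      Finset.sum_const, nsmul_eq_mul]
    refine mul_le_mul_of_nonneg_right ?_ (h.sum_wt_pos J).le
    have : (J.card : ℝ) * (8 * R * t k / n) ≤ R * (8 * R * t k / n) :=
      mul_le_mul_of_nonneg_right hJ (by positivity)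
    refine (add_le_add_right this _).trans_eq ?_
    ring
  rw [abs_mul] at h4
  have h5 : (n : ℝ) / 2 ≤ |(n : ℝ) - J.card| := by
    refine le_trans ?_ (le_abs_self _)
    linarith [h.R_le, h.R_nonneg]
  have h6 := (mul_le_mul_of_nonneg_right h5 (abs_nonneg _)).trans h4
  rw [h0]
  have h7 : 8 / n * t k * (∑ i ∈ J, t i + 2 * R ^ 2 / n) * ∑ π, wt F J π =
      2 / n * (4 * t k * (∑ i ∈ J, t i + 2 * R ^ 2 / n) * ∑ π, wt F J π) := by ring
  rw [h7, div_mul_eq_mul_div, le_div_iff₀ hn]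
  linarith

lemma abs_log_le_two_mul {y : ℝ} (hy : |y| ≤ 1 / 2) : |Real.log (1 + y)| ≤ 2 * |y| := by
  have h := abs_log_one_add_sub_le hy
  have hy0 := abs_nonneg y
  have h1 := abs_le.1 hy
  rw [abs_le]
  constructor
  · have := Real.one_sub_inv_le_log_of_pos (x := 1 + y) (by linarith)
    have e : 1 - (1 + y)⁻¹ = y / (1 + y) := by
      have : (1 + y) ≠ 0 := by linarith
      field_simp; ring
    refine le_trans ?_ this
    rw [e, le_div_iff₀ (by linarith)]
    rcases abs_cases y with ⟨h2, _⟩ | ⟨h2, _⟩ <;> rw [h2] <;> nlinarith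
  · have := Real.log_le_sub_one_of_pos (x := 1 + y) (by linarith)
    linarith [le_abs_self y]

/-- The total weight is close to the number of permutations. -/
lemma abs_log_sum_wt_sub_le (h : RowWt F t R) (J : Finset (Fin n)) (hJ : (J.card : ℝ) ≤ R) :
    |Real.log (∑ π, wt F J π) - Real.log (n.factorial)| ≤
      16 / n * (∑ i ∈ J, t i) * (∑ i ∈ J, t i + 2 * R ^ 2 / n) := by
  have hn := h.n_pos
  have hR := h.R_nonneg
  have main : ∀ K ⊆ J, |Real.log (∑ π, wt F K π) - Real.log (n.factorial)| ≤
      16 / n * (∑ i ∈ K, t i) * (∑ i ∈ J, t i + 2 * R ^ 2 / n) := by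
    intro K
    induction K using Finset.induction_on with
    | empty => intro _; simp [wt, Fintype.card_perm]
    | insert k K hk ih =>
      intro hKJ
      have hK : K ⊆ J := (Finset.subset_insert k K).trans hKJ
      have hKc : (K.card : ℝ) ≤ R := (Nat.cast_le.2 (Finset.card_le_card hK)).trans hJ
      have h1 := h.abs_sum_wt_insert_sub_le hKc hk
      have h2 := ih hK
      have hT : ∑ i ∈ K, t i ≤ ∑ i ∈ J, t i :=
        Finset.sum_le_sum_of_subset_of_nonneg hK fun i _ _ => h.t_nonneg i
      have hT1 : ∑ i ∈ J, t i ≤ R / 2 := by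
        refine (Finset.sum_le_sum (g := fun _ => 1 / 2) fun i _ => h.t_le i).trans ?_
        rw [Finset.sum_const, nsmul_eq_mul]; linarith
      set W := ∑ π, wt F K π with hW
      set W' := ∑ π, wt F (insert k K) π with hW'
      have hWpos : 0 < W := h.sum_wt_pos K
      have h3 : |W' / W - 1| ≤ 8 / n * t k * (∑ i ∈ J, t i + 2 * R ^ 2 / n) := by
        rw [div_sub_one hWpos.ne', abs_div, abs_of_pos hWpos, div_le_iff₀ hWpos]
        refine h1.trans (mul_le_mul_of_nonneg_right ?_ hWpos.le)
        refine mul_le_mul_of_nonneg_left (by linarith) ?_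
        have := h.t_nonneg k
        positivity
      have h4 : 8 / n * t k * (∑ i ∈ J, t i + 2 * R ^ 2 / n) ≤ 1 / 2 := by
        have e1 : 2 * R ^ 2 / n ≤ R / 2 := by
          rw [div_le_iff₀ hn]; nlinarith [h.R_le]
        have e2 : ∑ i ∈ J, t i + 2 * R ^ 2 / n ≤ R := by linarith
        have e3 : 8 / n * t k ≤ 8 / n * (1 / 2) :=
          mul_le_mul_of_nonneg_left (h.t_le k) (by positivity)
        have e4 : (0 : ℝ) ≤ 8 / n * (1 / 2) := by positivity
        have e5 : 0 ≤ ∑ i ∈ J, t i + 2 * R ^ 2 / n :=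
          add_nonneg (Finset.sum_nonneg fun i _ => h.t_nonneg i) (by positivity)
        refine (mul_le_mul e3 e2 e5 e4).trans ?_
        rw [div_mul_eq_mul_div, div_mul_eq_mul_div, div_le_iff₀ hn]
        linarith [h.R_le]
      have h5 := abs_log_le_two_mul (h3.trans h4)
      rw [add_sub_cancel, Real.log_div (h.sum_wt_pos _).ne' hWpos.ne'] at h5
      have h6 := (abs_add_le (Real.log W' - Real.log W) (Real.log W - Real.log n.factorial)).trans
        (add_le_add h5 h2)
      rw [sub_add_sub_cancel] at h6
      refine h6.trans ?_
      rw [Finset.sum_insert hk]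
      have e : 16 / (n : ℝ) * (t k + ∑ i ∈ K, t i) * (∑ i ∈ J, t i + 2 * R ^ 2 / n) =
        2 * (8 / n * t k * (∑ i ∈ J, t i + 2 * R ^ 2 / n)) +
          16 / n * (∑ i ∈ K, t i) * (∑ i ∈ J, t i + 2 * R ^ 2 / n) := by ring
      rw [e]
      linarith
  exact main J subset_rfl

end RowWt

end

section

open Equiv

variable {n : ℕ}

namespace RowWt

variable {F : Fin n → Fin n → ℝ} {t : Fin n → ℝ} {R : ℝ}

/-- Mixed second moments of a centred function under the tilted measure. -/
lemma abs_sum_wt_mul_mul_le (h : RowWt F t R) {J : Finset (Fin n)} (hJ : (J.card : ℝ) ≤ R)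
    {i j : Fin n} (hi : i ∈ J) (hj : j ∈ J) (hij : i ≠ j) {x : Fin n → ℝ} {δ : ℝ}
    (hx : ∀ v, |x v| ≤ δ) (hx0 : ∑ v, x v = 0) :
    |∑ π, wt F J π * (x (π i) * x (π j))| ≤
      δ ^ 2 * (16 * (t i * t j) + 20 * R / n) * ∑ π, wt F J π := by
  have hn := h.n_pos
  have hR := h.R_nonneg
  have hδ : 0 ≤ δ := (abs_nonneg _).trans (hx i)
  have hti := h.t_nonneg i
  have htj := h.t_nonneg j
  have hW := h.sum_wt_pos J
  have hc : (((J.erase i).card : ℕ) : ℝ) ≤ R :=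
    (Nat.cast_le.2 (Finset.card_le_card (Finset.erase_subset i J))).trans hJ
  have hji : j ∈ J.erase i := Finset.mem_erase.2 ⟨hij.symm, hj⟩
  have hc2 : ((((J.erase i).erase j).card : ℕ) : ℝ) ≤ R :=
    (Nat.cast_le.2 (Finset.card_le_card (Finset.erase_subset j _))).trans hc
  have hW1 := h.sum_wt_erase_le hi
  have hW2 := h.sum_wt_erase_le hji
  have hFx : ∀ k v, |F k v * x v| ≤ 3 / 2 * δ := fun k v =>
    abs_mul_le_mul (h.abs_le_three_halves k v) (hx v)
  have e0 : ∑ π, wt F J π * (x (π i) * x (π j)) =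
      ∑ π, (wt F (J.erase i) π * x (π j)) * ((fun v => F i v * x v) (π i)) := by
    refine Finset.sum_congr rfl fun π _ => ?_
    rw [wt_erase_mul F hi]; ring
  have e1 := sum_mul_apply_eq (J := J.erase i) (fun π => wt F (J.erase i) π * x (π j))
    (fun l hl π => by
      have hjl : j ≠ l := ne_of_mem_of_not_mem hji hl
      rw [wt_mul_swap F (Finset.notMem_erase i J) hl, Perm.mul_apply,
        swap_apply_of_ne_of_ne hij.symm hjl]) (fun v => F i v * x v)
  have e2 : |∑ π, wt F (J.erase i) π * x (π j)| ≤
      (2 * (t j * δ) + 2 * R * (3 / 2 * δ) / n) * (4 * ∑ π, wt F J π) := by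
    have e3 : ∑ π, wt F (J.erase i) π * x (π j) =
        ∑ π, wt F ((J.erase i).erase j) π * ((fun v => F j v * x v) (π j)) := by
      refine Finset.sum_congr rfl fun π _ => ?_
      rw [wt_erase_mul F hji]; ring
    rw [e3]
    refine (h.abs_sum_wt_mul_le hc2 (Finset.notMem_erase j _) (hFx j)
      (h.abs_sum_mul_le j hx hx0)).trans (mul_le_mul_of_nonneg_left (by linarith) (by positivity))
  have e4 : ∑ π, (wt F (J.erase i) π * x (π j)) *
      (∑ v, F i v * x v - ∑ l ∈ J.erase i, F i (π l) * x (π l)) =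
      (∑ v, F i v * x v) * ∑ π, wt F (J.erase i) π * x (π j) -
      ∑ π, (wt F (J.erase i) π * x (π j)) * ∑ l ∈ J.erase i, F i (π l) * x (π l) := by
    rw [Finset.mul_sum, ← Finset.sum_sub_distrib]
    exact Finset.sum_congr rfl fun π _ => by ring
  have e5 : |∑ π, (wt F (J.erase i) π * x (π j)) * ∑ l ∈ J.erase i, F i (π l) * x (π l)| ≤
      (δ * (R * (3 / 2 * δ))) * (2 * ∑ π, wt F J π) := by
    refine le_trans ?_ (mul_le_mul_of_nonneg_left hW1 (by positivity))
    rw [Finset.mul_sum]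
    refine (Finset.abs_sum_le_sum_abs _ _).trans (Finset.sum_le_sum fun π _ => ?_)
    rw [mul_assoc, abs_mul, abs_of_pos (h.wt_pos _ π), mul_comm]
    refine mul_le_mul_of_nonneg_right (abs_mul_le_mul (hx _) ?_) (h.wt_pos _ π).le
    refine (Finset.abs_sum_le_sum_abs _ _).trans
      ((Finset.sum_le_sum fun l _ => hFx i (π l)).trans ?_)
    rw [Finset.sum_const, nsmul_eq_mul]
    exact mul_le_mul_of_nonneg_right hc (by positivity)
  have e6 : |((n : ℝ) - (J.erase i).card) *
      ∑ π, (wt F (J.erase i) π * x (π j)) * ((fun v => F i v * x v) (π i))| ≤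
      n / 2 * (δ ^ 2 * (16 * (t i * t j) + 20 * R / n) * ∑ π, wt F J π) := by
    rw [e1, e4]
    refine (abs_sub_le_add (abs_mul_le_mul (h.abs_sum_mul_le i hx hx0) e2) e5).trans ?_
    have e7 : n * (t i * δ) * ((2 * (t j * δ) + 2 * R * (3 / 2 * δ) / n) *
        (4 * ∑ π, wt F J π)) + (δ * (R * (3 / 2 * δ))) * (2 * ∑ π, wt F J π) =
        (δ ^ 2 * ∑ π, wt F J π) * (8 * n * (t i * t j) + 12 * R * t i + 3 * R) := by
      field_simp; ring
    have e8 : n / 2 * (δ ^ 2 * (16 * (t i * t j) + 20 * R / n) * ∑ π, wt F J π) =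
        (δ ^ 2 * ∑ π, wt F J π) * (8 * n * (t i * t j) + 10 * R) := by
      field_simp; ring
    rw [e7, e8]
    refine mul_le_mul_of_nonneg_left ?_ (by positivity)
    nlinarith [mul_le_mul_of_nonneg_left (h.t_le i) hR]
  rw [abs_mul, ← e0] at e6
  have h5 : (n : ℝ) / 2 ≤ |(n : ℝ) - (J.erase i).card| := by
    refine le_trans ?_ (le_abs_self _)
    linarith [h.R_le, h.R_nonneg]
  exact le_of_mul_le_mul_left ((mul_le_mul_of_nonneg_right h5 (abs_nonneg _)).trans e6)
    (by positivity)

/-- The second moment of the sum of a centred function under the tilted measure. -/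
lemma sum_wt_mul_sum_sq_le (h : RowWt F t R) {J : Finset (Fin n)} (hJ : (J.card : ℝ) ≤ R)
    {x : Fin n → ℝ} {δ : ℝ} (hx : ∀ v, |x v| ≤ δ) (hx0 : ∑ v, x v = 0) :
    ∑ π, wt F J π * (∑ i ∈ J, x (π i)) ^ 2 ≤
      δ ^ 2 * (16 * (∑ i ∈ J, t i) ^ 2 + 20 * R ^ 3 / n + R) * ∑ π, wt F J π := by
  have hn := h.n_pos
  have hR := h.R_nonneg
  have hW := h.sum_wt_pos J
  have h1 : ∀ i ∈ J, ∀ j ∈ J, ∑ π, wt F J π * (x (π i) * x (π j)) ≤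
      δ ^ 2 * (16 * (t i * t j) + 20 * R / n + if i = j then 1 else 0) * ∑ π, wt F J π := by
    intro i hi j hj
    have hti := h.t_nonneg i
    have htj := h.t_nonneg j
    split_ifs with hij
    · subst hij
      rw [Finset.mul_sum]
      refine Finset.sum_le_sum fun π _ => ?_
      rw [mul_comm]
      refine mul_le_mul_of_nonneg_right ?_ (h.wt_pos J π).le
      have h2 : x (π i) * x (π i) ≤ δ ^ 2 := by
        rw [← abs_mul_abs_self, ← pow_two]
        exact pow_le_pow_left₀ (abs_nonneg _) (hx _) 2
      refine h2.trans (le_mul_of_one_le_right (by positivity) ?_)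
      have : 0 ≤ 16 * (t i * t i) + 20 * R / n := by positivity
      linarith
    · rw [add_zero]
      exact (le_abs_self _).trans (h.abs_sum_wt_mul_mul_le hJ hi hj hij hx hx0)
  have h2 : ∑ π, wt F J π * (∑ i ∈ J, x (π i)) ^ 2 =
      ∑ i ∈ J, ∑ j ∈ J, ∑ π, wt F J π * (x (π i) * x (π j)) := by
    have : ∀ π : Perm (Fin n), wt F J π * (∑ i ∈ J, x (π i)) ^ 2 =
        ∑ i ∈ J, ∑ j ∈ J, wt F J π * (x (π i) * x (π j)) := by
      intro π
      rw [pow_two, Finset.sum_mul_sum, Finset.mul_sum]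
      exact Finset.sum_congr rfl fun i _ => Finset.mul_sum _ _ _
    simp only [this]
    rw [Finset.sum_comm]
    exact Finset.sum_congr rfl fun i _ => Finset.sum_comm
  rw [h2]
  refine (Finset.sum_le_sum fun i hi => Finset.sum_le_sum fun j hj => h1 i hi j hj).trans ?_
  simp only [← Finset.sum_mul, ← Finset.mul_sum]
  refine mul_le_mul_of_nonneg_right (mul_le_mul_of_nonneg_left ?_ (by positivity)) hW.le
  have h3 : ∑ i ∈ J, ∑ j ∈ J, (16 * (t i * t j) + 20 * R / n + if i = j then (1 : ℝ) else 0) =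
      16 * (∑ i ∈ J, t i) ^ 2 + J.card * (J.card * (20 * R / n)) + J.card := by
    have : ∀ i ∈ J, ∑ j ∈ J, (16 * (t i * t j) + 20 * R / n + if i = j then (1 : ℝ) else 0) =
        16 * (t i * ∑ j ∈ J, t j) + J.card * (20 * R / n) + 1 := by
      intro i hi
      rw [Finset.sum_add_distrib, Finset.sum_add_distrib, ← Finset.mul_sum, ← Finset.mul_sum,
        Finset.sum_ite_eq, if_pos hi, Finset.sum_const, nsmul_eq_mul]
    rw [Finset.sum_congr rfl this, Finset.sum_add_distrib, Finset.sum_add_distrib,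
      ← Finset.mul_sum, ← Finset.sum_mul, Finset.sum_const, Finset.sum_const, nsmul_eq_mul,
      nsmul_eq_mul]
    ring
  rw [h3]
  have h0 : (0 : ℝ) ≤ J.card := by positivity
  have h4 : (J.card : ℝ) * (J.card * (20 * R / n)) ≤ R * (R * (20 * R / n)) :=
    mul_le_mul hJ (mul_le_mul_of_nonneg_right hJ (by positivity)) (by positivity) hR
  have h5 : R * (R * (20 * R / n)) = 20 * R ^ 3 / n := by ring
  linarith

end RowWt

end

section

open Equiv

variable {n : ℕ}

lemma RowWt.abs_log_sum_wt_mul_exp_sub_le {F : Fin n → Fin n → ℝ} {t : Fin n → ℝ} {R : ℝ}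
    (h : RowWt F t R) {J : Finset (Fin n)} (hJ : (J.card : ℝ) ≤ R)
    {x : Fin n → ℝ} {δ c κ : ℝ} (hx : ∀ v, |x v| ≤ δ) (hx0 : ∑ v, x v = 0)
    (hc : 0 ≤ c) (hκ : c * (δ ^ 2 * (16 * (∑ i ∈ J, t i) ^ 2 + 20 * R ^ 3 / n + R)) ≤ κ)
    (hκ1 : κ ≤ 1 / 2) :
    |Real.log (∑ π, wt F J π * Real.exp (-(c * (∑ i ∈ J, x (π i)) ^ 2))) -
        Real.log (n.factorial)| ≤
      16 / n * (∑ i ∈ J, t i) * (∑ i ∈ J, t i + 2 * R ^ 2 / n) + 2 * κ := by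
  have hn := h.n_pos
  have hR := h.R_nonneg
  have hW := h.sum_wt_pos J
  have h1 := h.abs_log_sum_wt_sub_le J hJ
  have h2 := h.sum_wt_mul_sum_sq_le hJ hx hx0
  set W := ∑ π, wt F J π with hWdef
  set V := ∑ π, wt F J π * Real.exp (-(c * (∑ i ∈ J, x (π i)) ^ 2)) with hV
  have h3 : V ≤ W := by
    refine Finset.sum_le_sum fun π _ => mul_le_of_le_one_right (h.wt_pos J π).le ?_
    rw [Real.exp_le_one_iff]
    have : 0 ≤ c * (∑ i ∈ J, x (π i)) ^ 2 := by positivity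
    linarith
  have h4 : W - κ * W ≤ V := by
    have e1 : W - c * ∑ π, wt F J π * (∑ i ∈ J, x (π i)) ^ 2 ≤ V := by
      rw [Finset.mul_sum, hWdef, ← Finset.sum_sub_distrib]
      refine Finset.sum_le_sum fun π _ => ?_
      have := mul_le_mul_of_nonneg_left (Real.add_one_le_exp (-(c * (∑ i ∈ J, x (π i)) ^ 2)))
        (h.wt_pos J π).le
      refine le_trans (le_of_eq ?_) this
      ring
    have e2 := mul_le_mul_of_nonneg_left h2 hc
    have e3 := mul_le_mul_of_nonneg_right hκ hW.le
    linarith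
  have h5 : 0 < V := by nlinarith
  have h6 : |Real.log V - Real.log W| ≤ 2 * κ := by
    rw [abs_sub_comm, abs_of_nonneg (sub_nonneg.2 (Real.log_le_log h5 h3)),
      ← Real.log_div hW.ne' h5.ne']
    have := Real.log_le_sub_one_of_pos (div_pos hW h5)
    refine this.trans ?_
    rw [div_sub_one h5.ne', div_le_iff₀ h5]
    have hκ0 : 0 ≤ κ := le_trans (mul_nonneg hc (mul_nonneg (by positivity) (by positivity))) hκ
    nlinarith
  have h7 := (abs_add_le (Real.log V - Real.log W) (Real.log W - Real.log n.factorial)).trans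
    (add_le_add h6 h1)
  rw [sub_add_sub_cancel] at h7
  linarith

lemma abs_exp_sub_quad_le {g : ℝ} (hg : |g| ≤ 1) :
    |Real.exp g - (1 + g + g ^ 2 / 2)| ≤ |g| ^ 3 := by
  have h := Real.exp_bound hg (n := 3) (by norm_num)
  simp only [Finset.sum_range_succ, Finset.sum_range_zero, Nat.factorial] at h
  norm_num at h
  have e : 1 + g + g ^ 2 / 2 = 1 + g + g ^ 2 / 2 := rfl
  refine h.trans ?_
  have := pow_nonneg (abs_nonneg g) 3
  nlinarith

/-- Averages of exponentials of small quadratic functions of a centred variable. -/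
lemma abs_log_avg_exp_sub_le {x : Fin n → ℝ} {α β a b : ℝ} (hn : 0 < (n : ℝ))
    (hx0 : ∑ v, x v = 0) (ha : ∀ v, |α * x v| ≤ a) (hb : ∀ v, |β * x v ^ 2| ≤ b)
    (hab : a + b ≤ 1 / 16) :
    1 / 2 ≤ (∑ v, Real.exp (α * x v + β * x v ^ 2)) / n ∧
    (∀ u, |Real.exp (α * x u + β * x u ^ 2) / ((∑ v, Real.exp (α * x v + β * x v ^ 2)) / n) - 1| ≤
      8 * (a + b)) ∧
    |Real.log ((∑ v, Real.exp (α * x v + β * x v ^ 2)) / n) -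
      (β * ((∑ v, x v ^ 2) / n) + α ^ 2 * ((∑ v, x v ^ 2) / n) / 2 +
        α * β * ((∑ v, x v ^ 3) / n))| ≤ 14 * b ^ 2 + 5 * a ^ 3 := by
  have hn' : 0 < n := by exact_mod_cast hn
  have ha0 : 0 ≤ a := (abs_nonneg _).trans (ha ⟨0, hn'⟩)
  have hb0 : 0 ≤ b := (abs_nonneg _).trans (hb ⟨0, hn'⟩)
  have avg_le : ∀ (f : Fin n → ℝ) (B : ℝ), (∀ v, |f v| ≤ B) → |(∑ v, f v) / n| ≤ B := by
    intro f B hf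
    rw [abs_div, abs_of_pos hn, div_le_iff₀ hn]
    refine (Finset.abs_sum_le_sum_abs _ _).trans ((Finset.sum_le_sum fun v _ => hf v).trans_eq ?_)
    rw [Finset.sum_const, Finset.card_univ, Fintype.card_fin, nsmul_eq_mul]; ring
  have hg : ∀ v, |α * x v + β * x v ^ 2| ≤ a + b := fun v => abs_add_le_add (ha v) (hb v)
  have hexp : ∀ v, |Real.exp (α * x v + β * x v ^ 2) - 1| ≤ 2 * (a + b) := fun v =>
    (Real.abs_exp_sub_one_le ((hg v).trans (by linarith))).trans
      (mul_le_mul_of_nonneg_left (hg v) (by norm_num))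
  set M := (∑ v, Real.exp (α * x v + β * x v ^ 2)) / n with hM
  have hM1 : M - 1 = (∑ v, (Real.exp (α * x v + β * x v ^ 2) - 1)) / n := by
    rw [Finset.sum_sub_distrib, sub_div, ← hM]
    simp [hn.ne']
  have hM2 : |M - 1| ≤ 2 * (a + b) := by rw [hM1]; exact avg_le _ _ hexp
  have hM3 : 1 / 2 ≤ M := by have := (abs_le.1 hM2).1; linarith
  refine ⟨hM3, fun u => ?_, ?_⟩
  · rw [div_sub_one (by linarith), abs_div, abs_of_pos (by linarith : 0 < M),
      div_le_iff₀ (by linarith)]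
    have e := abs_sub_le_add (hexp u) hM2
    rw [show Real.exp (α * x u + β * x u ^ 2) - 1 - (M - 1) =
      Real.exp (α * x u + β * x u ^ 2) - M by ring] at e
    nlinarith
  · set E1 := β * ((∑ v, x v ^ 2) / n) + α ^ 2 * ((∑ v, x v ^ 2) / n) / 2 +
        α * β * ((∑ v, x v ^ 3) / n) with hE1
    have h1 : M - 1 - E1 = (∑ v, (Real.exp (α * x v + β * x v ^ 2) -
        (1 + (α * x v + β * x v ^ 2) + (α * x v + β * x v ^ 2) ^ 2 / 2) +
        (β * x v ^ 2) ^ 2 / 2)) / n := by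
      have e1 : ∀ v, Real.exp (α * x v + β * x v ^ 2) -
          (1 + (α * x v + β * x v ^ 2) + (α * x v + β * x v ^ 2) ^ 2 / 2) +
          (β * x v ^ 2) ^ 2 / 2 = (Real.exp (α * x v + β * x v ^ 2) - 1) - α * x v -
          (β + α ^ 2 / 2) * x v ^ 2 - α * β * x v ^ 3 := by intro v; ring
      simp only [e1]
      rw [Finset.sum_sub_distrib, Finset.sum_sub_distrib, Finset.sum_sub_distrib,
        ← Finset.mul_sum, ← Finset.mul_sum, ← Finset.mul_sum, hx0, hM1, hE1]
      ring
    have h2 : |M - 1 - E1| ≤ (a + b) ^ 3 + b ^ 2 / 2 := by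
      rw [h1]
      refine avg_le _ _ fun v => abs_add_le_add ?_ ?_
      · exact (abs_exp_sub_quad_le ((hg v).trans (by linarith))).trans
          (pow_le_pow_left₀ (abs_nonneg _) (hg v) 3)
      · rw [abs_of_nonneg (by positivity), ← sq_abs]
        have := pow_le_pow_left₀ (abs_nonneg _) (hb v) 2
        linarith
    have h3 : |E1| ≤ b + a ^ 2 / 2 + a * b := by
      have e1 : E1 = (∑ v, (β * x v ^ 2 + (α * x v) ^ 2 / 2 + (α * x v) * (β * x v ^ 2))) / n := by
        have : ∀ v, β * x v ^ 2 + (α * x v) ^ 2 / 2 + (α * x v) * (β * x v ^ 2) =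
          (β + α ^ 2 / 2) * x v ^ 2 + α * β * x v ^ 3 := by intro v; ring
        simp only [this]
        rw [Finset.sum_add_distrib, ← Finset.mul_sum, ← Finset.mul_sum, hE1]
        ring
      rw [e1]
      refine avg_le _ _ fun v => abs_add_le_add (abs_add_le_add (hb v) ?_)
        (abs_mul_le_mul (ha v) (hb v))
      rw [abs_of_nonneg (by positivity), ← sq_abs]
      have := pow_le_pow_left₀ (abs_nonneg _) (ha v) 2
      linarith
    have hcube : (a + b) ^ 3 ≤ 4 * a ^ 3 + b ^ 2 / 4 := by
      have g1 : (a + b) ^ 3 ≤ 4 * (a ^ 3 + b ^ 3) := by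
        nlinarith [mul_nonneg (add_nonneg ha0 hb0) (sq_nonneg (a - b))]
      have g2 : b ^ 3 ≤ b ^ 2 * (1 / 16) := by
        rw [pow_succ]; exact mul_le_mul_of_nonneg_left (by linarith) (by positivity)
      linarith
    have h4 : |M - 1| ≤ 2 * b + a ^ 2 := by
      have e1 : M - 1 = (M - 1 - E1) + E1 := by ring
      rw [e1]
      refine (abs_add_le_add h2 h3).trans ?_
      have g1 : a * b ≤ 1 / 16 * b := mul_le_mul_of_nonneg_right (by linarith) hb0
      have g2 : b * b ≤ 1 / 16 * b := mul_le_mul_of_nonneg_right (by linarith) hb0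
      have g3 : a * a ^ 2 ≤ 1 / 16 * a ^ 2 :=
        mul_le_mul_of_nonneg_right (by linarith) (by positivity)
      nlinarith
    have h5 : (M - 1) ^ 2 ≤ 8 * b ^ 2 + a ^ 3 / 4 := by
      have g1 : (M - 1) ^ 2 ≤ (2 * b + a ^ 2) ^ 2 := by
        rw [← sq_abs]; exact pow_le_pow_left₀ (abs_nonneg _) h4 2
      have g2 : a * a ^ 3 ≤ 1 / 16 * a ^ 3 :=
        mul_le_mul_of_nonneg_right (by linarith) (by positivity)
      nlinarith [sq_nonneg (2 * b - a ^ 2), pow_nonneg ha0 3]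
    have h6 := abs_log_one_add_sub_le (y := M - 1) (hM2.trans (by linarith))
    rw [add_sub_cancel] at h6
    have h7 : |M - 1| ^ 3 ≤ 1 / 4 * (M - 1) ^ 2 := by
      rw [pow_succ', sq_abs]
      exact mul_le_mul_of_nonneg_right (hM2.trans (by linarith)) (sq_nonneg _)
    have e2 : Real.log M - E1 = (Real.log M - (M - 1 - (M - 1) ^ 2 / 2)) + (M - 1 - E1) -
      (M - 1) ^ 2 / 2 := by ring
    rw [e2]
    refine (abs_sub_le_add (abs_add_le_add h6 h2)
      (abs_of_nonneg (by positivity : (0 : ℝ) ≤ (M - 1) ^ 2 / 2)).le).trans ?_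
    nlinarith [pow_nonneg ha0 3, sq_nonneg b]

end

section

/-- Size of the leading linear term in the logarithm of the probability of an embedding. -/
noncomputable def linSize (p N δ y : ℝ) : ℝ := δ * |y| / (p * (1 - p) * N)

section Scalar

variable {p s L R ω y δ x : ℝ}

lemma abs_one_sub_two_mul_le (hp : 0 < p) (hq : 0 < 1 - p) : |(1 - 2 * p) / 2| ≤ 1 / 2 := by
  rw [abs_le]; constructor <;> linarith

variable (hp : 0 < p) (hq : 0 < 1 - p) (hA : 1 / (p * (1 - p)) ≤ L ^ 2) (hL : 1 ≤ L) (hs : 0 < s)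

include hp hq in
lemma abs_mul_div_le_linSize (hx : |x| ≤ δ) :
    |y * x / (p * (1 - p) * s ^ 2)| ≤ linSize p (s ^ 2) δ y := by
  have : 0 ≤ p * (1 - p) * s ^ 2 := by positivity
  unfold linSize
  rw [abs_div, abs_mul, abs_of_nonneg this, mul_comm |y|]
  gcongr

include hp hq hA hL hs in
lemma abs_div_le_of_abs_le (hx : |x| ≤ L * s) : |x / (p * (1 - p) * s ^ 2)| ≤ L ^ 7 / s := by
  have e : x / (p * (1 - p) * s ^ 2) = 1 / (p * (1 - p)) * (x / s ^ 2) := by field_simp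
  have h0 : |1 / (p * (1 - p))| ≤ L ^ 2 := by rwa [abs_of_nonneg (by positivity)]
  have h1 : |x / s ^ 2| ≤ L / s := by
    rw [abs_div, abs_of_nonneg (sq_nonneg s), div_le_div_iff₀ (by positivity) hs]
    nlinarith
  rw [e]
  refine (abs_mul_le_mul h0 h1).trans ?_
  rw [← mul_div_assoc]
  gcongr
  rw [← pow_succ]
  exact pow_le_pow_right₀ hL (by norm_num)

include hL hs in
lemma div_sq_le_of_le (hR : R ≤ L * s) : R / s ^ 2 ≤ L ^ 7 / s := by
  rw [div_le_div_iff₀ (by positivity) hs]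
  have h1 : L ≤ L ^ 7 := le_self_pow₀ hL (by norm_num)
  have := mul_le_mul_of_nonneg_right hR hs.le
  have := mul_le_mul_of_nonneg_right h1 (by positivity : 0 ≤ s ^ 2)
  nlinarith

include hp hq hA hL hs in
lemma abs_linc_sub_mul_le (hR0 : 0 ≤ R) (hR : R ≤ L * s) (hy : |y| ≤ L * s) (hx : |x| ≤ δ) :
    |(linc p (s ^ 2) R ω y - y / (p * (1 - p) * s ^ 2)) * x| ≤
      2 * (linSize p (s ^ 2) δ y * (L ^ 7 / s)) + δ * |ω| / (p * (1 - p) * s ^ 4) := by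
  have e : (linc p (s ^ 2) R ω y - y / (p * (1 - p) * s ^ 2)) * x =
      y * x / (p * (1 - p) * s ^ 2) * (R / s ^ 2) + ω * x / (p * (1 - p) * s ^ 4) +
      y * x / (p * (1 - p) * s ^ 2) * ((1 - 2 * p) / 2 * (y / (p * (1 - p) * s ^ 2))) := by
    unfold linc
    field_simp
    ring
  have h1 := abs_mul_div_le_linSize (s := s) (y := y) hp hq hx
  have h2 : |R / s ^ 2| ≤ L ^ 7 / s := by
    rw [abs_of_nonneg (by positivity)]; exact div_sq_le_of_le hL hs hR
  have h3 : |ω * x / (p * (1 - p) * s ^ 4)| ≤ δ * |ω| / (p * (1 - p) * s ^ 4) := by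
    have : 0 ≤ p * (1 - p) * s ^ 4 := by positivity
    rw [abs_div, abs_mul, abs_of_nonneg this, mul_comm |ω|]
    gcongr
  have h4 := abs_mul_le_mul (abs_one_sub_two_mul_le hp hq) (abs_div_le_of_abs_le hp hq hA hL hs hy)
  have h5 : 0 ≤ linSize p (s ^ 2) δ y := (abs_nonneg _).trans h1
  have h6 : 0 ≤ L ^ 7 / s := by positivity
  rw [e]
  refine (abs_add_le_add (abs_add_le_add (abs_mul_le_mul h1 h2) h3) (abs_mul_le_mul h1 h4)).trans ?_
  nlinarith [mul_nonneg h5 h6]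

include hp hq hA hL hs in
lemma abs_quadc_mul_le (hR0 : 0 ≤ R) (hR : R ≤ L * s) (hy : |y| ≤ L * s) (hx : |x| ≤ L * s) :
    |quadc p (s ^ 2) R y * x ^ 2| ≤ L ^ 7 / s := by
  have e : quadc p (s ^ 2) R y * x ^ 2 = -(1 / 2 * (1 / (p * (1 - p)) * (R * (x * x) / s ^ 4))) -
      (1 - 2 * p) / 2 * (1 / (p * (1 - p)) * (1 / (p * (1 - p))) * (y * (x * x) / s ^ 4)) := by
    unfold quadc
    field_simp
  have hA0 : |1 / (p * (1 - p))| ≤ L ^ 2 := by rwa [abs_of_nonneg (by positivity)]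
  have hR' : |R| ≤ L * s := by rwa [abs_of_nonneg hR0]
  have key : ∀ z : ℝ, |z| ≤ L * s → |z * (x * x) / s ^ 4| ≤ L ^ 3 / s := by
    intro z hz
    rw [abs_div, abs_of_nonneg (by positivity : 0 ≤ s ^ 4)]
    calc _ ≤ (L * s * ((L * s) * (L * s))) / s ^ 4 := by
          gcongr; exact abs_mul_le_mul hz (abs_mul_le_mul hx hx)
      _ = _ := by field_simp
  rw [e]
  refine (abs_sub_le_add (M := 1 / 2 * (L ^ 7 / s)) (N := 1 / 2 * (L ^ 7 / s)) ?_ ?_).trans_eq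
    (by ring)
  · rw [abs_neg]
    refine abs_mul_le_mul (by norm_num [abs_of_nonneg])
      ((abs_mul_le_mul hA0 (key R hR')).trans ?_)
    rw [← mul_div_assoc, ← pow_add]
    gcongr; norm_num
  · refine abs_mul_le_mul (abs_one_sub_two_mul_le hp hq)
      ((abs_mul_le_mul (abs_mul_le_mul hA0 hA0) (key y hy)).trans_eq ?_)
    ring

include hp hq hA hL hs in
lemma abs_cross_mul_le (hδ : δ ≤ L * s) (hx : |x| ≤ δ) :
    |y / (p * (1 - p) * s ^ 2) * (quadc p (s ^ 2) R y + R / (2 * (p * (1 - p)) * (s ^ 2) ^ 2)) *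
      x ^ 3| ≤ linSize p (s ^ 2) δ y ^ 2 * (L ^ 7 / s) := by
  have e : y / (p * (1 - p) * s ^ 2) * (quadc p (s ^ 2) R y +
      R / (2 * (p * (1 - p)) * (s ^ 2) ^ 2)) * x ^ 3 =
      (y * x / (p * (1 - p) * s ^ 2)) * (y * x / (p * (1 - p) * s ^ 2)) *
        (-((1 - 2 * p) / 2) * (x / (p * (1 - p) * s ^ 2))) := by
    unfold quadc
    field_simp
    ring
  have h1 := abs_mul_div_le_linSize (s := s) (y := y) hp hq hx
  have h4 := abs_mul_le_mul ((abs_neg _).trans_le (abs_one_sub_two_mul_le hp hq))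
    (abs_div_le_of_abs_le hp hq hA hL hs (hx.trans hδ))
  have h6 : 0 ≤ L ^ 7 / s := by positivity
  rw [e]
  refine (abs_mul_le_mul (abs_mul_le_mul h1 h1) h4).trans ?_
  rw [← pow_two]
  exact mul_le_mul_of_nonneg_left (by linarith) (sq_nonneg _)

end Scalar

/-- Comparison of the second-order expansion with its leading part. -/
lemma abs_main_sub_le {α α₀ β β₀ V S a b ρ δ : ℝ} (hδ : 0 ≤ δ) (ha : 0 ≤ a) (ha1 : a ≤ 1)
    (hb : 0 ≤ b) (hbρ : b ≤ ρ) (hρ : ρ ≤ 1 / 2) (hV : |V| ≤ δ ^ 2) (hS : |S| ≤ δ ^ 3)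
    (h0 : |α₀ * δ| ≤ a) (h1 : |(α - α₀) * δ| ≤ 2 * (a * ρ) + b) (h2 : |β * δ ^ 2| ≤ ρ)
    (h3 : |α₀ * (β - β₀) * δ ^ 3| ≤ a ^ 2 * ρ) :
    |(β * V + α ^ 2 * V / 2 + α * β * S) - (β * V + α₀ ^ 2 * V / 2 + α₀ * β₀ * S)| ≤
      4 * a ^ 3 + 2 * (a * b) + 9 * ρ ^ 2 := by
  have hρ0 : 0 ≤ ρ := hb.trans hbρ
  have scale : ∀ {u w : ℝ} (k : ℕ), |w| ≤ δ ^ k → |u * w| ≤ |u * δ ^ k| := by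
    intro u w k hw
    rw [abs_mul, abs_mul, abs_of_nonneg (pow_nonneg hδ k)]
    exact mul_le_mul_of_nonneg_left hw (abs_nonneg _)
  have e : (β * V + α ^ 2 * V / 2 + α * β * S) - (β * V + α₀ ^ 2 * V / 2 + α₀ * β₀ * S) =
      (α - α₀) * (2 * α₀ + (α - α₀)) * V / 2 + (α - α₀) * β * S + α₀ * (β - β₀) * S := by ring
  have t1 : |(α - α₀) * (2 * α₀ + (α - α₀)) * V / 2| ≤
      (2 * (a * ρ) + b) * (2 * a + (2 * (a * ρ) + b)) / 2 := by
    rw [abs_div, abs_two]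
    gcongr
    refine (scale 2 hV).trans ?_
    rw [show (α - α₀) * (2 * α₀ + (α - α₀)) * δ ^ 2 =
      ((α - α₀) * δ) * (2 * (α₀ * δ) + (α - α₀) * δ) by ring]
    refine abs_mul_le_mul h1 (abs_add_le_add ?_ h1)
    rw [abs_mul, abs_two]; linarith
  have t2 : |(α - α₀) * β * S| ≤ (2 * (a * ρ) + b) * ρ := by
    refine (scale 3 hS).trans ?_
    rw [show (α - α₀) * β * δ ^ 3 = ((α - α₀) * δ) * (β * δ ^ 2) by ring]
    exact abs_mul_le_mul h1 h2
  have t3 : |α₀ * (β - β₀) * S| ≤ a ^ 2 * ρ := (scale 3 hS).trans h3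
  rw [e]
  refine (abs_add_le_add (abs_add_le_add t1 t2) t3).trans ?_
  have g1 : a ^ 2 * ρ ≤ a ^ 3 + ρ ^ 2 := by
    rcases le_total ρ a with h | h
    · have := mul_le_mul_of_nonneg_left h (sq_nonneg a)
      nlinarith [sq_nonneg ρ]
    · have : a * ρ * a ≤ ρ * ρ * 1 :=
        mul_le_mul (mul_le_mul_of_nonneg_right h hρ0) ha1 ha (by positivity)
      nlinarith [pow_nonneg ha 3]
  have g2 : a * ρ ^ 2 ≤ ρ ^ 2 := mul_le_of_le_one_left (sq_nonneg _) ha1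
  have g3 : b ^ 2 ≤ ρ ^ 2 := pow_le_pow_left₀ hb hbρ 2
  have g4 : b * ρ ≤ ρ ^ 2 := by rw [pow_two]; exact mul_le_mul_of_nonneg_right hbρ hρ0
  have g5 : a * ρ * b ≤ a * b / 2 := by nlinarith [mul_nonneg ha hb]
  have g6 : a ^ 2 * ρ * ρ ≤ a ^ 2 * ρ * (1 / 2) :=
    mul_le_mul_of_nonneg_left hρ (by positivity)
  have g7 : 0 ≤ a * b := mul_nonneg ha hb
  nlinarith

end

section

open Equiv

variable {n : ℕ} {d : Fin n → ℕ} {p s L : ℝ}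

lemma sq_mul_le_cube_add {a ρ : ℝ} (ha : 0 ≤ a) (ha1 : a ≤ 1) (hρ : 0 ≤ ρ) :
    ρ * a ^ 2 ≤ a ^ 3 + ρ ^ 2 := by
  rcases le_total ρ a with h | h
  · have := mul_le_mul_of_nonneg_right h (sq_nonneg a)
    nlinarith [sq_nonneg ρ]
  · have : a * ρ * a ≤ ρ * ρ * 1 :=
      mul_le_mul (mul_le_mul_of_nonneg_right h hρ) ha1 ha (by positivity)
    nlinarith [pow_nonneg ha 3]

lemma mul_sum_sq_le {J : Finset (Fin n)} {a : Fin n → ℝ} {ρ : ℝ} (ha : ∀ k, 0 ≤ a k)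
    (ha1 : ∀ k, a k ≤ 1) (hρ : 0 ≤ ρ) :
    ρ * ∑ k ∈ J, a k ^ 2 ≤ ∑ k ∈ J, a k ^ 3 + J.card * ρ ^ 2 := by
  rw [Finset.mul_sum]
  refine (Finset.sum_le_sum fun k _ => sq_mul_le_cube_add (ha k) (ha1 k) hρ).trans_eq ?_
  rw [Finset.sum_add_distrib, Finset.sum_const, nsmul_eq_mul]

section Arith

variable {r S₁ S₂ τ T δ : ℝ} (hL : 2000 ≤ L) (hs : 0 < s) (hLs : L ^ 17 ≤ s)

include hL hs in
lemma sq_div_sq_le (hr : r ≤ L * s) (hS : S₁ ^ 2 ≤ r * S₂) (hS2 : 0 ≤ S₂)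
    (h2 : L ^ 7 / s * S₂ ≤ τ + L ^ 15 / s) : L ^ 4 * S₁ ^ 2 / s ^ 2 ≤ τ + L ^ 15 / s := by
  refine le_trans ?_ h2
  have hL0 : 0 < L := by linarith
  have h1 : L ^ 4 * S₁ ^ 2 / s ^ 2 ≤ L ^ 4 * (L * s * S₂) / s ^ 2 := by
    gcongr
    exact hS.trans (mul_le_mul_of_nonneg_right hr hS2)
  refine h1.trans ?_
  have h3 : L ^ 4 * (L * s * S₂) / s ^ 2 = L ^ 5 / s * S₂ := by field_simp
  rw [h3]
  gcongr
  · linarith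
  · norm_num

include hL hs hLs in
lemma pow_four_mul_sq_div_le (hr0 : 0 ≤ r) (hr : r ≤ L * s)
    (hS : L ^ 4 * S₁ ^ 2 / s ^ 2 ≤ τ + L ^ 15 / s)
    (hT : T = 24 * S₁ + 16 * (r * (L ^ 7 / s))) :
    L ^ 4 * T ^ 2 / s ^ 2 ≤ 1152 * τ + 1664 * (L ^ 15 / s) := by
  have hL0 : 0 < L := by linarith
  have h1 : T ^ 2 ≤ 1152 * S₁ ^ 2 + 512 * (L ^ 8) ^ 2 := by
    have e1 : r * (L ^ 7 / s) ≤ L ^ 8 := by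
      refine (mul_le_mul_of_nonneg_right hr (by positivity)).trans_eq ?_
      field_simp
    have e2 : (r * (L ^ 7 / s)) ^ 2 ≤ (L ^ 8) ^ 2 := pow_le_pow_left₀ (by positivity) e1 2
    rw [hT]
    nlinarith [sq_nonneg (24 * S₁ - 16 * (r * (L ^ 7 / s)))]
  have h2 : L ^ 4 * T ^ 2 / s ^ 2 ≤ L ^ 4 * (1152 * S₁ ^ 2 + 512 * (L ^ 8) ^ 2) / s ^ 2 := by
    gcongr
  have h3 : L ^ 4 * (1152 * S₁ ^ 2 + 512 * (L ^ 8) ^ 2) / s ^ 2 =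
      1152 * (L ^ 4 * S₁ ^ 2 / s ^ 2) + 512 * (L ^ 20 / s ^ 2) := by ring
  have h4 : L ^ 20 / s ^ 2 ≤ L ^ 15 / s := by
    rw [div_le_div_iff₀ (by positivity) hs]
    have : L ^ 5 ≤ s := (pow_le_pow_right₀ (by linarith) (by norm_num)).trans hLs
    calc L ^ 20 * s = L ^ 15 * s * L ^ 5 := by ring
      _ ≤ L ^ 15 * s * s := mul_le_mul_of_nonneg_left this (by positivity)
      _ = _ := by ring
  linarith

include hL hs in
lemma weight_error_le (hT0 : 0 ≤ T) (hT1 : T ≤ L * s / 2) {B : ℝ} (hB : L ^ 4 * T ^ 2 / s ^ 2 ≤ B) :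
    16 / s ^ 2 * T * (T + 2 * (L * s) ^ 2 / s ^ 2) ≤ 16 * (B + L ^ 15 / s) := by
  have hL0 : 0 < L := by linarith
  have e : 16 / s ^ 2 * T * (T + 2 * (L * s) ^ 2 / s ^ 2) =
      16 * (T ^ 2 / s ^ 2 + 2 * L ^ 2 * T / s ^ 2) := by field_simp
  rw [e]
  have h1 : T ^ 2 / s ^ 2 ≤ B := by
    refine le_trans ?_ hB
    gcongr
    exact le_mul_of_one_le_left (sq_nonneg _) (one_le_pow₀ (by linarith))
  have h2 : 2 * L ^ 2 * T / s ^ 2 ≤ L ^ 15 / s := by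
    calc 2 * L ^ 2 * T / s ^ 2 ≤ 2 * L ^ 2 * (L * s / 2) / s ^ 2 := by gcongr
      _ = L ^ 3 / s := by field_simp
      _ ≤ L ^ 15 / s := by gcongr <;> linarith
  linarith

include hL hs in
lemma square_error_le {A : ℝ} (hA : A ≤ L ^ 2) (hδ0 : 0 ≤ δ) (hδ : δ ≤ L * s)
    {B : ℝ} (hB : L ^ 4 * T ^ 2 / s ^ 2 ≤ B) :
    A / (2 * s ^ 4) * (δ ^ 2 * (16 * T ^ 2 + 20 * (L * s) ^ 3 / s ^ 2 + L * s)) ≤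
      8 * B + 11 * (L ^ 15 / s) := by
  have hL0 : 0 < L := by linarith
  calc A / (2 * s ^ 4) * (δ ^ 2 * (16 * T ^ 2 + 20 * (L * s) ^ 3 / s ^ 2 + L * s)) ≤
      L ^ 2 / (2 * s ^ 4) * ((L * s) ^ 2 * (16 * T ^ 2 + 20 * (L * s) ^ 3 / s ^ 2 + L * s)) := by
        gcongr
    _ = 8 * (L ^ 4 * T ^ 2 / s ^ 2) + (10 * L ^ 7 + L ^ 5 / 2) / s := by field_simp; ring
    _ ≤ 8 * B + 11 * (L ^ 15 / s) := by
        refine add_le_add (by linarith) ?_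
        rw [← mul_div_assoc]
        gcongr
        have h5 : L ^ 5 ≤ L ^ 15 := pow_le_pow_right₀ (by linarith) (by norm_num)
        have h7 : L ^ 7 ≤ L ^ 15 := pow_le_pow_right₀ (by linarith) (by norm_num)
        have := pow_pos hL0 15
        linarith

end Arith

end

section

open Equiv

variable {n : ℕ} {d : Fin n → ℕ} {p s L : ℝ}

/-- Leading part of the logarithm of the average of one factor. -/
noncomputable def rowMain (p N R V S y : ℝ) : ℝ :=
  quadc p N R y * V + (y / (p * (1 - p) * N)) ^ 2 * V / 2 +
    y / (p * (1 - p) * N) * (-(R / (2 * (p * (1 - p)) * N ^ 2))) * S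

/-- The exponent in the probability of an embedding, as a function of the deviation of the image
vertex. -/
noncomputable def gexp (p N R ω y x : ℝ) : ℝ := linc p N R ω y * x + quadc p N R y * x ^ 2

lemma abs_avg_pow_le {x : Fin n → ℝ} {δ : ℝ} (hn : 0 < (n : ℝ)) (hx : ∀ v, |x v| ≤ δ) (k : ℕ) :
    |(∑ v, x v ^ k) / n| ≤ δ ^ k := by
  rw [abs_div, abs_of_pos hn, div_le_iff₀ hn]
  refine (Finset.abs_sum_le_sum_abs _ _).trans
    ((Finset.sum_le_sum (g := fun _ => δ ^ k) fun v _ => ?_).trans_eq ?_)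
  · rw [abs_pow]; exact pow_le_pow_left₀ (abs_nonneg _) (hx v) k
  · rw [Finset.sum_const, Finset.card_univ, Fintype.card_fin, nsmul_eq_mul]; ring

/-- Average of one factor in the probability of an embedding. -/
lemma row_estimate (hP : Par n d p s L) {R ω y δ b : ℝ} (hR0 : 0 ≤ R) (hR : R ≤ L * s)
    (hδ0 : 0 ≤ δ) (hδ : ∀ v, |dev d p v| ≤ δ) (hδL : δ ≤ L * s) (hy : |y| ≤ L * s)
    (ha : linSize p n δ y ≤ 1 / 1000) (hb : δ * |ω| / (p * (1 - p) * s ^ 4) ≤ b)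
    (hbρ : b ≤ L ^ 7 / s) :
    1 / 2 ≤ (∑ v, Real.exp (gexp p n R ω y (dev d p v))) / n ∧
    (∀ u, |Real.exp (gexp p n R ω y (dev d p u)) /
      ((∑ v, Real.exp (gexp p n R ω y (dev d p v))) / n) - 1| ≤
      24 * linSize p n δ y + 16 * (L ^ 7 / s)) ∧
    |Real.log ((∑ v, Real.exp (gexp p n R ω y (dev d p v))) / n) -
      rowMain p n R ((∑ v, dev d p v ^ 2) / n) ((∑ v, dev d p v ^ 3) / n) y| ≤
      544 * linSize p n δ y ^ 3 + 2 * (linSize p n δ y * b) + 33 * (L ^ 7 / s) ^ 2 := by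
  have hs := hP.s_pos
  have hL := hP.one_le_L
  have hp := hP.p_pos
  have hq : 0 < 1 - p := by linarith [hP.p_lt_one]
  have hA := hP.inv_mul_le.2
  have hn : 0 < (n : ℝ) := by rw [← hP.sq]; positivity
  have hρ0 : 0 ≤ L ^ 7 / s := by have := hP.L_pos; positivity
  have hρ1 : L ^ 7 / s ≤ 1 / 1000 := by
    rw [div_le_div_iff₀ hs (by norm_num)]
    have h1 := hP.pow_le (k := 8) (by norm_num)
    have h2 : L ^ 8 = L * L ^ 7 := by ring
    have h3 := pow_pos hP.L_pos 7
    nlinarith [hP.L_ge]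
  have ha0 : 0 ≤ linSize p n δ y := by unfold linSize; positivity
  have hb0 : 0 ≤ b := le_trans (by positivity) hb
  have f0 : ∀ x, |x| ≤ δ → |y / (p * (1 - p) * n) * x| ≤ linSize p n δ y := by
    intro x hx
    rw [div_mul_eq_mul_div, ← hP.sq]
    exact abs_mul_div_le_linSize hp hq hx
  have f1 : ∀ x, |x| ≤ δ → |(linc p n R ω y - y / (p * (1 - p) * n)) * x| ≤
      2 * (linSize p n δ y * (L ^ 7 / s)) + b := by
    intro x hx
    rw [← hP.sq]
    exact (abs_linc_sub_mul_le hp hq hA hL hs hR0 hR hy hx).trans (by linarith)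
  have f2 : ∀ x, |x| ≤ L * s → |quadc p n R y * x ^ 2| ≤ L ^ 7 / s := by
    intro x hx
    rw [← hP.sq]
    exact abs_quadc_mul_le hp hq hA hL hs hR0 hR hy hx
  have f3 : ∀ x, |x| ≤ δ → |y / (p * (1 - p) * n) *
      (quadc p n R y - -(R / (2 * (p * (1 - p)) * (n : ℝ) ^ 2))) * x ^ 3| ≤
      linSize p n δ y ^ 2 * (L ^ 7 / s) := by
    intro x hx
    rw [← hP.sq, sub_neg_eq_add]
    exact abs_cross_mul_le hp hq hA hL hs hδL hx
  have g1 : ∀ v, |linc p n R ω y * dev d p v| ≤ 3 * linSize p n δ y + L ^ 7 / s := by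
    intro v
    have e : linc p n R ω y * dev d p v = y / (p * (1 - p) * n) * dev d p v +
      (linc p n R ω y - y / (p * (1 - p) * n)) * dev d p v := by ring
    rw [e]
    refine (abs_add_le_add (f0 _ (hδ v)) (f1 _ (hδ v))).trans ?_
    nlinarith
  have hdδ : |δ| ≤ δ := (abs_of_nonneg hδ0).le
  obtain ⟨r1, r2, r3⟩ := abs_log_avg_exp_sub_le (x := dev d p) hn hP.hsum g1
    (fun v => f2 (dev d p v) (abs_dev_le hP v)) (by linarith)
  refine ⟨r1, fun u => (r2 u).trans (by linarith), ?_⟩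
  have r4 := abs_main_sub_le (V := (∑ v, dev d p v ^ 2) / n) (S := (∑ v, dev d p v ^ 3) / n)
    hδ0 ha0 (by linarith) hb0 hbρ (by linarith) (abs_avg_pow_le hn hδ 2) (abs_avg_pow_le hn hδ 3)
    (f0 δ hdδ) (f1 δ hdδ) (f2 δ (hdδ.trans hδL)) (f3 δ hdδ)
  have r5 := abs_add_le_add r3 r4
  rw [sub_add_sub_cancel] at r5
  refine r5.trans ?_
  set a := linSize p n δ y
  set ρ := L ^ 7 / s
  have c1 : (3 * a + ρ) ^ 3 ≤ 4 * (27 * a ^ 3 + ρ ^ 3) := by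
    nlinarith [mul_nonneg (add_nonneg (mul_nonneg zero_le_three ha0) hρ0) (sq_nonneg (3 * a - ρ))]
  have c2 : ρ ^ 3 ≤ ρ ^ 2 * (1 / 1000) := by
    rw [pow_succ]; exact mul_le_mul_of_nonneg_left hρ1 (sq_nonneg _)
  nlinarith [sq_nonneg ρ]

lemma sum_exp_eq {F : Fin n → Fin n → ℝ} {M : Fin n → ℝ} {g : Fin n → Fin n → ℝ}
    (hM : ∀ k, M k ≠ 0) (hF : ∀ k v, F k v = Real.exp (g k v) / M k) (J : Finset (Fin n))
    (q : Perm (Fin n) → ℝ) :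
    ∑ π : Perm (Fin n), Real.exp (∑ k ∈ J, g k (π k) - q π) =
      (∏ k ∈ J, M k) * ∑ π, wt F J π * Real.exp (-q π) := by
  rw [Finset.mul_sum]
  refine Finset.sum_congr rfl fun π _ => ?_
  have : wt F J π = (∏ k ∈ J, Real.exp (g k (π k))) / ∏ k ∈ J, M k := by
    rw [← Finset.prod_div_distrib]; exact Finset.prod_congr rfl fun k _ => hF k _
  rw [this, ← Real.exp_sum, sub_eq_add_neg, Real.exp_add, ← mul_assoc,
    mul_div_cancel₀ _ (Finset.prod_ne_zero_iff.2 fun k _ => hM k)]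

lemma abs_sum_rows_le {J : Finset (Fin n)} {a e : Fin n → ℝ} {b ρ τ θ : ℝ}
    (he : ∀ k, |e k| ≤ 544 * a k ^ 3 + 2 * (a k * b) + 33 * ρ ^ 2)
    (hτ : ∑ k ∈ J, a k ^ 3 ≤ τ) (hb : ∑ k ∈ J, a k * b ≤ τ + θ) (hθ : J.card * ρ ^ 2 ≤ θ) :
    |∑ k ∈ J, e k| ≤ 546 * τ + 35 * θ := by
  refine (Finset.abs_sum_le_sum_abs _ _).trans ((Finset.sum_le_sum fun k _ => he k).trans ?_)
  rw [Finset.sum_add_distrib, Finset.sum_add_distrib, ← Finset.mul_sum, ← Finset.mul_sum,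
    Finset.sum_const, nsmul_eq_mul]
  linarith

set_option maxHeartbeats 1600000 in
/-- Averaging the probability of an embedding over all embeddings. -/
lemma abs_log_sum_exp_sub_le (hP : Par n d p s L) {J : Finset (Fin n)} {y : Fin n → ℝ} {δ τ : ℝ}
    (hJ : (J.card : ℝ) ≤ L * s) (hδ0 : 0 ≤ δ) (hδ : ∀ v, |dev d p v| ≤ δ) (hδL : δ ≤ L * s)
    (hy : ∀ k, |y k| ≤ L * s) (hy0 : ∀ k ∉ J, y k = 0)
    (hτ : ∑ k ∈ J, linSize p n δ (y k) ^ 3 ≤ τ) (hτ1 : τ ≤ 1 / 10 ^ 9) :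
    0 < ∑ π : Perm (Fin n), Real.exp (∑ k ∈ J, gexp p n J.card (∑ i ∈ J, y i) (y k)
      (dev d p (π k)) - (∑ k ∈ J, dev d p (π k)) ^ 2 / (2 * (p * (1 - p)) * n ^ 2)) ∧
    |Real.log (∑ π : Perm (Fin n), Real.exp (∑ k ∈ J, gexp p n J.card (∑ i ∈ J, y i) (y k)
      (dev d p (π k)) - (∑ k ∈ J, dev d p (π k)) ^ 2 / (2 * (p * (1 - p)) * n ^ 2))) -
      Real.log n.factorial -
      ∑ k ∈ J, rowMain p n J.card ((∑ v, dev d p v ^ 2) / n) ((∑ v, dev d p v ^ 3) / n) (y k)| ≤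
      10 ^ 5 * τ + L ^ 17 / s := by
  have hs := hP.s_pos
  have hL := hP.one_le_L
  have hL0 := hP.L_pos
  have hp := hP.p_pos
  have hq : 0 < 1 - p := by linarith [hP.p_lt_one]
  have hn : 0 < (n : ℝ) := by rw [← hP.sq]; positivity
  have hLs : L ^ 17 ≤ s := hP.pow_le (by norm_num)
  have hA := hP.inv_mul_le
  set a : Fin n → ℝ := fun k => linSize p n δ (y k) with ha_def
  set ρ := L ^ 7 / s with hρ_def
  set θ := L ^ 15 / s with hθ_def
  set ω := ∑ i ∈ J, y i with hω_def
  set r : ℝ := ((J.card : ℕ) : ℝ) with hr_def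
  have hr0 : 0 ≤ r := by positivity
  have hρ0 : 0 ≤ ρ := by positivity
  have ha0 : ∀ k, 0 ≤ a k := fun k => by simp only [ha_def]; unfold linSize; positivity
  have hτ0 : 0 ≤ τ := le_trans (Finset.sum_nonneg fun k _ => pow_nonneg (ha0 k) 3) hτ
  have ha1 : ∀ k, a k ≤ 1 / 1000 := by
    intro k
    by_cases hk : k ∈ J
    · have h1 : a k ^ 3 ≤ (1 / 1000) ^ 3 := by
        refine ((Finset.single_le_sum (fun i _ => pow_nonneg (ha0 i) 3) hk).trans hτ).trans ?_
        refine hτ1.trans (by norm_num)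
      exact le_of_pow_le_pow_left₀ (by norm_num) (by norm_num) h1
    · simp only [ha_def]; rw [hy0 k hk]; unfold linSize; simp
  have hθ : r * ρ ^ 2 ≤ θ := by
    refine (mul_le_mul_of_nonneg_right hJ (sq_nonneg _)).trans_eq ?_
    rw [hρ_def, hθ_def]; field_simp
  have hθL : L ^ 2 * θ ≤ 1 := by
    rw [hθ_def, ← mul_div_assoc, div_le_one hs, ← pow_add]; exact hLs
  have hL2 : (2000 : ℝ) ^ 2 ≤ L ^ 2 := pow_le_pow_left₀ (by norm_num) hP.L_ge 2
  have hθ0 : 0 ≤ θ := by positivity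
  have hS2 : ρ * ∑ k ∈ J, a k ^ 2 ≤ τ + θ :=
    (mul_sum_sq_le ha0 (fun k => (ha1 k).trans (by norm_num)) hρ0).trans (add_le_add hτ hθ)
  have hCS : (∑ k ∈ J, a k) ^ 2 ≤ r * ∑ k ∈ J, a k ^ 2 := sq_sum_le_card_mul_sum_sq
  have hS20 : 0 ≤ ∑ k ∈ J, a k ^ 2 := Finset.sum_nonneg fun k _ => sq_nonneg _
  have hS0 : 0 ≤ ∑ k ∈ J, a k := Finset.sum_nonneg fun k _ => ha0 k
  have hS1 : L ^ 4 * (∑ k ∈ J, a k) ^ 2 / s ^ 2 ≤ τ + θ :=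
    sq_div_sq_le hP.L_ge hs hJ hCS hS20 hS2
  set b := (∑ k ∈ J, a k) / s ^ 2 with hb_def
  have hb : δ * |ω| / (p * (1 - p) * s ^ 4) ≤ b := by
    have h1 : |ω| ≤ ∑ k ∈ J, |y k| := Finset.abs_sum_le_sum_abs _ _
    have h2 : b = δ * (∑ k ∈ J, |y k|) / (p * (1 - p) * s ^ 4) := by
      simp only [hb_def, ha_def]; unfold linSize
      rw [← Finset.sum_div, ← Finset.mul_sum, ← hP.sq]
      field_simp
    rw [h2]
    gcongr
  have hbρ : b ≤ ρ := by
    have h1 : ∑ k ∈ J, a k ≤ r := by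
      refine (Finset.sum_le_sum fun k _ =>
        (ha1 k).trans (by norm_num : (1 : ℝ) / 1000 ≤ 1)).trans ?_
      rw [Finset.sum_const, nsmul_eq_mul, mul_one]
    have h2 := div_sq_le_of_le hL hs (h1.trans hJ)
    exact h2
  have hSb : ∑ k ∈ J, a k * b ≤ τ + θ := by
    rw [← Finset.sum_mul]
    refine le_trans (le_trans (le_of_eq ?_) (div_le_div_of_nonneg_right
      (le_mul_of_one_le_left (sq_nonneg (∑ k ∈ J, a k)) (one_le_pow₀ hL (n := 4)))
      (sq_nonneg s))) hS1
    rw [hb_def]; ring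
  have hrow := fun k => row_estimate hP hr0 hJ hδ0 hδ hδL (hy k) (ha1 k) hb hbρ
  set M : Fin n → ℝ := fun k => (∑ v, Real.exp (gexp p n r ω (y k) (dev d p v))) / n with hM_def
  set F : Fin n → Fin n → ℝ := fun k v => Real.exp (gexp p n r ω (y k) (dev d p v)) / M k
    with hF_def
  have hMpos : ∀ k, 0 < M k := fun k => by linarith [(hrow k).1]
  set t : Fin n → ℝ := fun k => 24 * a k + 16 * ρ with ht_def
  have hρ1 : ρ ≤ 1 / 1000 := by
    rw [hρ_def, div_le_div_iff₀ hs (by norm_num)]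
    have h1 := hP.pow_le (k := 8) (by norm_num)
    have h2 : L ^ 8 = L * L ^ 7 := by ring
    have h3 := pow_pos hP.L_pos 7
    nlinarith [hP.L_ge]
  have hRW : RowWt F t (L * s) := by
    refine ⟨fun k v => (hrow k).2.1 v, fun k => ?_, fun k => ?_, by positivity, ?_, hn⟩
    · have := ha1 k
      simp only [ht_def]; linarith
    · rw [Finset.sum_sub_distrib, hF_def, ← Finset.sum_div]
      have : ∑ v, Real.exp (gexp p n r ω (y k) (dev d p v)) = n * M k := by
        simp only [hM_def]; field_simp
      rw [this, mul_div_cancel_right₀ _ (hMpos k).ne']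
      simp
    · rw [← hP.sq]
      have h1 := hP.pow_le (k := 2) (by norm_num)
      have h2 := hP.L_ge
      have h3 : 100 * L ≤ s := by nlinarith
      nlinarith
  have hT : ∑ k ∈ J, t k = 24 * ∑ k ∈ J, a k + 16 * (r * ρ) := by
    simp only [ht_def]
    rw [Finset.sum_add_distrib, ← Finset.mul_sum, Finset.sum_const, nsmul_eq_mul]; ring
  have hT0 : 0 ≤ ∑ k ∈ J, t k := Finset.sum_nonneg fun k _ => hRW.t_nonneg k
  have hT1 : ∑ k ∈ J, t k ≤ L * s / 2 := by
    refine (Finset.sum_le_sum fun k _ => hRW.t_le k).trans ?_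
    rw [Finset.sum_const, nsmul_eq_mul]; linarith
  have hB := pow_four_mul_sq_div_le hP.L_ge hs hLs hr0 hJ hS1 hT
  have hE1 := weight_error_le hP.L_ge hs hT0 hT1 hB
  have hE2 := square_error_le hP.L_ge hs hA.2 hδ0 hδL hB
  rw [← hθ_def] at hB hE1 hE2
  have hc : (∀ π : Perm (Fin n), (∑ k ∈ J, dev d p (π k)) ^ 2 / (2 * (p * (1 - p)) * (n : ℝ) ^ 2) =
      1 / (p * (1 - p)) / (2 * s ^ 4) * (∑ k ∈ J, dev d p (π k)) ^ 2) := by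
    intro π
    rw [← hP.sq]; field_simp
  have hθ1 : θ ≤ 1 / 4000000 := by nlinarith
  have hmain := hRW.abs_log_sum_wt_mul_exp_sub_le hJ hδ hP.hsum
    (c := 1 / (p * (1 - p)) / (2 * s ^ 4)) (κ := 8 * (1152 * τ + 1664 * θ) + 11 * θ)
    (by positivity) (by rw [← hP.sq]; exact hE2) (by norm_num at hτ1; linarith)
  rw [← hP.sq] at hmain
  have hsum : ∑ π : Perm (Fin n), Real.exp (∑ k ∈ J, gexp p n r ω (y k)
      (dev d p (π k)) - (∑ k ∈ J, dev d p (π k)) ^ 2 / (2 * (p * (1 - p)) * n ^ 2)) =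
      (∏ k ∈ J, M k) * ∑ π, wt F J π * Real.exp (-(1 / (p * (1 - p)) / (2 * s ^ 4) *
        (∑ k ∈ J, dev d p (π k)) ^ 2)) := by
    simp only [hc]
    exact sum_exp_eq (g := fun k v => gexp p n r ω (y k) (dev d p v)) (fun k => (hMpos k).ne')
      (fun k v => rfl) J fun π => 1 / (p * (1 - p)) / (2 * s ^ 4) * (∑ k ∈ J, dev d p (π k)) ^ 2
  have hVpos : 0 < ∑ π, wt F J π * Real.exp (-(1 / (p * (1 - p)) / (2 * s ^ 4) *
        (∑ k ∈ J, dev d p (π k)) ^ 2)) :=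
    Finset.sum_pos (fun π _ => mul_pos (hRW.wt_pos J π) (Real.exp_pos _)) Finset.univ_nonempty
  refine ⟨Finset.sum_pos (fun π _ => Real.exp_pos _) Finset.univ_nonempty, ?_⟩
  rw [hsum, Real.log_mul (Finset.prod_pos fun k _ => hMpos k).ne' hVpos.ne',
    Real.log_prod fun k _ => (hMpos k).ne']
  have hrows : |∑ k ∈ J, (Real.log (M k) - rowMain p n r ((∑ v, dev d p v ^ 2) / n)
      ((∑ v, dev d p v ^ 3) / n) (y k))| ≤ 546 * τ + 35 * θ :=
    abs_sum_rows_le (fun k => (hrow k).2.2) hτ hSb hθ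
  rw [Finset.sum_sub_distrib] at hrows
  have hfin : 10 ^ 5 * τ + L ^ 17 / s = 10 ^ 5 * τ + L ^ 2 * θ := by
    rw [hθ_def]; ring
  rw [hfin]
  refine le_trans (le_of_eq ?_) ((abs_add_le_add hrows (hmain.trans
    (add_le_add_left hE1 _))).trans ?_)
  · congr 1; ring
  · have : 2000 ^ 2 * θ ≤ L ^ 2 * θ := mul_le_mul_of_nonneg_right hL2 hθ0
    linarith

end

section

open Equiv

variable {n r : ℕ} {d : Fin n → ℕ} {p s L : ℝ}

/-- Embeddings of `H` onto induced subgraphs of `G`. -/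
noncomputable def indEmb (H : SimpleGraph (Fin r)) (G : SimpleGraph (Fin n)) :
    Finset (Fin r ↪ Fin n) :=
  Finset.univ.filter fun φ => ∀ i j, G.Adj (φ i) (φ j) ↔ H.Adj i j

lemma card_indEmb_fiber (H : SimpleGraph (Fin r)) (G : SimpleGraph (Fin n)) (S : Finset (Fin n))
    (e : (G.induce (S : Set (Fin n))) ≃g H) :
    ((indEmb H G).filter fun φ => Finset.univ.map φ = S).card = autCard H := by
  have hmem : ∀ i, ((e.symm i : (S : Set (Fin n))) : Fin n) ∈ S := fun i => (e.symm i).2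
  let φ₀ : Fin r ↪ Fin n := ⟨fun i => (e.symm i : (S : Set (Fin n))),
    fun i j h => e.symm.injective (Subtype.ext h)⟩
  have hφ₀ : ∀ i, φ₀ i = ((e.symm i : (S : Set (Fin n))) : Fin n) := fun i => rfl
  have hadj : ∀ i j, G.Adj (φ₀ i) (φ₀ j) ↔ H.Adj i j := fun i j =>
    e.symm.map_rel_iff' (a := i) (b := j)
  have hsurj : ∀ v ∈ S, ∃ i, φ₀ i = v := fun v hv => ⟨e ⟨v, hv⟩, by
    rw [hφ₀, RelIso.symm_apply_apply]⟩
  symm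
  refine Finset.card_bij (fun π _ => π.toEmbedding.trans φ₀) ?_ ?_ ?_
  · intro π hπ
    have hπ' : ∀ i j, H.Adj (π i) (π j) ↔ H.Adj i j := by simpa using hπ
    simp only [indEmb, Finset.mem_filter, Finset.mem_univ, true_and]
    refine ⟨fun i j => (hadj _ _).trans (hπ' i j), ?_⟩
    ext v
    simp only [Finset.mem_map, Finset.mem_univ, true_and]
    constructor
    · rintro ⟨i, rfl⟩; exact hmem _
    · intro hv
      obtain ⟨i, hi⟩ := hsurj v hv
      exact ⟨π.symm i, by simpa using hi⟩
  · intro π _ π' _ h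
    ext i
    have := DFunLike.congr_fun h i
    exact congrArg Fin.val (φ₀.injective this)
  · intro φ hφ
    simp only [indEmb, Finset.mem_filter, Finset.mem_univ, true_and] at hφ
    obtain ⟨h1, h2⟩ := hφ
    have h3 : ∀ i, ∃ j, φ₀ j = φ i := fun i => hsurj _ (by
      rw [← h2]; exact Finset.mem_map_of_mem _ (Finset.mem_univ _))
    choose f hf using h3
    have hinj : Function.Injective f := fun i j hij => φ.injective (by rw [← hf, ← hf, hij])
    refine ⟨Equiv.ofBijective f (Finite.injective_iff_bijective.1 hinj), ?_, ?_⟩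
    · simp only [Finset.mem_filter, Finset.mem_univ, true_and, Equiv.ofBijective_apply]
      intro i j
      rw [← hadj, hf, hf, h1]
    · ext i
      exact congrArg Fin.val (hf i)

lemma card_indEmb (H : SimpleGraph (Fin r)) (G : SimpleGraph (Fin n)) :
    (indEmb H G).card = indCount H G * autCard H := by
  rw [indCount, Finset.card_eq_sum_card_fiberwise (f := fun φ : Fin r ↪ Fin n => Finset.univ.map φ)
    (t := Finset.univ.filter (fun S : Finset (Fin n) =>
      S.card = r ∧ Nonempty ((G.induce (S : Set (Fin n))) ≃g H))), ← smul_eq_mul,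
    ← Finset.sum_const]
  · refine Finset.sum_congr rfl fun S hS => ?_
    simp only [Finset.mem_filter, Finset.mem_univ, true_and] at hS
    exact card_indEmb_fiber H G S hS.2.some
  · intro φ hφ
    simp only [indEmb, Finset.coe_filter, Finset.mem_univ, true_and, Set.mem_ofPred_eq] at hφ ⊢
    refine ⟨by simp, ⟨RelIso.symm ⟨Equiv.ofBijective
      (fun i => (⟨φ i, by simp⟩ : ((Finset.univ.map φ : Finset (Fin n)) : Set (Fin n)))) ⟨?_, ?_⟩,
      ?_⟩⟩⟩
    · intro i j h
      exact φ.injective (congrArg Subtype.val h)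
    · rintro ⟨v, hv⟩
      simp only [Finset.coe_map, Finset.coe_univ, Set.image_univ, Set.mem_range] at hv
      obtain ⟨i, rfl⟩ := hv
      exact ⟨i, rfl⟩
    · intro i j
      exact hφ i j

lemma autCard_pos (H : SimpleGraph (Fin r)) : 0 < autCard H :=
  Finset.card_pos.2 ⟨1, by simp⟩

lemma sum_indCount_mul_autCard (H : SimpleGraph (Fin r)) :
    (∑ G ∈ degFinset n d, indCount H G) * autCard H =
      ∑ φ : Fin r ↪ Fin n, (Om d ((⊤ : SimpleGraph (Fin r)).map φ) (H.map φ)).card := by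
  rw [Finset.sum_mul]
  simp only [← card_indEmb]
  have h1 : ∀ φ : Fin r ↪ Fin n, (Om d ((⊤ : SimpleGraph (Fin r)).map φ) (H.map φ)).card =
      ((degFinset n d).filter fun G => φ ∈ indEmb H G).card := by
    intro φ
    congr 1
    ext G
    rw [mem_Om_map, Finset.mem_filter, indEmb]
    simp
  simp only [h1]
  have := Finset.sum_card_bipartiteAbove_eq_sum_card_bipartiteBelow
    (s := degFinset n d) (t := (Finset.univ : Finset (Fin r ↪ Fin n))) (fun G φ => φ ∈ indEmb H G)
  simpa [Finset.bipartiteAbove, Finset.bipartiteBelow] using this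

/-- Sums over embeddings as averages over permutations. -/
lemma factorial_mul_sum_embedding (ι : Fin r ↪ Fin n) (f : (Fin r ↪ Fin n) → ℝ) :
    (n.factorial : ℝ) * ∑ φ, f φ =
      (n.descFactorial r : ℝ) * ∑ π : Perm (Fin n), f (ι.trans π.toEmbedding) := by
  let c := ((Finset.univ : Finset (Perm (Fin n))).filter fun π => ι.trans π.toEmbedding = ι).card
  have hfib : ∀ φ : Fin r ↪ Fin n, ((Finset.univ : Finset (Perm (Fin n))).filter
      fun π => ι.trans π.toEmbedding = φ).card = c := by
    intro φ
    have := Equiv.Perm.isMultiplyPretransitive (Fin n) r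
    obtain ⟨σ, hσ⟩ := MulAction.exists_smul_eq (Perm (Fin n)) ι φ
    have hσ' : ∀ i, σ (ι i) = φ i := fun i => DFunLike.congr_fun hσ i
    symm
    refine Finset.card_bij (fun π _ => σ * π) ?_ (fun π _ π' _ h => mul_left_cancel h) ?_
    · intro π hπ
      simp only [Finset.mem_filter, Finset.mem_univ, true_and] at hπ ⊢
      refine DFunLike.ext _ _ fun i => ?_
      have h := DFunLike.congr_fun hπ i
      simp only [Function.Embedding.trans_apply, Equiv.coe_toEmbedding] at h ⊢
      rw [Perm.mul_apply, h, hσ']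
    · intro π hπ
      simp only [Finset.mem_filter, Finset.mem_univ, true_and] at hπ
      refine ⟨σ⁻¹ * π, ?_, by simp⟩
      simp only [Finset.mem_filter, Finset.mem_univ, true_and]
      refine DFunLike.ext _ _ fun i => ?_
      have h := DFunLike.congr_fun hπ i
      simp only [Function.Embedding.trans_apply, Equiv.coe_toEmbedding] at h ⊢
      rw [Perm.mul_apply, h, ← hσ']
      simp
  have hsum : ∀ g : (Fin r ↪ Fin n) → ℝ, ∑ π : Perm (Fin n), g (ι.trans π.toEmbedding) =
      c * ∑ φ, g φ := by
    intro g
    rw [← Finset.sum_fiberwise (Finset.univ : Finset (Perm (Fin n)))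
      (fun π => ι.trans π.toEmbedding), Finset.mul_sum]
    refine Finset.sum_congr rfl fun φ _ => ?_
    rw [Finset.sum_congr rfl (g := fun _ => g φ) fun π hπ => by rw [(Finset.mem_filter.1 hπ).2],
      Finset.sum_const, hfib, nsmul_eq_mul]
  have h1 := hsum fun _ => 1
  simp only [Finset.sum_const, Finset.card_univ, Fintype.card_perm, Fintype.card_fin,
    Fintype.card_embedding_eq, nsmul_eq_mul, mul_one] at h1
  rw [hsum, h1]
  ring

lemma abs_log_sum_sub_le {α : Type*} [Fintype α] [Nonempty α] {w g : α → ℝ} {c η : ℝ}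
    (hw : ∀ x, 0 < w x) (h : ∀ x, |Real.log (w x) - c - g x| ≤ η) :
    |Real.log (∑ x, w x) - c - Real.log (∑ x, Real.exp (g x))| ≤ η := by
  have hE : 0 < ∑ x, Real.exp (g x) :=
    Finset.sum_pos (fun x _ => Real.exp_pos _) Finset.univ_nonempty
  have hW : 0 < ∑ x, w x := Finset.sum_pos (fun x _ => hw x) Finset.univ_nonempty
  have key : ∀ t : ℝ, Real.log (Real.exp t * ∑ x, Real.exp (g x)) =
      t + Real.log (∑ x, Real.exp (g x)) := fun t => by
    rw [Real.log_mul (Real.exp_pos _).ne' hE.ne', Real.log_exp]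
  have up : ∑ x, w x ≤ Real.exp (c + η) * ∑ x, Real.exp (g x) := by
    rw [Finset.mul_sum]
    refine Finset.sum_le_sum fun x _ => ?_
    rw [← Real.exp_add, ← Real.log_le_iff_le_exp (hw x)]
    have := (abs_le.1 (h x)).2
    linarith
  have lo : Real.exp (c - η) * ∑ x, Real.exp (g x) ≤ ∑ x, w x := by
    rw [Finset.mul_sum]
    refine Finset.sum_le_sum fun x _ => ?_
    rw [← Real.exp_add, ← Real.le_log_iff_exp_le (hw x)]
    have := (abs_le.1 (h x)).1
    linarith
  have up' := Real.log_le_log hW up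
  have lo' := Real.log_le_log (mul_pos (Real.exp_pos _) hE) lo
  rw [key] at up' lo'
  rw [abs_le]
  constructor <;> linarith

end

section

open Equiv

variable {n r : ℕ} {d : Fin n → ℕ} {p s L : ℝ}

/-- Zero extension of a sequence. -/
noncomputable def extendZero (n : ℕ) (y : Fin r → ℝ) (k : Fin n) : ℝ :=
  if h : (k : ℕ) < r then y ⟨k, h⟩ else 0

lemma extendZero_castLE (hr : r ≤ n) (y : Fin r → ℝ) (j : Fin r) :
    extendZero n y (Fin.castLEEmb hr j) = y j := by
  simp [extendZero]

lemma extendZero_eq_zero (hr : r ≤ n) (y : Fin r → ℝ) (k : Fin n)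
    (hk : k ∉ Finset.univ.map (Fin.castLEEmb hr)) : extendZero n y k = 0 := by
  rw [extendZero, dif_neg]
  intro h
  exact hk (Finset.mem_map.2 ⟨⟨k, h⟩, Finset.mem_univ _, by ext; simp⟩)

/-- The averaging estimate in terms of `Fin r`. -/
lemma abs_log_sum_perm_exp_sub_le (hP : Par n d p s L) (hrn : r ≤ n) {y : Fin r → ℝ} {δ τ : ℝ}
    (hr : (r : ℝ) ≤ L * s) (hδ0 : 0 ≤ δ) (hδ : ∀ v, |dev d p v| ≤ δ) (hδL : δ ≤ L * s)
    (hy : ∀ k, |y k| ≤ L * s) (hτ : ∑ k, linSize p n δ (y k) ^ 3 ≤ τ) (hτ1 : τ ≤ 1 / 10 ^ 9) :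
    |Real.log (∑ π : Perm (Fin n), Real.exp (∑ j, gexp p n r (∑ i, y i) (y j)
      (dev d p (π (Fin.castLEEmb hrn j))) -
        (∑ j, dev d p (π (Fin.castLEEmb hrn j))) ^ 2 / (2 * (p * (1 - p)) * n ^ 2))) -
      Real.log n.factorial -
      ∑ j, rowMain p n r ((∑ v, dev d p v ^ 2) / n) ((∑ v, dev d p v ^ 3) / n) (y j)| ≤
      10 ^ 5 * τ + L ^ 17 / s := by
  have hLs : 0 ≤ L * s := (Nat.cast_nonneg r).trans hr
  have h := (abs_log_sum_exp_sub_le hP (J := Finset.univ.map (Fin.castLEEmb hrn))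
    (y := extendZero n y) (τ := τ) (by simpa using hr) hδ0 hδ hδL
    (fun k => by
      unfold extendZero
      split_ifs
      · exact hy _
      · simpa using hLs)
    (extendZero_eq_zero hrn y) (by
      rw [Finset.sum_map]; simpa only [extendZero_castLE] using hτ) hτ1).2
  simpa only [Finset.sum_map, Finset.card_map, Finset.card_univ, Fintype.card_fin,
    extendZero_castLE] using h

/-- The expected number of induced copies, under the normalised hypotheses. -/
theorem expInd_eq (hP : Par n d p s L) (hne : (degFinset n d).Nonempty) (hr : (r : ℝ) ≤ L * s)
    (H : SimpleGraph (Fin r)) {m : ℕ} (hm : ∑ j, deg H j = 2 * m) (hmr : m ≤ r.choose 2) {δ τ : ℝ}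
    (hδ0 : 0 ≤ δ) (hδ : ∀ v, |dev d p v| ≤ δ) (hδL : δ ≤ L * s)
    (hτ : ∑ j, linSize p n δ (hdev p H j) ^ 3 ≤ τ) (hτ1 : τ ≤ 1 / 10 ^ 9) :
    ∃ E : ℝ, |E| ≤ 10 ^ 5 * τ + L ^ 17 / s + L ^ 90 / s ∧
      expInd n d H = ((Nat.factorial r : ℝ) / (autCard H : ℝ)) * (Nat.choose n r : ℝ) *
        p ^ m * (1 - p) ^ (Nat.choose r 2 - m) *
        Real.exp (basec p n (hdev p H) + ∑ j, rowMain p n r ((∑ v, dev d p v ^ 2) / n)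
          ((∑ v, dev d p v ^ 3) / n) (hdev p H j) + E) := by
  have hp := hP.p_pos
  have hq : 0 < 1 - p := by linarith [hP.p_lt_one]
  have hrn : r ≤ n := by
    have h1 : L * s ≤ s * s :=
      mul_le_mul_of_nonneg_right (by simpa using hP.pow_le (k := 1) (by norm_num)) hP.s_pos.le
    have h2 : (r : ℝ) ≤ n := by rw [← hP.sq]; linarith [sq s]
    exact_mod_cast h2
  set ι := Fin.castLEEmb hrn
  have hlog := fun π : Perm (Fin n) => log_card_Om_map hP hne hr H (ι.trans π.toEmbedding) hm
  set W : Perm (Fin n) → ℝ := fun π => ((Om d ((⊤ : SimpleGraph (Fin r)).map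
    (ι.trans π.toEmbedding)) (H.map (ι.trans π.toEmbedding))).card : ℝ) with hW
  have hWpos : ∀ π, 0 < W π := fun π => by
    have := Finset.card_pos.2 (hlog π).1
    simp only [hW]; exact_mod_cast this
  set D : ℝ := ((degFinset n d).card : ℝ)
  have hD : 0 < D := Nat.cast_pos.2 (Finset.card_pos.2 hne)
  set c₀ : ℝ := m * Real.log p + ((r.choose 2 : ℕ) - m) * Real.log (1 - p)
  set B := basec p n (hdev p H)
  set K := ∑ j, rowMain p n r ((∑ v, dev d p v ^ 2) / n) ((∑ v, dev d p v ^ 3) / n) (hdev p H j)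
  have hy : ∀ k, |hdev p H k| ≤ L * s := fun k => (abs_hdev_le hP H k).trans hr
  have h1 := abs_log_sum_perm_exp_sub_le hP hrn hr hδ0 hδ hδL hy hτ hτ1
  have h2 := abs_log_sum_sub_le (c := Real.log D + c₀ + B) (η := L ^ 90 / s) hWpos
    (g := fun π : Perm (Fin n) => ∑ j, gexp p n r (∑ i, hdev p H i) (hdev p H j)
      (dev d p (π (ι j))) - (∑ j, dev d p (π (ι j))) ^ 2 / (2 * (p * (1 - p)) * n ^ 2))
    (fun π => by
      refine le_trans (le_of_eq ?_) (hlog π).2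
      congr 1
      simp only [gexp, Function.Embedding.trans_apply, Equiv.coe_toEmbedding, hW]
      ring)
  refine ⟨Real.log (∑ π, W π) - Real.log n.factorial - Real.log D - c₀ - B - K, ?_, ?_⟩
  · refine le_trans (le_of_eq ?_) (abs_add_le_add h1 h2)
    congr 1
    ring
  · have hWs : 0 < ∑ π, W π := Finset.sum_pos (fun π _ => hWpos π) Finset.univ_nonempty
    have hf : (0 : ℝ) < n.factorial := by exact_mod_cast n.factorial_pos
    have ha : (0 : ℝ) < autCard H := by exact_mod_cast autCard_pos H
    have e1 : B + K + (Real.log (∑ π, W π) - Real.log n.factorial - Real.log D - c₀ - B - K) =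
        Real.log (∑ π, W π) - Real.log n.factorial - Real.log D - c₀ := by ring
    have e2 : p ^ m * (1 - p) ^ (Nat.choose r 2 - m) = Real.exp c₀ := by
      simp only [c₀]
      rw [← Nat.cast_sub hmr, Real.exp_add, Real.exp_nat_mul, Real.exp_nat_mul, Real.exp_log hp,
        Real.exp_log hq]
    have e3 := factorial_mul_sum_embedding ι fun φ =>
      ((Om d ((⊤ : SimpleGraph (Fin r)).map φ) (H.map φ)).card : ℝ)
    have e4 : (∑ G ∈ degFinset n d, (indCount H G : ℝ)) * autCard H =
      ∑ φ : Fin r ↪ Fin n, ((Om d ((⊤ : SimpleGraph (Fin r)).map φ) (H.map φ)).card : ℝ) := by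
      exact_mod_cast sum_indCount_mul_autCard (d := d) H
    rw [← e4, Nat.descFactorial_eq_factorial_mul_choose, Nat.cast_mul] at e3
    rw [e1, mul_assoc (_ * _) (p ^ m), e2, mul_assoc _ (Real.exp c₀), ← Real.exp_add]
    have e5 : c₀ + (Real.log (∑ π, W π) - Real.log n.factorial - Real.log D - c₀) =
        Real.log (∑ π, W π) - Real.log n.factorial - Real.log D := by ring
    rw [e5, Real.exp_sub, Real.exp_sub, Real.exp_log hWs, Real.exp_log hf, Real.exp_log hD, expInd]
    change _ / D = _
    field_simp
    linear_combination e3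

end

section

variable {n r : ℕ} {d : Fin n → ℕ} {p s L : ℝ}

lemma sum_rowMain (N R V S : ℝ) (y : Fin r → ℝ) :
    ∑ j, rowMain p N R V S (y j) = r * (-R * V / (2 * (p * (1 - p)) * N ^ 2)) -
      (1 - 2 * p) * V * (∑ j, y j) / (2 * (p * (1 - p)) ^ 2 * N ^ 2) +
      V * (∑ j, y j ^ 2) / (2 * (p * (1 - p) * N) ^ 2) -
      R * S * (∑ j, y j) / (p * (1 - p) * N * (2 * (p * (1 - p)) * N ^ 2)) := by
  have h : ∀ j, rowMain p N R V S (y j) = -R * V / (2 * (p * (1 - p)) * N ^ 2) -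
      (1 - 2 * p) * V / (2 * (p * (1 - p)) ^ 2 * N ^ 2) * y j +
      V / (2 * (p * (1 - p) * N) ^ 2) * y j ^ 2 -
      R * S / (p * (1 - p) * N * (2 * (p * (1 - p)) * N ^ 2)) * y j := by
    intro j
    unfold rowMain quadc
    generalize p * (1 - p) = A
    simp only [div_eq_mul_inv, mul_inv, mul_pow, inv_pow]
    ring
  simp only [h, Finset.sum_sub_distrib, Finset.sum_add_distrib, ← Finset.mul_sum, Finset.sum_const,
    Finset.card_univ, Fintype.card_fin, nsmul_eq_mul]
  ring

lemma card_edges_le_choose (H : SimpleGraph (Fin r)) {m : ℕ} (hm : ∑ j, deg H j = 2 * m) :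
    m ≤ r.choose 2 := by
  have h1 : ∀ j, deg H j ≤ r - 1 := by
    intro j
    have : (Finset.univ.filter fun k => H.Adj j k) ⊆ Finset.univ.erase j := by
      intro k hk
      simp only [Finset.mem_filter, Finset.mem_univ, true_and] at hk
      exact Finset.mem_erase.2 ⟨hk.ne', Finset.mem_univ _⟩
    rw [deg]
    simpa using Finset.card_le_card this
  have h2 : ∑ j, deg H j ≤ r * (r - 1) := by
    simpa using Finset.sum_le_sum fun j (_ : j ∈ Finset.univ) => h1 j
  rw [Nat.choose_two_right, Nat.le_div_iff_mul_le two_pos]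
  omega

lemma lam_mul (hn : 2 ≤ n) (d : Fin n → ℕ) : lam n d * ((n : ℝ) - 1) = dbar n d := by
  have : (2 : ℝ) ≤ n := by exact_mod_cast hn
  exact div_mul_cancel₀ _ (by linarith)

lemma dev_lam (hn : 2 ≤ n) (d : Fin n → ℕ) (v : Fin n) :
    dev d (lam n d) v = (d v : ℝ) - dbar n d := by
  rw [dev, lam_mul hn]

lemma abs_dev_lam_le (hn : 2 ≤ n) (d : Fin n → ℕ) (v : Fin n) :
    |dev d (lam n d) v| ≤ deltaPar n d := by
  rw [dev_lam hn]
  exact le_ciSup (f := fun j : Fin n => |(d j : ℝ) - dbar n d|) (Set.finite_range _).bddAbove v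

lemma exponent_eq (hn : 2 ≤ n) (hp : lam n d ≠ 0) (hq : 1 - lam n d ≠ 0)
    (H : SimpleGraph (Fin r)) :
    basec (lam n d) n (hdev (lam n d) H) + ∑ j, rowMain (lam n d) n r
      ((∑ v, dev d (lam n d) v ^ 2) / n) ((∑ v, dev d (lam n d) v ^ 3) / n) (hdev (lam n d) H j) =
    (-(omega n d H 2) / (2 * lam n d * (1 - lam n d) * n)
      + Rpar n d * omega n d H 2 / (2 * (lam n d) ^ 2 * (1 - lam n d) ^ 2 * (n : ℝ) ^ 2))
    + ((r : ℝ) ^ 2 / (2 * n)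
      + (1 - 2 * lam n d) * omega n d H 1 / (2 * lam n d * (1 - lam n d) * n)
      - (omega n d H 1) ^ 2 / (4 * lam n d * (1 - lam n d) * (n : ℝ) ^ 2)
      - (r : ℝ) ^ 2 * Rpar n d / (2 * lam n d * (1 - lam n d) * (n : ℝ) ^ 2)
      - (r : ℝ) * omega n d H 2 / (2 * lam n d * (1 - lam n d) * (n : ℝ) ^ 2)
      - (1 - 2 * lam n d) * omega n d H 3 /
          (6 * (lam n d) ^ 2 * (1 - lam n d) ^ 2 * (n : ℝ) ^ 2))
    + (-((1 - 2 * lam n d) * Rpar n d * omega n d H 1 /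
          (2 * (lam n d) ^ 2 * (1 - lam n d) ^ 2 * (n : ℝ) ^ 2))
      - (r : ℝ) * omega n d H 1 * (∑ j, ((d j : ℝ) - dbar n d) ^ 3) /
          (2 * (lam n d) ^ 2 * (1 - lam n d) ^ 2 * (n : ℝ) ^ 4)) := by
  have hn' : (n : ℝ) ≠ 0 := by positivity
  have e1 : ∑ j, hdev (lam n d) H j = omega n d H 1 := by simp [omega, hdev]
  have e2 : ∑ j, hdev (lam n d) H j ^ 2 = omega n d H 2 := rfl
  have e3 : ∑ j, hdev (lam n d) H j ^ 3 = omega n d H 3 := rfl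
  have e4 : (∑ v, dev d (lam n d) v ^ 2) / n = Rpar n d := by simp only [dev_lam hn, Rpar]
  rw [sum_rowMain, basec, e1, e2, e3, e4]
  simp only [dev_lam hn]
  field_simp
  ring

lemma sum_linSize_cube {N δ : ℝ} (y : Fin r → ℝ) :
    ∑ j, linSize p N δ (y j) ^ 3 =
      δ ^ 3 / (p ^ 3 * (1 - p) ^ 3 * N ^ 3) * ∑ j, |y j| ^ 3 := by
  rw [Finset.mul_sum]
  refine Finset.sum_congr rfl fun j _ => ?_
  rw [linSize, div_pow, mul_pow, mul_pow, mul_pow]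
  ring

lemma sum_dev_eq_zero (hn : 2 ≤ n) (d : Fin n → ℕ) :
    ∑ v, ((d v : ℝ) - lam n d * ((n : ℝ) - 1)) = 0 := by
  have hn' : (n : ℝ) ≠ 0 := by positivity
  rw [lam_mul hn, Finset.sum_sub_distrib, dbar]
  simp only [Finset.sum_const, Finset.card_univ, Fintype.card_fin, nsmul_eq_mul]
  field_simp
  ring

/-- Largeness conditions on `n` in terms of the auxiliary exponent `κ`. -/
lemma eventually_large {a b C₀ κ : ℝ} (hb : 0 < b) (hκ : 0 < κ) :
    ∃ N : ℕ, ∀ n : ℕ, N ≤ n → 2 ≤ n ∧ 2000 ≤ (n : ℝ) ^ κ ∧ C₀ ≤ (n : ℝ) ^ (κ / 2) ∧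
      Real.log n ≤ (n : ℝ) ^ κ ∧ 3 * a * Real.log n ≤ (n : ℝ) ^ κ ∧
      C₀ * (n : ℝ) ^ (-b) ≤ 1 / 10 ^ 9 := by
  have t := tendsto_natCast_atTop_atTop (R := ℝ)
  have h1 := ((tendsto_rpow_atTop hκ).comp t).eventually_ge_atTop 2000
  have h2 := ((tendsto_rpow_atTop (half_pos hκ)).comp t).eventually_ge_atTop C₀
  have lo : ∀ c : ℝ, ∀ᶠ n : ℕ in Filter.atTop, c * Real.log n ≤ (n : ℝ) ^ κ := by
    intro c
    have h := (((isLittleO_log_rpow_atTop hκ).const_mul_left c).comp_tendsto t).bound one_pos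
    filter_upwards [h] with n hn
    simp only [Function.comp_apply, Real.norm_eq_abs, one_mul] at hn
    rw [abs_of_nonneg (Real.rpow_nonneg (Nat.cast_nonneg n) κ)] at hn
    exact (le_abs_self _).trans hn
  have h3 := (((tendsto_rpow_neg_atTop hb).comp t).const_mul C₀).eventually_le_const
    (show C₀ * 0 < 1 / 10 ^ 9 by norm_num)
  obtain ⟨N, hN⟩ := Filter.eventually_atTop.1
    ((Filter.eventually_ge_atTop 2).and (h1.and (h2.and ((lo 1).and ((lo (3 * a)).and h3)))))
  refine ⟨N, fun n hn => ?_⟩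
  obtain ⟨g1, g2, g3, g4, g5, g6⟩ := hN n hn
  exact ⟨g1, g2, g3, by simpa using g4, g5, g6⟩

lemma one_le_mul_div {x c ℓ : ℝ} (hn : 2 ≤ n) (hc : 0 < c) (hcℓ : c ≤ ℓ)
    (hx : (n : ℝ) / c ≤ x) : 1 ≤ ℓ * (x / ((n : ℝ) - 1)) := by
  have hn' : (2 : ℝ) ≤ n := by exact_mod_cast hn
  rw [← mul_div_assoc, one_le_div (by linarith)]
  rw [div_le_iff₀ hc] at hx
  have : 0 ≤ x := by
    by_contra! h
    nlinarith
  nlinarith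

lemma mul_rpow_le {C₀ κ x : ℝ} (hx : 0 < x) (hC : C₀ ≤ x ^ (κ / 2)) :
    C₀ * x ^ ((1 : ℝ) / 2 + κ / 2) ≤ x ^ κ * √x := by
  refine (mul_le_mul_of_nonneg_right hC (Real.rpow_nonneg hx.le _)).trans_eq ?_
  rw [Real.sqrt_eq_rpow, ← Real.rpow_add hx, ← Real.rpow_add hx]
  congr 1
  ring

/-- The normalised hypotheses hold with `s = √n` and `L = n ^ κ`. -/
lemma Par.of_large {a C₀ κ : ℝ} (ha : 0 < a) (hκ : κ ≤ 1 / 2000) (hn : 2 ≤ n)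
    (h2000 : 2000 ≤ (n : ℝ) ^ κ) (hC : C₀ ≤ (n : ℝ) ^ (κ / 2)) (hlog : Real.log n ≤ (n : ℝ) ^ κ)
    (halog : 3 * a * Real.log n ≤ (n : ℝ) ^ κ)
    (hδ : deltaPar n d ≤ C₀ * (n : ℝ) ^ ((1 : ℝ) / 2 + κ / 2))
    (hmin : min (dbar n d) ((n : ℝ) - dbar n d - 1) ≥ (n : ℝ) / (3 * a * Real.log n)) :
    Par n d (lam n d) √n ((n : ℝ) ^ κ) := by
  have hn' : (2 : ℝ) ≤ n := by exact_mod_cast hn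
  have hn0 : (0 : ℝ) < n := by linarith
  have hc : 0 < 3 * a * Real.log n := by
    have := Real.log_pos (show (1 : ℝ) < n by linarith)
    positivity
  refine ⟨Real.sq_sqrt hn0.le, Real.sqrt_pos.2 hn0, h2000, ?_, ?_, ?_, fun v => ?_,
    sum_dev_eq_zero hn d, ?_⟩
  · rw [← Real.rpow_natCast, ← Real.rpow_mul hn0.le, Real.sqrt_eq_rpow]
    exact Real.rpow_le_rpow_of_exponent_le (by linarith) (by push_cast; linarith)
  · exact one_le_mul_div hn hc halog (hmin.trans (min_le_left _ _))
  · have h := one_le_mul_div hn hc halog (hmin.trans (min_le_right _ _))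
    have e : ((n : ℝ) - dbar n d - 1) / ((n : ℝ) - 1) = 1 - lam n d := by
      rw [lam]
      field_simp [show (n : ℝ) - 1 ≠ 0 by linarith]
      ring
    rwa [e] at h
  · refine (abs_dev_lam_le hn d v).trans (hδ.trans ?_)
    exact mul_rpow_le hn0 hC
  · rw [Real.log_sqrt hn0.le]
    have := Real.log_nonneg (show (1 : ℝ) ≤ n by linarith)
    linarith

end

theorem statement15 (a b C₀ : ℝ) (ha : 0 < a) (hb : 0 < b) (hab : a + b < 1 / 2)
    (hC₀ : 0 < C₀) :
    ∃ ε : ℝ, 0 < ε ∧ ∃ C : ℝ, 0 < C ∧ ∃ N : ℕ, ∀ n : ℕ, N ≤ n →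
      ∀ d : Fin n → ℕ, (degFinset n d).Nonempty →
        deltaPar n d ≤ C₀ * (n : ℝ) ^ ((1 : ℝ) / 2 + ε) →
        min (dbar n d) ((n : ℝ) - dbar n d - 1) ≥ (n : ℝ) / (3 * a * Real.log n) →
        ∀ r : ℕ, (r : ℝ) ≤ C₀ * (n : ℝ) ^ ((1 : ℝ) / 2 + ε) →
          ∀ H : SimpleGraph (Fin r), ∀ m : ℕ,
            (∑ j, deg H j) = 2 * m →
            (deltaPar n d) ^ 3 / ((lam n d) ^ 3 * (1 - lam n d) ^ 3 * (n : ℝ) ^ 3) *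
                (∑ j : Fin r, |(deg H j : ℝ) - lam n d * ((r : ℝ) - 1)| ^ 3) ≤
              C₀ * (n : ℝ) ^ (-b) →
            ∃ E : ℝ, |E| ≤ C * (n : ℝ) ^ (-b) ∧
              expInd n d H =
                ((Nat.factorial r : ℝ) / (autCard H : ℝ)) * (Nat.choose n r : ℝ) *
                  (lam n d) ^ m * (1 - lam n d) ^ (Nat.choose r 2 - m) *
                  Real.exp (
                    (-(omega n d H 2) / (2 * lam n d * (1 - lam n d) * n)
                      + Rpar n d * omega n d H 2 /
                          (2 * (lam n d) ^ 2 * (1 - lam n d) ^ 2 * (n : ℝ) ^ 2))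
                    + ((r : ℝ) ^ 2 / (2 * n)
                      + (1 - 2 * lam n d) * omega n d H 1 /
                          (2 * lam n d * (1 - lam n d) * n)
                      - (omega n d H 1) ^ 2 /
                          (4 * lam n d * (1 - lam n d) * (n : ℝ) ^ 2)
                      - (r : ℝ) ^ 2 * Rpar n d /
                          (2 * lam n d * (1 - lam n d) * (n : ℝ) ^ 2)
                      - (r : ℝ) * omega n d H 2 /
                          (2 * lam n d * (1 - lam n d) * (n : ℝ) ^ 2)
                      - (1 - 2 * lam n d) * omega n d H 3 /
                          (6 * (lam n d) ^ 2 * (1 - lam n d) ^ 2 * (n : ℝ) ^ 2))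
                    + (-((1 - 2 * lam n d) * Rpar n d * omega n d H 1 /
                          (2 * (lam n d) ^ 2 * (1 - lam n d) ^ 2 * (n : ℝ) ^ 2))
                      - (r : ℝ) * omega n d H 1 *
                          (∑ j, ((d j : ℝ) - dbar n d) ^ 3) /
                          (2 * (lam n d) ^ 2 * (1 - lam n d) ^ 2 * (n : ℝ) ^ 4))
                    + E) := by
  set κ : ℝ := min (1 / 2000) ((1 / 2 - b) / 90) with hκ
  have hκ0 : 0 < κ := lt_min (by norm_num) (by linarith)
  have hκ1 : κ ≤ 1 / 2000 := min_le_left _ _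
  have hκ2 : κ ≤ (1 / 2 - b) / 90 := min_le_right _ _
  obtain ⟨N, hN⟩ := eventually_large (a := a) (C₀ := C₀) hb hκ0
  refine ⟨κ / 2, half_pos hκ0, 10 ^ 5 * C₀ + 2, by positivity, N, ?_⟩
  intro n hn d hne hδ hmin r hr H m hm hτ
  obtain ⟨hn2, h2000, hC, hlog, halog, hτ1⟩ := hN n hn
  have hP := Par.of_large ha hκ1 hn2 h2000 hC hlog halog hδ hmin
  have hn1 : (1 : ℝ) ≤ n := by exact_mod_cast (by omega : 1 ≤ n)
  have hn0 : (0 : ℝ) < n := by linarith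
  have hτ' : ∑ j, linSize (lam n d) n (deltaPar n d) (hdev (lam n d) H j) ^ 3 ≤
      C₀ * (n : ℝ) ^ (-b) := by
    rw [sum_linSize_cube]
    exact hτ
  obtain ⟨E, hE, hexp⟩ := expInd_eq hP hne (hr.trans (mul_rpow_le hn0 hC)) H hm
    (card_edges_le_choose H hm) ((abs_nonneg _).trans (abs_dev_lam_le hn2 d ⟨0, by omega⟩))
    (abs_dev_lam_le hn2 d) (hδ.trans (mul_rpow_le hn0 hC)) hτ' hτ1
  refine ⟨E, hE.trans ?_, ?_⟩
  · have hpow : ∀ k : ℕ, k ≤ 90 → ((n : ℝ) ^ κ) ^ k / √n ≤ (n : ℝ) ^ (-b) := by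
      intro k hk
      have hk' : (k : ℝ) ≤ 90 := by exact_mod_cast hk
      rw [← Real.rpow_natCast, ← Real.rpow_mul hn0.le, Real.sqrt_eq_rpow, ← Real.rpow_sub hn0]
      exact Real.rpow_le_rpow_of_exponent_le hn1 (by nlinarith)
    have h1 := hpow 17 (by norm_num)
    have h2 := hpow 90 le_rfl
    linarith
  · rw [hexp, exponent_eq hn2 hP.p_pos.ne' (by linarith [hP.p_lt_one])]

end Stmt15
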